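/- There exists an absolute constant C ≥ 1 such that the following holds. Let Q, ρ, L > 0 be reals with C·Q^{-1} ≤ ρ ≤ C^{-1}·Q, and let A ⊂ ℝ² be the intersection of an annulus of radius Q and width ρ (with arbitrary center) and a disc of radius L (with arbitrary center). Then the number of integer lattice points in A satisfies #(A ∩ ℤ²) ≤ C · min( Qρ + Q^{7/11}, (Qρ)^{1/2} + L·(Qρ)^{3/2}·Q^{-1} + L·(Qρ)^{1/2}·Q^{-1/3} ). -/

import Mathlib

open scoped BigOperators

noncomputable section

/-- The integer lattice `ℤ²` inside `ℝ²`. -/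
def intLattice2 : Set (EuclideanSpace ℝ (Fin 2)) :=
  {x | ∀ i, ∃ m : ℤ, x i = (m : ℝ)}

/-- The matrices of determinant one whose upper left entry is the largest, equal to `m`. -/
theorem card_unimodular_corner_le (m : ℕ) (hm : 1 ≤ m) (T : Finset (ℤ × ℤ × ℤ × ℤ))
    (hT : ∀ g ∈ T, g.1 * g.2.2.2 - g.2.1 * g.2.2.1 = 1 ∧ |g.1| = m ∧ |g.2.1| ≤ m ∧
      |g.2.2.1| ≤ m) : T.card ≤ 18 * m := by
  have hm' : (0 : ℤ) < m := by exact_mod_cast hm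
  let U : Finset (ℤ × ℤ × ℤ) :=
    ({(m : ℤ), -(m : ℤ)} : Finset ℤ) ×ˢ Finset.Icc (-(m : ℤ)) m ×ˢ Finset.Icc (-1 : ℤ) 1
  have hU : U.card ≤ 18 * m := by
    simp only [U, Finset.card_product, Int.card_Icc]
    have h1 : ({(m : ℤ), -(m : ℤ)} : Finset ℤ).card ≤ 2 := Finset.card_le_two
    have h2 : ((m : ℤ) + 1 - -(m : ℤ)).toNat ≤ 3 * m := by omega
    have h3 : ((1 : ℤ) + 1 - -1).toNat = 3 := by decide
    rw [h3]
    calc _ ≤ 2 * ((3 * m) * 3) := by gcongr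
      _ = _ := by ring
  refine le_trans (Finset.card_le_card_of_injOn
    (fun g => (g.1, g.2.1, g.2.2.1 / (m : ℤ))) ?_ ?_) hU
  · rintro ⟨a, b, c, d⟩ hg
    obtain ⟨-, h2, h3, h4⟩ := hT _ hg
    simp only at h2 h3 h4
    simp only [U, Finset.coe_product, Set.mem_prod, Finset.mem_coe, Finset.mem_insert,
      Finset.mem_singleton, Finset.mem_Icc]
    rw [abs_le] at h3 h4
    refine ⟨?_, ⟨h3.1, h3.2⟩, ?_, ?_⟩
    · rcases abs_eq hm'.le |>.1 h2 with h | h <;> simp [h]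
    · rw [Int.le_ediv_iff_mul_le hm']; linarith [h4.1]
    · have := Int.ediv_le_ediv hm' h4.2
      rwa [Int.ediv_self hm'.ne'] at this
  · rintro ⟨a, b, c, d⟩ hg ⟨a', b', c', d'⟩ hg' h
    obtain ⟨h1, h2, -, -⟩ := hT _ hg
    obtain ⟨h1', -, -, -⟩ := hT _ hg'
    simp only [Prod.mk.injEq] at h h1 h2 h1' ⊢
    obtain ⟨rfl, rfl, h⟩ := h
    have hdvd : a ∣ b * (c - c') := ⟨d - d', by linear_combination h1' - h1⟩
    have hcop : IsCoprime a b := ⟨d, -c, by linear_combination h1⟩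
    have h5 : a ∣ c - c' := hcop.dvd_of_dvd_mul_left hdvd
    have h6 : (m : ℤ) ∣ c - c' := by rw [← h2]; exact (abs_dvd _ _).2 h5
    have hc : c = c' := by
      have e1 := Int.mul_ediv_add_emod c m
      have e2 := Int.mul_ediv_add_emod c' m
      have e3 : c % m = c' % m := (Int.modEq_iff_dvd.2 h6).symm
      rw [← e1, ← e2, h, e3]
    subst hc
    have ha : a ≠ 0 := by rintro rfl; simp at h2; omega
    have : d = d' := mul_left_cancel₀ ha (by linear_combination h1 - h1')
    simp [this]

/-- The largest absolute value of an entry. -/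
def entryMax (g : ℤ × ℤ × ℤ × ℤ) : ℕ :=
  max (max g.1.natAbs g.2.1.natAbs) (max g.2.2.1.natAbs g.2.2.2.natAbs)

theorem card_unimodular_entryMax_le (m : ℕ) (hm : 1 ≤ m) (T : Finset (ℤ × ℤ × ℤ × ℤ))
    (hT : ∀ g ∈ T, g.1 * g.2.2.2 - g.2.1 * g.2.2.1 = 1 ∧ entryMax g = m) :
    T.card ≤ 72 * m := by
  classical
  let T1 := T.filter fun g => g.1.natAbs = m
  let T2 := T.filter fun g => g.2.1.natAbs = m
  let T3 := T.filter fun g => g.2.2.1.natAbs = m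
  let T4 := T.filter fun g => g.2.2.2.natAbs = m
  have hsub : T ⊆ (T1 ∪ T2) ∪ (T3 ∪ T4) := by
    rintro ⟨a, b, c, d⟩ hg
    have h := (hT _ hg).2
    simp only [entryMax] at h
    simp only [T1, T2, T3, T4, Finset.mem_union, Finset.mem_filter, hg, true_and]
    omega
  have key : ∀ (S : Finset (ℤ × ℤ × ℤ × ℤ)) (f : ℤ × ℤ × ℤ × ℤ → ℤ × ℤ × ℤ × ℤ)
      (_ : Function.Injective f) (_ : ∀ g ∈ S, (f g).1 * (f g).2.2.2 - (f g).2.1 * (f g).2.2.1 = 1 ∧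
        |(f g).1| = m ∧ |(f g).2.1| ≤ m ∧ |(f g).2.2.1| ≤ m), S.card ≤ 18 * m := by
    intro S f hf h
    rw [← Finset.card_image_of_injective S hf]
    apply card_unimodular_corner_le m hm
    intro g hg
    obtain ⟨g', hg', rfl⟩ := Finset.mem_image.1 hg
    exact h g' hg'
  have h1 : T1.card ≤ 18 * m := by
    refine key T1 id Function.injective_id ?_
    rintro ⟨a, b, c, d⟩ hg
    obtain ⟨hg, h⟩ := Finset.mem_filter.1 hg
    obtain ⟨h1, h2⟩ := hT _ hg
    simp only [entryMax, id] at *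
    refine ⟨h1, ?_, ?_, ?_⟩ <;> simp only [Int.abs_eq_natAbs] <;> omega
  have h2 : T2.card ≤ 18 * m := by
    refine key T2 (fun g => (g.2.1, -g.1, g.2.2.2, -g.2.2.1)) ?_ ?_
    · rintro ⟨a, b, c, d⟩ ⟨a', b', c', d'⟩ h
      simp only [Prod.mk.injEq] at h ⊢
      omega
    rintro ⟨a, b, c, d⟩ hg
    obtain ⟨hg, h⟩ := Finset.mem_filter.1 hg
    obtain ⟨h1, h2⟩ := hT _ hg
    simp only [entryMax] at *
    refine ⟨by linear_combination h1, ?_, ?_, ?_⟩ <;> simp only [Int.abs_eq_natAbs] <;> omega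
  have h3 : T3.card ≤ 18 * m := by
    refine key T3 (fun g => (g.2.2.1, g.2.2.2, -g.1, -g.2.1)) ?_ ?_
    · rintro ⟨a, b, c, d⟩ ⟨a', b', c', d'⟩ h
      simp only [Prod.mk.injEq] at h ⊢
      omega
    rintro ⟨a, b, c, d⟩ hg
    obtain ⟨hg, h⟩ := Finset.mem_filter.1 hg
    obtain ⟨h1, h2⟩ := hT _ hg
    simp only [entryMax] at *
    refine ⟨by linear_combination h1, ?_, ?_, ?_⟩ <;> simp only [Int.abs_eq_natAbs] <;> omega
  have h4 : T4.card ≤ 18 * m := by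
    refine key T4 (fun g => (g.2.2.2, -g.2.2.1, -g.2.1, g.1)) ?_ ?_
    · rintro ⟨a, b, c, d⟩ ⟨a', b', c', d'⟩ h
      simp only [Prod.mk.injEq] at h ⊢
      omega
    rintro ⟨a, b, c, d⟩ hg
    obtain ⟨hg, h⟩ := Finset.mem_filter.1 hg
    obtain ⟨h1, h2⟩ := hT _ hg
    simp only [entryMax] at *
    refine ⟨by linear_combination h1, ?_, ?_, ?_⟩ <;> simp only [Int.abs_eq_natAbs] <;> omega
  have := Finset.card_le_card hsub
  have := Finset.card_union_le (T1 ∪ T2) (T3 ∪ T4)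
  have := Finset.card_union_le T1 T2
  have := Finset.card_union_le T3 T4
  omega

/-- Sums of a decreasing weight over unimodular matrices of bounded size. -/
theorem sum_unimodular_le (M : ℕ) (E : ℝ) (hE : 0 ≤ E) (T : Finset (ℤ × ℤ × ℤ × ℤ))
    (hT : ∀ g ∈ T, g.1 * g.2.2.2 - g.2.1 * g.2.2.1 = 1 ∧ entryMax g ≤ M) :
    ∑ g ∈ T, (1 + E / entryMax g) ≤ 72 * (M ^ 2 + E * M) := by
  classical
  have hpos : ∀ g ∈ T, 1 ≤ entryMax g := by
    rintro ⟨a, b, c, d⟩ hg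
    by_contra hcon
    have h0 : entryMax (a, b, c, d) = 0 := by omega
    have h1 := (hT _ hg).1
    simp only [entryMax] at h0 h1
    have ha : a = 0 := by omega
    have hb : b = 0 := by omega
    simp [ha, hb] at h1
  have hmap : ∀ g ∈ T, entryMax g ∈ Finset.Icc 1 M := fun g hg =>
    Finset.mem_Icc.2 ⟨hpos g hg, (hT g hg).2⟩
  rw [← Finset.sum_fiberwise_of_maps_to hmap]
  calc _ ≤ ∑ m ∈ Finset.Icc 1 M, 72 * ((M : ℝ) + E) := by
        refine Finset.sum_le_sum fun m hm => ?_
        obtain ⟨hm1, hm2⟩ := Finset.mem_Icc.1 hm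
        have hm0 : (0 : ℝ) < m := by exact_mod_cast hm1
        have hm2' : (m : ℝ) ≤ M := by exact_mod_cast hm2
        have hc := card_unimodular_entryMax_le m hm1 (T.filter fun g => entryMax g = m)
          (fun g hg => ⟨(hT g (Finset.mem_filter.1 hg).1).1, (Finset.mem_filter.1 hg).2⟩)
        have : ∑ g ∈ T.filter (fun g => entryMax g = m), (1 + E / entryMax g)
            = (T.filter fun g => entryMax g = m).card * (1 + E / m) := by
          rw [← nsmul_eq_mul, ← Finset.sum_const]
          refine Finset.sum_congr rfl fun g hg => ?_
          rw [(Finset.mem_filter.1 hg).2]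
        rw [this]
        have hc' : ((T.filter fun g => entryMax g = m).card : ℝ) ≤ 72 * m := by exact_mod_cast hc
        calc _ ≤ 72 * (m : ℝ) * (1 + E / m) := by gcongr
          _ = 72 * (m + E) := by field_simp
          _ ≤ _ := by gcongr
    _ = _ := by
        simp
        ring

/-- Squared length of an integer vector. -/
def sqLen (v : ℤ × ℤ) : ℤ := v.1 ^ 2 + v.2 ^ 2

/-- Scalar product of integer vectors. -/
def dotZ (v w : ℤ × ℤ) : ℤ := v.1 * w.1 + v.2 * w.2

/-- Determinant of two integer vectors. -/
def crossZ (v w : ℤ × ℤ) : ℤ := v.1 * w.2 - v.2 * w.1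

/-- The action of a two by two integer matrix. -/
def matAct (g : ℤ × ℤ × ℤ × ℤ) (v : ℤ × ℤ) : ℤ × ℤ :=
  (g.1 * v.1 + g.2.1 * v.2, g.2.2.1 * v.1 + g.2.2.2 * v.2)

/-- The octant of the plane containing a vector. -/
def octant (v : ℤ × ℤ) : Bool × Bool × Bool :=
  (decide (0 ≤ v.1), decide (0 ≤ v.2), decide (|v.2| ≤ |v.1|))

theorem sqLen_mul_sqLen (v w : ℤ × ℤ) :
    sqLen v * sqLen w = dotZ v w ^ 2 + crossZ v w ^ 2 := by
  simp only [sqLen, dotZ, crossZ]; ring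

theorem sqLen_mul_le_of_octant_eq {v w : ℤ × ℤ} (h : octant v = octant w) :
    sqLen v * sqLen w ≤ 4 * dotZ v w ^ 2 ∧ 0 ≤ dotZ v w := by
  obtain ⟨a, b⟩ := v
  obtain ⟨c, d⟩ := w
  simp only [octant, Prod.mk.injEq, decide_eq_decide] at h
  obtain ⟨h1, h2, h3⟩ := h
  have hac : 0 ≤ a * c := by
    rcases le_or_gt 0 a with ha | ha
    · exact mul_nonneg ha (h1.1 ha)
    · have : c < 0 := by by_contra hc; exact absurd (h1.2 (not_lt.1 hc)) (not_le.2 ha)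
      exact (mul_pos_of_neg_of_neg ha this).le
  have hbd : 0 ≤ b * d := by
    rcases le_or_gt 0 b with ha | ha
    · exact mul_nonneg ha (h2.1 ha)
    · have : d < 0 := by by_contra hc; exact absurd (h2.2 (not_lt.1 hc)) (not_le.2 ha)
      exact (mul_pos_of_neg_of_neg ha this).le
  simp only [sqLen, dotZ]
  refine ⟨?_, by linarith⟩
  rcases le_or_gt |b| |a| with hb | hb
  · have hb1 := sq_le_sq.2 hb
    have hd1 := sq_le_sq.2 (h3.1 hb)
    have : (a ^ 2 + b ^ 2) * (c ^ 2 + d ^ 2) ≤ (2 * a ^ 2) * (2 * c ^ 2) := by gcongr <;> linarith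
    nlinarith [mul_nonneg hac hbd, sq_nonneg (b * d)]
  · have hd : |c| < |d| := by by_contra hc; exact absurd (h3.2 (not_lt.1 hc)) (not_le.2 hb)
    have hb1 := sq_le_sq.2 hb.le
    have hd1 := sq_le_sq.2 hd.le
    have : (a ^ 2 + b ^ 2) * (c ^ 2 + d ^ 2) ≤ (2 * b ^ 2) * (2 * d ^ 2) := by gcongr <;> linarith
    nlinarith [mul_nonneg hac hbd, sq_nonneg (a * c)]

/-- Vectors of comparable length in one octant close to a given line. -/
theorem card_near_line_le (T : ℕ) (S : Finset (ℤ × ℤ)) (v : ℤ × ℤ)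
    (hv : IsCoprime v.1 v.2)
    (hS : ∀ w ∈ S, |crossZ v w| ≤ T ∧ octant v = octant w ∧ sqLen w ≤ 256 * sqLen v) :
    S.card ≤ 17 * (2 * T + 1) := by
  have hpos : 0 < sqLen v := by
    obtain ⟨a, b⟩ := v
    simp only [sqLen]
    by_contra hcon
    have ha : a = 0 := by nlinarith [sq_nonneg a, sq_nonneg b]
    have hb : b = 0 := by nlinarith [sq_nonneg a, sq_nonneg b]
    rw [ha, hb] at hv
    exact not_isCoprime_zero_zero hv
  let U : Finset (ℤ × ℤ) := Finset.Icc (-(T : ℤ)) T ×ˢ Finset.Icc (0 : ℤ) 16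
  have hU : U.card = 17 * (2 * T + 1) := by
    simp only [U, Finset.card_product, Int.card_Icc]
    have h2 : ((T : ℤ) + 1 - -(T : ℤ)).toNat = 2 * T + 1 := by omega
    rw [h2, mul_comm]; rfl
  rw [← hU]
  refine Finset.card_le_card_of_injOn (fun w => (crossZ v w, dotZ v w / sqLen v)) ?_ ?_
  · intro w hw
    obtain ⟨h1, h2, h3⟩ := hS w hw
    simp only [U, Finset.coe_product, Set.mem_prod, Finset.mem_coe, Finset.mem_Icc]
    refine ⟨abs_le.1 h1, Int.ediv_nonneg (sqLen_mul_le_of_octant_eq h2).2 hpos.le, ?_⟩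
    have hd : dotZ v w ≤ 16 * sqLen v := by
      have := sqLen_mul_sqLen v w
      have h5 : dotZ v w ^ 2 ≤ (16 * sqLen v) ^ 2 := by
        nlinarith [sq_nonneg (crossZ v w)]
      exact le_trans (le_abs_self _) (abs_le_of_sq_le_sq h5 (by positivity))
    have := Int.ediv_le_ediv hpos hd
    rwa [Int.mul_ediv_cancel _ hpos.ne'] at this
  · intro w hw w' hw' h
    simp only [Prod.mk.injEq] at h
    obtain ⟨h1, h2⟩ := h
    have key : ∃ k, w.1 - w'.1 = k * v.1 ∧ w.2 - w'.2 = k * v.2 := by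
      obtain ⟨x, y, hxy⟩ := hv
      simp only [crossZ] at h1
      exact ⟨x * (w.1 - w'.1) + y * (w.2 - w'.2),
        by linear_combination (w'.1 - w.1) * hxy - y * h1,
        by linear_combination (w'.2 - w.2) * hxy + x * h1⟩
    obtain ⟨k, hk1, hk2⟩ := key
    have h3 : dotZ v w = dotZ v w' + k * sqLen v := by
      simp only [dotZ, sqLen]; linear_combination v.1 * hk1 + v.2 * hk2
    rw [h3, Int.add_mul_ediv_right _ _ hpos.ne'] at h2
    have hk : k = 0 := by linarith
    rw [hk] at hk1 hk2
    ext <;> linarith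

theorem crossZ_bound {P E : ℝ} (hE : 0 ≤ E) (hP : 1 ≤ P) {g : ℤ × ℤ × ℤ × ℤ}
    (hg : g.1 * g.2.2.2 - g.2.1 * g.2.2.1 = 1)
    (hg3 : 3 ≤ g.1 ^ 2 + g.2.1 ^ 2 + g.2.2.1 ^ 2 + g.2.2.2 ^ 2)
    {v w : ℤ × ℤ} (ho : octant v = octant w) (ho' : octant (matAct g v) = octant (matAct g w))
    (hv : P / 256 ≤ sqLen v ∧ (sqLen v : ℝ) ≤ P) (hw : P / 256 ≤ sqLen w ∧ (sqLen w : ℝ) ≤ P)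
    (hv' : P / 256 ≤ sqLen (matAct g v) ∧ (sqLen (matAct g v) : ℝ) ≤ P)
    (hw' : P / 256 ≤ sqLen (matAct g w) ∧ (sqLen (matAct g w) : ℝ) ≤ P)
    (hvE : |(sqLen (matAct g v) : ℝ) - sqLen v| ≤ E)
    (hwE : |(sqLen (matAct g w) : ℝ) - sqLen w| ≤ E) :
    (entryMax g : ℝ) * |(crossZ v w : ℝ)| ≤ 2048 * E := by
  have hm : (entryMax g : ℤ) ^ 2 ≤ g.1 ^ 2 + g.2.1 ^ 2 + g.2.2.1 ^ 2 + g.2.2.2 ^ 2 := by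
    have h1 := sq_nonneg g.1
    have h2 := sq_nonneg g.2.1
    have h3 := sq_nonneg g.2.2.1
    have h4 := sq_nonneg g.2.2.2
    have : entryMax g = g.1.natAbs ∨ entryMax g = g.2.1.natAbs ∨ entryMax g = g.2.2.1.natAbs ∨
      entryMax g = g.2.2.2.natAbs := by simp only [entryMax]; omega
    rcases this with h | h | h | h <;> rw [h, Int.natCast_natAbs, sq_abs] <;> linarith
  set F := g.1 ^ 2 + g.2.1 ^ 2 + g.2.2.1 ^ 2 + g.2.2.2 ^ 2 with hF
  have hcr : crossZ (matAct g v) (matAct g w) = crossZ v w := by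
    simp only [crossZ, matAct]
    linear_combination (v.1 * w.2 - v.2 * w.1) * hg
  have hpol : (dotZ (matAct g v) (matAct g w) - dotZ v w) ^ 2 -
      (sqLen (matAct g v) - sqLen v) * (sqLen (matAct g w) - sqLen w) =
      (F - 2) * crossZ v w ^ 2 := by
    simp only [crossZ, matAct, dotZ, sqLen, hF]
    linear_combination (-(g.1 * g.2.2.2 - g.2.1 * g.2.2.1) - 1) * (v.1 * w.2 - v.2 * w.1) ^ 2 * hg
  have hdot : ∀ x y : ℤ × ℤ, octant x = octant y → P / 256 ≤ sqLen x → P / 256 ≤ sqLen y →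
      P / 512 ≤ dotZ x y := by
    intro x y hxy hx hy
    obtain ⟨h1, h2⟩ := sqLen_mul_le_of_octant_eq hxy
    have h1' : (sqLen x : ℝ) * sqLen y ≤ 4 * (dotZ x y : ℝ) ^ 2 := by exact_mod_cast h1
    have h2' : (0 : ℝ) ≤ dotZ x y := by exact_mod_cast h2
    have h3 : (P / 256) * (P / 256) ≤ (sqLen x : ℝ) * sqLen y :=
      mul_le_mul hx hy (by positivity) (le_trans (by positivity) hx)
    have : (P / 512) ^ 2 ≤ (dotZ x y : ℝ) ^ 2 := by nlinarith
    exact le_of_sq_le_sq this h2' |>.trans le_rfl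
  have hd1 := hdot v w ho hv.1 hw.1
  have hd2 := hdot _ _ ho' hv'.1 hw'.1
  have e1 := sqLen_mul_sqLen v w
  have e2 := sqLen_mul_sqLen (matAct g v) (matAct g w)
  rw [hcr] at e2
  have e1' : (sqLen v : ℝ) * sqLen w = (dotZ v w : ℝ) ^ 2 + (crossZ v w : ℝ) ^ 2 := by
    exact_mod_cast e1
  have e2' : (sqLen (matAct g v) : ℝ) * sqLen (matAct g w) =
    (dotZ (matAct g v) (matAct g w) : ℝ) ^ 2 + (crossZ v w : ℝ) ^ 2 := by exact_mod_cast e2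
  have hpol' : ((dotZ (matAct g v) (matAct g w) : ℝ) - dotZ v w) ^ 2 -
      ((sqLen (matAct g v) : ℝ) - sqLen v) * ((sqLen (matAct g w) : ℝ) - sqLen w) =
      ((F : ℝ) - 2) * (crossZ v w : ℝ) ^ 2 := by exact_mod_cast hpol
  have hmF : (entryMax g : ℝ) ^ 2 ≤ F := by exact_mod_cast hm
  have hF3 : (3 : ℝ) ≤ F := by exact_mod_cast hg3
  generalize (dotZ (matAct g v) (matAct g w) : ℝ) = D' at *
  generalize (dotZ v w : ℝ) = D at *
  generalize (crossZ v w : ℝ) = X at *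
  generalize (sqLen (matAct g v) : ℝ) = A' at *
  generalize (sqLen (matAct g w) : ℝ) = B' at *
  generalize (sqLen v : ℝ) = A at *
  generalize (sqLen w : ℝ) = B at *
  generalize (entryMax g : ℝ) = m at *
  generalize (F : ℝ) = F at *
  have hPp : 0 < P := by linarith
  have hdiff : |D' - D| ≤ 512 * E := by
    have h1 : (D' - D) * (D' + D) = (A' - A) * B' + A * (B' - B) := by linear_combination e1' - e2'
    have h2 : |D' - D| * (D' + D) ≤ 2 * E * P := by
      have : |D' - D| * (D' + D) = |(D' - D) * (D' + D)| := by
        rw [abs_mul, abs_of_pos (by linarith : 0 < D' + D)]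
      rw [this, h1]
      calc _ ≤ |(A' - A) * B'| + |A * (B' - B)| := abs_add_le _ _
        _ = |A' - A| * |B'| + |A| * |B' - B| := by rw [abs_mul, abs_mul]
        _ ≤ E * P + P * E := by
          rw [abs_of_nonneg (by linarith : 0 ≤ B'), abs_of_nonneg (by linarith : 0 ≤ A)]
          have : 0 ≤ B' := by linarith
          gcongr
          · exact hw'.2
          · exact hv.2
        _ = _ := by ring
    have h3 : |D' - D| * (P / 256) ≤ |D' - D| * (D' + D) := by gcongr; linarith
    have h4 : |D' - D| * P ≤ 512 * E * P := by linarith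
    exact le_of_mul_le_mul_right h4 hPp
  have hs : (D' - D) ^ 2 ≤ (512 * E) ^ 2 := by rw [← sq_abs]; gcongr
  have hq : |(A' - A) * (B' - B)| ≤ E * E := by rw [abs_mul]; gcongr
  have hq' := (abs_le.1 hq).1
  have h5 : (F - 2) * X ^ 2 ≤ (512 ^ 2 + 1) * E ^ 2 := by nlinarith
  have h6 : (m * |X|) ^ 2 ≤ (2048 * E) ^ 2 := by
    rw [mul_pow, sq_abs]
    have : m ^ 2 * X ^ 2 ≤ F * X ^ 2 := by gcongr
    nlinarith [sq_nonneg X, mul_nonneg (by linarith : (0:ℝ) ≤ F - 3) (sq_nonneg X), sq_nonneg E]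
  exact le_trans (le_abs_self _) (abs_le_of_sq_le_sq h6 (by positivity))

theorem card_le_of_sqLen_le {P : ℝ} (hP : 1 ≤ P) (V : Finset (ℤ × ℤ))
    (hV : ∀ v ∈ V, (sqLen v : ℝ) ≤ P) : (V.card : ℝ) ≤ 9 * P := by
  set n := ⌊√P⌋₊
  have hn : (n : ℝ) ≤ √P := Nat.floor_le (Real.sqrt_nonneg P)
  have h1 : (1 : ℝ) ≤ √P := by rw [Real.one_le_sqrt]; exact hP
  have hsq : √P ^ 2 = P := Real.sq_sqrt (by linarith)
  have hb : ∀ (x : ℤ), (x : ℝ) ^ 2 ≤ P → x ∈ Finset.Icc (-(n : ℤ)) n := by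
    intro x hx
    have h2 : (x.natAbs : ℝ) ≤ √P := by
      rw [Nat.cast_natAbs, Int.cast_abs]
      exact Real.abs_le_sqrt hx
    have h3 : x.natAbs ≤ n := Nat.le_floor h2
    rw [Finset.mem_Icc]; omega
  have hsub : V ⊆ Finset.Icc (-(n : ℤ)) n ×ˢ Finset.Icc (-(n : ℤ)) n := by
    intro v hv
    have := hV v hv
    simp only [sqLen] at this
    push_cast at this
    exact Finset.mem_product.2 ⟨hb _ (by nlinarith [sq_nonneg (v.2 : ℝ)]),
      hb _ (by nlinarith [sq_nonneg (v.1 : ℝ)])⟩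
  have hc := Finset.card_le_card hsub
  rw [Finset.card_product, Int.card_Icc] at hc
  have h2 : ((n : ℤ) + 1 - -(n : ℤ)).toNat = 2 * n + 1 := by omega
  rw [h2] at hc
  have hc' : (V.card : ℝ) ≤ (2 * n + 1) * (2 * n + 1) := by exact_mod_cast hc
  nlinarith

theorem card_fixed_matrix_le {P E : ℝ} (hE : 0 ≤ E) (hP : 1 ≤ P) {g : ℤ × ℤ × ℤ × ℤ}
    (hg : g.1 * g.2.2.2 - g.2.1 * g.2.2.1 = 1)
    (hg3 : 3 ≤ g.1 ^ 2 + g.2.1 ^ 2 + g.2.2.1 ^ 2 + g.2.2.2 ^ 2) (S : Finset (ℤ × ℤ))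
    (hS : ∀ v ∈ S, IsCoprime v.1 v.2 ∧ (P / 256 ≤ sqLen v ∧ (sqLen v : ℝ) ≤ P) ∧
      (P / 256 ≤ sqLen (matAct g v) ∧ (sqLen (matAct g v) : ℝ) ≤ P) ∧
      |(sqLen (matAct g v) : ℝ) - sqLen v| ≤ E) :
    (S.card : ℝ) ≤ 64 * 17 * 4096 * (1 + E / entryMax g) := by
  classical
  have hm : 0 < entryMax g := by
    by_contra hcon
    have h0 : entryMax g = 0 := by omega
    simp only [entryMax] at h0
    have ha : g.1 = 0 := by omega
    have hb : g.2.1 = 0 := by omega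
    simp [ha, hb] at hg
  have hm0 : (0 : ℝ) < entryMax g := by exact_mod_cast hm
  set T := ⌊2048 * E / entryMax g⌋₊ with hT
  have hTle : (T : ℝ) ≤ 2048 * E / entryMax g := Nat.floor_le (by positivity)
  let f : ℤ × ℤ → (Bool × Bool × Bool) × (Bool × Bool × Bool) :=
    fun v => (octant v, octant (matAct g v))
  have hcl := Finset.card_le_mul_card_image (f := f) S (17 * (2 * T + 1)) (by
    intro a ha
    obtain ⟨v, hv, rfl⟩ := Finset.mem_image.1 ha
    obtain ⟨hv1, hv2, hv3, hv4⟩ := hS v hv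
    refine card_near_line_le T _ v hv1 ?_
    intro w hw
    obtain ⟨hw, hf⟩ := Finset.mem_filter.1 hw
    simp only [f, Prod.mk.injEq] at hf
    obtain ⟨hw1, hw2, hw3, hw4⟩ := hS w hw
    have hcb := crossZ_bound hE hP hg hg3 (Prod.ext_iff.2 ⟨congrArg Prod.fst hf.1.symm,
      congrArg Prod.snd hf.1.symm⟩) hf.2.symm hv2 hw2 hv3 hw3 hv4 hw4
    refine ⟨?_, hf.1.symm, ?_⟩
    · have h1 : ((crossZ v w).natAbs : ℝ) ≤ 2048 * E / entryMax g := by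
        rw [le_div_iff₀ hm0, Nat.cast_natAbs, Int.cast_abs]; linarith
      have h2 : (crossZ v w).natAbs ≤ T := Nat.le_floor h1
      rw [Int.abs_eq_natAbs]; exact_mod_cast h2
    · have : (sqLen w : ℝ) ≤ 256 * sqLen v := by linarith [hw2.2, hv2.1]
      exact_mod_cast this)
  have him : (S.image f).card ≤ 64 := (Finset.card_le_univ _).trans (by decide)
  have hc : S.card ≤ 17 * (2 * T + 1) * 64 := hcl.trans (Nat.mul_le_mul_left _ him)
  have hc' : (S.card : ℝ) ≤ 17 * (2 * T + 1) * 64 := by exact_mod_cast hc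
  have : 2048 * E / entryMax g = 2048 * (E / entryMax g) := by ring
  have : 0 ≤ E / entryMax g := by positivity
  nlinarith

/-- The second spacing problem: pairs of primitive vectors with close inverse residues
and close lengths. -/
theorem second_spacing : ∃ C : ℝ, 1 ≤ C ∧ ∀ (P Y E : ℝ) (V : Finset (ℤ × ℤ)) (bar : ℤ × ℤ → ℤ × ℤ)
    (S : Finset ((ℤ × ℤ) × (ℤ × ℤ))), 1 ≤ P → 0 ≤ Y → 0 ≤ E →
    (∀ v ∈ V, crossZ v (bar v) = 1 ∧ P / 256 ≤ sqLen v ∧ (sqLen v : ℝ) ≤ P) →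
    (∀ p ∈ S, p.1 ∈ V ∧ p.2 ∈ V ∧
      (∃ k : ℤ, |(dotZ p.1 (bar p.1) : ℝ) / sqLen p.1 - dotZ p.2 (bar p.2) / sqLen p.2 - k| ≤ Y) ∧
      |(sqLen p.1 : ℝ) - sqLen p.2| ≤ E) →
    (S.card : ℝ) ≤ C * (P + (1 + P * Y) ^ 2 + E * (1 + P * Y)) := by
  classical
  refine ⟨729 + 64 * 17 * 4096 * 72 * 529, by norm_num, ?_⟩
  intro P Y E V bar S hP hY hE hV hS
  have hk : ∀ p : (ℤ × ℤ) × (ℤ × ℤ), ∃ k : ℤ, p ∈ S →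
      |(dotZ p.1 (bar p.1) : ℝ) / sqLen p.1 - dotZ p.2 (bar p.2) / sqLen p.2 - k| ≤ Y := by
    intro p
    by_cases hp : p ∈ S
    · obtain ⟨k, hk⟩ := (hS p hp).2.2.1
      exact ⟨k, fun _ => hk⟩
    · exact ⟨0, fun h => absurd h hp⟩
  choose k hk using hk
  let gf : (ℤ × ℤ) × (ℤ × ℤ) → ℤ × ℤ × ℤ × ℤ := fun p =>
    (p.2.1 * (bar p.1).2 - ((bar p.2).1 + k p * p.2.1) * p.1.2,
     -(p.2.1 * (bar p.1).1) + ((bar p.2).1 + k p * p.2.1) * p.1.1,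
     p.2.2 * (bar p.1).2 - ((bar p.2).2 + k p * p.2.2) * p.1.2,
     -(p.2.2 * (bar p.1).1) + ((bar p.2).2 + k p * p.2.2) * p.1.1)
  have hact : ∀ p ∈ S, matAct (gf p) p.1 = p.2 := by
    intro p hp
    have h1 := (hV _ (hS p hp).1).1
    simp only [crossZ] at h1
    refine Prod.ext ?_ ?_ <;> simp only [matAct, gf]
    · linear_combination p.2.1 * h1
    · linear_combination p.2.2 * h1
  have hdet : ∀ p ∈ S, (gf p).1 * (gf p).2.2.2 - (gf p).2.1 * (gf p).2.2.1 = 1 := by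
    intro p hp
    have h1 := (hV _ (hS p hp).1).1
    have h2 := (hV _ (hS p hp).2.1).1
    simp only [crossZ] at h1 h2
    simp only [gf]
    linear_combination (p.2.1 * (bar p.2).2 - p.2.2 * (bar p.2).1) * h1 + h2
  have hnorm : ∀ p ∈ S, (((gf p).1 ^ 2 + (gf p).2.1 ^ 2 + (gf p).2.2.1 ^ 2 + (gf p).2.2.2 ^ 2 : ℤ) : ℝ)
      ≤ 512 + P ^ 2 * Y ^ 2 := by
    intro p hp
    obtain ⟨h1, h1a, h1b⟩ := hV _ (hS p hp).1
    obtain ⟨h2, h2a, h2b⟩ := hV _ (hS p hp).2.1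
    have hkp := hk p hp
    have e : ((gf p).1 ^ 2 + (gf p).2.1 ^ 2 + (gf p).2.2.1 ^ 2 + (gf p).2.2.2 ^ 2) *
        (sqLen p.1 * sqLen p.2) = sqLen p.2 ^ 2 + sqLen p.1 ^ 2 +
        (sqLen p.2 * dotZ p.1 (bar p.1) - sqLen p.1 * dotZ p.2 (bar p.2)
          - k p * (sqLen p.1 * sqLen p.2)) ^ 2 := by
      have e1 : sqLen p.2 ^ 2 = sqLen p.2 ^ 2 * crossZ p.1 (bar p.1) ^ 2 := by rw [h1]; ring
      have e2 : sqLen p.1 ^ 2 = sqLen p.1 ^ 2 * crossZ p.2 (bar p.2) ^ 2 := by rw [h2]; ring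
      rw [e1, e2]
      simp only [gf, sqLen, dotZ, crossZ]
      ring
    have ha : (0 : ℝ) < sqLen p.1 := lt_of_lt_of_le (by positivity) h1a
    have hb : (0 : ℝ) < sqLen p.2 := lt_of_lt_of_le (by positivity) h2a
    have e' : ((((gf p).1 ^ 2 + (gf p).2.1 ^ 2 + (gf p).2.2.1 ^ 2 + (gf p).2.2.2 ^ 2 : ℤ) : ℝ)) *
        ((sqLen p.1 : ℝ) * sqLen p.2) = (sqLen p.2 : ℝ) ^ 2 + (sqLen p.1 : ℝ) ^ 2 +
        ((sqLen p.2 : ℝ) * dotZ p.1 (bar p.1) - sqLen p.1 * dotZ p.2 (bar p.2)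
          - k p * (sqLen p.1 * sqLen p.2)) ^ 2 := by exact_mod_cast e
    have e3 : (sqLen p.2 : ℝ) * dotZ p.1 (bar p.1) - sqLen p.1 * dotZ p.2 (bar p.2)
          - k p * (sqLen p.1 * sqLen p.2) = (sqLen p.1 * sqLen p.2) *
          ((dotZ p.1 (bar p.1) : ℝ) / sqLen p.1 - dotZ p.2 (bar p.2) / sqLen p.2 - k p) := by
      field_simp
    rw [e3, mul_pow] at e'
    generalize (dotZ p.1 (bar p.1) : ℝ) / sqLen p.1 - dotZ p.2 (bar p.2) / sqLen p.2 - k p = δ at *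
    generalize (((gf p).1 ^ 2 + (gf p).2.1 ^ 2 + (gf p).2.2.1 ^ 2 + (gf p).2.2.2 ^ 2 : ℤ) : ℝ) = F at *
    generalize (sqLen p.1 : ℝ) = a at *
    generalize (sqLen p.2 : ℝ) = b at *
    have hd : δ ^ 2 ≤ Y ^ 2 := by rw [← sq_abs]; gcongr
    have hab : 0 < a * b := by positivity
    refine le_of_mul_le_mul_right ?_ hab
    rw [e']
    have t1 : b ^ 2 ≤ 256 * (a * b) := by nlinarith
    have t2 : a ^ 2 ≤ 256 * (a * b) := by nlinarith
    have t3 : (a * b) ^ 2 * δ ^ 2 ≤ (a * b) * P ^ 2 * Y ^ 2 := by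
      have : a * b ≤ P ^ 2 := by nlinarith
      calc _ = (a * b) * (a * b) * δ ^ 2 := by ring
        _ ≤ _ := by gcongr
    linarith
  set G := 1 + P * Y with hG
  have hG1 : 1 ≤ G := by have : 0 ≤ P * Y := by positivity
                         linarith
  set M := ⌊23 * G⌋₊ with hM
  have hMle : (M : ℝ) ≤ 23 * G := Nat.floor_le (by positivity)
  have hmax : ∀ p ∈ S, entryMax (gf p) ≤ M := by
    intro p hp
    have hn := hnorm p hp
    refine Nat.le_floor ?_
    have hm : (entryMax (gf p) : ℤ) ^ 2 ≤
        (gf p).1 ^ 2 + (gf p).2.1 ^ 2 + (gf p).2.2.1 ^ 2 + (gf p).2.2.2 ^ 2 := by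
      generalize gf p = g
      have h1 := sq_nonneg g.1
      have h2 := sq_nonneg g.2.1
      have h3 := sq_nonneg g.2.2.1
      have h4 := sq_nonneg g.2.2.2
      have : entryMax g = g.1.natAbs ∨ entryMax g = g.2.1.natAbs ∨ entryMax g = g.2.2.1.natAbs ∨
        entryMax g = g.2.2.2.natAbs := by simp only [entryMax]; omega
      rcases this with h | h | h | h <;> rw [h, Int.natCast_natAbs, sq_abs] <;> linarith
    have hm' : (((entryMax (gf p) : ℤ) ^ 2 : ℤ) : ℝ) ≤ _ := Int.cast_le.2 hm
    rw [Int.cast_pow, Int.cast_natCast] at hm'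
    have : (entryMax (gf p) : ℝ) ^ 2 ≤ (23 * G) ^ 2 := by
      refine (hm'.trans hn).trans ?_
      rw [hG]
      nlinarith [mul_nonneg (by linarith : (0:ℝ) ≤ P) hY, sq_nonneg (P * Y)]
    exact le_of_sq_le_sq this (by positivity)
  have hfib : ∀ g ∈ S.image gf, ((S.filter fun p => gf p = g).card : ℝ) ≤
      (if g.1 ^ 2 + g.2.1 ^ 2 + g.2.2.1 ^ 2 + g.2.2.2 ^ 2 = 2 then 9 * P else 0) +
        64 * 17 * 4096 * (1 + E / entryMax g) := by
    intro g hg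
    obtain ⟨p0, hp0, hp0g⟩ := Finset.mem_image.1 hg
    have hdg := hdet p0 hp0
    rw [hp0g] at hdg
    have hinj : Set.InjOn Prod.fst (↑(S.filter fun p => gf p = g) : Set ((ℤ × ℤ) × (ℤ × ℤ))) := by
      intro p hp q hq hpq
      obtain ⟨hp, hpg⟩ := Finset.mem_filter.1 hp
      obtain ⟨hq, hqg⟩ := Finset.mem_filter.1 hq
      refine Prod.ext hpq ?_
      rw [← hact p hp, ← hact q hq, hpg, hqg, hpq]
    rw [← Finset.card_image_of_injOn hinj]
    have hmem : ∀ v ∈ (S.filter fun p => gf p = g).image Prod.fst, ∃ p ∈ S, p.1 = v ∧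
        p.2 = matAct g v := by
      intro v hv
      obtain ⟨p, hp, rfl⟩ := Finset.mem_image.1 hv
      obtain ⟨hp, hpg⟩ := Finset.mem_filter.1 hp
      exact ⟨p, hp, rfl, by rw [← hpg, hact p hp]⟩
    have hw : 0 ≤ E / entryMax g := by positivity
    split_ifs with h2
    · have := card_le_of_sqLen_le hP ((S.filter fun p => gf p = g).image Prod.fst) (by
        intro v hv
        obtain ⟨p, hp, rfl, -⟩ := hmem v hv
        exact (hV _ (hS p hp).1).2.2)
      linarith
    · rw [zero_add]
      refine card_fixed_matrix_le hE hP hdg ?_ _ ?_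
      · have : 2 ≤ g.1 ^ 2 + g.2.1 ^ 2 + g.2.2.1 ^ 2 + g.2.2.2 ^ 2 := by
          nlinarith [sq_nonneg (g.1 - g.2.2.2), sq_nonneg (g.2.1 + g.2.2.1)]
        omega
      · intro v hv
        obtain ⟨p, hp, rfl, hpv⟩ := hmem v hv
        obtain ⟨h1, h1b⟩ := hV _ (hS p hp).1
        obtain ⟨-, h2b⟩ := hV _ (hS p hp).2.1
        rw [← hpv]
        refine ⟨⟨(bar p.1).2, -(bar p.1).1, ?_⟩, h1b, h2b, ?_⟩
        · simp only [crossZ] at h1; linear_combination h1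
        · rw [abs_sub_comm]; exact (hS p hp).2.2.2
  have hcard : (S.card : ℝ) = ∑ g ∈ S.image gf, ((S.filter fun p => gf p = g).card : ℝ) := by
    exact_mod_cast Finset.card_eq_sum_card_image gf S
  rw [hcard]
  refine (Finset.sum_le_sum hfib).trans ?_
  rw [Finset.sum_add_distrib, ← Finset.mul_sum]
  have hsum := sum_unimodular_le M E hE (S.image gf) (by
    intro g hg
    obtain ⟨p, hp, rfl⟩ := Finset.mem_image.1 hg
    exact ⟨hdet p hp, hmax p hp⟩)
  have h81 : ∑ g ∈ S.image gf,
      (if g.1 ^ 2 + g.2.1 ^ 2 + g.2.2.1 ^ 2 + g.2.2.2 ^ 2 = 2 then 9 * P else 0) ≤ 729 * P := by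
    rw [← Finset.sum_filter, Finset.sum_const, nsmul_eq_mul]
    have : ((S.image gf).filter fun g : ℤ × ℤ × ℤ × ℤ =>
        g.1 ^ 2 + g.2.1 ^ 2 + g.2.2.1 ^ 2 + g.2.2.2 ^ 2 = 2).card ≤ 81 := by
      have hI : (Finset.Icc (-1 : ℤ) 1).card = 3 := by decide
      refine (Finset.card_le_card (t := Finset.Icc (-1 : ℤ) 1 ×ˢ Finset.Icc (-1 : ℤ) 1 ×ˢ
        Finset.Icc (-1 : ℤ) 1 ×ˢ Finset.Icc (-1 : ℤ) 1) ?_).trans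
        (by simp only [Finset.card_product, hI]; norm_num)
      intro g hg
      have h2 := (Finset.mem_filter.1 hg).2
      have h1 := sq_nonneg g.1
      have h2 := sq_nonneg g.2.1
      have h3 := sq_nonneg g.2.2.1
      have h4 := sq_nonneg g.2.2.2
      have hb : ∀ x : ℤ, x ^ 2 ≤ 2 → x ∈ Finset.Icc (-1 : ℤ) 1 := by
        intro x hx
        rw [Finset.mem_Icc]
        constructor <;> nlinarith
      simp only [Finset.mem_product]
      exact ⟨hb _ (by linarith), hb _ (by linarith), hb _ (by linarith), hb _ (by linarith)⟩
    have h' : (((S.image gf).filter fun g : ℤ × ℤ × ℤ × ℤ =>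
        g.1 ^ 2 + g.2.1 ^ 2 + g.2.2.1 ^ 2 + g.2.2.2 ^ 2 = 2).card : ℝ) ≤ 81 := by exact_mod_cast this
    nlinarith
  have hM2 : (M : ℝ) ^ 2 + E * M ≤ 529 * (G ^ 2 + E * G) := by
    have : (M : ℝ) ^ 2 ≤ (23 * G) ^ 2 := by gcongr
    have : E * M ≤ E * (23 * G) := by gcongr
    nlinarith [mul_nonneg hE (by linarith : 0 ≤ G)]
  have : 0 ≤ G ^ 2 + E * G := by positivity
  nlinarith

/-- The additive character `exp (2 π i x)`. -/
def ec (x : ℝ) : ℂ := Complex.exp ((2 * Real.pi * x : ℝ) * Complex.I)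

theorem ec_add (x y : ℝ) : ec (x + y) = ec x * ec y := by
  simp only [ec, ← Complex.exp_add]
  congr 1
  push_cast
  ring

theorem ec_zero : ec 0 = 1 := by simp [ec]

theorem norm_ec (x : ℝ) : ‖ec x‖ = 1 := Complex.norm_exp_ofReal_mul_I _

theorem ec_int (n : ℤ) : ec n = 1 := by
  rw [ec, Complex.exp_eq_one_iff]
  exact ⟨n, by push_cast; ring⟩

theorem ec_nat_mul (n : ℕ) (x : ℝ) : ec (n * x) = ec x ^ n := by
  rw [ec, ec, ← Complex.exp_nat_mul]
  congr 1
  push_cast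
  ring

theorem conj_ec (x : ℝ) : (starRingEnd ℂ) (ec x) = ec (-x) := by
  rw [ec, ec, ← Complex.exp_conj]
  congr 1
  rw [map_mul, Complex.conj_ofReal, Complex.conj_I]
  push_cast
  ring

theorem ec_re (x : ℝ) : (ec x).re = Real.cos (2 * Real.pi * x) := Complex.exp_ofReal_mul_I_re _

theorem norm_ec_sub_one_ge {x : ℝ} (hx : |x| ≤ 1 / 2) : 4 * |x| ≤ ‖ec x - 1‖ := by
  have h : ‖ec x - 1‖ = ‖2 * Real.sin (2 * Real.pi * x / 2)‖ := by
    rw [ec, mul_comm _ Complex.I]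
    exact Complex.norm_exp_I_mul_ofReal_sub_one _
  rw [h, norm_mul, Real.norm_eq_abs, Real.norm_eq_abs, abs_of_pos (by norm_num : (0 : ℝ) < 2)]
  have h1 : 2 * Real.pi * x / 2 = Real.pi * x := by ring
  rw [h1]
  have hp := Real.pi_pos
  have h2 := Real.mul_abs_le_abs_sin (x := Real.pi * x) (by
    rw [abs_mul, abs_of_pos hp]; nlinarith)
  rw [abs_mul, abs_of_pos hp] at h2
  have h3 : 2 / Real.pi * (Real.pi * |x|) = 2 * |x| := by field_simp
  rw [h3] at h2
  linarith

/-- The geometric sum of characters. -/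
def ecSum (N : ℕ) (x : ℝ) : ℂ := ∑ j ∈ Finset.range N, ec (j * x)

theorem norm_ecSum_le (N : ℕ) (x : ℝ) : ‖ecSum N x‖ ≤ N := by
  refine (norm_sum_le _ _).trans ?_
  simp [norm_ec]

theorem norm_ecSum_mul_le (N : ℕ) {x : ℝ} (hx : |x| ≤ 1 / 2) : ‖ecSum N x‖ * |x| ≤ 1 / 2 := by
  have h : ecSum N x * (ec x - 1) = ec x ^ N - 1 := by
    simp only [ecSum, ec_nat_mul]
    exact geom_sum_mul _ _
  have h1 : ‖ecSum N x‖ * ‖ec x - 1‖ ≤ 2 := by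
    rw [← norm_mul, h]
    refine (norm_sub_le _ _).trans ?_
    rw [norm_pow, norm_ec]
    norm_num
  have h2 := norm_ec_sub_one_ge hx
  nlinarith [norm_nonneg (ecSum N x)]

theorem summable_int_inv_one_add_sq : Summable fun m : ℤ => 1 / (1 + (m : ℝ) ^ 2) := by
  have h : Summable fun m : ℤ => 1 / (m : ℝ) ^ 2 := Real.summable_one_div_int_pow.2 (by norm_num)
  refine Summable.of_norm_bounded_eventually (g := fun m : ℤ => 1 / (m : ℝ) ^ 2) h ?_
  rw [Filter.eventually_cofinite]
  refine (Set.finite_singleton (0 : ℤ)).subset ?_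
  intro m hm
  by_contra h0
  apply hm
  have : (0 : ℝ) < (m : ℝ) ^ 2 := by
    have : (m : ℝ) ≠ 0 := by exact_mod_cast h0
    positivity
  rw [Real.norm_eq_abs, abs_of_pos (by positivity)]
  apply one_div_le_one_div_of_le this
  linarith

/-- Schur's test for a convolution weight, in terms of coincidences. -/
theorem sum_weight_le {ι : Type*} (P : Finset ι) (b : ι → ℤ) :
    ∑ n ∈ P, ∑ n' ∈ P, 1 / (1 + ((b n - b n' : ℤ) : ℝ) ^ 2) ≤
      (∑' m : ℤ, 1 / (1 + (m : ℝ) ^ 2)) *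
        (((P ×ˢ P).filter fun q => b q.1 = b q.2).card : ℝ) := by
  classical
  set K := ∑' m : ℤ, 1 / (1 + (m : ℝ) ^ 2) with hK
  set I := P.image b with hI
  set c : ℤ → ℝ := fun z => ((P.filter fun n => b n = z).card : ℝ) with hc
  have hmap : ∀ n ∈ P, b n ∈ I := fun n hn => Finset.mem_image_of_mem _ hn
  have h1 : ∀ F : ℤ → ℝ, ∑ n ∈ P, F (b n) = ∑ z ∈ I, c z * F z := by
    intro F
    rw [← Finset.sum_fiberwise_of_maps_to hmap]
    refine Finset.sum_congr rfl fun z _ => ?_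
    rw [hc, ← nsmul_eq_mul, ← Finset.sum_const]
    exact Finset.sum_congr rfl fun n hn => by rw [(Finset.mem_filter.1 hn).2]
  have h2 : ∑ n ∈ P, ∑ n' ∈ P, 1 / (1 + ((b n - b n' : ℤ) : ℝ) ^ 2) =
      ∑ z ∈ I, ∑ z' ∈ I, c z * c z' * (1 / (1 + ((z - z' : ℤ) : ℝ) ^ 2)) := by
    rw [h1 fun z => ∑ n' ∈ P, 1 / (1 + ((z - b n' : ℤ) : ℝ) ^ 2)]
    refine Finset.sum_congr rfl fun z _ => ?_
    rw [h1 fun z' => 1 / (1 + ((z - z' : ℤ) : ℝ) ^ 2), Finset.mul_sum]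
    exact Finset.sum_congr rfl fun _ _ => by ring
  have h3 : (((P ×ˢ P).filter fun q => b q.1 = b q.2).card : ℝ) = ∑ z ∈ I, c z * c z := by
    rw [Finset.card_filter, Finset.sum_product]
    push_cast
    rw [h1 fun z => ∑ n' ∈ P, if z = b n' then (1 : ℝ) else 0]
    refine Finset.sum_congr rfl fun z _ => ?_
    congr 1
    rw [hc]
    simp only [Finset.card_filter]
    push_cast
    exact Finset.sum_congr rfl fun n _ => by simp [eq_comm]
  have hrow : ∀ z : ℤ, ∑ z' ∈ I, 1 / (1 + ((z - z' : ℤ) : ℝ) ^ 2) ≤ K := by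
    intro z
    rw [← Finset.sum_image (f := fun m : ℤ => 1 / (1 + (m : ℝ) ^ 2)) (g := fun z' => z - z')
      (fun x _ y _ h => by simpa using h)]
    exact summable_int_inv_one_add_sq.sum_le_tsum _ fun m _ => by positivity
  rw [h2, h3]
  have hs : ∑ z ∈ I, ∑ z' ∈ I, c z * c z' * (1 / (1 + ((z - z' : ℤ) : ℝ) ^ 2)) ≤
      ∑ z ∈ I, ∑ z' ∈ I, ((c z * c z / 2) * (1 / (1 + ((z - z' : ℤ) : ℝ) ^ 2)) +
        (c z' * c z' / 2) * (1 / (1 + ((z' - z : ℤ) : ℝ) ^ 2))) := by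
    refine Finset.sum_le_sum fun z _ => Finset.sum_le_sum fun z' _ => ?_
    have e : ((z' - z : ℤ) : ℝ) ^ 2 = ((z - z' : ℤ) : ℝ) ^ 2 := by push_cast; ring
    rw [e, ← add_mul]
    gcongr
    nlinarith [sq_nonneg (c z - c z')]
  refine hs.trans ?_
  simp only [Finset.sum_add_distrib]
  rw [Finset.sum_comm (f := fun z z' => (c z' * c z' / 2) * (1 / (1 + ((z' - z : ℤ) : ℝ) ^ 2)))]
  rw [← two_mul]
  simp only [← Finset.mul_sum]
  have : ∑ z ∈ I, c z * c z / 2 * ∑ z' ∈ I, 1 / (1 + ((z - z' : ℤ) : ℝ) ^ 2) ≤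
      ∑ z ∈ I, c z * c z / 2 * K := by
    refine Finset.sum_le_sum fun z _ => ?_
    have := hrow z
    have : 0 ≤ c z * c z / 2 := by positivity
    gcongr
  rw [← Finset.sum_mul, ← Finset.sum_div] at this
  linarith

theorem normSq_sum_mul_ec {ι : Type*} (P : Finset ι) (c : ι → ℂ) (θ : ι → ℝ) (t : ℝ) :
    ((‖∑ n ∈ P, c n * ec (θ n * t)‖ ^ 2 : ℝ) : ℂ) =
      ∑ n ∈ P, ∑ n' ∈ P, c n * (starRingEnd ℂ) (c n') * ec ((θ n - θ n') * t) := by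
  rw [← Complex.normSq_eq_norm_sq, ← Complex.mul_conj, map_sum, Finset.sum_mul_sum]
  refine Finset.sum_congr rfl fun n _ => Finset.sum_congr rfl fun n' _ => ?_
  rw [map_mul, conj_ec, sub_mul, sub_eq_add_neg, ec_add]
  ring

/-- Mean square of a trigonometric sum with close frequencies. -/
theorem mean_square_le : ∃ C : ℝ, 0 < C ∧ ∀ {ι : Type} (P : Finset ι) (c : ι → ℂ) (θ : ι → ℝ)
    (N : ℕ), 1 ≤ N → (∀ n ∈ P, ‖c n‖ ≤ 1) → (∀ n ∈ P, ∀ n' ∈ P, |θ n - θ n'| ≤ 1 / 2) →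
    ∑ k ∈ Finset.range N, ‖∑ n ∈ P, c n * ec (θ n * k)‖ ^ 2 ≤
      C * N * ((P ×ˢ P).filter fun q => |θ q.1 - θ q.2| * N ≤ 1).card := by
  classical
  set K := ∑' m : ℤ, 1 / (1 + (m : ℝ) ^ 2) with hK
  have hKpos : 0 < K := by
    have := summable_int_inv_one_add_sq.le_tsum (0 : ℤ) (fun m _ => by positivity)
    simp only [Int.cast_zero] at this
    norm_num at this
    simp only [one_div] at hK
    linarith
  refine ⟨20 * K, by positivity, ?_⟩
  intro ι P c θ N hN hc hθ
  have hN0 : (0 : ℝ) < N := by exact_mod_cast hN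
  set f : ℝ → ℝ := fun t => ‖∑ n ∈ P, c n * ec (θ n * t)‖ ^ 2 with hf
  have hf0 : ∀ t, 0 ≤ f t := fun t => by positivity
  have h1 : (N : ℝ) * ∑ k ∈ Finset.range N, f k ≤
      ∑ j' ∈ Finset.range (2 * N), ∑ j ∈ Finset.range (2 * N), f ((j : ℝ) - j') := by
    calc (N : ℝ) * ∑ k ∈ Finset.range N, f k
        = ∑ j' ∈ Finset.range N, ∑ k ∈ Finset.range N, f k := by simp
      _ ≤ ∑ j' ∈ Finset.range N, ∑ j ∈ Finset.range (2 * N), f ((j : ℝ) - j') := by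
          refine Finset.sum_le_sum fun j' hj' => ?_
          have hj' := Finset.mem_range.1 hj'
          have e := Finset.sum_image (f := fun j : ℕ => f ((j : ℝ) - j')) (g := fun k => j' + k)
            (s := Finset.range N) (fun x _ y _ h => by simpa using h)
          simp only [Nat.cast_add, add_sub_cancel_left] at e
          rw [← e]
          refine Finset.sum_le_sum_of_subset_of_nonneg ?_ fun _ _ _ => hf0 _
          intro j hj
          obtain ⟨k, hk, rfl⟩ := Finset.mem_image.1 hj
          have := Finset.mem_range.1 hk
          exact Finset.mem_range.2 (by omega)
      _ ≤ _ := by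
          refine Finset.sum_le_sum_of_subset_of_nonneg ?_ fun _ _ _ =>
            Finset.sum_nonneg fun _ _ => hf0 _
          intro j hj
          have := Finset.mem_range.1 hj
          exact Finset.mem_range.2 (by omega)
  have h2 : ((∑ j' ∈ Finset.range (2 * N), ∑ j ∈ Finset.range (2 * N), f ((j : ℝ) - j') : ℝ) : ℂ) =
      ∑ n ∈ P, ∑ n' ∈ P, c n * (starRingEnd ℂ) (c n') * ((‖ecSum (2 * N) (θ n - θ n')‖ ^ 2 : ℝ) : ℂ) := by
    push_cast [hf]
    have e1 : ∀ j' ∈ Finset.range (2 * N), ∀ j ∈ Finset.range (2 * N),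
        ((‖∑ n ∈ P, c n * ec (θ n * ((j : ℝ) - j'))‖ : ℝ) : ℂ) ^ 2 =
        ∑ n ∈ P, ∑ n' ∈ P, c n * (starRingEnd ℂ) (c n') *
          (ec (j * (θ n - θ n')) * ec (-(j' * (θ n - θ n')))) := by
      intro j' _ j _
      rw [← Complex.ofReal_pow, normSq_sum_mul_ec]
      refine Finset.sum_congr rfl fun n _ => Finset.sum_congr rfl fun n' _ => ?_
      rw [← ec_add]
      congr 2
      ring
    rw [Finset.sum_congr rfl fun j' hj' => Finset.sum_congr rfl fun j hj => e1 j' hj' j hj]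
    have e2 : ∀ n n', ((‖ecSum (2 * N) (θ n - θ n')‖ : ℝ) : ℂ) ^ 2 =
        ∑ j' ∈ Finset.range (2 * N), ∑ j ∈ Finset.range (2 * N),
          (ec (j * (θ n - θ n')) * ec (-(j' * (θ n - θ n')))) := by
      intro n n'
      rw [← Complex.ofReal_pow, ← Complex.normSq_eq_norm_sq, ← Complex.mul_conj, ecSum, map_sum,
        Finset.sum_mul_sum, Finset.sum_comm]
      refine Finset.sum_congr rfl fun _ _ => Finset.sum_congr rfl fun _ _ => ?_
      rw [conj_ec]
    simp only [e2, Finset.mul_sum]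
    rw [Finset.sum_congr rfl fun j' _ => Finset.sum_comm]
    rw [Finset.sum_comm]
    refine Finset.sum_congr rfl fun n _ => ?_
    rw [Finset.sum_congr rfl fun j' _ => Finset.sum_comm]
    rw [Finset.sum_comm]
  have h3 : ∑ j' ∈ Finset.range (2 * N), ∑ j ∈ Finset.range (2 * N), f ((j : ℝ) - j') ≤
      ∑ n ∈ P, ∑ n' ∈ P, ‖ecSum (2 * N) (θ n - θ n')‖ ^ 2 := by
    have : ∑ j' ∈ Finset.range (2 * N), ∑ j ∈ Finset.range (2 * N), f ((j : ℝ) - j') =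
        ‖((∑ j' ∈ Finset.range (2 * N), ∑ j ∈ Finset.range (2 * N), f ((j : ℝ) - j') : ℝ) : ℂ)‖ := by
      rw [Complex.norm_real, Real.norm_eq_abs, abs_of_nonneg]
      exact Finset.sum_nonneg fun _ _ => Finset.sum_nonneg fun _ _ => hf0 _
    rw [this, h2]
    refine (norm_sum_le _ _).trans (Finset.sum_le_sum fun n hn => ?_)
    refine (norm_sum_le _ _).trans (Finset.sum_le_sum fun n' hn' => ?_)
    rw [norm_mul, norm_mul, Complex.norm_real, Complex.norm_conj, Real.norm_eq_abs,
      abs_of_nonneg (by positivity)]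
    have := hc n hn
    have := hc n' hn'
    have : ‖c n‖ * ‖c n'‖ ≤ 1 * 1 := by gcongr
    have h0 : 0 ≤ ‖ecSum (2 * N) (θ n - θ n')‖ ^ 2 := by positivity
    nlinarith
  set b : ι → ℤ := fun n => ⌊θ n * N⌋ with hb
  have h4 : ∀ n ∈ P, ∀ n' ∈ P, ‖ecSum (2 * N) (θ n - θ n')‖ ^ 2 ≤
      20 * N ^ 2 * (1 / (1 + ((b n - b n' : ℤ) : ℝ) ^ 2)) := by
    intro n hn n' hn'
    have s1 := norm_ecSum_le (2 * N) (θ n - θ n')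
    have s2 := norm_ecSum_mul_le (2 * N) (hθ n hn n' hn')
    push_cast at s1
    set S := ‖ecSum (2 * N) (θ n - θ n')‖ with hS
    have hS0 : 0 ≤ S := norm_nonneg _
    have hbd : |((b n - b n' : ℤ) : ℝ)| ≤ |θ n - θ n'| * N + 1 := by
      have a1 := Int.floor_le (θ n * N)
      have a2 := Int.lt_floor_add_one (θ n * N)
      have a3 := Int.floor_le (θ n' * N)
      have a4 := Int.lt_floor_add_one (θ n' * N)
      have a5 : |θ n - θ n'| * N = |θ n * N - θ n' * N| := by
        rw [← sub_mul, abs_mul, abs_of_pos hN0]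
      rw [a5]
      push_cast [hb]
      rw [abs_le]
      have := le_abs_self (θ n * N - θ n' * N)
      have := neg_abs_le (θ n * N - θ n' * N)
      constructor <;> linarith
    set m := ((b n - b n' : ℤ) : ℝ) with hm
    rw [mul_one_div, le_div_iff₀ (by positivity)]
    have hm2 : m ^ 2 ≤ 2 * (|θ n - θ n'| * N) ^ 2 + 2 := by
      rw [← sq_abs]
      have : |m| ^ 2 ≤ (|θ n - θ n'| * N + 1) ^ 2 := by gcongr
      nlinarith [sq_nonneg (|θ n - θ n'| * N - 1)]
    have hS2 : S ^ 2 ≤ (2 * N) ^ 2 := by gcongr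
    have hS3 : S ^ 2 * (|θ n - θ n'| * N) ^ 2 ≤ N ^ 2 / 4 := by
      have : (S * |θ n - θ n'|) ^ 2 ≤ (1 / 2) ^ 2 := by gcongr
      calc _ = (S * |θ n - θ n'|) ^ 2 * N ^ 2 := by ring
        _ ≤ (1 / 2) ^ 2 * N ^ 2 := by gcongr
        _ = _ := by ring
    nlinarith [mul_le_mul_of_nonneg_left hm2 (sq_nonneg S)]
  have h5 := (Finset.sum_le_sum fun n hn => Finset.sum_le_sum fun n' hn' => h4 n hn n' hn')
  simp only [← Finset.mul_sum] at h5
  have h6 := sum_weight_le P b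
  have h7 : (((P ×ˢ P).filter fun q => b q.1 = b q.2).card : ℝ) ≤
      ((P ×ˢ P).filter fun q => |θ q.1 - θ q.2| * N ≤ 1).card := by
    have : ((P ×ˢ P).filter fun q => b q.1 = b q.2).card ≤
      ((P ×ˢ P).filter fun q => |θ q.1 - θ q.2| * N ≤ 1).card := by
      refine Finset.card_le_card (Finset.monotone_filter_right _ fun q _ hq => ?_)
      have := Int.abs_sub_lt_one_of_floor_eq_floor hq
      rw [← sub_mul, abs_mul, abs_of_pos hN0] at this
      exact this.le
    exact_mod_cast this
  set D := (((P ×ˢ P).filter fun q => |θ q.1 - θ q.2| * N ≤ 1).card : ℝ) with hD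
  have h8 : (N : ℝ) * ∑ k ∈ Finset.range N, f k ≤ N * (20 * K * N * D) := by
    calc _ ≤ _ := h1.trans (h3.trans h5)
      _ ≤ 20 * N ^ 2 * (K * D) := by
        refine mul_le_mul_of_nonneg_left (h6.trans ?_) (by positivity)
        gcongr
      _ = _ := by ring
  exact le_of_mul_le_mul_left h8 hN0

theorem ec_eq_one_iff {x : ℝ} : ec x = 1 ↔ ∃ n : ℤ, x = n := by
  constructor
  · intro h
    rw [ec, Complex.exp_eq_one_iff] at h
    obtain ⟨n, hn⟩ := h
    refine ⟨n, ?_⟩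
    have h1 : ((2 * Real.pi * x : ℝ) : ℂ) * Complex.I = ((2 * Real.pi * n : ℝ) : ℂ) * Complex.I := by
      rw [hn]; push_cast; ring
    have h2 := Complex.ofReal_injective (mul_right_cancel₀ Complex.I_ne_zero h1)
    have h3 : 2 * Real.pi ≠ 0 := by positivity
    exact mul_left_cancel₀ h3 h2
  · rintro ⟨n, rfl⟩
    exact ec_int n

theorem ecSum_eq_ite {N : ℕ} (hN : 1 ≤ N) {u v : ℕ} (hu : u < N) (hv : v < N) :
    ecSum N (((u : ℝ) - v) / N) = if u = v then (N : ℂ) else 0 := by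
  have hN0 : (N : ℝ) ≠ 0 := by positivity
  split_ifs with h
  · simp [ecSum, h, ec_zero]
  · have h1 : ecSum N (((u : ℝ) - v) / N) * (ec (((u : ℝ) - v) / N) - 1) =
        ec (((u : ℝ) - v) / N) ^ N - 1 := by
      simp only [ecSum, ec_nat_mul]
      exact geom_sum_mul _ _
    rw [← ec_nat_mul, mul_div_cancel₀ _ hN0] at h1
    have h2 : ec ((u : ℝ) - v) = 1 := ec_eq_one_iff.2 ⟨(u : ℤ) - v, by push_cast; ring⟩
    rw [h2, sub_self] at h1
    rcases mul_eq_zero.1 h1 with h3 | h3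
    · exact h3
    · exfalso
      obtain ⟨n, hn⟩ := ec_eq_one_iff.1 (sub_eq_zero.1 h3)
      rw [div_eq_iff hN0] at hn
      have hn' : (u : ℤ) - v = n * N := by exact_mod_cast hn
      have hdvd : (N : ℤ) ∣ (u : ℤ) - v := ⟨n, by rw [hn']; ring⟩
      have := Int.eq_zero_of_abs_lt_dvd hdvd (by rw [abs_lt]; constructor <;> omega)
      omega

theorem sum_norm_sq_orthogonality {ι : Type*} (P : Finset ι) (a : ι → ℂ) (u : ι → ℕ) {N : ℕ}
    (hN : 1 ≤ N) (hu : ∀ n ∈ P, u n < N) :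
    ∑ x ∈ Finset.range N, ‖∑ n ∈ P, a n * ec ((u n : ℝ) * x / N)‖ ^ 2 =
      N * ∑ j ∈ Finset.range N, ‖∑ n ∈ P.filter (fun n => u n = j), a n‖ ^ 2 := by
  classical
  have h1 : ∀ x : ℕ, ((‖∑ n ∈ P, a n * ec ((u n : ℝ) * x / N)‖ ^ 2 : ℝ) : ℂ) =
      ∑ n ∈ P, ∑ n' ∈ P, a n * (starRingEnd ℂ) (a n') * ec (x * (((u n : ℝ) - u n') / N)) := by
    intro x
    have := normSq_sum_mul_ec P a (fun n => (u n : ℝ)) ((x : ℝ) / N)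
    simp only [mul_div_assoc]
    rw [this]
    refine Finset.sum_congr rfl fun n _ => Finset.sum_congr rfl fun n' _ => ?_
    congr 2
    ring
  have h2 : ((∑ x ∈ Finset.range N, ‖∑ n ∈ P, a n * ec ((u n : ℝ) * x / N)‖ ^ 2 : ℝ) : ℂ) =
      N * ∑ n ∈ P, ∑ n' ∈ P, if u n = u n' then a n * (starRingEnd ℂ) (a n') else 0 := by
    rw [Complex.ofReal_sum, Finset.sum_congr rfl fun x _ => h1 x, Finset.sum_comm, Finset.mul_sum]
    refine Finset.sum_congr rfl fun n hn => ?_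
    rw [Finset.sum_comm, Finset.mul_sum]
    refine Finset.sum_congr rfl fun n' hn' => ?_
    rw [← Finset.mul_sum]
    have := ecSum_eq_ite hN (hu n hn) (hu n' hn')
    rw [ecSum] at this
    rw [this]
    split_ifs <;> ring
  have h3 : ∀ j : ℕ, ((‖∑ n ∈ P.filter (fun n => u n = j), a n‖ ^ 2 : ℝ) : ℂ) =
      ∑ n ∈ P, ∑ n' ∈ P, if u n = j ∧ u n' = j then a n * (starRingEnd ℂ) (a n') else 0 := by
    intro j
    rw [← Complex.normSq_eq_norm_sq, ← Complex.mul_conj, map_sum, Finset.sum_mul_sum,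
      Finset.sum_filter]
    refine Finset.sum_congr rfl fun n _ => ?_
    rw [Finset.sum_filter]
    split_ifs with h
    · exact Finset.sum_congr rfl fun n' _ => by simp [h]
    · simp [h]
  have h4 : ((N * ∑ j ∈ Finset.range N, ‖∑ n ∈ P.filter (fun n => u n = j), a n‖ ^ 2 : ℝ) : ℂ) =
      N * ∑ n ∈ P, ∑ n' ∈ P, if u n = u n' then a n * (starRingEnd ℂ) (a n') else 0 := by
    rw [Complex.ofReal_mul, Complex.ofReal_sum, Finset.sum_congr rfl fun j _ => h3 j,
      Finset.sum_comm, Complex.ofReal_natCast]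
    congr 1
    refine Finset.sum_congr rfl fun n hn => ?_
    rw [Finset.sum_comm]
    refine Finset.sum_congr rfl fun n' _ => ?_
    rw [Finset.sum_eq_single (u n)]
    · simp [eq_comm]
    · intro j _ hj
      rw [if_neg]
      rintro ⟨h, -⟩
      exact hj h.symm
    · intro h
      exact absurd (Finset.mem_range.2 (hu n hn)) h
  exact Complex.ofReal_injective (h2.trans h4.symm)

/-- A mean square over two full systems of residues and a well spaced system of real points. -/
theorem mean_square_grid_le : ∃ C : ℝ, 0 < C ∧ ∀ {ι : Type} (P : Finset ι) (c : ι → ℂ)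
    (u w : ι → ℕ) (θ : ι → ℝ) (N₁ N₂ N₃ : ℕ), 1 ≤ N₁ → 1 ≤ N₂ → 1 ≤ N₃ → (∀ n ∈ P, ‖c n‖ ≤ 1) →
    (∀ n ∈ P, u n < N₁) → (∀ n ∈ P, w n < N₂) → (∀ n ∈ P, ∀ n' ∈ P, |θ n - θ n'| ≤ 1 / 2) →
    ∑ x ∈ Finset.range N₁, ∑ y ∈ Finset.range N₂, ∑ k ∈ Finset.range N₃,
      ‖∑ n ∈ P, c n * ec ((u n : ℝ) * x / N₁ + (w n : ℝ) * y / N₂ + θ n * k)‖ ^ 2 ≤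
      C * N₁ * N₂ * N₃ * ((P ×ˢ P).filter fun q => u q.1 = u q.2 ∧ w q.1 = w q.2 ∧
        |θ q.1 - θ q.2| * N₃ ≤ 1).card := by
  classical
  obtain ⟨C, hC, hms⟩ := mean_square_le
  refine ⟨C, hC, ?_⟩
  intro ι P c u w θ N₁ N₂ N₃ h₁ h₂ h₃ hc hu hw hθ
  set Q : ℕ → ℕ → Finset ι := fun j l => (P.filter fun n => u n = j).filter fun n => w n = l with hQ
  have e1 : ∀ y k : ℕ, ∑ x ∈ Finset.range N₁,
      ‖∑ n ∈ P, c n * ec ((u n : ℝ) * x / N₁ + (w n : ℝ) * y / N₂ + θ n * k)‖ ^ 2 =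
      N₁ * ∑ j ∈ Finset.range N₁, ‖∑ n ∈ P.filter (fun n => u n = j),
        (c n * ec (θ n * k)) * ec ((w n : ℝ) * y / N₂)‖ ^ 2 := by
    intro y k
    rw [← sum_norm_sq_orthogonality P (fun n => (c n * ec (θ n * k)) * ec ((w n : ℝ) * y / N₂)) u
      h₁ hu]
    refine Finset.sum_congr rfl fun x _ => ?_
    congr 2
    refine Finset.sum_congr rfl fun n _ => ?_
    rw [ec_add, ec_add]
    ring
  have e2 : ∀ j k : ℕ, ∑ y ∈ Finset.range N₂, ‖∑ n ∈ P.filter (fun n => u n = j),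
        (c n * ec (θ n * k)) * ec ((w n : ℝ) * y / N₂)‖ ^ 2 =
      N₂ * ∑ l ∈ Finset.range N₂, ‖∑ n ∈ Q j l, c n * ec (θ n * k)‖ ^ 2 := by
    intro j k
    rw [sum_norm_sq_orthogonality (P.filter fun n => u n = j) (fun n => c n * ec (θ n * k)) w h₂
      fun n hn => hw n (Finset.mem_filter.1 hn).1]
  have e3 : ∀ j l : ℕ, ∑ k ∈ Finset.range N₃, ‖∑ n ∈ Q j l, c n * ec (θ n * k)‖ ^ 2 ≤
      C * N₃ * ((Q j l ×ˢ Q j l).filter fun q => |θ q.1 - θ q.2| * N₃ ≤ 1).card := by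
    intro j l
    have hsub : ∀ n ∈ Q j l, n ∈ P := fun n hn =>
      (Finset.mem_filter.1 (Finset.mem_filter.1 hn).1).1
    exact hms (Q j l) c θ N₃ h₃ (fun n hn => hc n (hsub n hn))
      fun n hn n' hn' => hθ n (hsub n hn) n' (hsub n' hn')
  set A := (P ×ˢ P).filter fun q => u q.1 = u q.2 ∧ w q.1 = w q.2 ∧ |θ q.1 - θ q.2| * N₃ ≤ 1 with hA
  have e4 : (A.card : ℝ) = ∑ j ∈ Finset.range N₁, ∑ l ∈ Finset.range N₂,
      (((Q j l ×ˢ Q j l).filter fun q => |θ q.1 - θ q.2| * N₃ ≤ 1).card : ℝ) := by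
    have hmap : ∀ q ∈ A, (u q.1, w q.1) ∈ Finset.range N₁ ×ˢ Finset.range N₂ := by
      intro q hq
      have := Finset.mem_product.1 (Finset.mem_filter.1 hq).1
      exact Finset.mem_product.2 ⟨Finset.mem_range.2 (hu _ this.1), Finset.mem_range.2 (hw _ this.1)⟩
    rw [Finset.card_eq_sum_card_fiberwise hmap, Finset.sum_product]
    push_cast
    refine Finset.sum_congr rfl fun j _ => Finset.sum_congr rfl fun l _ => ?_
    congr 2
    ext q
    simp only [hA, hQ, Finset.mem_filter, Finset.mem_product, Prod.mk.injEq]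
    constructor
    · rintro ⟨⟨⟨h1, h2⟩, h3, h4, h5⟩, h6, h7⟩
      exact ⟨⟨⟨⟨h1, h6⟩, h7⟩, ⟨h2, by rw [← h3, h6]⟩, by rw [← h4, h7]⟩, h5⟩
    · rintro ⟨⟨⟨⟨h1, h6⟩, h7⟩, ⟨h2, h8⟩, h9⟩, h5⟩
      exact ⟨⟨⟨h1, h2⟩, by rw [h6, h8], by rw [h7, h9], h5⟩, h6, h7⟩
  calc _ = ∑ k ∈ Finset.range N₃, ∑ y ∈ Finset.range N₂, ∑ x ∈ Finset.range N₁,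
      ‖∑ n ∈ P, c n * ec ((u n : ℝ) * x / N₁ + (w n : ℝ) * y / N₂ + θ n * k)‖ ^ 2 := by
        rw [Finset.sum_congr rfl fun x _ => Finset.sum_comm, Finset.sum_comm]
        refine Finset.sum_congr rfl fun k _ => ?_
        rw [Finset.sum_comm]
    _ = ∑ k ∈ Finset.range N₃, (N₁ : ℝ) * ∑ j ∈ Finset.range N₁,
        (N₂ * ∑ l ∈ Finset.range N₂, ‖∑ n ∈ Q j l, c n * ec (θ n * k)‖ ^ 2) := by
        refine Finset.sum_congr rfl fun k _ => ?_
        rw [Finset.sum_congr rfl fun y _ => e1 y k, ← Finset.mul_sum, Finset.sum_comm]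
        congr 1
        exact Finset.sum_congr rfl fun j _ => e2 j k
    _ = N₁ * N₂ * ∑ j ∈ Finset.range N₁, ∑ l ∈ Finset.range N₂, ∑ k ∈ Finset.range N₃,
        ‖∑ n ∈ Q j l, c n * ec (θ n * k)‖ ^ 2 := by
        simp only [← Finset.mul_sum]
        rw [← mul_assoc, Finset.sum_comm]
        congr 1
        refine Finset.sum_congr rfl fun j _ => ?_
        rw [Finset.sum_comm]
    _ ≤ N₁ * N₂ * ∑ j ∈ Finset.range N₁, ∑ l ∈ Finset.range N₂, (C * N₃ *
        (((Q j l ×ˢ Q j l).filter fun q => |θ q.1 - θ q.2| * N₃ ≤ 1).card : ℝ)) := by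
        gcongr with j _ l _
        exact e3 j l
    _ = _ := by
        simp only [← Finset.mul_sum]
        rw [← e4]
        ring

theorem norm_sq_ecSum_eq (H : ℕ) (x : ℝ) : ‖ecSum H x‖ ^ 2 =
    H + 2 * (∑ k ∈ Finset.Ico 1 H, ((H : ℂ) - k) * ec (k * x)).re := by
  induction H with
  | zero => simp [ecSum]
  | succ H ih =>
    have h1 : ecSum (H + 1) x = ecSum H x + ec (H * x) := by
      simp only [ecSum, Finset.sum_range_succ]
    have h2 : ec (H * x) * (starRingEnd ℂ) (ecSum H x) = ∑ k ∈ Finset.Ico 1 (H + 1), ec (k * x) := by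
      rw [ecSum, map_sum, Finset.mul_sum]
      refine Finset.sum_bij' (fun j _ => H - j) (fun k _ => H - k) ?_ ?_ ?_ ?_ ?_
      · intro j hj; have := Finset.mem_range.1 hj; exact Finset.mem_Ico.2 (by omega)
      · intro j hj; have := Finset.mem_Ico.1 hj; exact Finset.mem_range.2 (by omega)
      · intro j hj; have := Finset.mem_range.1 hj; omega
      · intro j hj; have := Finset.mem_Ico.1 hj; omega
      · intro j hj
        have := Finset.mem_range.1 hj
        rw [conj_ec, ← ec_add, Nat.cast_sub this.le]
        congr 1
        ring
    have h3 : ‖ecSum (H + 1) x‖ ^ 2 = ‖ecSum H x‖ ^ 2 + 1 +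
        2 * (ec (H * x) * (starRingEnd ℂ) (ecSum H x)).re := by
      rw [h1, ← Complex.normSq_eq_norm_sq, Complex.normSq_add, Complex.normSq_eq_norm_sq,
        Complex.normSq_eq_norm_sq, norm_ec]
      have : (ecSum H x * (starRingEnd ℂ) (ec (H * x))).re =
          (ec (H * x) * (starRingEnd ℂ) (ecSum H x)).re := by
        simp [Complex.mul_re]; ring
      rw [this]; ring
    have h4 : ∑ k ∈ Finset.Ico 1 (H + 1), (((H + 1 : ℕ) : ℂ) - k) * ec (k * x) =
        ∑ k ∈ Finset.Ico 1 H, ((H : ℂ) - k) * ec (k * x) + ∑ k ∈ Finset.Ico 1 (H + 1), ec (k * x) := by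
      have : ∑ k ∈ Finset.Ico 1 H, ((H : ℂ) - k) * ec (k * x) =
          ∑ k ∈ Finset.Ico 1 (H + 1), ((H : ℂ) - k) * ec (k * x) := by
        rcases Nat.eq_zero_or_pos H with rfl | hH
        · simp
        · rw [Finset.sum_Ico_succ_top hH]; simp
      rw [this, ← Finset.sum_add_distrib]
      refine Finset.sum_congr rfl fun k _ => ?_
      push_cast
      ring
    rw [h3, ih, h2, h4, Complex.add_re]
    push_cast
    ring

theorem norm_sq_ecSum_ge {H : ℕ} (hH : 1 ≤ H) {x : ℝ} {n : ℤ} (hx : |x - n| * (8 * H) ≤ 1) :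
    (H : ℝ) ^ 2 / 2 ≤ ‖ecSum H x‖ ^ 2 := by
  have hH0 : (0 : ℝ) < H := by exact_mod_cast hH
  have hper : ecSum H x = ecSum H (x - n) := by
    simp only [ecSum]
    refine Finset.sum_congr rfl fun j _ => ?_
    rw [ec_nat_mul, ec_nat_mul]
    congr 1
    have := ec_add (x - n) n
    rwa [sub_add_cancel, ec_int, mul_one] at this
  rw [hper]
  have h1 : (H : ℝ) * (√2 / 2) ≤ (ecSum H (x - n)).re := by
    rw [ecSum, Complex.re_sum]
    have : ∑ j ∈ Finset.range H, (√2 / 2 : ℝ) = H * (√2 / 2) := by simp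
    rw [← this]
    refine Finset.sum_le_sum fun j hj => ?_
    rw [ec_re, ← Real.cos_abs, ← Real.cos_pi_div_four]
    have hj' : (j : ℝ) ≤ H := by exact_mod_cast (Finset.mem_range.1 hj).le
    have hp := Real.pi_pos
    have hle : |2 * Real.pi * (j * (x - n))| ≤ Real.pi / 4 := by
      rw [abs_mul, abs_of_pos (by positivity : 0 < 2 * Real.pi), abs_mul, Nat.abs_cast]
      have : (j : ℝ) * |x - n| ≤ H * |x - n| := by gcongr
      nlinarith
    exact Real.cos_le_cos_of_nonneg_of_le_pi (abs_nonneg _) (by linarith) hle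
  have h2 := (Complex.abs_re_le_norm (ecSum H (x - n)))
  have h3 : (H : ℝ) * (√2 / 2) ≤ ‖ecSum H (x - n)‖ := h1.trans ((le_abs_self _).trans h2)
  have h4 : ((H : ℝ) * (√2 / 2)) ^ 2 ≤ ‖ecSum H (x - n)‖ ^ 2 := by gcongr
  have h5 : (√2) ^ 2 = (2 : ℝ) := Real.sq_sqrt (by norm_num)
  calc _ = ((H : ℝ) * (√2 / 2)) ^ 2 := by rw [mul_pow, div_pow, h5]; ring
    _ ≤ _ := h4

open Classical in
/-- Counting points near the integers by exponential sums. -/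
theorem card_near_int_le {ι : Type*} (I : Finset ι) (X : ι → ℝ) {H : ℕ} (hH : 1 ≤ H) :
    ((I.filter fun i => ∃ n : ℤ, |X i - n| * (8 * H) ≤ 1).card : ℝ) ≤
      2 * I.card / H + 4 / H * ‖∑ k ∈ Finset.Ico 1 H, ((1 - k / H : ℝ) : ℂ) *
        ∑ i ∈ I, ec (k * X i)‖ := by
  have hH0 : (0 : ℝ) < H := by exact_mod_cast hH
  set A := I.filter fun i => ∃ n : ℤ, |X i - n| * (8 * H) ≤ 1 with hA
  have h1 : (A.card : ℝ) * ((H : ℝ) ^ 2 / 2) ≤ ∑ i ∈ I, ‖ecSum H (X i)‖ ^ 2 := by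
    rw [← nsmul_eq_mul, ← Finset.sum_const]
    refine (Finset.sum_le_sum fun i hi => ?_).trans
      (Finset.sum_le_sum_of_subset_of_nonneg (Finset.filter_subset _ _) fun _ _ _ => by positivity)
    obtain ⟨n, hn⟩ := (Finset.mem_filter.1 hi).2
    exact norm_sq_ecSum_ge hH hn
  set Z := ∑ k ∈ Finset.Ico 1 H, ((1 - k / H : ℝ) : ℂ) * ∑ i ∈ I, ec (k * X i) with hZ
  have h2 : ∑ i ∈ I, ‖ecSum H (X i)‖ ^ 2 = I.card * H + 2 * (H * Z.re) := by
    simp only [norm_sq_ecSum_eq]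
    rw [Finset.sum_add_distrib, Finset.sum_const, nsmul_eq_mul, ← Finset.mul_sum, ← Complex.re_sum]
    congr 2
    have : (H : ℂ) * Z = ∑ i ∈ I, ∑ k ∈ Finset.Ico 1 H, ((H : ℂ) - k) * ec (k * X i) := by
      rw [Finset.sum_comm, hZ, Finset.mul_sum]
      refine Finset.sum_congr rfl fun k _ => ?_
      rw [← Finset.mul_sum, ← mul_assoc]
      congr 1
      have : (H : ℂ) ≠ 0 := by exact_mod_cast hH0.ne'
      push_cast
      field_simp
    rw [← this]
    simp [Complex.mul_re]
  have h3 : Z.re ≤ ‖Z‖ := (le_abs_self _).trans (Complex.abs_re_le_norm Z)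
  rw [h2] at h1
  have h4 : (A.card : ℝ) * (H ^ 2 / 2) ≤ (2 * I.card / H + 4 / H * ‖Z‖) * (H ^ 2 / 2) := by
    have : (2 * I.card / H + 4 / H * ‖Z‖) * (H ^ 2 / 2) = I.card * H + 2 * (H * ‖Z‖) := by
      field_simp
      ring
    rw [this]
    nlinarith
  exact le_of_mul_le_mul_right h4 (by positivity)

/-- The ratio governing a four term relation between square roots. -/
def sqrtRatio (z₁ z₂ z₃ z₄ : ℝ) : ℝ :=
  (√z₁ + √z₂) * (√z₁ + √z₃) / ((√z₄ + √z₂) * (√z₄ + √z₃))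

theorem sqrt_mem_of_mem {Y z : ℝ} (h : Y ≤ z ∧ z ≤ 4 * Y) : √Y ≤ √z ∧ √z ≤ 2 * √Y := by
  refine ⟨Real.sqrt_le_sqrt h.1, ?_⟩
  have : √(4 * Y) = 2 * √Y := by
    rw [Real.sqrt_mul (by norm_num), show (4 : ℝ) = 2 ^ 2 by norm_num, Real.sqrt_sq (by norm_num)]
  rw [← this]
  exact Real.sqrt_le_sqrt h.2

theorem sqrtRatio_bounds {Y z₁ z₂ z₃ z₄ : ℝ} (hY : 0 < Y) (h₁ : Y ≤ z₁ ∧ z₁ ≤ 4 * Y)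
    (h₂ : Y ≤ z₂ ∧ z₂ ≤ 4 * Y) (h₃ : Y ≤ z₃ ∧ z₃ ≤ 4 * Y) (h₄ : Y ≤ z₄ ∧ z₄ ≤ 4 * Y) :
    1 / 4 ≤ sqrtRatio z₁ z₂ z₃ z₄ ∧ sqrtRatio z₁ z₂ z₃ z₄ ≤ 4 := by
  have a := Real.sqrt_pos.2 hY
  have b₁ := sqrt_mem_of_mem h₁
  have b₂ := sqrt_mem_of_mem h₂
  have b₃ := sqrt_mem_of_mem h₃
  have b₄ := sqrt_mem_of_mem h₄
  unfold sqrtRatio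
  generalize √Y = y at *
  generalize √z₁ = x₁ at *
  generalize √z₂ = x₂ at *
  generalize √z₃ = x₃ at *
  generalize √z₄ = x₄ at *
  have p₁ : 0 < x₁ := by linarith
  have p₂ : 0 < x₂ := by linarith
  have p₃ : 0 < x₃ := by linarith
  have p₄ : 0 < x₄ := by linarith
  constructor
  · rw [le_div_iff₀ (by positivity)]
    have e₁ : x₄ + x₂ ≤ 2 * (x₁ + x₂) := by linarith
    have e₂ : x₄ + x₃ ≤ 2 * (x₁ + x₃) := by linarith
    have := mul_le_mul e₁ e₂ (by positivity) (by positivity)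
    linarith
  · rw [div_le_iff₀ (by positivity)]
    have e₁ : x₁ + x₂ ≤ 2 * (x₄ + x₂) := by linarith
    have e₂ : x₁ + x₃ ≤ 2 * (x₄ + x₃) := by linarith
    have := mul_le_mul e₁ e₂ (by positivity) (by positivity)
    linarith

theorem sqrtRatio_relation {Y ε h₁ h₂ h₃ h₄ z₁ z₂ z₃ z₄ : ℝ} (hY : 0 < Y)
    (hz₁ : Y ≤ z₁ ∧ z₁ ≤ 4 * Y) (hz₂ : Y ≤ z₂ ∧ z₂ ≤ 4 * Y) (hz₃ : Y ≤ z₃ ∧ z₃ ≤ 4 * Y)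
    (hz₄ : Y ≤ z₄ ∧ z₄ ≤ 4 * Y) (hh : h₁ + h₂ = h₃ + h₄)
    (hz : h₁ * z₁ + h₂ * z₂ = h₃ * z₃ + h₄ * z₄)
    (hΦ : |h₁ * √z₁ + h₂ * √z₂ - h₃ * √z₃ - h₄ * √z₄| ≤ ε) :
    |h₄ * (z₄ - z₂) * (z₄ - z₃) * sqrtRatio z₁ z₂ z₃ z₄ - h₁ * (z₁ - z₂) * (z₁ - z₃)| ≤
      64 * (ε * (Y * √Y)) ∧
    |h₄ * (z₄ - z₂) * (z₄ - z₃) - h₁ * (z₁ - z₂) * (z₁ - z₃) * (sqrtRatio z₁ z₂ z₃ z₄)⁻¹| ≤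
      64 * (ε * (Y * √Y)) := by
  have a := Real.sqrt_pos.2 hY
  have b₁ := sqrt_mem_of_mem hz₁
  have b₂ := sqrt_mem_of_mem hz₂
  have b₃ := sqrt_mem_of_mem hz₃
  have b₄ := sqrt_mem_of_mem hz₄
  have s := Real.sq_sqrt hY.le
  have s₁ := Real.sq_sqrt (hY.le.trans hz₁.1)
  have s₂ := Real.sq_sqrt (hY.le.trans hz₂.1)
  have s₃ := Real.sq_sqrt (hY.le.trans hz₃.1)
  have s₄ := Real.sq_sqrt (hY.le.trans hz₄.1)
  have hε : 0 ≤ ε := (abs_nonneg _).trans hΦ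
  unfold sqrtRatio
  generalize √Y = y at *
  generalize √z₁ = x₁ at *
  generalize √z₂ = x₂ at *
  generalize √z₃ = x₃ at *
  generalize √z₄ = x₄ at *
  have p₁ : 0 < x₁ := by linarith
  have p₂ : 0 < x₂ := by linarith
  have p₃ : 0 < x₃ := by linarith
  have p₄ : 0 < x₄ := by linarith
  subst s s₁ s₂ s₃ s₄
  have key : (h₁ * x₁ + h₂ * x₂ - h₃ * x₃ - h₄ * x₄) * (x₂ + x₃) =
      h₄ * (x₄ - x₂) * (x₄ - x₃) - h₁ * (x₁ - x₂) * (x₁ - x₃) := by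
    linear_combination hz + x₂ * x₃ * hh
  have e₁ : h₄ * (x₄ ^ 2 - x₂ ^ 2) * (x₄ ^ 2 - x₃ ^ 2) *
      ((x₁ + x₂) * (x₁ + x₃) / ((x₄ + x₂) * (x₄ + x₃))) - h₁ * (x₁ ^ 2 - x₂ ^ 2) * (x₁ ^ 2 - x₃ ^ 2) =
      (h₁ * x₁ + h₂ * x₂ - h₃ * x₃ - h₄ * x₄) * ((x₂ + x₃) * (x₁ + x₂) * (x₁ + x₃)) := by
    rw [← mul_assoc, ← mul_assoc, key]
    field_simp
    ring
  have e₂ : h₄ * (x₄ ^ 2 - x₂ ^ 2) * (x₄ ^ 2 - x₃ ^ 2) - h₁ * (x₁ ^ 2 - x₂ ^ 2) * (x₁ ^ 2 - x₃ ^ 2) *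
      ((x₁ + x₂) * (x₁ + x₃) / ((x₄ + x₂) * (x₄ + x₃)))⁻¹ =
      (h₁ * x₁ + h₂ * x₂ - h₃ * x₃ - h₄ * x₄) * ((x₂ + x₃) * (x₄ + x₂) * (x₄ + x₃)) := by
    rw [← mul_assoc, ← mul_assoc, key]
    field_simp
    ring
  rw [e₁, e₂, abs_mul _ ((x₂ + x₃) * (x₁ + x₂) * (x₁ + x₃)),
    abs_mul _ ((x₂ + x₃) * (x₄ + x₂) * (x₄ + x₃))]
  have t : ∀ u v w : ℝ, 0 < u → 0 < v → 0 < w → u ≤ 4 * y → v ≤ 4 * y → w ≤ 4 * y →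
      |h₁ * x₁ + h₂ * x₂ - h₃ * x₃ - h₄ * x₄| * |u * v * w| ≤ 64 * (ε * (y ^ 2 * y)) := by
    intro u v w hu hv hw hu' hv' hw'
    rw [abs_of_pos (show 0 < u * v * w by positivity)]
    calc _ ≤ ε * ((4 * y) * (4 * y) * (4 * y)) := by gcongr
      _ = _ := by ring
  exact ⟨t _ _ _ (by positivity) (by positivity) (by positivity) (by linarith) (by linarith)
    (by linarith), t _ _ _ (by positivity) (by positivity) (by positivity) (by linarith)
    (by linarith) (by linarith)⟩

theorem sqrtRatio_sub_le {Y Δ z₁ z₂ z₃ z₄ : ℝ} (hY : 0 < Y) (hΔ : 0 ≤ Δ) (h14 : z₄ ≤ z₁)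
    (hz₁ : Y ≤ z₁ ∧ z₁ + Δ ≤ 4 * Y) (hz₂ : Y ≤ z₂ ∧ z₂ + Δ ≤ 4 * Y)
    (hz₃ : Y ≤ z₃ ∧ z₃ + Δ ≤ 4 * Y) (hz₄ : Y ≤ z₄ ∧ z₄ + Δ ≤ 4 * Y) :
    (z₁ - z₄) * Δ ≤ 256 * Y ^ 2 * (sqrtRatio z₁ z₂ z₃ z₄ -
      sqrtRatio (z₁ + Δ) (z₂ + Δ) (z₃ + Δ) (z₄ + Δ)) := by
  have hf : ∀ a b c : ℝ, Y ≤ a → Y ≤ b → Y ≤ c →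
      (√a + √c) / (√b + √c) = 1 + (a - b) / ((√a + √b) * (√b + √c)) := by
    intro a b c ha hb hc
    have p₁ := Real.sqrt_pos.2 (hY.trans_le ha)
    have p₂ := Real.sqrt_pos.2 (hY.trans_le hb)
    have p₃ := Real.sqrt_pos.2 (hY.trans_le hc)
    have s₁ := Real.sq_sqrt (hY.le.trans ha)
    have s₂ := Real.sq_sqrt (hY.le.trans hb)
    generalize √a = x at *
    generalize √b = y at *
    generalize √c = z at *
    subst s₁ s₂
    field_simp
    ring
  have hR : ∀ a b c d : ℝ, Y ≤ a → Y ≤ b → Y ≤ c → Y ≤ d → sqrtRatio a b c d =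
      (1 + (a - d) / ((√a + √d) * (√d + √b))) * (1 + (a - d) / ((√a + √d) * (√d + √c))) := by
    intro a b c d ha hb hc hd
    rw [← hf a d b ha hd hb, ← hf a d c ha hd hc, sqrtRatio]
    field_simp
  rw [hR _ _ _ _ hz₁.1 hz₂.1 hz₃.1 hz₄.1, hR _ _ _ _ (by linarith) (by linarith) (by linarith)
    (by linarith), show z₁ + Δ - (z₄ + Δ) = z₁ - z₄ by ring]
  have hmono : ∀ a : ℝ, √a ≤ √(a + Δ) := fun a => Real.sqrt_le_sqrt (by linarith)
  have hsq : ∀ a : ℝ, Y ≤ a → a + Δ ≤ 4 * Y → Δ ≤ (√(a + Δ) - √a) * (4 * √Y) := by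
    intro a ha ha'
    have s₁ := Real.sq_sqrt (hY.le.trans ha)
    have s₂ := Real.sq_sqrt (show (0 : ℝ) ≤ a + Δ by linarith)
    have b₁ := (sqrt_mem_of_mem (Y := Y) (z := a) ⟨ha, by linarith⟩).2
    have b₂ := (sqrt_mem_of_mem (Y := Y) (z := a + Δ) ⟨by linarith, ha'⟩).2
    have := hmono a
    have : Δ = (√(a + Δ) - √a) * (√(a + Δ) + √a) := by linear_combination s₁ - s₂
    calc Δ = (√(a + Δ) - √a) * (√(a + Δ) + √a) := this
      _ ≤ _ := by gcongr <;> linarith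
  have a := Real.sqrt_pos.2 hY
  have s := Real.sq_sqrt hY.le
  have b₁ := (sqrt_mem_of_mem (Y := Y) (z := z₁) ⟨hz₁.1, by linarith⟩).1
  have b₂ := (sqrt_mem_of_mem (Y := Y) (z := z₂) ⟨hz₂.1, by linarith⟩).1
  have b₃ := (sqrt_mem_of_mem (Y := Y) (z := z₃) ⟨hz₃.1, by linarith⟩).1
  have b₄ := (sqrt_mem_of_mem (Y := Y) (z := z₄) ⟨hz₄.1, by linarith⟩).1
  have b₁' := (sqrt_mem_of_mem (Y := Y) (z := z₁ + Δ) ⟨by linarith, hz₁.2⟩).2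
  have b₂' := (sqrt_mem_of_mem (Y := Y) (z := z₂ + Δ) ⟨by linarith, hz₂.2⟩).2
  have b₄' := (sqrt_mem_of_mem (Y := Y) (z := z₄ + Δ) ⟨by linarith, hz₄.2⟩).2
  have c₁ := hsq z₁ hz₁.1 hz₁.2
  have c₄ := hsq z₄ hz₄.1 hz₄.2
  have m₁ := hmono z₁
  have m₂ := hmono z₂
  have m₃ := hmono z₃
  have m₄ := hmono z₄
  have hD : 0 ≤ z₁ - z₄ := by linarith
  generalize √Y = y at *
  generalize √(z₁ + Δ) = w₁ at *
  generalize √(z₂ + Δ) = w₂ at *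
  generalize √(z₃ + Δ) = w₃ at *
  generalize √(z₄ + Δ) = w₄ at *
  generalize √z₁ = x₁ at *
  generalize √z₂ = x₂ at *
  generalize √z₃ = x₃ at *
  generalize √z₄ = x₄ at *
  generalize z₁ - z₄ = D at *
  subst s
  have p₁ : 0 < x₁ := by linarith
  have p₂ : 0 < x₂ := by linarith
  have p₃ : 0 < x₃ := by linarith
  have p₄ : 0 < x₄ := by linarith
  have q₁ : 0 < w₁ := by linarith
  have q₂ : 0 < w₂ := by linarith
  have q₃ : 0 < w₃ := by linarith
  have q₄ : 0 < w₄ := by linarith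
  have f₃ : D / ((w₁ + w₄) * (w₄ + w₃)) ≤ D / ((x₁ + x₄) * (x₄ + x₃)) := by gcongr
  have f₂ : D / ((w₁ + w₄) * (w₄ + w₂)) ≤ D / ((x₁ + x₄) * (x₄ + x₂)) := by gcongr
  have f₂' : D * Δ ≤ 256 * (y ^ 2) ^ 2 *
      (D / ((x₁ + x₄) * (x₄ + x₂)) - D / ((w₁ + w₄) * (w₄ + w₂))) := by
    have hM : Δ ≤ (w₁ + w₄) * (w₄ + w₂) - (x₁ + x₄) * (x₄ + x₂) := by
      have : (w₁ + w₄ - (x₁ + x₄)) * (x₄ + x₂) ≤ (w₁ + w₄) * (w₄ + w₂) - (x₁ + x₄) * (x₄ + x₂) := by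
        nlinarith
      have : Δ ≤ (w₁ + w₄ - (x₁ + x₄)) * (2 * y) := by linarith
      have : (w₁ + w₄ - (x₁ + x₄)) * (2 * y) ≤ (w₁ + w₄ - (x₁ + x₄)) * (x₄ + x₂) := by
        gcongr <;> linarith
      linarith
    have e : D / ((x₁ + x₄) * (x₄ + x₂)) - D / ((w₁ + w₄) * (w₄ + w₂)) =
        D * ((w₁ + w₄) * (w₄ + w₂) - (x₁ + x₄) * (x₄ + x₂)) /
          (((x₁ + x₄) * (x₄ + x₂)) * ((w₁ + w₄) * (w₄ + w₂))) := by
      field_simp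
    rw [e, ← mul_div_assoc, le_div_iff₀ (by positivity)]
    have hMM : ((x₁ + x₄) * (x₄ + x₂)) * ((w₁ + w₄) * (w₄ + w₂)) ≤
        ((4 * y) * (4 * y)) * ((4 * y) * (4 * y)) := by gcongr <;> linarith
    calc D * Δ * (((x₁ + x₄) * (x₄ + x₂)) * ((w₁ + w₄) * (w₄ + w₂))) ≤
        D * ((w₁ + w₄) * (w₄ + w₂) - (x₁ + x₄) * (x₄ + x₂)) *
          (((4 * y) * (4 * y)) * ((4 * y) * (4 * y))) :=
          mul_le_mul (mul_le_mul_of_nonneg_left hM hD) hMM (by positivity)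
            (mul_nonneg hD (hΔ.trans hM))
      _ = _ := by ring
  have g₃ : 0 ≤ D / ((x₁ + x₄) * (x₄ + x₃)) := by positivity
  have g₂ : 0 ≤ D / ((w₁ + w₄) * (w₄ + w₂)) := by positivity
  refine f₂'.trans (mul_le_mul_of_nonneg_left ?_ (by positivity))
  nlinarith

/-- The four term relations of the first spacing problem; entries of `t` are pairs `(h, i)`. -/
structure FourRel (K μ : ℤ) (y₀ ε : ℝ) (t : (ℤ × ℤ) × (ℤ × ℤ) × (ℤ × ℤ) × (ℤ × ℤ)) : Prop where
  h₁ : K ≤ t.1.1 ∧ t.1.1 < 2 * K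
  h₂ : K ≤ t.2.1.1 ∧ t.2.1.1 < 2 * K
  h₃ : K ≤ t.2.2.1.1 ∧ t.2.2.1.1 < 2 * K
  h₄ : K ≤ t.2.2.2.1 ∧ t.2.2.2.1 < 2 * K
  i₁ : 0 ≤ t.1.2 ∧ t.1.2 < μ
  i₂ : 0 ≤ t.2.1.2 ∧ t.2.1.2 < μ
  i₃ : 0 ≤ t.2.2.1.2 ∧ t.2.2.1.2 < μ
  i₄ : 0 ≤ t.2.2.2.2 ∧ t.2.2.2.2 < μ
  add : t.1.1 + t.2.1.1 = t.2.2.1.1 + t.2.2.2.1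
  mul : t.1.1 * t.1.2 + t.2.1.1 * t.2.1.2 = t.2.2.1.1 * t.2.2.1.2 + t.2.2.2.1 * t.2.2.2.2
  sqrt : |(t.1.1 : ℝ) * √(y₀ + t.1.2) + t.2.1.1 * √(y₀ + t.2.1.2) -
    t.2.2.1.1 * √(y₀ + t.2.2.1.2) - t.2.2.2.1 * √(y₀ + t.2.2.2.2)| ≤ ε

section Real
variable {K Θ R h₁ h₂ h₃ h₄ d d' l m : ℝ}

/-- Here `l = z₁ - z₃` and `m = z₄ - z₂`. -/
theorem four_rel_far (hK : 0 < K) (k₁ : K ≤ h₁ ∧ h₁ ≤ 2 * K) (k₂ : K ≤ h₂ ∧ h₂ ≤ 2 * K)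
    (k₃ : K ≤ h₃ ∧ h₃ ≤ 2 * K) (k₄ : K ≤ h₄ ∧ h₄ ≤ 2 * K) (hR : 1 / 4 ≤ R)
    (hl : (h₁ + h₂) * l = h₂ * d - h₄ * d') (hm : (h₁ + h₂) * m = h₁ * d - h₃ * d')
    (hd' : 0 ≤ d') (hdd : 4 * d' ≤ d)
    (hpq : |-(h₄ * d' * m) * R - h₁ * d * l| ≤ 64 * Θ) : K * d ^ 2 ≤ 512 * Θ := by
  have hd : 0 ≤ d := by linarith
  have hm0 : 0 ≤ m := by
    by_contra h
    have : (h₁ + h₂) * m < 0 := mul_neg_of_pos_of_neg (by linarith) (by linarith)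
    nlinarith
  have hl0 : d / 8 ≤ l := by
    by_contra! h
    have h1 : (h₁ + h₂) * l < (h₁ + h₂) * (d / 8) := mul_lt_mul_of_pos_left h (by linarith)
    have h2 : (h₁ + h₂) * (d / 8) ≤ (4 * K) * (d / 8) := by gcongr; linarith
    have h3 : h₄ * d' ≤ 2 * K * d' := by gcongr; linarith
    have h4 : K * d ≤ h₂ * d := by gcongr; linarith
    have h5 : K * (4 * d') ≤ K * d := by gcongr
    linarith
  have h1 := (abs_le.1 hpq).1
  have h2 : 0 ≤ h₄ * d' * m * R := by
    have : 0 ≤ h₄ := by linarith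
    have : 0 ≤ R := by linarith
    positivity
  have h3 : K * d * (d / 8) ≤ h₁ * d * l :=
    mul_le_mul (mul_le_mul_of_nonneg_right k₁.1 hd) hl0 (by positivity)
      (mul_nonneg (by linarith) hd)
  nlinarith

theorem four_rel_far' (hK : 0 < K) (k₁ : K ≤ h₁ ∧ h₁ ≤ 2 * K) (k₂ : K ≤ h₂ ∧ h₂ ≤ 2 * K)
    (k₃ : K ≤ h₃ ∧ h₃ ≤ 2 * K) (k₄ : K ≤ h₄ ∧ h₄ ≤ 2 * K) (hR : 1 / 4 ≤ R)
    (hl : (h₁ + h₂) * l = h₂ * d - h₄ * d') (hm : (h₁ + h₂) * m = h₁ * d - h₃ * d')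
    (hd : 0 ≤ d) (hdd : 4 * d ≤ d')
    (hpq : |-(h₄ * d' * m) - h₁ * d * l * R⁻¹| ≤ 64 * Θ) : K * d' ^ 2 ≤ 512 * Θ := by
  have hd' : 0 ≤ d' := by linarith
  have hl0 : l ≤ 0 := by
    by_contra! h
    have : 0 < (h₁ + h₂) * l := mul_pos (by linarith) h
    nlinarith
  have hm0 : d' / 8 ≤ -m := by
    by_contra! h
    have h1 : (h₁ + h₂) * -m < (h₁ + h₂) * (d' / 8) := mul_lt_mul_of_pos_left h (by linarith)
    have h2 : (h₁ + h₂) * (d' / 8) ≤ (4 * K) * (d' / 8) := by gcongr; linarith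
    have h3 : h₁ * d ≤ 2 * K * d := by gcongr; linarith
    have h4 : K * d' ≤ h₃ * d' := by gcongr; linarith
    have h5 : K * (4 * d) ≤ K * d' := by gcongr
    linarith
  have h1 := (abs_le.1 hpq).2
  have h2 : 0 ≤ h₁ * d * -l * R⁻¹ := by
    have : 0 ≤ h₁ := by linarith
    have : 0 ≤ R := by linarith
    have : 0 ≤ -l := by linarith
    positivity
  have h3 : K * d' * (d' / 8) ≤ h₄ * d' * -m :=
    mul_le_mul (mul_le_mul_of_nonneg_right k₄.1 hd') hm0 (by positivity)
      (mul_nonneg (by linarith) hd')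
  nlinarith

theorem four_rel_diag (hK : 0 < K) (k₁ : K ≤ h₁ ∧ h₁ ≤ 2 * K) (k₂ : K ≤ h₂ ∧ h₂ ≤ 2 * K)
    (hR : 1 / 4 ≤ R)
    (hl : (h₁ + h₂) * l = h₂ * d - h₂ * d') (hm : (h₁ + h₂) * m = h₁ * d - h₁ * d')
    (hd : 0 ≤ d) (hd' : 0 ≤ d')
    (hpq : |-(h₂ * d' * m) * R - h₁ * d * l| ≤ 64 * Θ) :
    K * (|d - d'| * (d + d')) ≤ 512 * Θ := by
  have hu : 0 < h₁ + h₂ := by linarith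
  have e : (h₁ + h₂) * (-(h₂ * d' * m) * R - h₁ * d * l) =
      -(h₁ * h₂ * (d - d') * (d + d' * R)) := by
    linear_combination (-(h₂ * d' * R)) * hm - h₁ * d * hl
  have e2 : (h₁ + h₂) * |-(h₂ * d' * m) * R - h₁ * d * l| =
      h₁ * h₂ * |d - d'| * (d + d' * R) := by
    have p1 : 0 ≤ h₁ := by linarith
    have p2 : 0 ≤ h₂ := by linarith
    have p3 : 0 ≤ d + d' * R := by
      have : 0 ≤ R := by linarith
      positivity
    have := congrArg abs e
    rwa [abs_neg, abs_mul, abs_of_pos hu, abs_mul _ (d + d' * R), abs_mul _ (d - d'),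
      abs_of_nonneg (mul_nonneg p1 p2), abs_of_nonneg p3] at this
  have h1 : (h₁ + h₂) * |-(h₂ * d' * m) * R - h₁ * d * l| ≤ (h₁ + h₂) * (64 * Θ) := by gcongr
  have h2 : K * (h₁ + h₂) ≤ 2 * (h₁ * h₂) := by nlinarith
  have h3 : (d + d') ≤ 4 * (d + d' * R) := by nlinarith
  have h4 : (h₁ + h₂) * (K * (|d - d'| * (d + d'))) ≤ (h₁ + h₂) * (512 * Θ) := by
    calc (h₁ + h₂) * (K * (|d - d'| * (d + d'))) = K * (h₁ + h₂) * |d - d'| * (d + d') := by ring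
      _ ≤ 2 * (h₁ * h₂) * |d - d'| * (4 * (d + d' * R)) := by
          have : 0 ≤ h₁ * h₂ := mul_nonneg (by linarith) (by linarith)
          gcongr
      _ = 8 * ((h₁ + h₂) * |-(h₂ * d' * m) * R - h₁ * d * l|) := by rw [e2]; ring
      _ ≤ _ := by linarith
  exact le_of_mul_le_mul_left h4 hu

/-- Two translates of a solution of the four term relation are close. -/
theorem four_rel_translate {D Δ R' Y n : ℝ} (hK : 0 < K) (k₁ : K ≤ h₁ ∧ h₁ ≤ 2 * K)
    (k₂ : K ≤ h₂ ∧ h₂ ≤ 2 * K) (k₃ : K ≤ h₃ ∧ h₃ ≤ 2 * K) (k₄ : K ≤ h₄ ∧ h₄ ≤ 2 * K)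
    (hsum : h₁ + h₂ = h₃ + h₄) (hR : 1 / 4 ≤ R ∧ R ≤ 4) (hR' : 1 / 4 ≤ R' ∧ R' ≤ 4)
    (hl : (h₁ + h₂) * l = h₂ * d - h₄ * d') (hm : (h₁ + h₂) * m = h₁ * d - h₃ * d')
    (hn : (h₁ + h₂) * n = h₂ * d + h₃ * d')
    (hD : 0 ≤ D) (hd : D ≤ d) (hd' : D ≤ d') (hΔ : 0 ≤ Δ)
    (hRR : n * Δ ≤ 256 * Y ^ 2 * (R - R'))
    (hp : |-(h₄ * d' * m) * R - h₁ * d * l| ≤ 64 * Θ)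
    (hp' : |-(h₄ * d' * m) * R' - h₁ * d * l| ≤ 64 * Θ)
    (hq : |-(h₄ * d' * m) - h₁ * d * l * R⁻¹| ≤ 64 * Θ)
    (hq' : |-(h₄ * d' * m) - h₁ * d * l * R'⁻¹| ≤ 64 * Θ) :
    |h₁ - h₃| * D ^ 3 * Δ ≤ 2 ^ 22 * (Θ * Y ^ 2) := by
  have hu : 0 < h₁ + h₂ := by linarith
  have hd0 : 0 ≤ d := hD.trans hd
  have hd0' : 0 ≤ d' := hD.trans hd'
  have hn0 : D / 2 ≤ n := by
    by_contra! h
    have h1 : (h₁ + h₂) * n < (h₁ + h₂) * (D / 2) := mul_lt_mul_of_pos_left h hu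
    have h2 : (h₁ + h₂) * (D / 2) ≤ (4 * K) * (D / 2) := by gcongr; linarith
    have h3 : K * D ≤ h₂ * d := mul_le_mul k₂.1 hd hD (by linarith)
    have h4 : K * D ≤ h₃ * d' := mul_le_mul k₃.1 hd' hD (by linarith)
    linarith
  have key : h₂ * m - h₁ * l = d' * (h₁ - h₃) := by
    have : (h₁ + h₂) * (h₂ * m - h₁ * l) = (h₁ + h₂) * (d' * (h₁ - h₃)) := by
      have : h₄ = h₁ + h₂ - h₃ := by linarith
      subst this
      linear_combination h₂ * hm - h₁ * hl
    exact mul_left_cancel₀ hu.ne' this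
  have hP : ∀ P, |P * R - h₁ * d * l| ≤ 64 * Θ → |P * R' - h₁ * d * l| ≤ 64 * Θ →
      |P| * (R - R') ≤ 128 * Θ := by
    intro P a b
    have : |P * (R - R')| ≤ 128 * Θ := by
      have := abs_sub (P * R - h₁ * d * l) (P * R' - h₁ * d * l)
      rw [show P * (R - R') = P * R - h₁ * d * l - (P * R' - h₁ * d * l) by ring]
      linarith
    rw [abs_mul] at this
    exact (mul_le_mul_of_nonneg_left (le_abs_self _) (abs_nonneg _)).trans this
  have h1 := hP _ hp hp'
  have hQ : |h₁ * d * l| * (R - R') ≤ 2048 * Θ := by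
    have p1 : 0 < R := by linarith
    have p2 : 0 < R' := by linarith
    have : |h₁ * d * l * (R'⁻¹ - R⁻¹)| ≤ 128 * Θ := by
      have := abs_sub (-(h₄ * d' * m) - h₁ * d * l * R⁻¹) (-(h₄ * d' * m) - h₁ * d * l * R'⁻¹)
      rw [show h₁ * d * l * (R'⁻¹ - R⁻¹) = -(h₄ * d' * m) - h₁ * d * l * R⁻¹ -
        (-(h₄ * d' * m) - h₁ * d * l * R'⁻¹) by ring]
      linarith
    rw [abs_mul] at this
    have e : R - R' = (R'⁻¹ - R⁻¹) * (R * R') := by field_simp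
    have e2 : R - R' ≤ 16 * |R'⁻¹ - R⁻¹| := by
      rw [e]
      calc (R'⁻¹ - R⁻¹) * (R * R') ≤ |R'⁻¹ - R⁻¹| * (4 * 4) :=
            mul_le_mul (le_abs_self _) (mul_le_mul hR.2 hR'.2 p2.le (by norm_num))
              (by positivity) (abs_nonneg _)
        _ = _ := by ring
    nlinarith [mul_le_mul_of_nonneg_left e2 (abs_nonneg (h₁ * d * l))]
  have hΘ : 0 ≤ Θ := by linarith [(abs_nonneg _).trans hp]
  have hmax : |h₁ - h₃| * D ^ 2 / 4 ≤ |-(h₄ * d' * m)| ∨ |h₁ - h₃| * D ^ 2 / 4 ≤ |h₁ * d * l| := by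
    have t : d' * |h₁ - h₃| ≤ h₂ * |m| + h₁ * |l| := by
      have := abs_sub (h₂ * m) (h₁ * l)
      rw [key, abs_mul, abs_mul, abs_mul, abs_of_nonneg hd0',
        abs_of_nonneg (show 0 ≤ h₂ by linarith), abs_of_nonneg (show 0 ≤ h₁ by linarith)] at this
      exact this
    rcases le_total (d' * |h₁ - h₃| / 2) (h₂ * |m|) with h | h
    · left
      rw [abs_neg, abs_mul, abs_mul, abs_of_nonneg hd0',
        abs_of_nonneg (show 0 ≤ h₄ by linarith)]
      have a1 : h₂ * |m| ≤ 2 * h₄ * |m| := by gcongr; linarith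
      have a2 : D * (D * |h₁ - h₃| / 2) ≤ d' * (d' * |h₁ - h₃| / 2) := by gcongr
      have a3 := mul_le_mul_of_nonneg_left (h.trans a1) hd0'
      linarith
    · right
      rw [abs_mul, abs_mul, abs_of_nonneg hd0, abs_of_nonneg (show 0 ≤ h₁ by linarith)]
      have a1 : d' * |h₁ - h₃| / 2 ≤ h₁ * |l| := by linarith
      have a2 : D * (D * |h₁ - h₃| / 2) ≤ d * (d' * |h₁ - h₃| / 2) := by gcongr
      have a3 := mul_le_mul_of_nonneg_left a1 hd0
      have a4 : 0 ≤ |h₁ - h₃| * D ^ 2 := by positivity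
      have a5 : D * (D * |h₁ - h₃| / 2) = |h₁ - h₃| * D ^ 2 / 2 := by ring
      linarith
  have hRR0 : 0 ≤ Y ^ 2 * (R - R') := by nlinarith [mul_nonneg (show 0 ≤ n by linarith) hΔ]
  have hlast : ∀ P, 0 ≤ P → |h₁ - h₃| * D ^ 2 / 4 ≤ P → P * (R - R') ≤ 2048 * Θ →
      |h₁ - h₃| * D ^ 3 * Δ ≤ 2 ^ 22 * (Θ * Y ^ 2) := by
    intro P hP0 h2 h3
    have b1 : |h₁ - h₃| * D ^ 2 / 4 * (D / 2 * Δ) ≤ P * (n * Δ) := by gcongr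
    have b2 : P * (n * Δ) ≤ P * (256 * Y ^ 2 * (R - R')) := by gcongr
    have b3 : Y ^ 2 * (P * (R - R')) ≤ Y ^ 2 * (2048 * Θ) := by gcongr
    nlinarith
  rcases hmax with h | h
  · exact hlast _ (abs_nonneg _) h (by linarith)
  · exact hlast _ (abs_nonneg _) h hQ

end Real

theorem FourRel.classes {K μ : ℤ} {Y y₀ ε : ℝ} {h₁ i₁ h₂ i₂ h₃ i₃ h₄ i₄ : ℤ} (hK : 1 ≤ K)
    (hY : 0 < Y) (hy : Y ≤ y₀) (hy' : y₀ + μ ≤ 4 * Y)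
    (t : FourRel K μ y₀ ε ((h₁, i₁), (h₂, i₂), (h₃, i₃), (h₄, i₄)))
    (hd : i₂ ≤ i₁) (hd' : i₄ ≤ i₃) :
    ((K : ℝ) * ((i₁ : ℝ) - i₂) ^ 2 ≤ 512 * (ε * (Y * √Y)) ∧
      (K : ℝ) * ((i₃ : ℝ) - i₄) ^ 2 ≤ 512 * (ε * (Y * √Y))) ∨
    (h₁ = h₃ ∧ i₁ - i₂ = i₃ - i₄) ∨
    (h₁ = h₃ ∧ i₁ - i₂ ≠ i₃ - i₄ ∧ (K : ℝ) * (|((i₁ : ℝ) - i₂) - (i₃ - i₄)| *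
      ((i₁ - i₂) + (i₃ - i₄))) ≤ 512 * (ε * (Y * √Y))) ∨
    (h₁ ≠ h₃ ∧ i₁ - i₂ < 4 * (i₃ - i₄) ∧ i₃ - i₄ < 4 * (i₁ - i₂)) := by
  obtain ⟨k₁, k₂, k₃, k₄, m₁, m₂, m₃, m₄, hadd, hmul, hsq⟩ := t
  dsimp only at *
  have kR : ∀ h : ℤ, K ≤ h ∧ h < 2 * K → (K : ℝ) ≤ h ∧ (h : ℝ) ≤ 2 * K := fun h hh =>
    ⟨by exact_mod_cast hh.1, by exact_mod_cast hh.2.le⟩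
  have mR : ∀ i : ℤ, 0 ≤ i ∧ i < μ → Y ≤ y₀ + i ∧ y₀ + i ≤ 4 * Y := fun i hi => by
    have h1 : (0 : ℝ) ≤ i := by exact_mod_cast hi.1
    have h2 : (i : ℝ) ≤ μ := by exact_mod_cast hi.2.le
    constructor <;> linarith
  have z₁ := mR _ m₁
  have z₂ := mR _ m₂
  have z₃ := mR _ m₃
  have z₄ := mR _ m₄
  have kp : (0 : ℝ) < K := by exact_mod_cast hK
  have haddR : (h₁ : ℝ) + h₂ = h₃ + h₄ := by exact_mod_cast hadd
  have hmulR : (h₁ : ℝ) * i₁ + h₂ * i₂ = h₃ * i₃ + h₄ * i₄ := by exact_mod_cast hmul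
  obtain ⟨r₁, r₂⟩ := sqrtRatio_relation hY z₁ z₂ z₃ z₄ haddR
    (by linear_combination hmulR + y₀ * haddR) hsq
  have hRb := sqrtRatio_bounds hY z₁ z₂ z₃ z₄
  set R := sqrtRatio (y₀ + i₁) (y₀ + i₂) (y₀ + i₃) (y₀ + i₄)
  have el : ((h₁ : ℝ) + h₂) * (i₁ - i₃) = h₂ * (i₁ - i₂) - h₄ * (i₃ - i₄) := by
    linear_combination hmulR - i₃ * haddR
  have em : ((h₁ : ℝ) + h₂) * (i₄ - i₂) = h₁ * (i₁ - i₂) - h₃ * (i₃ - i₄) := by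
    linear_combination i₄ * haddR - hmulR
  have dR : (0 : ℝ) ≤ i₁ - i₂ := sub_nonneg.2 (by exact_mod_cast hd)
  have dR' : (0 : ℝ) ≤ i₃ - i₄ := sub_nonneg.2 (by exact_mod_cast hd')
  have r₁' : |-(h₄ * ((i₃ : ℝ) - i₄) * (i₄ - i₂)) * R - h₁ * (i₁ - i₂) * (i₁ - i₃)| ≤
      64 * (ε * (Y * √Y)) := by convert r₁ using 2; ring
  have r₂' : |-(h₄ * ((i₃ : ℝ) - i₄) * (i₄ - i₂)) - h₁ * (i₁ - i₂) * (i₁ - i₃) * R⁻¹| ≤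
      64 * (ε * (Y * √Y)) := by convert r₂ using 2; ring
  by_cases c₁ : 4 * (i₃ - i₄) ≤ i₁ - i₂
  · left
    have c₁' : 4 * ((i₃ : ℝ) - i₄) ≤ i₁ - i₂ := by exact_mod_cast c₁
    have := four_rel_far kp (kR _ k₁) (kR _ k₂) (kR _ k₃) (kR _ k₄) hRb.1 el em dR' c₁' r₁'
    exact ⟨this, le_trans (mul_le_mul_of_nonneg_left
      (pow_le_pow_left₀ dR' (by linarith) 2) kp.le) this⟩
  by_cases c₂ : 4 * (i₁ - i₂) ≤ i₃ - i₄
  · left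
    have c₂' : 4 * ((i₁ : ℝ) - i₂) ≤ i₃ - i₄ := by exact_mod_cast c₂
    have := four_rel_far' kp (kR _ k₁) (kR _ k₂) (kR _ k₃) (kR _ k₄) hRb.1 el em dR c₂' r₂'
    exact ⟨le_trans (mul_le_mul_of_nonneg_left
      (pow_le_pow_left₀ dR (by linarith) 2) kp.le) this, this⟩
  right
  by_cases c₃ : h₁ = h₃
  · have c₄ : h₄ = h₂ := by omega
    subst c₃ c₄
    by_cases c₅ : i₁ - i₂ = i₃ - i₄
    · exact Or.inl ⟨rfl, c₅⟩
    · exact Or.inr (Or.inl ⟨rfl, c₅, four_rel_diag kp (kR _ k₁) (kR _ k₂) hRb.1 el em dR dR' r₁'⟩)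
  · exact Or.inr (Or.inr ⟨c₃, by omega, by omega⟩)

theorem FourRel.translate {K μ : ℤ} {Y y₀ ε : ℝ} {h₁ i₁ h₂ i₂ h₃ i₃ h₄ i₄ Δ D : ℤ} (hK : 1 ≤ K)
    (hY : 0 < Y) (hy : Y ≤ y₀) (hy' : y₀ + μ ≤ 4 * Y)
    (t : FourRel K μ y₀ ε ((h₁, i₁), (h₂, i₂), (h₃, i₃), (h₄, i₄)))
    (t' : FourRel K μ y₀ ε ((h₁, i₁ + Δ), (h₂, i₂ + Δ), (h₃, i₃ + Δ), (h₄, i₄ + Δ)))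
    (hΔ : 0 ≤ Δ) (hD : 0 ≤ D) (hd : D ≤ i₁ - i₂) (hd' : D ≤ i₃ - i₄) :
    |(h₁ : ℝ) - h₃| * (D : ℝ) ^ 3 * Δ ≤ 2 ^ 22 * (ε * (Y * √Y) * Y ^ 2) := by
  obtain ⟨k₁, k₂, k₃, k₄, m₁, m₂, m₃, m₄, hadd, hmul, hsq⟩ := t
  obtain ⟨-, -, -, -, m₁', m₂', m₃', m₄', -, hmul', hsq'⟩ := t'
  dsimp only at *
  have kR : ∀ h : ℤ, K ≤ h ∧ h < 2 * K → (K : ℝ) ≤ h ∧ (h : ℝ) ≤ 2 * K := fun h hh =>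
    ⟨by exact_mod_cast hh.1, by exact_mod_cast hh.2.le⟩
  have mR : ∀ i : ℤ, 0 ≤ i ∧ i < μ → Y ≤ y₀ + i ∧ y₀ + i ≤ 4 * Y := fun i hi => by
    have h1 : (0 : ℝ) ≤ i := by exact_mod_cast hi.1
    have h2 : (i : ℝ) ≤ μ := by exact_mod_cast hi.2.le
    constructor <;> linarith
  have z₁ := mR _ m₁
  have z₂ := mR _ m₂
  have z₃ := mR _ m₃
  have z₄ := mR _ m₄
  have z₁' := mR _ m₁'
  have z₂' := mR _ m₂'
  have z₃' := mR _ m₃'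
  have z₄' := mR _ m₄'
  have kp : (0 : ℝ) < K := by exact_mod_cast hK
  have haddR : (h₁ : ℝ) + h₂ = h₃ + h₄ := by exact_mod_cast hadd
  have hmulR : (h₁ : ℝ) * i₁ + h₂ * i₂ = h₃ * i₃ + h₄ * i₄ := by exact_mod_cast hmul
  push_cast at z₁' z₂' z₃' z₄' hsq'
  simp only [← add_assoc] at z₁' z₂' z₃' z₄' hsq'
  obtain ⟨r₁, r₂⟩ := sqrtRatio_relation hY z₁ z₂ z₃ z₄ haddR
    (by linear_combination hmulR + y₀ * haddR) hsq
  obtain ⟨s₁, s₂⟩ := sqrtRatio_relation hY z₁' z₂' z₃' z₄' haddR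
    (by linear_combination hmulR + (y₀ + Δ) * haddR) hsq'
  have hRb := sqrtRatio_bounds hY z₁ z₂ z₃ z₄
  have hRb' := sqrtRatio_bounds hY z₁' z₂' z₃' z₄'
  have dR : (D : ℝ) ≤ i₁ - i₂ := by exact_mod_cast hd
  have dR' : (D : ℝ) ≤ i₃ - i₄ := by exact_mod_cast hd'
  have hDR : (0 : ℝ) ≤ D := by exact_mod_cast hD
  have hΔR : (0 : ℝ) ≤ Δ := by exact_mod_cast hΔ
  have el : ((h₁ : ℝ) + h₂) * (i₁ - i₃) = h₂ * (i₁ - i₂) - h₄ * (i₃ - i₄) := by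
    linear_combination hmulR - i₃ * haddR
  have em : ((h₁ : ℝ) + h₂) * (i₄ - i₂) = h₁ * (i₁ - i₂) - h₃ * (i₃ - i₄) := by
    linear_combination i₄ * haddR - hmulR
  have en : ((h₁ : ℝ) + h₂) * (i₁ - i₄) = h₂ * (i₁ - i₂) + h₃ * (i₃ - i₄) := by
    linear_combination hmulR - i₄ * haddR
  have h14 : y₀ + (i₄ : ℝ) ≤ y₀ + i₁ := by
    have k₂' := kR _ k₂
    have k₃' := kR _ k₃
    have k₁' := kR _ k₁
    have : 0 ≤ ((h₁ : ℝ) + h₂) * (i₁ - i₄) := by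
      rw [en]
      exact add_nonneg (mul_nonneg (by linarith) (by linarith))
        (mul_nonneg (by linarith) (by linarith))
    have := nonneg_of_mul_nonneg_right this (by linarith)
    linarith
  have hsub := sqrtRatio_sub_le hY hΔR h14 ⟨z₁.1, z₁'.2⟩ ⟨z₂.1, z₂'.2⟩ ⟨z₃.1, z₃'.2⟩ ⟨z₄.1, z₄'.2⟩
  refine four_rel_translate kp (kR _ k₁) (kR _ k₂) (kR _ k₃) (kR _ k₄) haddR hRb hRb' el em en
    hDR dR dR' hΔR (by convert hsub using 2; ring) ?_ ?_ ?_ ?_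
  · convert r₁ using 2; ring
  · convert s₁ using 2; ring
  · convert r₂ using 2; ring
  · convert s₂ using 2; ring

theorem card_mul_le_of_dvd_sub {a : ℤ} {N w : ℕ} (hw : 1 ≤ w) (S : Finset ℤ)
    (hS : ∀ x ∈ S, a ≤ x ∧ x < a + N) (hd : ∀ x ∈ S, ∀ y ∈ S, (w : ℤ) ∣ x - y) :
    S.card * w ≤ N + w := by
  have hw' : (0 : ℤ) < w := by exact_mod_cast hw
  have h : S.card ≤ (Finset.range (N / w + 1)).card := by
    refine Finset.card_le_card_of_injOn (fun x => ((x - a) / w).toNat) ?_ ?_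
    · intro x hx
      obtain ⟨h1, h2⟩ := hS x hx
      have : (x - a) / w ≤ (N : ℤ) / w := Int.ediv_le_ediv hw' (by linarith)
      have h0 : 0 ≤ (x - a) / w := Int.ediv_nonneg (by linarith) hw'.le
      have e : ((N / w : ℕ) : ℤ) = (N : ℤ) / w := by push_cast; rfl
      simp only [Finset.coe_range, Set.mem_Iio]
      omega
    · intro x hx y hy hxy
      have hx0 : 0 ≤ (x - a) / w := Int.ediv_nonneg (by linarith [hS x hx]) hw'.le
      have hy0 : 0 ≤ (y - a) / w := Int.ediv_nonneg (by linarith [hS y hy]) hw'.le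
      have e : (x - a) / w = (y - a) / w := by
        dsimp only at hxy
        omega
      have h1 := Int.mul_ediv_add_emod (x - a) w
      have h2 := Int.mul_ediv_add_emod (y - a) w
      have h3 := Int.emod_nonneg (x - a) hw'.ne'
      have h4 := Int.emod_lt_of_pos (x - a) hw'
      have h5 := Int.emod_nonneg (y - a) hw'.ne'
      have h6 := Int.emod_lt_of_pos (y - a) hw'
      rw [e] at h1
      have h7 : x - y = 0 := Int.eq_zero_of_abs_lt_dvd (hd x hx y hy) (by
        rw [abs_lt]; constructor <;> linarith)
      linarith
  rw [Finset.card_range] at h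
  calc S.card * w ≤ (N / w + 1) * w := Nat.mul_le_mul_right _ h
    _ = N / w * w + w := by ring
    _ ≤ N + w := Nat.add_le_add_right (Nat.div_mul_le_self _ _) _

theorem card_dvd_mul_le {N c : ℕ} (hc : 1 ≤ c) :
    ((Finset.Icc (1 : ℤ) N).filter fun x => (c : ℤ) ∣ x).card * c ≤ N := by
  have hc' : (0 : ℤ) < c := by exact_mod_cast hc
  have h : ((Finset.Icc (1 : ℤ) N).filter fun x => (c : ℤ) ∣ x).card ≤
      (Finset.Icc 1 (N / c)).card := by
    refine Finset.card_le_card_of_injOn (fun x => (x / c).toNat) ?_ ?_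
    · intro x hx
      simp only [Finset.coe_filter, Finset.mem_Icc, Set.mem_ofPred_eq] at hx
      obtain ⟨⟨h1, h2⟩, k, rfl⟩ := hx
      have e : ((N / c : ℕ) : ℤ) = (N : ℤ) / c := by push_cast; rfl
      have hk : 0 < k := by
        by_contra! h
        nlinarith
      have hk2 : k ≤ (N : ℤ) / c := by
        rw [Int.le_ediv_iff_mul_le hc']; linarith
      simp only [Finset.coe_Icc, Set.mem_Icc, Int.mul_ediv_cancel_left _ hc'.ne']
      rw [← e] at hk2
      omega
    · intro x hx y hy hxy
      simp only [Finset.coe_filter, Finset.mem_Icc, Set.mem_ofPred_eq] at hx hy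
      obtain ⟨⟨h1, h2⟩, k, rfl⟩ := hx
      obtain ⟨⟨h3, h4⟩, l, rfl⟩ := hy
      have hk : 0 < k := by
        by_contra! h
        nlinarith
      have hl : 0 < l := by
        by_contra! h
        nlinarith
      simp only [Int.mul_ediv_cancel_left _ hc'.ne'] at hxy
      have : k = l := by omega
      rw [this]
  rw [Nat.card_Icc, Nat.add_sub_cancel] at h
  calc _ ≤ (N / c) * c := Nat.mul_le_mul_right _ h
    _ ≤ N := Nat.div_mul_le_self _ _

theorem card_lattice_dvd_le {u h₂ h₄ : ℤ} {N : ℕ} (hu : 1 ≤ u) (huN : u ≤ N) :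
    (((Finset.Icc (1 : ℤ) N ×ˢ Finset.Icc (1 : ℤ) N).filter fun p => u ∣ h₂ * p.1 - h₄ * p.2).card :
      ℤ) * u ≤ 2 * N ^ 2 * (Int.gcd (Int.gcd u h₂) h₄) := by
  set g : ℕ := Int.gcd u h₂ with hg
  set g₀ : ℕ := Int.gcd g h₄ with hg₀
  have gpos : 0 < g := Int.gcd_pos_of_ne_zero_left _ (by omega)
  have gpos' : (0 : ℤ) < g := by exact_mod_cast gpos
  have g0pos : 0 < g₀ := Int.gcd_pos_of_ne_zero_left _ (by omega)
  obtain ⟨w', hw'⟩ : (g : ℤ) ∣ u := Int.gcd_dvd_left _ _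
  have hw'0 : 0 < w' := by
    by_contra! h
    nlinarith
  lift w' to ℕ using hw'0.le
  have hw1 : 1 ≤ w' := by exact_mod_cast hw'0
  obtain ⟨c, hc⟩ : g₀ ∣ g := by
    have : ((g₀ : ℕ) : ℤ) ∣ (g : ℤ) := Int.gcd_dvd_left _ _
    exact_mod_cast this
  have hcpos : 1 ≤ c := by
    rcases Nat.eq_zero_or_pos c with h | h
    · subst h; omega
    · exact h
  obtain ⟨h₂', hh₂⟩ : (g : ℤ) ∣ h₂ := Int.gcd_dvd_right _ _
  have cop2 : IsCoprime (w' : ℤ) h₂' := by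
    have := Int.isCoprime_iff_gcd_eq_one.2 (Int.gcd_div_gcd_div_gcd (i := u) (j := h₂) gpos)
    rw [← hg] at this
    have e1 : u / g = w' := by
      conv_lhs => rw [hw']
      exact Int.mul_ediv_cancel_left _ gpos'.ne'
    have e2 : h₂ / g = h₂' := by
      conv_lhs => rw [hh₂]
      exact Int.mul_ediv_cancel_left _ gpos'.ne'
    rwa [e1, e2] at this
  have cop4 : ∀ y : ℤ, (g : ℤ) ∣ h₄ * y → (c : ℤ) ∣ y := by
    intro y hy
    have g0pos' : (0 : ℤ) < g₀ := by exact_mod_cast g0pos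
    obtain ⟨h₄', hh₄⟩ : (g₀ : ℤ) ∣ h₄ := Int.gcd_dvd_right _ _
    have cop : IsCoprime (c : ℤ) h₄' := by
      have := Int.isCoprime_iff_gcd_eq_one.2 (Int.gcd_div_gcd_div_gcd (i := g) (j := h₄) g0pos)
      rw [← hg₀] at this
      have e1 : (g : ℤ) / g₀ = c := by
        rw [hc, Nat.cast_mul, Int.mul_ediv_cancel_left _ g0pos'.ne']
      have e2 : h₄ / g₀ = h₄' := by
        conv_lhs => rw [hh₄]
        exact Int.mul_ediv_cancel_left _ g0pos'.ne'
      rwa [e1, e2] at this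
    rw [hc, hh₄] at hy
    push_cast at hy
    rw [mul_assoc] at hy
    exact cop.dvd_of_dvd_mul_left (Int.dvd_of_mul_dvd_mul_left g0pos'.ne' hy)
  have hcard : ((Finset.Icc (1 : ℤ) N ×ˢ Finset.Icc (1 : ℤ) N).filter fun p =>
      u ∣ h₂ * p.1 - h₄ * p.2).card * w' ≤
      ((Finset.Icc (1 : ℤ) N).filter fun x => (c : ℤ) ∣ x).card * (N + w') := by
    rw [Finset.card_eq_sum_card_fiberwise (f := Prod.snd)
      (t := (Finset.Icc (1 : ℤ) N).filter fun x => (c : ℤ) ∣ x), Finset.sum_mul]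
    · rw [← smul_eq_mul (Finset.card _), ← Finset.sum_const]
      refine Finset.sum_le_sum fun y _ => ?_
      rw [← Finset.card_image_of_injOn (f := Prod.fst)]
      · refine card_mul_le_of_dvd_sub (a := 1) hw1 _ ?_ ?_
        · simp only [Finset.mem_image, Finset.mem_filter, Finset.mem_product, Finset.mem_Icc]
          rintro x ⟨p, ⟨⟨⟨hp, -⟩, -⟩, -⟩, rfl⟩
          omega
        · simp only [Finset.mem_image, Finset.mem_filter, Finset.mem_product, Finset.mem_Icc]
          rintro x ⟨p, ⟨⟨-, hp⟩, rfl⟩, rfl⟩ x' ⟨p', ⟨⟨-, hp'⟩, hpp⟩, rfl⟩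
          have h1 := dvd_sub hp hp'
          rw [hpp, show h₂ * p.1 - h₄ * p.2 - (h₂ * p'.1 - h₄ * p.2) = h₂ * (p.1 - p'.1) by ring,
            hw', hh₂, mul_assoc] at h1
          exact cop2.dvd_of_dvd_mul_left (Int.dvd_of_mul_dvd_mul_left gpos'.ne' h1)
      · intro p hp p' hp' h
        simp only [Finset.coe_filter, Set.mem_ofPred_eq] at hp hp'
        exact Prod.ext h (hp.2.trans hp'.2.symm)
    · intro p hp
      simp only [Finset.coe_filter, Finset.mem_product, Set.mem_ofPred_eq] at hp ⊢
      refine ⟨hp.1.2, cop4 _ ?_⟩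
      have h1 : (g : ℤ) ∣ h₂ * p.1 - h₄ * p.2 := (Dvd.intro _ hw'.symm).trans hp.2
      have h2 : (g : ℤ) ∣ h₂ * p.1 := (Dvd.intro _ hh₂.symm).mul_right _
      have := dvd_sub h2 h1
      rwa [sub_sub_cancel] at this
  have hm := card_dvd_mul_le (N := N) hcpos
  have hwN : w' ≤ N := by
    have : (w' : ℤ) ≤ N := by nlinarith
    exact_mod_cast this
  generalize ((Finset.Icc (1 : ℤ) N ×ˢ Finset.Icc (1 : ℤ) N).filter fun p =>
      u ∣ h₂ * p.1 - h₄ * p.2).card = A at *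
  generalize ((Finset.Icc (1 : ℤ) N).filter fun x => (c : ℤ) ∣ x).card = M at *
  rw [hw', hc]
  have : A * (g₀ * c * w') ≤ 2 * N ^ 2 * g₀ := by
    calc A * (g₀ * c * w') = A * w' * (c * g₀) := by ring
      _ ≤ M * (N + w') * (c * g₀) := Nat.mul_le_mul_right _ hcard
      _ = (M * c) * (N + w') * g₀ := by ring
      _ ≤ N * (N + N) * g₀ := by gcongr
      _ = _ := by ring
  exact_mod_cast this

theorem sum_Icc_one_div_sq_le (K : ℕ) : ∑ q ∈ Finset.Icc 1 K, 1 / (q : ℝ) ^ 2 ≤ 2 := by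
  have : ∀ K : ℕ, ∑ q ∈ Finset.Icc 1 (K + 1), 1 / (q : ℝ) ^ 2 ≤ 2 - 1 / ((K : ℝ) + 1) := by
    intro K
    induction K with
    | zero => norm_num
    | succ n ih =>
      rw [Finset.sum_Icc_succ_top (by omega)]
      have h1 : 1 / ((n + 1 + 1 : ℕ) : ℝ) ^ 2 ≤ 1 / ((n : ℝ) + 1) - 1 / ((n : ℝ) + 2) := by
        rw [div_sub_div _ _ (by positivity) (by positivity), div_le_div_iff₀ (by positivity)
          (by positivity)]
        push_cast
        ring_nf
        nlinarith [show (0 : ℝ) ≤ n by positivity]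
      push_cast at *
      have : (n : ℝ) + 1 + 1 = n + 2 := by ring
      rw [this] at h1 ⊢
      linarith
  rcases K with _ | K
  · simp
  · have h1 := this K
    have : (0 : ℝ) ≤ 1 / ((K : ℝ) + 1) := by positivity
    linarith

theorem sum_gcd_weight_le {K : ℕ} (hK : 1 ≤ K) (w : ℕ → ℝ) (hw : ∀ j, 0 ≤ w j) {W : ℝ}
    (hW : ∀ q ∈ Finset.Icc 1 K, ∑ k ∈ Finset.Icc 1 (K / q), w (q * k) ≤ W / q) :
    ∑ t ∈ (Finset.Ico (K : ℤ) (2 * K) ×ˢ Finset.Ico (K : ℤ) (2 * K) ×ˢ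
        Finset.Ico (K : ℤ) (2 * K)).filter (fun t => t.1 ≠ t.2.2),
      (Int.gcd (Int.gcd (t.1 + t.2.1) t.2.1) (t.1 + t.2.1 - t.2.2) : ℝ) * w (t.1 - t.2.2).natAbs ≤
      16 * K ^ 2 * W := by
  set I := Finset.Ico (K : ℤ) (2 * K) with hI
  set f : ℕ → ℤ → ℤ → ℝ := fun q x y =>
    if (q : ℤ) ∣ x ∧ (q : ℤ) ∣ y ∧ x ≠ y then w (x - y).natAbs else 0 with hf
  have hf0 : ∀ q x y, 0 ≤ f q x y := by
    intro q x y
    simp only [hf]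
    split_ifs
    · exact hw _
    · exact le_rfl
  -- replace the gcd by a sum over common divisors
  have h1 : ∀ t ∈ (I ×ˢ I ×ˢ I).filter (fun t => t.1 ≠ t.2.2),
      (Int.gcd (Int.gcd (t.1 + t.2.1) t.2.1) (t.1 + t.2.1 - t.2.2) : ℝ) * w (t.1 - t.2.2).natAbs ≤
      ∑ q ∈ Finset.Icc 1 K, (q : ℝ) * ((if (q : ℤ) ∣ t.2.1 then 1 else 0) * f q t.1 t.2.2) := by
    rintro ⟨x, z, y⟩ ht
    simp only [hI, Finset.mem_filter, Finset.mem_product, Finset.mem_Ico] at ht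
    obtain ⟨⟨hx, hz, hy⟩, hxy⟩ := ht
    dsimp only at *
    set g := Int.gcd (Int.gcd (x + z) z) (x + z - y) with hg
    have d1 : (g : ℤ) ∣ (Int.gcd (x + z) z : ℤ) := Int.gcd_dvd_left _ _
    have d2 : (g : ℤ) ∣ x + z - y := Int.gcd_dvd_right _ _
    have d3 : (g : ℤ) ∣ x + z := d1.trans (Int.gcd_dvd_left _ _)
    have d4 : (g : ℤ) ∣ z := d1.trans (Int.gcd_dvd_right _ _)
    have d5 : (g : ℤ) ∣ x := by simpa using dvd_sub d3 d4
    have d6 : (g : ℤ) ∣ y := by simpa using dvd_sub d3 d2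
    have d7 : g ∣ (x - y).natAbs := Int.natCast_dvd.1 (dvd_sub d5 d6)
    have g1 : g ≤ (x - y).natAbs := Nat.le_of_dvd (by omega) d7
    have g2 : 0 < g := Nat.pos_of_dvd_of_pos d7 (by omega)
    refine le_trans (le_of_eq ?_) (Finset.single_le_sum (f := fun q : ℕ => (q : ℝ) *
      ((if (q : ℤ) ∣ z then 1 else 0) * f q x y)) (fun q _ => ?_)
      (Finset.mem_Icc.2 ⟨g2, by omega⟩ : g ∈ Finset.Icc 1 K))
    · simp only [hf]
      rw [if_pos d4, if_pos ⟨d5, d6, hxy⟩, one_mul]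
    · have := hf0 q x y
      positivity
  have hmult : ∀ q ∈ Finset.Icc 1 K, ((I.filter fun x => (q : ℤ) ∣ x).card : ℝ) ≤ 2 * K / q := by
    intro q hq
    rw [Finset.mem_Icc] at hq
    have := card_mul_le_of_dvd_sub (a := K) (N := K) hq.1 (I.filter fun x => (q : ℤ) ∣ x)
      (fun x hx => by
        simp only [hI, Finset.mem_filter, Finset.mem_Ico] at hx
        constructor <;> omega)
      (fun x hx y hy => dvd_sub (Finset.mem_filter.1 hx).2 (Finset.mem_filter.1 hy).2)
    rw [le_div_iff₀ (by exact_mod_cast hq.1)]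
    have h2 : (I.filter fun x => (q : ℤ) ∣ x).card * q ≤ 2 * K := by omega
    exact_mod_cast h2
  have hone : ∀ q ∈ Finset.Icc 1 K, ∀ x ∈ I, (q : ℤ) ∣ x → ∑ y ∈ I, f q x y ≤ 2 * (W / q) := by
    intro q hq x hx hqx
    have hW' := hW q hq
    rw [Finset.mem_Icc] at hq
    have hq0 : (0 : ℤ) < q := by exact_mod_cast hq.1
    simp only [hI, Finset.mem_Ico] at hx
    have hfil : ∑ y ∈ I, f q x y =
        ∑ y ∈ I.filter (fun y => (q : ℤ) ∣ y ∧ y ≠ x), w (x - y).natAbs := by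
      rw [Finset.sum_filter]
      refine Finset.sum_congr rfl fun y _ => ?_
      simp only [hf, hqx, true_and, ne_comm]
    have half : ∀ s : ℤ, s = 1 ∨ s = -1 →
        ∑ y ∈ (I.filter (fun y => (q : ℤ) ∣ y ∧ y ≠ x)).filter (fun y => 0 < s * (x - y)),
          w (x - y).natAbs ≤ W / q := by
      intro s hs
      refine le_trans ?_ hW'
      have hinj : Set.InjOn (fun y : ℤ => (x - y).natAbs / q)
          ((I.filter (fun y => (q : ℤ) ∣ y ∧ y ≠ x)).filter (fun y => 0 < s * (x - y)) : Set ℤ) := by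
        intro y hy y' hy' h
        simp only [Finset.coe_filter, Finset.mem_filter, Set.mem_ofPred_eq] at hy hy'
        have a1 : q ∣ (x - y).natAbs := Int.natCast_dvd.1 (dvd_sub hqx hy.1.2.1)
        have a2 : q ∣ (x - y').natAbs := Int.natCast_dvd.1 (dvd_sub hqx hy'.1.2.1)
        have a3 := Nat.div_left_inj a1 a2 |>.1 h
        rcases hs with rfl | rfl <;> omega
      rw [Finset.sum_congr (g := fun y => w (q * ((x - y).natAbs / q))) rfl]
      · rw [← Finset.sum_image (f := fun k => w (q * k)) hinj]
        refine Finset.sum_le_sum_of_subset_of_nonneg ?_ fun _ _ _ => hw _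
        intro k hk
        simp only [hI, Finset.mem_image, Finset.mem_filter, Finset.mem_Ico] at hk
        obtain ⟨y, ⟨⟨⟨hy1, hy2⟩, hy3, hy4⟩, -⟩, rfl⟩ := hk
        have a1 : q ∣ (x - y).natAbs := Int.natCast_dvd.1 (dvd_sub hqx hy3)
        rw [Finset.mem_Icc]
        exact ⟨Nat.div_pos (Nat.le_of_dvd (by omega) a1) hq.1, Nat.div_le_div_right (by omega)⟩
      · intro y hy
        simp only [Finset.mem_filter] at hy
        have a1 : q ∣ (x - y).natAbs := Int.natCast_dvd.1 (dvd_sub hqx hy.1.2.1)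
        rw [Nat.mul_div_cancel' a1]
    rw [hfil, ← Finset.sum_filter_add_sum_filter_not _ (fun y => 0 < (1 : ℤ) * (x - y)), two_mul]
    refine add_le_add (half 1 (Or.inl rfl)) (le_trans (le_of_eq ?_) (half (-1) (Or.inr rfl)))
    refine Finset.sum_congr (Finset.filter_congr fun y hy => ?_) fun _ _ => rfl
    have := (Finset.mem_filter.1 hy).2.2
    omega
  have hW0 : 0 ≤ W := by
    have := (Finset.sum_nonneg fun k _ => hw (1 * k)).trans (hW 1 (by simp [hK]))
    simpa using this
  calc _ ≤ ∑ t ∈ (I ×ˢ I ×ˢ I).filter (fun t => t.1 ≠ t.2.2), ∑ q ∈ Finset.Icc 1 K, (q : ℝ) *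
        ((if (q : ℤ) ∣ t.2.1 then 1 else 0) * f q t.1 t.2.2) := Finset.sum_le_sum h1
    _ ≤ ∑ t ∈ I ×ˢ I ×ˢ I, ∑ q ∈ Finset.Icc 1 K, (q : ℝ) *
        ((if (q : ℤ) ∣ t.2.1 then 1 else 0) * f q t.1 t.2.2) := by
      refine Finset.sum_le_sum_of_subset_of_nonneg (Finset.filter_subset _ _) fun t _ _ =>
        Finset.sum_nonneg fun q _ => ?_
      have := hf0 q t.1 t.2.2
      positivity
    _ = ∑ q ∈ Finset.Icc 1 K, (q : ℝ) * (((I.filter fun x => (q : ℤ) ∣ x).card : ℝ) *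
        ∑ x ∈ I, ∑ y ∈ I, f q x y) := by
      rw [Finset.sum_comm]
      refine Finset.sum_congr rfl fun q _ => ?_
      rw [← Finset.mul_sum, Finset.sum_product]
      congr 1
      rw [← Finset.sum_boole, Finset.mul_sum]
      refine Finset.sum_congr rfl fun x _ => ?_
      rw [Finset.sum_product, Finset.sum_mul]
      refine Finset.sum_congr rfl fun z _ => ?_
      rw [Finset.mul_sum]
    _ ≤ ∑ q ∈ Finset.Icc 1 K, (q : ℝ) * ((2 * K / q) * ((2 * K / q) * (2 * (W / q)))) := by
      refine Finset.sum_le_sum fun q hq => ?_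
      have hm := hmult q hq
      have h3 : ∑ x ∈ I, ∑ y ∈ I, f q x y ≤ (2 * K / q) * (2 * (W / q)) := by
        calc ∑ x ∈ I, ∑ y ∈ I, f q x y = ∑ x ∈ I.filter fun x => (q : ℤ) ∣ x, ∑ y ∈ I, f q x y := by
              rw [Finset.sum_filter]
              refine Finset.sum_congr rfl fun x _ => ?_
              split_ifs with h
              · rfl
              · exact Finset.sum_eq_zero fun y _ => by simp [hf, h]
          _ ≤ ∑ x ∈ I.filter fun x => (q : ℤ) ∣ x, 2 * (W / q) :=
              Finset.sum_le_sum fun x hx => hone q hq x (Finset.mem_filter.1 hx).1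
                (Finset.mem_filter.1 hx).2
          _ = ((I.filter fun x => (q : ℤ) ∣ x).card : ℝ) * (2 * (W / q)) := by
              rw [Finset.sum_const, nsmul_eq_mul]
          _ ≤ _ := by gcongr
      have h4 : 0 ≤ ∑ x ∈ I, ∑ y ∈ I, f q x y :=
        Finset.sum_nonneg fun _ _ => Finset.sum_nonneg fun _ _ => hf0 _ _ _
      gcongr
    _ = 8 * K ^ 2 * W * ∑ q ∈ Finset.Icc 1 K, 1 / (q : ℝ) ^ 2 := by
      rw [Finset.mul_sum]
      refine Finset.sum_congr rfl fun q hq => ?_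
      have : (q : ℝ) ≠ 0 := by
        have := (Finset.mem_Icc.1 hq).1
        positivity
      field_simp
      ring
    _ ≤ 8 * K ^ 2 * W * 2 := by
      gcongr
      exact sum_Icc_one_div_sq_le K
    _ = _ := by ring

/-- The nonnegative fourth root. -/
def fourthRoot (x : ℝ) : ℝ := √(√x)

theorem fourthRoot_nonneg (x : ℝ) : 0 ≤ fourthRoot x := Real.sqrt_nonneg _

theorem fourthRoot_pos {x : ℝ} (hx : 0 < x) : 0 < fourthRoot x :=
  Real.sqrt_pos.2 (Real.sqrt_pos.2 hx)

theorem fourthRoot_pow {x : ℝ} (hx : 0 ≤ x) : fourthRoot x ^ 4 = x := by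
  rw [fourthRoot, show (4 : ℕ) = 2 * 2 by norm_num, pow_mul, Real.sq_sqrt (Real.sqrt_nonneg _),
    Real.sq_sqrt hx]

theorem fourthRoot_mono {x y : ℝ} (h : x ≤ y) : fourthRoot x ≤ fourthRoot y :=
  Real.sqrt_le_sqrt (Real.sqrt_le_sqrt h)

theorem fourthRoot_mul {x : ℝ} (hx : 0 ≤ x) (y : ℝ) :
    fourthRoot (x * y) = fourthRoot x * fourthRoot y := by
  rw [fourthRoot, Real.sqrt_mul hx, Real.sqrt_mul (Real.sqrt_nonneg _)]; rfl

theorem fourthRoot_pow_four {x : ℝ} (hx : 0 ≤ x) : fourthRoot (x ^ 4) = x := by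
  rw [fourthRoot, show x ^ 4 = (x ^ 2) ^ 2 by ring, Real.sqrt_sq (by positivity),
    Real.sqrt_sq hx]

theorem le_fourthRoot {x y : ℝ} (hx : 0 ≤ x) (h : x ^ 4 ≤ y) : x ≤ fourthRoot y := by
  rw [← fourthRoot_pow_four hx]; exact fourthRoot_mono h

theorem fourthRoot_le {x y : ℝ} (hx : 0 ≤ x) (h : y ≤ x ^ 4) : fourthRoot y ≤ x := by
  rw [← fourthRoot_pow_four hx]; exact fourthRoot_mono h

theorem sum_fourthRoot_le (n : ℕ) :
    ∑ k ∈ Finset.Icc 1 n, 1 / fourthRoot (k : ℝ) ^ 3 ≤ 4 * fourthRoot (n : ℝ) := by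
  induction n with
  | zero => simp [fourthRoot]
  | succ n ih =>
    rw [Finset.sum_Icc_succ_top (by omega)]
    have h1 := fourthRoot_pow (x := ((n + 1 : ℕ) : ℝ)) (by positivity)
    have h2 := fourthRoot_pow (x := (n : ℝ)) (by positivity)
    have h3 := fourthRoot_mono (x := (n : ℝ)) (y := ((n + 1 : ℕ) : ℝ)) (by push_cast; linarith)
    have h4 := fourthRoot_pos (x := ((n + 1 : ℕ) : ℝ)) (by positivity)
    have h5 := fourthRoot_nonneg (n : ℝ)
    have h6 : fourthRoot ((n + 1 : ℕ) : ℝ) ^ 4 - fourthRoot (n : ℝ) ^ 4 = 1 := by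
      rw [h1, h2]; push_cast; ring
    generalize fourthRoot ((n + 1 : ℕ) : ℝ) = a at *
    generalize fourthRoot (n : ℝ) = b at *
    have : 1 / a ^ 3 ≤ 4 * (a - b) := by
      rw [div_le_iff₀ (by positivity), ← h6]
      have : a ^ 4 - b ^ 4 = (a - b) * (a ^ 3 + a ^ 2 * b + a * b ^ 2 + b ^ 3) := by ring
      rw [this]
      have e1 : a ^ 2 * b ≤ a ^ 2 * a := by gcongr
      have e2 : a * b ^ 2 ≤ a * a ^ 2 := by gcongr
      have e3 : b ^ 3 ≤ a ^ 3 := by gcongr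
      calc (a - b) * (a ^ 3 + a ^ 2 * b + a * b ^ 2 + b ^ 3) ≤ (a - b) * (4 * a ^ 3) :=
            mul_le_mul_of_nonneg_left (by nlinarith) (by linarith)
        _ = _ := by ring
    linarith

theorem sum_fourthRoot_mul_le (K q : ℕ) (hq : 1 ≤ q) :
    ∑ k ∈ Finset.Icc 1 (K / q), 1 / fourthRoot ((q * k : ℕ) : ℝ) ^ 3 ≤
      4 * fourthRoot (K : ℝ) / q := by
  have hq0 : (0 : ℝ) < q := by exact_mod_cast hq
  have h1 := fourthRoot_pos hq0
  have e : ∀ k : ℕ, 1 / fourthRoot ((q * k : ℕ) : ℝ) ^ 3 =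
      1 / fourthRoot (q : ℝ) ^ 3 * (1 / fourthRoot (k : ℝ) ^ 3) := by
    intro k
    rw [Nat.cast_mul, fourthRoot_mul hq0.le, mul_pow, div_mul_div_comm, one_mul]
  simp_rw [e]
  rw [← Finset.mul_sum]
  have h2 : fourthRoot ((K / q : ℕ) : ℝ) ≤ fourthRoot (K : ℝ) / fourthRoot (q : ℝ) := by
    rw [le_div_iff₀ h1, ← fourthRoot_mul (by positivity)]
    exact fourthRoot_mono (by exact_mod_cast Nat.div_mul_le_self K q)
  calc 1 / fourthRoot (q : ℝ) ^ 3 * ∑ k ∈ Finset.Icc 1 (K / q), 1 / fourthRoot (k : ℝ) ^ 3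
      ≤ 1 / fourthRoot (q : ℝ) ^ 3 * (4 * (fourthRoot (K : ℝ) / fourthRoot (q : ℝ))) := by
        gcongr
        exact (sum_fourthRoot_le _).trans (by gcongr)
    _ = 4 * fourthRoot (K : ℝ) / fourthRoot (q : ℝ) ^ 4 := by field_simp
    _ = _ := by rw [fourthRoot_pow hq0.le]

theorem min_le_fourthRoot {m x : ℝ} (hm : 0 ≤ m) (hx : 0 ≤ x) :
    min m x ≤ fourthRoot m * fourthRoot x ^ 3 := by
  have h0 : 0 ≤ min m x := le_min hm hx
  have e : min m x = fourthRoot (min m x) * fourthRoot (min m x) ^ 3 := by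
    rw [← pow_succ', fourthRoot_pow h0]
  rw [e]
  have := fourthRoot_nonneg (min m x)
  have := fourthRoot_nonneg m
  gcongr
  · exact fourthRoot_mono (min_le_left _ _)
  · exact fourthRoot_mono (min_le_right _ _)

set_option maxHeartbeats 1000000 in
theorem lattice_weight_le {T μ : ℕ} {u h₂ h₄ : ℤ} (hT : 4 ≤ T) (hTμ : T ^ 2 ≤ μ)
    (hμT : μ ≤ 4 * T ^ 2) (hu : 1 ≤ u) (huT : u ≤ 4 * T) {b : ℝ} (hb : 0 ≤ b) :
    ∑ p ∈ (Finset.Icc (1 : ℤ) μ ×ˢ Finset.Icc (1 : ℤ) μ).filter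
      (fun p => u ∣ h₂ * p.1 - h₄ * p.2 ∧ p.1 < 4 * p.2 ∧ p.2 < 4 * p.1),
      (1 + min (μ : ℝ) (b / ((min p.1 p.2 : ℤ) : ℝ) ^ 3)) ≤
    (Int.gcd (Int.gcd u h₂) h₄ : ℝ) / u * (34 * μ ^ 2 + 32768 * fourthRoot T * fourthRoot b ^ 3) := by
  set g₀ := Int.gcd (Int.gcd u h₂) h₄ with hg₀
  set Lat := (Finset.Icc (1 : ℤ) μ ×ˢ Finset.Icc (1 : ℤ) μ).filter
      (fun p => u ∣ h₂ * p.1 - h₄ * p.2 ∧ p.1 < 4 * p.2 ∧ p.2 < 4 * p.1) with hLat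
  have hu' : (0 : ℝ) < u := by exact_mod_cast hu
  have hT0 : (0 : ℝ) < T := by
    have : 0 < T := by omega
    exact_mod_cast this
  have hbox : ∀ (N : ℕ) (P : Finset (ℤ × ℤ)), u ≤ N →
      (∀ p ∈ P, p ∈ Lat ∧ p.1 ≤ N ∧ p.2 ≤ N) → (P.card : ℝ) ≤ g₀ / u * (2 * N ^ 2) := by
    intro N P hN hP
    have h1 := card_lattice_dvd_le (h₂ := h₂) (h₄ := h₄) hu hN
    have h2 : P.card ≤ ((Finset.Icc (1 : ℤ) N ×ˢ Finset.Icc (1 : ℤ) N).filter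
        fun p => u ∣ h₂ * p.1 - h₄ * p.2).card := by
      refine Finset.card_le_card fun p hp => ?_
      obtain ⟨h3, h4, h5⟩ := hP p hp
      simp only [hLat, Finset.mem_filter, Finset.mem_product, Finset.mem_Icc] at h3 ⊢
      exact ⟨⟨⟨h3.1.1.1, h4⟩, h3.1.2.1, h5⟩, h3.2.1⟩
    rw [← hg₀] at h1
    have h3 : (P.card : ℤ) * u ≤ 2 * N ^ 2 * g₀ :=
      le_trans (mul_le_mul_of_nonneg_right (by exact_mod_cast h2) (by omega)) h1
    rw [div_mul_eq_mul_div, le_div_iff₀ hu']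
    have h4 : (P.card : ℝ) * u ≤ 2 * N ^ 2 * g₀ := by exact_mod_cast h3
    linarith
  have hmin : ∀ (M : ℕ) , (T : ℤ) ≤ M → ((Lat.filter fun p => min p.1 p.2 < (M : ℤ)).card : ℝ) ≤
      g₀ / u * (32 * M ^ 2) := by
    intro M hM
    have := hbox (4 * M) (Lat.filter fun p => min p.1 p.2 < (M : ℤ)) (by push_cast; omega) (by
      intro p hp
      rw [Finset.mem_filter] at hp
      have h3 := hp.1
      simp only [hLat, Finset.mem_filter, Finset.mem_product, Finset.mem_Icc] at h3
      have h4 := hp.2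
      refine ⟨hp.1, ?_, ?_⟩ <;> push_cast <;> omega)
    refine this.trans (le_of_eq ?_)
    push_cast; ring
  set c : ℝ := fourthRoot μ * fourthRoot b ^ 3 with hc
  have hc0 : 0 ≤ c := mul_nonneg (fourthRoot_nonneg _) (pow_nonneg (fourthRoot_nonneg _) _)
  have hpt : ∀ p ∈ Lat, (1 + min (μ : ℝ) (b / ((min p.1 p.2 : ℤ) : ℝ) ^ 3)) ≤
      1 + (μ : ℝ) * (if min p.1 p.2 < (T : ℤ) then (1 : ℝ) else 0) +
      ∑ s ∈ Finset.range μ, c / fourthRoot (16 ^ s * T) ^ 9 *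
        (if min p.1 p.2 < ((16 ^ (s + 1) * T : ℕ) : ℤ) then (1 : ℝ) else 0) *
        (if ((16 ^ s * T : ℕ) : ℤ) ≤ min p.1 p.2 then (1 : ℝ) else 0) := by
    intro p hp
    simp only [hLat, Finset.mem_filter, Finset.mem_product, Finset.mem_Icc] at hp
    have hnn : ∀ s ∈ Finset.range μ, 0 ≤ c / fourthRoot (16 ^ s * T) ^ 9 *
        (if min p.1 p.2 < ((16 ^ (s + 1) * T : ℕ) : ℤ) then (1 : ℝ) else 0) *
        (if ((16 ^ s * T : ℕ) : ℤ) ≤ min p.1 p.2 then (1 : ℝ) else 0) := by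
      intro s _
      have := fourthRoot_nonneg (16 ^ s * T)
      positivity
    obtain ⟨D, hD⟩ : ∃ D : ℕ, min p.1 p.2 = D := ⟨(min p.1 p.2).toNat, by omega⟩
    have hDμ : D ≤ μ := by omega
    have hD1 : 1 ≤ D := by omega
    rw [hD] at hnn ⊢
    by_cases h : (D : ℤ) < T
    · rw [if_pos h]
      have := Finset.sum_nonneg hnn
      have := min_le_left (μ : ℝ) (b / ((D : ℤ) : ℝ) ^ 3)
      linarith
    · rw [if_neg h, mul_zero, add_zero]
      gcongr
      have hTD : 1 ≤ D / T := by
        rw [Nat.le_div_iff_mul_le (by omega)]; omega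
      set s := Nat.log 16 (D / T) with hs
      have hs1 : 16 ^ s * T ≤ D := by
        have := Nat.pow_log_le_self 16 (x := D / T) (by omega)
        exact (Nat.le_div_iff_mul_le (by omega)).1 this
      have hs2 : D < 16 ^ (s + 1) * T := by
        have := Nat.lt_pow_succ_log_self (b := 16) (by norm_num) (D / T)
        exact (Nat.div_lt_iff_lt_mul (by omega)).1 this
      have hsμ : s ∈ Finset.range μ := by
        rw [Finset.mem_range]
        have h1 : s < 16 ^ s := Nat.lt_pow_self (by norm_num)
        have h2 : 16 ^ s * 1 ≤ 16 ^ s * T := Nat.mul_le_mul_left _ (by omega)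
        omega
      refine le_trans ?_ (Finset.single_le_sum hnn hsμ)
      rw [if_pos (by exact_mod_cast hs2), if_pos (by exact_mod_cast hs1), mul_one, mul_one]
      have hDr : (0 : ℝ) < D := by exact_mod_cast hD1
      have hsr : (16 : ℝ) ^ s * T ≤ D := by exact_mod_cast hs1
      refine (min_le_fourthRoot (by positivity) (by positivity)).trans ?_
      have hx : fourthRoot (b / ((D : ℤ) : ℝ) ^ 3) = fourthRoot b / fourthRoot D ^ 3 := by
        have hD4 := fourthRoot_pow hDr.le
        have hpos := fourthRoot_pos hDr
        have h12 : (((D : ℤ) : ℝ)) ^ 3 = (fourthRoot D ^ 3) ^ 4 := by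
          rw [← pow_mul, mul_comm, pow_mul, hD4]; simp
        rw [eq_div_iff (by positivity)]
        conv_lhs => rw [← fourthRoot_pow_four (x := fourthRoot (D : ℝ) ^ 3) (by positivity)]
        rw [← fourthRoot_mul (by positivity), ← h12, div_mul_cancel₀ _ (by
          rw [h12]; positivity)]
      rw [hx, div_pow, ← pow_mul, ← mul_div_assoc, ← hc]
      have h0 : 0 < fourthRoot (16 ^ s * T) := fourthRoot_pos (by positivity)
      gcongr
      exact fourthRoot_mono hsr
  have h16 : ∀ s : ℕ, fourthRoot ((16 : ℝ) ^ s * T) = 2 ^ s * fourthRoot T := by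
    intro s
    rw [fourthRoot_mul (by positivity), show (16 : ℝ) ^ s = (2 ^ s) ^ 4 by
      rw [← pow_mul, mul_comm, pow_mul]; norm_num, fourthRoot_pow_four (by positivity)]
  have hTpos := fourthRoot_pos hT0
  have hμ4 : fourthRoot μ ≤ 2 * fourthRoot T ^ 2 := by
    refine fourthRoot_le (by positivity) ?_
    rw [mul_pow, ← pow_mul, mul_comm 2 4, pow_mul, fourthRoot_pow hT0.le]
    have : (μ : ℝ) ≤ 4 * T ^ 2 := by exact_mod_cast hμT
    nlinarith
  have hgu : (0 : ℝ) ≤ g₀ / u := by positivity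
  have s0 : (Lat.card : ℝ) ≤ g₀ / u * (2 * μ ^ 2) := by
    refine hbox μ Lat ?_ fun p hp => ⟨hp, ?_, ?_⟩
    · have : (4 * T : ℤ) ≤ μ := by
        have : 4 * T ≤ μ := by nlinarith
        exact_mod_cast this
      omega
    · simp only [hLat, Finset.mem_filter, Finset.mem_product, Finset.mem_Icc] at hp
      exact hp.1.1.2
    · simp only [hLat, Finset.mem_filter, Finset.mem_product, Finset.mem_Icc] at hp
      exact hp.1.2.2
  have s1 := hmin T le_rfl
  calc _ ≤ ∑ p ∈ Lat, (1 + (μ : ℝ) * (if min p.1 p.2 < (T : ℤ) then (1 : ℝ) else 0) +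
        ∑ s ∈ Finset.range μ, c / fourthRoot (16 ^ s * T) ^ 9 *
        (if min p.1 p.2 < ((16 ^ (s + 1) * T : ℕ) : ℤ) then (1 : ℝ) else 0) *
        (if ((16 ^ s * T : ℕ) : ℤ) ≤ min p.1 p.2 then (1 : ℝ) else 0)) := Finset.sum_le_sum hpt
    _ ≤ ∑ p ∈ Lat, (1 + (μ : ℝ) * (if min p.1 p.2 < (T : ℤ) then (1 : ℝ) else 0) +
        ∑ s ∈ Finset.range μ, c / fourthRoot (16 ^ s * T) ^ 9 *
        (if min p.1 p.2 < ((16 ^ (s + 1) * T : ℕ) : ℤ) then (1 : ℝ) else 0)) := by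
      refine Finset.sum_le_sum fun p _ => add_le_add le_rfl (Finset.sum_le_sum fun s _ => ?_)
      have := fourthRoot_nonneg (16 ^ s * T)
      refine mul_le_of_le_one_right (by positivity) ?_
      split_ifs <;> norm_num
    _ = Lat.card + μ * ((Lat.filter fun p => min p.1 p.2 < (T : ℤ)).card : ℝ) +
        ∑ s ∈ Finset.range μ, c / fourthRoot (16 ^ s * T) ^ 9 *
        ((Lat.filter fun p => min p.1 p.2 < ((16 ^ (s + 1) * T : ℕ) : ℤ)).card : ℝ) := by
      rw [Finset.sum_add_distrib, Finset.sum_add_distrib, Finset.sum_comm, ← Finset.mul_sum,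
        Finset.sum_boole]
      simp_rw [← Finset.mul_sum, Finset.sum_boole]
      simp
    _ ≤ g₀ / u * (2 * μ ^ 2) + μ * (g₀ / u * (32 * T ^ 2)) +
        ∑ s ∈ Finset.range μ, g₀ / u * (8192 * (c / fourthRoot T)) * (1 / 2) ^ s := by
      refine add_le_add (add_le_add s0 (mul_le_mul_of_nonneg_left s1 (by positivity)))
        (Finset.sum_le_sum fun s hs => ?_)
      have h := hmin (16 ^ (s + 1) * T) (by
        have : 1 * T ≤ 16 ^ (s + 1) * T := Nat.mul_le_mul_right _ (Nat.one_le_pow _ _ (by norm_num))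
        exact_mod_cast (by omega : T ≤ 16 ^ (s + 1) * T))
      have h0 : 0 < fourthRoot (16 ^ s * T) := fourthRoot_pos (by positivity)
      calc _ ≤ c / fourthRoot (16 ^ s * T) ^ 9 *
            (g₀ / u * (32 * ((16 ^ (s + 1) * T : ℕ) : ℝ) ^ 2)) :=
            mul_le_mul_of_nonneg_left h (by positivity)
        _ = g₀ / u * 8192 * (c / fourthRoot (16 ^ s * T) ^ 9 * ((16 ^ s * T : ℝ)) ^ 2) := by
          push_cast; ring
        _ = g₀ / u * 8192 * (c / fourthRoot (16 ^ s * T)) := by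
          rw [← fourthRoot_pow (x := (16 : ℝ) ^ s * T) (by positivity),
            fourthRoot_pow_four h0.le]
          field_simp
        _ = g₀ / u * (8192 * (c / fourthRoot T)) * (1 / 2) ^ s := by
          rw [h16, one_div, inv_pow]
          field_simp
    _ ≤ g₀ / u * (2 * μ ^ 2) + μ * (g₀ / u * (32 * μ)) +
        g₀ / u * (8192 * (c / fourthRoot T)) * 2 := by
      rw [← Finset.mul_sum]
      have hT2 : (T : ℝ) ^ 2 ≤ μ := by exact_mod_cast hTμ
      have := sum_geometric_two_le μ
      gcongr
    _ = g₀ / u * (34 * μ ^ 2 + 16384 * (fourthRoot μ * fourthRoot b ^ 3 / fourthRoot T)) := by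
      rw [hc]; ring
    _ ≤ _ := by
      have hb0 := fourthRoot_nonneg b
      have : fourthRoot μ * fourthRoot b ^ 3 / fourthRoot T ≤
          2 * fourthRoot T * fourthRoot b ^ 3 := by
        rw [div_le_iff₀ hTpos]
        calc fourthRoot μ * fourthRoot b ^ 3 ≤ 2 * fourthRoot T ^ 2 * fourthRoot b ^ 3 := by gcongr
          _ = _ := by ring
      refine mul_le_mul_of_nonneg_left ?_ hgu
      linarith

theorem FourRel.eq_of {K μ : ℤ} {y₀ ε : ℝ} (hK : 1 ≤ K)
    {t t' : (ℤ × ℤ) × (ℤ × ℤ) × (ℤ × ℤ) × (ℤ × ℤ)}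
    (h : FourRel K μ y₀ ε t) (h' : FourRel K μ y₀ ε t') (e₁ : t.1.1 = t'.1.1)
    (e₂ : t.2.1.1 = t'.2.1.1) (e₃ : t.2.2.1.1 = t'.2.2.1.1) (e₄ : t.1.2 = t'.1.2)
    (e₅ : t.1.2 - t.2.1.2 = t'.1.2 - t'.2.1.2)
    (e₆ : t.2.2.1.2 - t.2.2.2.2 = t'.2.2.1.2 - t'.2.2.2.2) : t = t' := by
  obtain ⟨⟨h₁, i₁⟩, ⟨h₂, i₂⟩, ⟨h₃, i₃⟩, ⟨h₄, i₄⟩⟩ := t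
  obtain ⟨⟨h₁', i₁'⟩, ⟨h₂', i₂'⟩, ⟨h₃', i₃'⟩, ⟨h₄', i₄'⟩⟩ := t'
  have a := h.add
  have a' := h'.add
  have m := h.mul
  have m' := h'.mul
  have k := h.h₁
  have k2 := h.h₂
  dsimp only at *
  subst e₁ e₂ e₃ e₄
  have b : h₄ = h₄' := by linarith
  have c : i₂ = i₂' := by linarith
  subst b c
  have d : i₃ = i₃' := by
    have : (h₁ + h₂) * (i₃ - i₃') = 0 := by
      have e : i₄' = i₄ - i₃ + i₃' := by linarith
      subst e
      linear_combination m' - m + (i₃ - i₃') * a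
    rcases mul_eq_zero.1 this with h | h <;> linarith
  subst d
  have e : i₄ = i₄' := by linarith
  rw [e]

theorem FourRel.dvd {K μ : ℤ} {y₀ ε : ℝ} {t : (ℤ × ℤ) × (ℤ × ℤ) × (ℤ × ℤ) × (ℤ × ℤ)}
    (h : FourRel K μ y₀ ε t) : t.1.1 + t.2.1.1 ∣ t.2.1.1 * (t.1.2 - t.2.1.2) -
      (t.1.1 + t.2.1.1 - t.2.2.1.1) * (t.2.2.1.2 - t.2.2.2.2) :=
  ⟨t.1.2 - t.2.2.1.2, by
    linear_combination t.2.2.2.2 * h.add - h.mul⟩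

section
variable {K μ : ℕ} {y₀ ε M : ℝ}

theorem card_four_rel_small (hK : 1 ≤ K) (hM : 0 ≤ M)
    (S : Finset ((ℤ × ℤ) × (ℤ × ℤ) × (ℤ × ℤ) × (ℤ × ℤ)))
    (hS : ∀ t ∈ S, FourRel K μ y₀ ε t ∧ t.2.1.2 ≤ t.1.2 ∧ t.2.2.2.2 ≤ t.2.2.1.2 ∧
      ((t.1.2 : ℝ) - t.2.1.2) ^ 2 ≤ M ∧ ((t.2.2.1.2 : ℝ) - t.2.2.2.2) ^ 2 ≤ M) :
    (S.card : ℝ) ≤ 2 * K ^ 3 * μ * (M + 1) := by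
  set n := ⌊√M⌋₊ with hn
  have hle : ∀ a b : ℤ, a ≤ b → ((b : ℝ) - a) ^ 2 ≤ M → b - a < n + 1 := by
    intro a b hab h
    have h1 : (b : ℝ) - a ≤ √M := Real.le_sqrt_of_sq_le h
    have h2 := h1.trans_lt (Nat.lt_floor_add_one _)
    rw [← hn] at h2
    exact_mod_cast h2
  have h1 : S.card ≤ (Finset.Ico (K : ℤ) (2 * K) ×ˢ Finset.Ico (K : ℤ) (2 * K) ×ˢ
      Finset.Ico (K : ℤ) (2 * K) ×ˢ Finset.Ico (0 : ℤ) μ ×ˢ Finset.Ico (0 : ℤ) (n + 1) ×ˢ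
      Finset.Ico (0 : ℤ) (n + 1)).card := by
    refine Finset.card_le_card_of_injOn (fun t => (t.1.1, t.2.1.1, t.2.2.1.1, t.1.2,
      t.1.2 - t.2.1.2, t.2.2.1.2 - t.2.2.2.2)) ?_ ?_
    · intro t ht
      obtain ⟨h, a, b, c, d⟩ := hS t ht
      simp only [Finset.coe_product, Set.mem_prod, Finset.coe_Ico, Set.mem_Ico]
      exact ⟨h.h₁, h.h₂, h.h₃, h.i₁, ⟨by linarith, hle _ _ a c⟩, ⟨by linarith, hle _ _ b d⟩⟩
    · intro t ht t' ht' e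
      simp only [Prod.mk.injEq] at e
      exact FourRel.eq_of (by exact_mod_cast hK) (hS t ht).1 (hS t' ht').1 e.1 e.2.1 e.2.2.1
        e.2.2.2.1 e.2.2.2.2.1 e.2.2.2.2.2
  simp only [Finset.card_product, Int.card_Ico] at h1
  have e1 : (2 * (K : ℤ) - K).toNat = K := by omega
  have e2 : ((μ : ℤ) - 0).toNat = μ := by omega
  have e3 : ((n : ℤ) + 1 - 0).toNat = n + 1 := by omega
  rw [e1, e2, e3] at h1
  have h2 : (S.card : ℝ) ≤ K * (K * (K * (μ * ((n + 1) * (n + 1))))) := by exact_mod_cast h1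
  have h3 : ((n : ℝ) + 1) * (n + 1) ≤ 2 * (M + 1) := by
    have h4 : (n : ℝ) ≤ √M := Nat.floor_le (Real.sqrt_nonneg _)
    have h5 := Real.sq_sqrt hM
    have h6 : (n : ℝ) ^ 2 ≤ √M ^ 2 := by gcongr
    nlinarith [sq_nonneg ((n : ℝ) - 1)]
  calc (S.card : ℝ) ≤ K * (K * (K * (μ * ((n + 1) * (n + 1))))) := h2
    _ ≤ K * (K * (K * (μ * (2 * (M + 1))))) := by gcongr
    _ = _ := by ring

theorem card_four_rel_eq (hK : 1 ≤ K)
    (S : Finset ((ℤ × ℤ) × (ℤ × ℤ) × (ℤ × ℤ) × (ℤ × ℤ)))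
    (hS : ∀ t ∈ S, FourRel K μ y₀ ε t ∧ t.2.1.2 ≤ t.1.2 ∧
      t.1.1 = t.2.2.1.1 ∧ t.1.2 - t.2.1.2 = t.2.2.1.2 - t.2.2.2.2) :
    (S.card : ℝ) ≤ K ^ 2 * μ ^ 2 := by
  have h1 : S.card ≤ (Finset.Ico (K : ℤ) (2 * K) ×ˢ Finset.Ico (K : ℤ) (2 * K) ×ˢ
      Finset.Ico (0 : ℤ) μ ×ˢ Finset.Ico (0 : ℤ) μ).card := by
    refine Finset.card_le_card_of_injOn (fun t => (t.1.1, t.2.1.1, t.1.2, t.1.2 - t.2.1.2)) ?_ ?_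
    · intro t ht
      obtain ⟨h, a, b⟩ := hS t ht
      simp only [Finset.coe_product, Set.mem_prod, Finset.coe_Ico, Set.mem_Ico]
      have := h.i₁
      have := h.i₂
      exact ⟨h.h₁, h.h₂, h.i₁, ⟨by omega, by omega⟩⟩
    · intro t ht t' ht' e
      simp only [Prod.mk.injEq] at e
      obtain ⟨h, a, b, c⟩ := hS t ht
      obtain ⟨h', a', b', c'⟩ := hS t' ht'
      exact FourRel.eq_of (by exact_mod_cast hK) h h' e.1 e.2.1 (by omega) e.2.2.1 e.2.2.2
        (by omega)
  simp only [Finset.card_product, Int.card_Ico] at h1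
  have e1 : (2 * (K : ℤ) - K).toNat = K := by omega
  have e2 : ((μ : ℤ) - 0).toNat = μ := by omega
  rw [e1, e2] at h1
  calc (S.card : ℝ) ≤ K * (K * (μ * μ)) := by exact_mod_cast h1
    _ = _ := by ring

theorem card_four_rel_diag (hK : 1 ≤ K) (hM : 0 ≤ M)
    (S : Finset ((ℤ × ℤ) × (ℤ × ℤ) × (ℤ × ℤ) × (ℤ × ℤ)))
    (hS : ∀ t ∈ S, FourRel K μ y₀ ε t ∧ t.2.1.2 ≤ t.1.2 ∧ t.2.2.2.2 ≤ t.2.2.1.2 ∧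
      t.1.1 = t.2.2.1.1 ∧ t.1.2 - t.2.1.2 ≠ t.2.2.1.2 - t.2.2.2.2 ∧
      |((t.1.2 : ℝ) - t.2.1.2) - (t.2.2.1.2 - t.2.2.2.2)| *
        ((t.1.2 - t.2.1.2) + (t.2.2.1.2 - t.2.2.2.2)) ≤ M) :
    (S.card : ℝ) ≤ 3 * K ^ 2 * μ * (M * √M) := by
  rcases S.eq_empty_or_nonempty with rfl | ⟨t₀, ht₀⟩
  · simp; positivity
  have key : ∀ d d' : ℤ, 0 ≤ d → 0 ≤ d' → d ≠ d' → |(d : ℝ) - d'| * (d + d') ≤ M →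
      1 ≤ M ∧ (1 ≤ d + d' ∧ d + d' < ⌊M⌋₊ + 1) ∧
      (-(⌊√M⌋₊ : ℤ) ≤ d - d' ∧ d - d' < ⌊√M⌋₊ + 1) := by
    intro d d' h0 h0' hne h
    have a1 : (1 : ℝ) ≤ |(d : ℝ) - d'| := by
      have : 1 ≤ |d - d'| := Int.one_le_abs (sub_ne_zero.2 hne)
      exact_mod_cast this
    have a2 : (1 : ℝ) ≤ d + d' := by
      have : 1 ≤ d + d' := by omega
      exact_mod_cast this
    have a3 : (d : ℝ) + d' ≤ M := by nlinarith
    have a4 : |(d : ℝ) - d'| ≤ d + d' := by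
      have : |d - d'| ≤ d + d' := abs_le.2 ⟨by omega, by omega⟩
      exact_mod_cast this
    have a5 : |(d : ℝ) - d'| ≤ √M := Real.le_sqrt_of_sq_le (by nlinarith)
    have a6 : |d - d'| < ⌊√M⌋₊ + 1 := by
      have := a5.trans_lt (Nat.lt_floor_add_one _)
      exact_mod_cast this
    have a7 : d + d' < ⌊M⌋₊ + 1 := by
      have := a3.trans_lt (Nat.lt_floor_add_one _)
      exact_mod_cast this
    rw [abs_lt] at a6
    exact ⟨by linarith, ⟨by exact_mod_cast a2, a7⟩, by omega, by omega⟩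
  have hM1 : 1 ≤ M := by
    obtain ⟨h, a, b, c, d, e⟩ := hS t₀ ht₀
    exact (key (t₀.1.2 - t₀.2.1.2) (t₀.2.2.1.2 - t₀.2.2.2.2) (by omega) (by omega) d
      (by exact_mod_cast e)).1
  have h1 : S.card ≤ (Finset.Ico (K : ℤ) (2 * K) ×ˢ Finset.Ico (K : ℤ) (2 * K) ×ˢ
      Finset.Ico (0 : ℤ) μ ×ˢ Finset.Ico (1 : ℤ) (⌊M⌋₊ + 1) ×ˢ
      Finset.Ico (-(⌊√M⌋₊ : ℤ)) (⌊√M⌋₊ + 1)).card := by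
    refine Finset.card_le_card_of_injOn (fun t => (t.1.1, t.2.1.1, t.1.2,
      (t.1.2 - t.2.1.2) + (t.2.2.1.2 - t.2.2.2.2),
      (t.1.2 - t.2.1.2) - (t.2.2.1.2 - t.2.2.2.2))) ?_ ?_
    · intro t ht
      obtain ⟨h, a, b, c, d, e⟩ := hS t ht
      simp only [Finset.coe_product, Set.mem_prod, Finset.coe_Ico, Set.mem_Ico]
      have := key (t.1.2 - t.2.1.2) (t.2.2.1.2 - t.2.2.2.2) (by omega) (by omega) d
        (by exact_mod_cast e)
      exact ⟨h.h₁, h.h₂, h.i₁, this.2.1, this.2.2⟩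
    · intro t ht t' ht' e
      simp only [Prod.mk.injEq] at e
      obtain ⟨h, a, b, c, -⟩ := hS t ht
      obtain ⟨h', a', b', c', -⟩ := hS t' ht'
      exact FourRel.eq_of (by exact_mod_cast hK) h h' e.1 e.2.1 (by omega) e.2.2.1 (by omega)
        (by omega)
  simp only [Finset.card_product, Int.card_Ico] at h1
  have e1 : (2 * (K : ℤ) - K).toNat = K := by omega
  have e2 : ((μ : ℤ) - 0).toNat = μ := by omega
  have e3 : ((⌊M⌋₊ : ℤ) + 1 - 1).toNat = ⌊M⌋₊ := by omega
  have e4 : ((⌊√M⌋₊ : ℤ) + 1 - -(⌊√M⌋₊ : ℤ)).toNat = 2 * ⌊√M⌋₊ + 1 := by omega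
  rw [e1, e2, e3, e4] at h1
  have h2 : (S.card : ℝ) ≤ K * (K * (μ * (⌊M⌋₊ * (2 * ⌊√M⌋₊ + 1)))) := by exact_mod_cast h1
  have h4 : (⌊√M⌋₊ : ℝ) ≤ √M := Nat.floor_le (Real.sqrt_nonneg _)
  have h5 : (⌊M⌋₊ : ℝ) ≤ M := Nat.floor_le hM
  have h6 : 1 ≤ √M := Real.one_le_sqrt.2 hM1
  calc (S.card : ℝ) ≤ K * (K * (μ * (⌊M⌋₊ * (2 * ⌊√M⌋₊ + 1)))) := h2
    _ ≤ K * (K * (μ * (M * (3 * √M)))) := by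
      gcongr
      linarith
    _ = _ := by ring

end

theorem FourRel.eq_shift {K μ : ℤ} {y₀ ε : ℝ} (hK : 1 ≤ K)
    {t t' : (ℤ × ℤ) × (ℤ × ℤ) × (ℤ × ℤ) × (ℤ × ℤ)}
    (h : FourRel K μ y₀ ε t) (h' : FourRel K μ y₀ ε t') (e₁ : t'.1.1 = t.1.1)
    (e₂ : t'.2.1.1 = t.2.1.1) (e₃ : t'.2.2.1.1 = t.2.2.1.1)
    (e₅ : t'.1.2 - t'.2.1.2 = t.1.2 - t.2.1.2)
    (e₆ : t'.2.2.1.2 - t'.2.2.2.2 = t.2.2.1.2 - t.2.2.2.2) :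
    t' = ((t.1.1, t.1.2 + (t'.1.2 - t.1.2)), (t.2.1.1, t.2.1.2 + (t'.1.2 - t.1.2)),
      (t.2.2.1.1, t.2.2.1.2 + (t'.1.2 - t.1.2)), (t.2.2.2.1, t.2.2.2.2 + (t'.1.2 - t.1.2))) := by
  obtain ⟨⟨h₁, i₁⟩, ⟨h₂, i₂⟩, ⟨h₃, i₃⟩, ⟨h₄, i₄⟩⟩ := t
  obtain ⟨⟨h₁', i₁'⟩, ⟨h₂', i₂'⟩, ⟨h₃', i₃'⟩, ⟨h₄', i₄'⟩⟩ := t'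
  have a := h.add
  have a' := h'.add
  have m := h.mul
  have m' := h'.mul
  have k := h.h₁
  have k2 := h.h₂
  dsimp only at *
  subst e₁ e₂ e₃
  have b : h₄ = h₄' := by linarith
  subst b
  obtain ⟨Δ, rfl⟩ : ∃ Δ, i₁' = i₁ + Δ := ⟨i₁' - i₁, by ring⟩
  have c : i₂' = i₂ + Δ := by linarith
  subst c
  obtain ⟨Γ, rfl⟩ : ∃ Γ, i₃' = i₃ + Γ := ⟨i₃' - i₃, by ring⟩
  have c : i₄' = i₄ + Γ := by linarith
  subst c
  have d : Γ = Δ := by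
    have : (h₁' + h₂') * (Γ - Δ) = 0 := by linear_combination m - m' + Γ * a
    rcases mul_eq_zero.1 this with h | h <;> linarith
  subst d
  simp

theorem card_le_one_add_of_sub_le {ι : Type*} (F : Finset ι) (f : ι → ℤ) (hf : Set.InjOn f F)
    {b : ℝ} (hb : 0 ≤ b) (h : ∀ x ∈ F, ∀ y ∈ F, f x ≤ f y → ((f y - f x : ℤ) : ℝ) ≤ b) :
    (F.card : ℝ) ≤ 1 + b := by
  rcases F.eq_empty_or_nonempty with rfl | hne
  · simp; linarith
  obtain ⟨x, hx, hxm⟩ := F.exists_min_image f hne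
  obtain ⟨y, hy, hym⟩ := F.exists_max_image f hne
  have h1 : F.card ≤ (Finset.Icc (f x) (f y)).card :=
    Finset.card_le_card_of_injOn f (fun z hz => by
      simpa using ⟨hxm z hz, hym z hz⟩) hf
  rw [Int.card_Icc] at h1
  have h2 : (F.card : ℤ) ≤ f y - f x + 1 := by
    have := hxm y hy
    omega
  have h3 : (F.card : ℝ) ≤ ((f y - f x : ℤ) : ℝ) + 1 := by exact_mod_cast h2
  linarith [h x hx y hy (hxm y hy)]

section
variable {K μ T : ℕ} {y₀ ε Y B : ℝ}

theorem card_four_rel_fiber_le (hK : 1 ≤ K) (hY : 0 < Y) (hy : Y ≤ y₀) (hy' : y₀ + μ ≤ 4 * Y)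
    (hB0 : 0 ≤ B) (hB : 2 ^ 22 * (ε * (Y * √Y) * Y ^ 2) ≤ B) {h₁ h₂ h₃ d d' : ℤ}
    (F : Finset ((ℤ × ℤ) × (ℤ × ℤ) × (ℤ × ℤ) × (ℤ × ℤ)))
    (hF : ∀ t ∈ F, FourRel K μ y₀ ε t ∧ (t.1.1, t.2.1.1, t.2.2.1.1) = (h₁, h₂, h₃) ∧
      (t.1.2 - t.2.1.2, t.2.2.1.2 - t.2.2.2.2) = (d, d')) (hd : 1 ≤ d) (hd' : 1 ≤ d')
    (hne : h₁ ≠ h₃) :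
    (F.card : ℝ) ≤ 1 + min (μ : ℝ) (B / (h₁ - h₃).natAbs / ((min d d' : ℤ) : ℝ) ^ 3) := by
  have hD : (0 : ℝ) < ((min d d' : ℤ) : ℝ) := by
    have : 0 < min d d' := lt_min (by omega) (by omega)
    exact_mod_cast this
  have hj : (0 : ℝ) < (h₁ - h₃).natAbs := by
    have : 0 < (h₁ - h₃).natAbs := Int.natAbs_pos.2 (sub_ne_zero.2 hne)
    exact_mod_cast this
  refine card_le_one_add_of_sub_le F (fun t => t.1.2) ?_ (le_min (by positivity) (by positivity)) ?_
  · intro t ht t' ht' e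
    obtain ⟨h, a, b⟩ := hF t ht
    obtain ⟨h', a', b'⟩ := hF t' ht'
    simp only [Prod.mk.injEq] at a b a' b'
    exact FourRel.eq_of (by exact_mod_cast hK) h h' (by rw [a.1, a'.1]) (by rw [a.2.1, a'.2.1])
      (by rw [a.2.2, a'.2.2]) e (by rw [b.1, b'.1]) (by rw [b.2, b'.2])
  · intro t ht t' ht' e
    obtain ⟨h, a, b⟩ := hF t ht
    obtain ⟨h', a', b'⟩ := hF t' ht'
    simp only [Prod.mk.injEq] at a b a' b'
    have m1 := h.i₁
    have m2 := h'.i₁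
    have e2 := FourRel.eq_shift (by exact_mod_cast hK) h h' (by rw [a.1, a'.1])
      (by rw [a.2.1, a'.2.1]) (by rw [a.2.2, a'.2.2]) (by rw [b.1, b'.1]) (by rw [b.2, b'.2])
    refine le_min (by exact_mod_cast (by omega : t'.1.2 - t.1.2 ≤ (μ : ℤ))) ?_
    rw [e2] at h'
    have key := FourRel.translate (D := min d d') (by exact_mod_cast hK : (1 : ℤ) ≤ K) hY hy
      (by exact_mod_cast hy') h h' (sub_nonneg.2 e) (le_min (by omega) (by omega))
      (b.1 ▸ min_le_left _ _) (b.2 ▸ min_le_right _ _)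
    rw [a.1, a.2.2] at key
    rw [div_div, le_div_iff₀ (by positivity)]
    have e3 : ((h₁ - h₃).natAbs : ℝ) = |(h₁ : ℝ) - h₃| := by
      rw [Nat.cast_natAbs]; simp
    rw [e3]
    linarith

theorem card_four_rel_comparable (hK : 1 ≤ K) (hY : 0 < Y) (hy : Y ≤ y₀) (hy' : y₀ + μ ≤ 4 * Y)
    (hB0 : 0 ≤ B) (hB : 2 ^ 22 * (ε * (Y * √Y) * Y ^ 2) ≤ B) (hT : 4 ≤ T) (hTμ : T ^ 2 ≤ μ)
    (hμT : μ ≤ 4 * T ^ 2) (hKT : K ≤ T)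
    (S : Finset ((ℤ × ℤ) × (ℤ × ℤ) × (ℤ × ℤ) × (ℤ × ℤ)))
    (hS : ∀ t ∈ S, FourRel K μ y₀ ε t ∧ t.1.1 ≠ t.2.2.1.1 ∧
      t.1.2 - t.2.1.2 < 4 * (t.2.2.1.2 - t.2.2.2.2) ∧
      t.2.2.1.2 - t.2.2.2.2 < 4 * (t.1.2 - t.2.1.2)) :
    (S.card : ℝ) ≤ 272 * μ ^ 2 * K ^ 2 +
      2 ^ 20 * K * fourthRoot K * fourthRoot T * fourthRoot B ^ 3 := by
  set T3 := (Finset.Ico (K : ℤ) (2 * K) ×ˢ Finset.Ico (K : ℤ) (2 * K) ×ˢ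
    Finset.Ico (K : ℤ) (2 * K)).filter (fun t => t.1 ≠ t.2.2) with hT3
  set Lat : ℤ × ℤ × ℤ → Finset (ℤ × ℤ) := fun g =>
    (Finset.Icc (1 : ℤ) μ ×ˢ Finset.Icc (1 : ℤ) μ).filter
      (fun p => (g.1 + g.2.1) ∣ g.2.1 * p.1 - (g.1 + g.2.1 - g.2.2) * p.2 ∧
        p.1 < 4 * p.2 ∧ p.2 < 4 * p.1) with hLat
  set f := fun t : (ℤ × ℤ) × (ℤ × ℤ) × (ℤ × ℤ) × (ℤ × ℤ) => (t.1.1, t.2.1.1, t.2.2.1.1) with hf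
  set f' := fun t : (ℤ × ℤ) × (ℤ × ℤ) × (ℤ × ℤ) × (ℤ × ℤ) =>
    (t.1.2 - t.2.1.2, t.2.2.1.2 - t.2.2.2.2) with hf'
  have hK0 : (0 : ℝ) < K := by exact_mod_cast hK
  have hfib : ∀ g ∈ T3, ((S.filter (fun t => f t = g)).card : ℝ) ≤
      (Int.gcd (Int.gcd (g.1 + g.2.1) g.2.1) (g.1 + g.2.1 - g.2.2) : ℝ) *
        (17 * μ ^ 2 / K) +
      (Int.gcd (Int.gcd (g.1 + g.2.1) g.2.1) (g.1 + g.2.1 - g.2.2) : ℝ) *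
        (16384 * fourthRoot T * fourthRoot B ^ 3 / K *
          (1 / fourthRoot ((g.1 - g.2.2).natAbs : ℝ) ^ 3)) := by
    intro g hg
    rw [hT3, Finset.mem_filter, Finset.mem_product, Finset.mem_product] at hg
    simp only [Finset.mem_Ico] at hg
    obtain ⟨⟨g1, g2, g3⟩, gne⟩ := hg
    have hj : (0 : ℝ) < (g.1 - g.2.2).natAbs := by
      have : 0 < (g.1 - g.2.2).natAbs := Int.natAbs_pos.2 (sub_ne_zero.2 gne)
      exact_mod_cast this
    have hmaps : ∀ t ∈ S.filter (fun t => f t = g), f' t ∈ Lat g := by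
      intro t ht
      rw [Finset.mem_filter] at ht
      obtain ⟨ht, e⟩ := ht
      obtain ⟨h, a, b, c⟩ := hS t ht
      have := h.i₁
      have := h.i₂
      have := h.i₃
      have := h.i₄
      rw [← e]
      simp only [hLat, hf, hf', Finset.mem_filter, Finset.mem_product, Finset.mem_Icc]
      exact ⟨⟨⟨by omega, by omega⟩, by omega, by omega⟩, h.dvd, b, c⟩
    rw [Finset.card_eq_sum_card_fiberwise hmaps, Nat.cast_sum]
    have hlw := lattice_weight_le (u := g.1 + g.2.1) (h₂ := g.2.1) (h₄ := g.1 + g.2.1 - g.2.2)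
      (b := B / (g.1 - g.2.2).natAbs) hT hTμ hμT (by omega) (by omega) (by positivity)
    refine (Finset.sum_le_sum fun p hp => ?_).trans (hlw.trans ?_)
    · simp only [hLat, Finset.mem_filter, Finset.mem_product, Finset.mem_Icc] at hp
      refine card_four_rel_fiber_le hK hY hy hy' hB0 hB (h₂ := g.2.1) _ (fun t ht => ?_) hp.1.1.1 hp.1.2.1 gne
      rw [Finset.mem_filter, Finset.mem_filter] at ht
      exact ⟨(hS t ht.1.1).1, ht.1.2, ht.2⟩
    · have hu : (2 * K : ℝ) ≤ ((g.1 + g.2.1 : ℤ) : ℝ) := by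
        have : 2 * (K : ℤ) ≤ g.1 + g.2.1 := by omega
        exact_mod_cast this
      have e1 : fourthRoot (B / (g.1 - g.2.2).natAbs) = fourthRoot B /
          fourthRoot ((g.1 - g.2.2).natAbs : ℝ) := by
        rw [eq_div_iff (fourthRoot_pos hj).ne', ← fourthRoot_mul (by positivity),
          div_mul_cancel₀ _ hj.ne']
      rw [e1, ← mul_add]
      have hfT := fourthRoot_nonneg T
      have hfB := fourthRoot_nonneg B
      have hfj := fourthRoot_pos hj
      calc _ ≤ (Int.gcd (Int.gcd (g.1 + g.2.1) g.2.1) (g.1 + g.2.1 - g.2.2) : ℝ) / (2 * K) *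
            (34 * μ ^ 2 + 32768 * fourthRoot T *
              (fourthRoot B / fourthRoot ((g.1 - g.2.2).natAbs : ℝ)) ^ 3) := by gcongr
        _ = _ := by field_simp; ring
  have hSm : ∀ t ∈ S, f t ∈ T3 := by
    intro t ht
    obtain ⟨h, a, b, c⟩ := hS t ht
    simp only [hT3, hf, Finset.mem_filter, Finset.mem_product, Finset.mem_Ico]
    exact ⟨⟨h.h₁, h.h₂, h.h₃⟩, a⟩
  have hfT := fourthRoot_nonneg T
  have hfB := fourthRoot_nonneg B
  rw [Finset.card_eq_sum_card_fiberwise hSm, Nat.cast_sum]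
  refine (Finset.sum_le_sum hfib).trans ?_
  rw [Finset.sum_add_distrib]
  have s1 := sum_gcd_weight_le hK (fun _ => 17 * (μ : ℝ) ^ 2 / K) (fun _ => by positivity)
    (W := 17 * μ ^ 2) (fun q hq => by
      have hq1 : 1 ≤ q := (Finset.mem_Icc.1 hq).1
      have hq0 : (0 : ℝ) < q := by exact_mod_cast hq1
      rw [Finset.sum_const, Nat.card_Icc, nsmul_eq_mul, Nat.add_sub_cancel]
      have : ((K / q : ℕ) : ℝ) ≤ K / q := Nat.cast_div_le
      calc ((K / q : ℕ) : ℝ) * (17 * μ ^ 2 / K) ≤ K / q * (17 * μ ^ 2 / K) := by gcongr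
        _ = _ := by field_simp)
  have s2 := sum_gcd_weight_le hK (fun j => 16384 * fourthRoot T * fourthRoot B ^ 3 / K *
          (1 / fourthRoot (j : ℝ) ^ 3)) (fun j => by
            have := fourthRoot_nonneg (j : ℝ)
            positivity)
    (W := 16384 * fourthRoot T * fourthRoot B ^ 3 / K * (4 * fourthRoot K)) (fun q hq => by
      have hq1 : 1 ≤ q := (Finset.mem_Icc.1 hq).1
      rw [← Finset.mul_sum]
      exact (mul_le_mul_of_nonneg_left (sum_fourthRoot_mul_le K q hq1) (by positivity)).trans
        (le_of_eq (by ring)))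
  refine (add_le_add s1 s2).trans (le_of_eq ?_)
  field_simp
  ring

end

theorem mul_fourthRoot_le {K H T μ L s B β γ : ℝ} (hH : 0 ≤ H) (hT : 0 ≤ T) (hμ : 0 ≤ μ)
    (hL : 1 ≤ L) (hs0 : 0 ≤ s) (hs1 : s ≤ 1) (hKs : K = s ^ 2 * H) (hT4 : T ^ 4 ≤ μ ^ 2)
    (hB : 0 ≤ B) (hγ : 0 ≤ γ) (hβ : β ^ 3 ≤ γ ^ 4) (hB1 : B ≤ β * (L * H * μ ^ 2 * T)) :
    K * fourthRoot K * fourthRoot T * fourthRoot B ^ 3 ≤ γ * (s * (H ^ 2 * μ ^ 2 * L)) := by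
  have hK : 0 ≤ K := by rw [hKs]; positivity
  refine le_of_pow_le_pow_left₀ (n := 4) (by norm_num) (by positivity) ?_
  have e1 : B ^ 3 ≤ γ ^ 4 * (L ^ 3 * H ^ 3 * μ ^ 6 * T ^ 3) := by
    calc B ^ 3 ≤ (β * (L * H * μ ^ 2 * T)) ^ 3 := pow_le_pow_left₀ hB hB1 3
      _ = β ^ 3 * (L ^ 3 * H ^ 3 * μ ^ 6 * T ^ 3) := by ring
      _ ≤ _ := mul_le_mul_of_nonneg_right hβ (by positivity)
  have e2 : L ^ 3 * s ^ 6 ≤ L ^ 4 := by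
    calc L ^ 3 * s ^ 6 ≤ L ^ 3 * L := by
          gcongr
          exact (pow_le_one₀ hs0 hs1).trans hL
      _ = L ^ 4 := by ring
  calc (K * fourthRoot K * fourthRoot T * fourthRoot B ^ 3) ^ 4
      = K ^ 4 * fourthRoot K ^ 4 * fourthRoot T ^ 4 * (fourthRoot B ^ 4) ^ 3 := by ring
    _ = K ^ 5 * T * B ^ 3 := by
      rw [fourthRoot_pow hK, fourthRoot_pow hT, fourthRoot_pow hB]; ring
    _ ≤ K ^ 5 * T * (γ ^ 4 * (L ^ 3 * H ^ 3 * μ ^ 6 * T ^ 3)) :=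
      mul_le_mul_of_nonneg_left e1 (by positivity)
    _ = γ ^ 4 * L ^ 3 * K ^ 5 * H ^ 3 * μ ^ 6 * T ^ 4 := by ring
    _ ≤ γ ^ 4 * L ^ 3 * K ^ 5 * H ^ 3 * μ ^ 6 * μ ^ 2 :=
      mul_le_mul_of_nonneg_left hT4 (by positivity)
    _ = γ ^ 4 * s ^ 4 * H ^ 8 * μ ^ 8 * (L ^ 3 * s ^ 6) := by rw [hKs]; ring
    _ ≤ γ ^ 4 * s ^ 4 * H ^ 8 * μ ^ 8 * L ^ 4 := mul_le_mul_of_nonneg_left e2 (by positivity)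
    _ = _ := by ring

theorem mul_sqrt_mul_le {M s z : ℝ} (hM : 0 ≤ M) (hz : 0 ≤ z)
    (h : M ^ 3 * s ^ 6 ≤ z ^ 2) : M * √M * s ^ 3 ≤ z := by
  refine le_of_sq_le_sq ?_ hz
  rw [mul_pow, mul_pow, Real.sq_sqrt hM]
  exact (le_of_eq (by ring)).trans h

section
variable {K H μ T : ℕ} {y₀ ε Y A L : ℝ}

open Classical in
theorem card_four_rel_oriented (hK : 1 ≤ K) (hY : 0 < Y) (hy : Y ≤ y₀) (hy' : y₀ + μ ≤ 4 * Y)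
    (hε : 0 ≤ ε) (hT : 4 ≤ T) (hTμ : T ^ 2 ≤ μ) (hμT : μ ≤ 4 * T ^ 2) (hKT : K ≤ T)
    (S : Finset ((ℤ × ℤ) × (ℤ × ℤ) × (ℤ × ℤ) × (ℤ × ℤ)))
    (hS : ∀ t ∈ S, FourRel K μ y₀ ε t ∧ t.2.1.2 ≤ t.1.2 ∧ t.2.2.2.2 ≤ t.2.2.1.2) :
    (S.card : ℝ) ≤ 2 * K ^ 3 * μ * (512 * (ε * (Y * √Y)) / K + 1) + K ^ 2 * μ ^ 2 +
      3 * K ^ 2 * μ * (512 * (ε * (Y * √Y)) / K * √(512 * (ε * (Y * √Y)) / K)) +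
      (272 * μ ^ 2 * K ^ 2 + 2 ^ 20 * K * fourthRoot K * fourthRoot T *
        fourthRoot (2 ^ 22 * (ε * (Y * √Y) * Y ^ 2)) ^ 3) := by
  have hK0 : (0 : ℝ) < K := by exact_mod_cast hK
  have hM : 0 ≤ 512 * (ε * (Y * √Y)) / K := by positivity
  set M := 512 * (ε * (Y * √Y)) / K with hMdef
  set P₁ : (ℤ × ℤ) × (ℤ × ℤ) × (ℤ × ℤ) × (ℤ × ℤ) → Prop := fun t =>
    ((t.1.2 : ℝ) - t.2.1.2) ^ 2 ≤ M ∧ ((t.2.2.1.2 : ℝ) - t.2.2.2.2) ^ 2 ≤ M with hP₁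
  set P₂ : (ℤ × ℤ) × (ℤ × ℤ) × (ℤ × ℤ) × (ℤ × ℤ) → Prop := fun t =>
    t.1.1 = t.2.2.1.1 ∧ t.1.2 - t.2.1.2 = t.2.2.1.2 - t.2.2.2.2 with hP₂
  set P₃ : (ℤ × ℤ) × (ℤ × ℤ) × (ℤ × ℤ) × (ℤ × ℤ) → Prop := fun t =>
    t.1.1 = t.2.2.1.1 ∧ t.1.2 - t.2.1.2 ≠ t.2.2.1.2 - t.2.2.2.2 ∧
      |((t.1.2 : ℝ) - t.2.1.2) - (t.2.2.1.2 - t.2.2.2.2)| *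
        ((t.1.2 - t.2.1.2) + (t.2.2.1.2 - t.2.2.2.2)) ≤ M with hP₃
  set P₄ : (ℤ × ℤ) × (ℤ × ℤ) × (ℤ × ℤ) × (ℤ × ℤ) → Prop := fun t =>
    t.1.1 ≠ t.2.2.1.1 ∧ t.1.2 - t.2.1.2 < 4 * (t.2.2.1.2 - t.2.2.2.2) ∧
      t.2.2.1.2 - t.2.2.2.2 < 4 * (t.1.2 - t.2.1.2) with hP₄
  have hsub : S ⊆ S.filter P₁ ∪ S.filter P₂ ∪ S.filter P₃ ∪ S.filter P₄ := by
    intro t ht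
    obtain ⟨h, a, b⟩ := hS t ht
    have := FourRel.classes (K := (K : ℤ)) (μ := (μ : ℤ)) (by exact_mod_cast hK) hY hy
      (by exact_mod_cast hy') h a b
    simp only [Finset.mem_union, Finset.mem_filter]
    have e : ∀ x : ℝ, (K : ℝ) * x ≤ 512 * (ε * (Y * √Y)) → x ≤ M := fun x hx => by
      rw [hMdef, le_div_iff₀ hK0]; linarith
    rcases this with h | h | h | h
    · exact Or.inl (Or.inl (Or.inl ⟨ht, e _ (by exact_mod_cast h.1), e _ (by exact_mod_cast h.2)⟩))
    · exact Or.inl (Or.inl (Or.inr ⟨ht, h⟩))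
    · exact Or.inl (Or.inr ⟨ht, h.1, h.2.1, e _ (by exact_mod_cast h.2.2)⟩)
    · exact Or.inr ⟨ht, h⟩
  have hc : (S.card : ℝ) ≤ (S.filter P₁).card + (S.filter P₂).card + (S.filter P₃).card +
      (S.filter P₄).card := by
    have h1 := Finset.card_le_card hsub
    have h2 := Finset.card_union_le (S.filter P₁ ∪ S.filter P₂ ∪ S.filter P₃) (S.filter P₄)
    have h3 := Finset.card_union_le (S.filter P₁ ∪ S.filter P₂) (S.filter P₃)
    have h4 := Finset.card_union_le (S.filter P₁) (S.filter P₂)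
    exact_mod_cast (by omega : S.card ≤ (S.filter P₁).card + (S.filter P₂).card +
      (S.filter P₃).card + (S.filter P₄).card)
  refine hc.trans (add_le_add (add_le_add (add_le_add ?_ ?_) ?_) ?_)
  · refine card_four_rel_small (y₀ := y₀) (ε := ε) hK hM _ fun t ht => ?_
    rw [Finset.mem_filter] at ht
    exact ⟨(hS t ht.1).1, (hS t ht.1).2.1, (hS t ht.1).2.2, ht.2⟩
  · refine card_four_rel_eq (y₀ := y₀) (ε := ε) hK _ fun t ht => ?_
    rw [Finset.mem_filter] at ht
    exact ⟨(hS t ht.1).1, (hS t ht.1).2.1, ht.2⟩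
  · refine card_four_rel_diag (y₀ := y₀) (ε := ε) hK hM _ fun t ht => ?_
    rw [Finset.mem_filter] at ht
    exact ⟨(hS t ht.1).1, (hS t ht.1).2.1, (hS t ht.1).2.2, ht.2⟩
  · refine card_four_rel_comparable hK hY hy hy' (by positivity) le_rfl hT hTμ hμT hKT _
      fun t ht => ?_
    rw [Finset.mem_filter] at ht
    exact ⟨(hS t ht.1).1, ht.2⟩

theorem FourRel.swap_left {K μ : ℤ} {y₀ ε : ℝ} {t : (ℤ × ℤ) × (ℤ × ℤ) × (ℤ × ℤ) × (ℤ × ℤ)}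
    (h : FourRel K μ y₀ ε t) : FourRel K μ y₀ ε (t.2.1, t.1, t.2.2) :=
  ⟨h.h₂, h.h₁, h.h₃, h.h₄, h.i₂, h.i₁, h.i₃, h.i₄, by have := h.add; dsimp only; linarith,
    by have := h.mul; dsimp only; linarith, by
      have := h.sqrt
      dsimp only
      rwa [add_comm ((t.2.1.1 : ℝ) * _)]⟩

theorem FourRel.swap_right {K μ : ℤ} {y₀ ε : ℝ} {t : (ℤ × ℤ) × (ℤ × ℤ) × (ℤ × ℤ) × (ℤ × ℤ)}
    (h : FourRel K μ y₀ ε t) : FourRel K μ y₀ ε (t.1, t.2.1, t.2.2.2, t.2.2.1) :=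
  ⟨h.h₁, h.h₂, h.h₄, h.h₃, h.i₁, h.i₂, h.i₄, h.i₃, by have := h.add; dsimp only; linarith,
    by have := h.mul; dsimp only; linarith, by
      have := h.sqrt
      dsimp only
      rwa [sub_right_comm]⟩

open Classical in
/-- Passing to oriented tuples costs a factor of four. -/
theorem card_four_rel_le_of_oriented {b : ℝ} 
    (hb : ∀ S : Finset ((ℤ × ℤ) × (ℤ × ℤ) × (ℤ × ℤ) × (ℤ × ℤ)),
      (∀ t ∈ S, FourRel K μ y₀ ε t ∧ t.2.1.2 ≤ t.1.2 ∧ t.2.2.2.2 ≤ t.2.2.1.2) → (S.card : ℝ) ≤ b)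
    (S : Finset ((ℤ × ℤ) × (ℤ × ℤ) × (ℤ × ℤ) × (ℤ × ℤ)))
    (hS : ∀ t ∈ S, FourRel K μ y₀ ε t) : (S.card : ℝ) ≤ 4 * b := by
  have half : ∀ S : Finset ((ℤ × ℤ) × (ℤ × ℤ) × (ℤ × ℤ) × (ℤ × ℤ)),
      (∀ t ∈ S, FourRel K μ y₀ ε t ∧ t.2.1.2 ≤ t.1.2) → (S.card : ℝ) ≤ 2 * b := by
    intro S hS
    have h1 := hb (S.filter fun t => t.2.2.2.2 ≤ t.2.2.1.2) (fun t ht => by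
      rw [Finset.mem_filter] at ht
      exact ⟨(hS t ht.1).1, (hS t ht.1).2, ht.2⟩)
    have h2 := hb ((S.filter fun t => ¬ t.2.2.2.2 ≤ t.2.2.1.2).image
      fun t => (t.1, t.2.1, t.2.2.2, t.2.2.1)) (fun t ht => by
        rw [Finset.mem_image] at ht
        obtain ⟨t', ht', rfl⟩ := ht
        rw [Finset.mem_filter] at ht'
        exact ⟨(hS t' ht'.1).1.swap_right, (hS t' ht'.1).2, (not_le.1 ht'.2).le⟩)
    rw [Finset.card_image_of_injective _ (fun t t' e => by
      simp only [Prod.mk.injEq] at e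
      exact Prod.ext e.1 (Prod.ext e.2.1 (Prod.ext e.2.2.2 e.2.2.1)))] at h2
    have h3 := Finset.card_filter_add_card_filter_not (s := S) (fun t => t.2.2.2.2 ≤ t.2.2.1.2)
    have h4 : (S.card : ℝ) = (S.filter fun t => t.2.2.2.2 ≤ t.2.2.1.2).card +
      (S.filter fun t => ¬ t.2.2.2.2 ≤ t.2.2.1.2).card := by exact_mod_cast h3.symm
    linarith
  have h1 := half (S.filter fun t => t.2.1.2 ≤ t.1.2) (fun t ht => by
    rw [Finset.mem_filter] at ht
    exact ⟨hS t ht.1, ht.2⟩)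
  have h2 := half ((S.filter fun t => ¬ t.2.1.2 ≤ t.1.2).image
    fun t => (t.2.1, t.1, t.2.2)) (fun t ht => by
      rw [Finset.mem_image] at ht
      obtain ⟨t', ht', rfl⟩ := ht
      rw [Finset.mem_filter] at ht'
      exact ⟨(hS t' ht'.1).swap_left, (not_le.1 ht'.2).le⟩)
  rw [Finset.card_image_of_injective _ (fun t t' e => by
    simp only [Prod.mk.injEq] at e
    exact Prod.ext e.2.1 (Prod.ext e.1 e.2.2))] at h2
  have h3 := Finset.card_filter_add_card_filter_not (s := S) (fun t => t.2.1.2 ≤ t.1.2)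
  have h4 : (S.card : ℝ) = (S.filter fun t => t.2.1.2 ≤ t.1.2).card +
    (S.filter fun t => ¬ t.2.1.2 ≤ t.1.2).card := by exact_mod_cast h3.symm
  linarith

set_option maxHeartbeats 1000000 in
/-- The first spacing estimate. -/
theorem first_spacing (hK : 1 ≤ K) (hKH : K ≤ H) (hHμ : 16 * H ^ 2 ≤ μ) (hY : 0 < Y) (hy : Y ≤ y₀)
    (hy' : y₀ + μ ≤ 4 * Y) (hε : 0 ≤ ε) (hA : 1 ≤ A) (hL : 1 ≤ L) (h1 : ε * (Y * √Y) ≤ A * μ)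
    (h2 : (ε * (Y * √Y)) ^ 3 ≤ A * (H ^ 3 * μ ^ 2))
    (h3 : ε * (Y * √Y) * Y ^ 2 ≤ L * (H * μ ^ 2 * √μ))
    (S : Finset ((ℤ × ℤ) × (ℤ × ℤ) × (ℤ × ℤ) × (ℤ × ℤ)))
    (hS : ∀ t ∈ S, FourRel K μ y₀ ε t) :
    (S.card : ℝ) ≤ 2 ^ 42 * A * (√(K / H) * (H ^ 2 * μ ^ 2 * L)) := by
  set T := Nat.sqrt μ with hTdef
  have hH : 1 ≤ H := hK.trans hKH
  have hHT : 4 * H ≤ T := Nat.le_sqrt.2 (by nlinarith)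
  have hTμ : T ^ 2 ≤ μ := Nat.sqrt_le' μ
  have hμT : μ ≤ 4 * T ^ 2 := by
    have := Nat.succ_le_succ_sqrt' μ
    nlinarith
  have hS4 := card_four_rel_le_of_oriented (fun S => card_four_rel_oriented hK hY hy hy' hε
    (by omega) hTμ hμT (by omega) S) S hS
  have hK0 : (0 : ℝ) < K := by exact_mod_cast hK
  have hH0 : (0 : ℝ) < H := by exact_mod_cast hH
  have hT0 : (0 : ℝ) < T := by exact_mod_cast (by omega : 0 < T)
  have hμ0 : (1 : ℝ) ≤ μ := by exact_mod_cast (by nlinarith : 1 ≤ μ)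
  set Θ := ε * (Y * √Y) with hΘ
  have hΘ0 : 0 ≤ Θ := by positivity
  set s := √((K : ℝ) / H) with hs
  have hs0 : 0 < s := Real.sqrt_pos.2 (by positivity)
  have hs1 : s ≤ 1 := by
    rw [hs, Real.sqrt_le_one, div_le_one hH0]
    exact_mod_cast hKH
  have hKs : (K : ℝ) = s ^ 2 * H := by
    rw [hs, Real.sq_sqrt (by positivity), div_mul_cancel₀ _ hH0.ne']
  have hs4 : s ^ 4 ≤ s := by
    have : s ^ 3 ≤ 1 := pow_le_one₀ hs0.le hs1
    nlinarith
  set Z := s * ((H : ℝ) ^ 2 * μ ^ 2 * L) with hZ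
  have hK2 : (K : ℝ) ^ 2 * μ ^ 2 ≤ Z := by
    rw [hKs, hZ]
    calc (s ^ 2 * H) ^ 2 * (μ : ℝ) ^ 2 = s ^ 4 * (H ^ 2 * μ ^ 2 * 1) := by ring
      _ ≤ _ := by gcongr
  have hZ0 : 0 ≤ Z := by positivity
  have a1 : 2 * (K : ℝ) ^ 3 * μ * (512 * Θ / K + 1) ≤ 1026 * A * Z := by
    have e1 : (K : ℝ) ≤ μ := by exact_mod_cast (by nlinarith : K ≤ μ)
    calc 2 * (K : ℝ) ^ 3 * μ * (512 * Θ / K + 1) = 1024 * (K ^ 2 * μ * Θ) + 2 * (K ^ 2 * μ * K) := by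
          field_simp; ring
      _ ≤ 1024 * (K ^ 2 * μ * (A * μ)) + 2 * (K ^ 2 * μ * μ) := by gcongr
      _ = 1024 * A * (K ^ 2 * μ ^ 2) + 2 * (K ^ 2 * μ ^ 2) := by ring
      _ ≤ 1024 * A * Z + 2 * A * Z := by
        have : Z ≤ A * Z := by nlinarith
        have := mul_le_mul_of_nonneg_left hK2 (by positivity : 0 ≤ 1024 * A)
        linarith
      _ = _ := by ring
  have a2 : 3 * (K : ℝ) ^ 2 * μ * (512 * Θ / K * √(512 * Θ / K)) ≤ 3 * 2 ^ 14 * A * Z := by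
    have hM0 : 0 ≤ 512 * Θ / K := by positivity
    have e1 : 512 * Θ / K * √(512 * Θ / K) ≤ 2 ^ 14 * A * μ / s ^ 3 := by
      rw [le_div_iff₀ (by positivity)]
      refine mul_sqrt_mul_le hM0 (by positivity) ?_
      have e3 : (512 * Θ / K) ^ 3 * s ^ 6 = 512 ^ 3 * (Θ ^ 3 / H ^ 3) := by
        rw [hKs]; field_simp
      have e4 : Θ ^ 3 / H ^ 3 ≤ A * μ ^ 2 := by
        rw [div_le_iff₀ (by positivity)]; linarith
      have e5 : A * (μ : ℝ) ^ 2 ≤ A * A * μ ^ 2 := by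
        gcongr; exact le_mul_of_one_le_left (by linarith) hA
      rw [e3]
      nlinarith
    calc 3 * (K : ℝ) ^ 2 * μ * (512 * Θ / K * √(512 * Θ / K))
        ≤ 3 * (K : ℝ) ^ 2 * μ * (2 ^ 14 * A * μ / s ^ 3) := by gcongr
      _ = 3 * 2 ^ 14 * A * (s * (H ^ 2 * μ ^ 2 * 1)) := by rw [hKs]; field_simp
      _ ≤ _ := by rw [hZ]; gcongr
  have a3 : 2 ^ 20 * K * fourthRoot K * fourthRoot T * fourthRoot (2 ^ 22 * (Θ * Y ^ 2)) ^ 3 ≤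
      2 ^ 38 * Z := by
    have hB0 : 0 ≤ 2 ^ 22 * (Θ * Y ^ 2) := by positivity
    have hfK := fourthRoot_nonneg K
    have hfT := fourthRoot_nonneg T
    have hfB := fourthRoot_nonneg (2 ^ 22 * (Θ * Y ^ 2))
    have hsμ : √(μ : ℝ) ≤ 2 * T := by
      rw [Real.sqrt_le_iff]
      exact ⟨by positivity, by rw [mul_pow]; exact_mod_cast (by linarith : μ ≤ 2 ^ 2 * T ^ 2)⟩
    have hB1 : 2 ^ 22 * (Θ * Y ^ 2) ≤ 2 ^ 23 * (L * H * μ ^ 2 * T) := by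
      have e1 : L * (H * μ ^ 2 * √μ) ≤ L * (H * μ ^ 2 * (2 * T)) := by gcongr
      linarith
    have hT4 : (T : ℝ) ^ 4 ≤ μ ^ 2 := by
      have : (T : ℝ) ^ 2 ≤ μ := by exact_mod_cast hTμ
      calc (T : ℝ) ^ 4 = (T ^ 2) ^ 2 := by ring
        _ ≤ _ := by gcongr
    have key := mul_fourthRoot_le hH0.le hT0.le (by positivity) hL hs0.le hs1 hKs hT4 hB0
      (γ := 2 ^ 18) (by positivity) (by norm_num) hB1
    linarith
  have hAZ : Z ≤ A * Z := by nlinarith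
  have hAZ0 : 0 ≤ A * Z := by positivity
  have a4 : 272 * (μ : ℝ) ^ 2 * K ^ 2 ≤ 272 * (A * Z) := by linarith
  refine (hS4.trans (mul_le_mul_of_nonneg_left (add_le_add (add_le_add (add_le_add a1
    (hK2.trans hAZ)) a2) (add_le_add a4 a3)) (by norm_num))).trans ?_
  linarith

end

/-- The difference between the square root and its linear approximation at `y`. -/
def sqrtBend (y j : ℝ) : ℝ := √(y + j) - √y - j / (2 * √y)

theorem sqrtBend_eq {y j : ℝ} (hy : 0 < y) (hj : 0 ≤ j) :
    sqrtBend y j = -(j ^ 2 / (2 * √y * (√(y + j) + √y) ^ 2)) := by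
  have h1 : 0 < √y := Real.sqrt_pos.2 hy
  have h2 : 0 < √(y + j) := Real.sqrt_pos.2 (by linarith)
  have e : j = √(y + j) ^ 2 - √y ^ 2 := by
    rw [Real.sq_sqrt (by linarith), Real.sq_sqrt hy.le]; ring
  have h3 : √(y + j) + √y ≠ 0 := by positivity
  rw [sqrtBend]
  set a := √(y + j)
  set b := √y
  rw [e]
  field_simp
  ring

theorem le_two_mul_sqrt_mul {Y y j : ℝ} (hY : 0 < Y) (hy : Y ≤ y) (hj : 0 ≤ j) :
    8 * (Y * √Y) ≤ 2 * √y * (√(y + j) + √y) ^ 2 := by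
  have h0 := Real.sqrt_nonneg Y
  have h1 : √Y ≤ √y := Real.sqrt_le_sqrt hy
  have h2 : √Y ≤ √(y + j) := Real.sqrt_le_sqrt (by linarith)
  calc 8 * (Y * √Y) = 2 * √Y * (√Y + √Y) ^ 2 := by
        have := Real.sq_sqrt hY.le
        linear_combination (-8 * √Y) * this
    _ ≤ _ := by gcongr

theorem abs_sqrtBend_le {Y y j : ℝ} (hY : 0 < Y) (hy : Y ≤ y) (hj : 0 ≤ j) :
    |sqrtBend y j| ≤ j ^ 2 / (8 * (Y * √Y)) := by
  have h0 : 0 < √Y := Real.sqrt_pos.2 hY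
  rw [sqrtBend_eq (hY.trans_le hy) hj, abs_neg, abs_of_nonneg (by positivity)]
  exact div_le_div_of_nonneg_left (by positivity) (by positivity) (le_two_mul_sqrt_mul hY hy hj)

theorem abs_sqrtBend_sub_le {Y y y' j : ℝ} (hY : 0 < Y) (hy : Y ≤ y) (hy' : Y ≤ y') (hj : 0 ≤ j) :
    |sqrtBend y j - sqrtBend y' j| ≤ |y - y'| * j ^ 2 / (4 * (Y ^ 2 * √Y)) := by
  wlog h : y ≤ y' generalizing y y'
  · rw [abs_sub_comm, abs_sub_comm y]
    exact this hy' hy (not_le.1 h).le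
  have h0 : 0 < √Y := Real.sqrt_pos.2 hY
  have y0 : 0 < y := hY.trans_le hy
  have y0' : 0 < y' := hY.trans_le hy'
  have hb : 0 < √y := Real.sqrt_pos.2 y0
  have hb' : 0 < √y' := Real.sqrt_pos.2 y0'
  rw [sqrtBend_eq y0 hj, sqrtBend_eq y0' hj]
  have hg := le_two_mul_sqrt_mul hY hy hj
  set g := 2 * √y * (√(y + j) + √y) ^ 2 with hgdef
  set g' := 2 * √y' * (√(y' + j) + √y') ^ 2 with hg'def
  have hg0 : 0 < g := by positivity
  have hg0' : 0 < g' := by positivity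
  have hgg : g ≤ g' := by
    rw [hgdef, hg'def]
    gcongr
  set s := y' / y with hs
  have hs1 : 1 ≤ s := (one_le_div y0).2 h
  have hss : 1 ≤ √s := Real.one_le_sqrt.2 hs1
  have hsy : y' = s * y := by rw [hs, div_mul_cancel₀ _ y0.ne']
  have hg's : g' ≤ s ^ 2 * g := by
    have e1 : √y' = √s * √y := by rw [hsy, Real.sqrt_mul (by linarith)]
    have e2 : √(y' + j) ≤ √s * √(y + j) := by
      rw [← Real.sqrt_mul (by linarith)]
      exact Real.sqrt_le_sqrt (by rw [hsy]; nlinarith)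
    have e3 : √s ^ 2 = s := Real.sq_sqrt (by linarith)
    have e4 : √s ≤ s := by nlinarith
    calc g' ≤ 2 * (√s * √y) * (√s * √(y + j) + √s * √y) ^ 2 := by
          rw [hg'def, e1]
          gcongr
      _ = √s * √s ^ 2 * g := by rw [hgdef]; ring
      _ ≤ s * s * g := by rw [e3]; gcongr
      _ = _ := by ring
  rw [show -(j ^ 2 / g) - -(j ^ 2 / g') = -(j ^ 2 / g - j ^ 2 / g') by ring, abs_neg,
    abs_of_nonneg (sub_nonneg.2 (div_le_div_of_nonneg_left (by positivity) hg0 hgg)),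
    abs_sub_comm y, abs_of_nonneg (sub_nonneg.2 h)]
  have h1 : (1 : ℝ) / g - 1 / g' ≤ 2 * (s - 1) / g := by
    have : 1 / (s ^ 2 * g) ≤ 1 / g' := div_le_div_of_nonneg_left (by norm_num) hg0' hg's
    have h2 : 1 - 2 * (s - 1) ≤ 1 / s ^ 2 := by
      rw [le_div_iff₀ (by positivity)]
      nlinarith [mul_nonneg (sq_nonneg (s - 1)) (by linarith : 0 ≤ 2 * s + 1)]
    have h3 : (1 - 2 * (s - 1)) / g ≤ 1 / (s ^ 2 * g) := by
      rw [← div_div 1 (s ^ 2) g]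
      exact div_le_div_of_nonneg_right h2 hg0.le
    rw [sub_div] at h3
    linarith
  have hs1' : s - 1 ≤ (y' - y) / Y := by
    rw [hs, div_sub_one y0.ne']
    gcongr
  calc j ^ 2 / g - j ^ 2 / g' = j ^ 2 * (1 / g - 1 / g') := by ring
    _ ≤ j ^ 2 * (2 * ((y' - y) / Y) / (8 * (Y * √Y))) := by
      gcongr
      refine h1.trans ?_
      have : 0 ≤ (y' - y) / Y := div_nonneg (by linarith) hY.le
      gcongr
    _ = _ := by field_simp; ring

theorem sum_comp_pow_four_le {ι κ : Type*} [DecidableEq κ] (W : Finset ι) (D : Finset κ) (c : ι → κ)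
    (hc : ∀ i ∈ W, c i ∈ D) (z : κ → ℝ) :
    (∑ i ∈ W, z (c i)) ^ 4 ≤ (W.card : ℝ) ^ 2 *
      ((W ×ˢ W).filter fun q => c q.1 = c q.2).card * ∑ d ∈ D, z d ^ 4 := by
  set n : κ → ℝ := fun d => ((W.filter fun i => c i = d).card : ℝ) with hn
  have h1 : (∑ i ∈ W, z (c i)) ^ 2 ≤ W.card * ∑ i ∈ W, z (c i) ^ 2 := sq_sum_le_card_mul_sum_sq
  have h2 : ∑ i ∈ W, z (c i) ^ 2 = ∑ d ∈ D, n d * z d ^ 2 := by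
    rw [← Finset.sum_fiberwise_of_maps_to hc]
    refine Finset.sum_congr rfl fun d _ => ?_
    rw [hn, ← nsmul_eq_mul, ← Finset.sum_const]
    exact Finset.sum_congr rfl fun i hi => by rw [(Finset.mem_filter.1 hi).2]
  have h3 : (∑ d ∈ D, n d * z d ^ 2) ^ 2 ≤ (∑ d ∈ D, n d ^ 2) * ∑ d ∈ D, (z d ^ 2) ^ 2 :=
    Finset.sum_mul_sq_le_sq_mul_sq _ _ _
  have h4 : ∑ d ∈ D, n d ^ 2 = ((W ×ˢ W).filter fun q => c q.1 = c q.2).card := by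
    have : ∀ q ∈ (W ×ˢ W).filter (fun q => c q.1 = c q.2), c q.1 ∈ D := fun q hq =>
      hc _ (Finset.mem_product.1 (Finset.mem_filter.1 hq).1).1
    rw [Finset.card_eq_sum_card_fiberwise this, Nat.cast_sum]
    refine Finset.sum_congr rfl fun d _ => ?_
    have : ((W ×ˢ W).filter (fun q => c q.1 = c q.2)).filter (fun q => c q.1 = d) =
        (W.filter fun i => c i = d) ×ˢ (W.filter fun i => c i = d) := by
      ext q
      simp only [Finset.mem_filter, Finset.mem_product]
      constructor
      · rintro ⟨⟨⟨a, b⟩, e⟩, f⟩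
        exact ⟨⟨a, f⟩, b, e ▸ f⟩
      · rintro ⟨⟨a, e⟩, b, f⟩
        exact ⟨⟨⟨a, b⟩, e.trans f.symm⟩, e⟩
    rw [this, Finset.card_product, hn]
    push_cast
    ring
  calc (∑ i ∈ W, z (c i)) ^ 4 = ((∑ i ∈ W, z (c i)) ^ 2) ^ 2 := by ring
    _ ≤ (W.card * ∑ i ∈ W, z (c i) ^ 2) ^ 2 := by gcongr
    _ = (W.card : ℝ) ^ 2 * (∑ d ∈ D, n d * z d ^ 2) ^ 2 := by rw [h2]; ring
    _ ≤ (W.card : ℝ) ^ 2 * ((∑ d ∈ D, n d ^ 2) * ∑ d ∈ D, (z d ^ 2) ^ 2) := by gcongr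
    _ = _ := by
      rw [h4, ← mul_assoc]
      congr 1
      exact Finset.sum_congr rfl fun d _ => by ring

theorem fourRel_of_coincidence {K μ : ℕ} {y ε η : ℝ} {N₃ : ℕ} (hy : 0 < y) (hη : 0 < η)
    (hN : 1 ≤ N₃) (hε : 1 ≤ ε * (η * N₃))
    {q : ((ℕ × ℕ) × (ℕ × ℕ)) × ((ℕ × ℕ) × (ℕ × ℕ))}
    (hq : q ∈ (((Finset.Ico K (2 * K) ×ˢ Finset.range μ) ×ˢ (Finset.Ico K (2 * K) ×ˢ Finset.range μ)) ×ˢ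
      ((Finset.Ico K (2 * K) ×ˢ Finset.range μ) ×ˢ (Finset.Ico K (2 * K) ×ˢ Finset.range μ))))
    (e₁ : q.1.1.1 + q.1.2.1 = q.2.1.1 + q.2.2.1)
    (e₂ : q.1.1.1 * q.1.1.2 + q.1.2.1 * q.1.2.2 = q.2.1.1 * q.2.1.2 + q.2.2.1 * q.2.2.2)
    (e₃ : |η * (q.1.1.1 * sqrtBend y q.1.1.2 + q.1.2.1 * sqrtBend y q.1.2.2) -
      η * (q.2.1.1 * sqrtBend y q.2.1.2 + q.2.2.1 * sqrtBend y q.2.2.2)| * N₃ ≤ 1) :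
    FourRel K μ y ε (((q.1.1.1 : ℤ), (q.1.1.2 : ℤ)), ((q.1.2.1 : ℤ), (q.1.2.2 : ℤ)),
      ((q.2.1.1 : ℤ), (q.2.1.2 : ℤ)), ((q.2.2.1 : ℤ), (q.2.2.2 : ℤ))) := by
  obtain ⟨⟨⟨h₁, i₁⟩, ⟨h₂, i₂⟩⟩, ⟨⟨h₃, i₃⟩, ⟨h₄, i₄⟩⟩⟩ := q
  simp only [Finset.mem_product, Finset.mem_Ico, Finset.mem_range] at hq e₁ e₂ e₃
  refine ⟨by dsimp only; omega, by dsimp only; omega, by dsimp only; omega, by dsimp only; omega,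
    by dsimp only; omega, by dsimp only; omega, by dsimp only; omega, by dsimp only; omega,
    by dsimp only; exact_mod_cast e₁, by dsimp only; exact_mod_cast e₂, ?_⟩
  simp only [Int.cast_natCast]
  have e₁' : (h₁ : ℝ) + h₂ = h₃ + h₄ := by exact_mod_cast e₁
  have e₂' : (h₁ : ℝ) * i₁ + h₂ * i₂ = h₃ * i₃ + h₄ * i₄ := by exact_mod_cast e₂
  have hy0 : √y ≠ 0 := (Real.sqrt_pos.2 hy).ne'
  have hN0 : (0 : ℝ) < N₃ := by exact_mod_cast hN
  have e : η * (h₁ * sqrtBend y i₁ + h₂ * sqrtBend y i₂) -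
      η * (h₃ * sqrtBend y i₃ + h₄ * sqrtBend y i₄) =
      η * (h₁ * √(y + i₁) + h₂ * √(y + i₂) - h₃ * √(y + i₃) - h₄ * √(y + i₄)) := by
    simp only [sqrtBend]
    linear_combination (-η * √y) * e₁' - η / (2 * √y) * e₂'
  rw [e, abs_mul, abs_of_pos hη] at e₃
  by_contra hcon
  rw [not_le] at hcon
  have := mul_lt_mul_of_pos_right hcon (mul_pos hη hN0)
  linarith

theorem mean_fourth_power_le : ∃ C : ℝ, 0 < C ∧ ∀ (K H μ N₃ : ℕ) (y Y A₀ κ L : ℝ), 1 ≤ K →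
    2 * K ≤ H → 16 * H ^ 2 ≤ μ → 1 ≤ N₃ → μ ≤ Y → Y ≤ y → y ≤ Y + 1 → 1 ≤ κ → 1 ≤ L →
    80 * H * (μ : ℝ) ≤ κ * N₃ → (80 * H * (μ : ℝ) ^ 2 / N₃) ^ 3 ≤ κ * (H ^ 3 * μ ^ 2) →
    80 * H * (μ : ℝ) ^ 2 / N₃ * Y ^ 2 ≤ L * (H * μ ^ 2 * √μ) →
    ∑ a ∈ Finset.range (80 * H), ∑ b ∈ Finset.range (80 * H * μ), ∑ k ∈ Finset.range N₃,
      ‖∑ h ∈ Finset.Ico K (2 * K), ((1 - h / H : ℝ) : ℂ) * ∑ j ∈ Finset.range μ,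
        ec (h * ((a : ℝ) / (80 * H : ℕ) + (b : ℝ) / (80 * H * μ : ℕ) * j +
          (A₀ + Y * √Y / (80 * H * μ ^ 2) * k) * sqrtBend y j))‖ ^ 4 ≤
      C * (κ * √(K / H) * (H ^ 4 * μ ^ 3 * N₃ * L)) := by
  obtain ⟨C, hC, hms⟩ := mean_square_grid_le
  refine ⟨C * (80 * 80 * 2 ^ 42), by positivity, ?_⟩
  intro K H μ N₃ y Y A₀ κ L hK hKH hHμ hN₃ hμY hy hy1 hκ hL c₁ c₂ c₃
  have hH : 1 ≤ H := by omega
  have hμ : 1 ≤ μ := by nlinarith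
  have hH0 : (0 : ℝ) < H := by exact_mod_cast hH
  have hμ0 : (1 : ℝ) ≤ μ := by exact_mod_cast hμ
  have hN0 : (0 : ℝ) < N₃ := by exact_mod_cast hN₃
  have hY : 0 < Y := by linarith
  have hy0 : 0 < y := by linarith
  have hsY : 0 < √Y := Real.sqrt_pos.2 hY
  set η := Y * √Y / (80 * H * (μ : ℝ) ^ 2) with hη
  have hη0 : 0 < η := by positivity
  set D := Finset.Ico K (2 * K) ×ˢ Finset.range μ with hD
  set f : (ℕ × ℕ) → ℂ := fun n => ((1 - n.1 / H : ℝ) : ℂ) * ec (A₀ * (n.1 * sqrtBend y n.2)) with hf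
  have hf1 : ∀ n ∈ D, ‖f n‖ ≤ 1 := by
    intro n hn
    simp only [hD, Finset.mem_product, Finset.mem_Ico] at hn
    rw [hf, norm_mul, norm_ec, mul_one, Complex.norm_real, Real.norm_eq_abs]
    have h1 : (n.1 : ℝ) / H ≤ 1 := by
      rw [div_le_one hH0]
      exact_mod_cast (by omega : n.1 ≤ H)
    have h2 : (0 : ℝ) ≤ n.1 / H := by positivity
    rw [abs_of_nonneg (by linarith)]
    linarith
  have e1 : ∀ a b k : ℕ, ‖∑ h ∈ Finset.Ico K (2 * K), ((1 - h / H : ℝ) : ℂ) *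
      ∑ j ∈ Finset.range μ, ec (h * ((a : ℝ) / (80 * H : ℕ) + (b : ℝ) / (80 * H * μ : ℕ) * j +
          (A₀ + η * k) * sqrtBend y j))‖ ^ 4 =
      ‖∑ q ∈ D ×ˢ D, f q.1 * f q.2 * ec (((q.1.1 + q.2.1 : ℕ) : ℝ) * a / (80 * H : ℕ) +
        ((q.1.1 * q.1.2 + q.2.1 * q.2.2 : ℕ) : ℝ) * b / (80 * H * μ : ℕ) +
        η * (q.1.1 * sqrtBend y q.1.2 + q.2.1 * sqrtBend y q.2.2) * k)‖ ^ 2 := by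
    intro a b k
    have e2 : ∑ h ∈ Finset.Ico K (2 * K), ((1 - h / H : ℝ) : ℂ) *
      ∑ j ∈ Finset.range μ, ec (h * ((a : ℝ) / (80 * H : ℕ) + (b : ℝ) / (80 * H * μ : ℕ) * j +
          (A₀ + η * k) * sqrtBend y j)) = ∑ n ∈ D, f n * ec ((n.1 : ℝ) * a / (80 * H : ℕ) +
          ((n.1 : ℝ) * n.2) * b / (80 * H * μ : ℕ) + η * (n.1 * sqrtBend y n.2) * k) := by
      rw [hD, Finset.sum_product]
      refine Finset.sum_congr rfl fun h _ => ?_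
      rw [Finset.mul_sum]
      refine Finset.sum_congr rfl fun j _ => ?_
      rw [hf]
      dsimp only
      rw [mul_assoc ((1 - (h : ℝ) / H : ℝ) : ℂ), ← ec_add]
      congr 2
      ring
    rw [e2, show (4 : ℕ) = 2 * 2 by norm_num, pow_mul, ← norm_pow, sq (∑ n ∈ D, _),
      Finset.sum_mul_sum, ← Finset.sum_product']
    congr 2
    refine Finset.sum_congr rfl fun q _ => ?_
    rw [mul_mul_mul_comm, ← ec_add]
    congr 2
    push_cast
    ring
  simp only [e1]
  have hbend : ∀ n ∈ D, |η * (n.1 * sqrtBend y n.2)| ≤ 1 / 320 := by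
    intro n hn
    simp only [hD, Finset.mem_product, Finset.mem_Ico, Finset.mem_range] at hn
    have h1 : (n.1 : ℝ) ≤ H := by exact_mod_cast (by omega : n.1 ≤ H)
    have h2 : (n.2 : ℝ) ≤ μ := by exact_mod_cast hn.2.le
    have h3 := abs_sqrtBend_le (j := n.2) hY hy (by positivity)
    rw [abs_mul, abs_mul, abs_of_pos hη0, Nat.abs_cast]
    calc η * (n.1 * |sqrtBend y n.2|) ≤ η * (H * ((μ : ℝ) ^ 2 / (8 * (Y * √Y)))) := by
          gcongr
          exact h3.trans (by gcongr)
      _ = 1 / 640 := by rw [hη]; field_simp; norm_num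
      _ ≤ _ := by norm_num
  refine (hms (D ×ˢ D) (fun q => f q.1 * f q.2) (fun q => q.1.1 + q.2.1)
    (fun q => q.1.1 * q.1.2 + q.2.1 * q.2.2)
    (fun q => η * (q.1.1 * sqrtBend y q.1.2 + q.2.1 * sqrtBend y q.2.2)) (80 * H) (80 * H * μ) N₃
    (by omega) (by nlinarith) hN₃ ?_ ?_ ?_ ?_).trans ?_
  · intro q hq
    rw [Finset.mem_product] at hq
    rw [norm_mul]
    exact mul_le_one₀ (hf1 _ hq.1) (norm_nonneg _) (hf1 _ hq.2)
  · intro q hq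
    simp only [hD, Finset.mem_product, Finset.mem_Ico] at hq
    omega
  · intro q hq
    simp only [hD, Finset.mem_product, Finset.mem_Ico, Finset.mem_range] at hq
    have h1 : q.1.1 * q.1.2 ≤ H * μ := Nat.mul_le_mul (by omega) (by omega)
    have h2 : q.2.1 * q.2.2 ≤ H * μ := Nat.mul_le_mul (by omega) (by omega)
    have h3 : 0 < H * μ := by positivity
    rw [mul_assoc]
    omega
  · intro q hq q' hq'
    rw [Finset.mem_product] at hq hq'
    have h1 := hbend _ hq.1
    have h2 := hbend _ hq.2
    have h3 := hbend _ hq'.1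
    have h4 := hbend _ hq'.2
    rw [abs_le] at *
    constructor <;> linarith
  · set ε := 1 / (η * N₃) with hε
    have hΘ : ε * (Y * √Y) = 80 * H * (μ : ℝ) ^ 2 / N₃ := by
      rw [hε, hη]; field_simp
    set S := ((D ×ˢ D) ×ˢ (D ×ˢ D)).filter fun q => q.1.1.1 + q.1.2.1 = q.2.1.1 + q.2.2.1 ∧
      q.1.1.1 * q.1.1.2 + q.1.2.1 * q.1.2.2 = q.2.1.1 * q.2.1.2 + q.2.2.1 * q.2.2.2 ∧
      |η * (q.1.1.1 * sqrtBend y q.1.1.2 + q.1.2.1 * sqrtBend y q.1.2.2) -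
        η * (q.2.1.1 * sqrtBend y q.2.1.2 + q.2.2.1 * sqrtBend y q.2.2.2)| * N₃ ≤ 1 with hS
    set g : ((ℕ × ℕ) × (ℕ × ℕ)) × ((ℕ × ℕ) × (ℕ × ℕ)) → (ℤ × ℤ) × (ℤ × ℤ) × (ℤ × ℤ) × (ℤ × ℤ) :=
      fun q => (((q.1.1.1 : ℤ), (q.1.1.2 : ℤ)), ((q.1.2.1 : ℤ), (q.1.2.2 : ℤ)),
      ((q.2.1.1 : ℤ), (q.2.1.2 : ℤ)), ((q.2.2.1 : ℤ), (q.2.2.2 : ℤ))) with hg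
    have hginj : Function.Injective g := by
      intro q q' e
      simp only [hg, Prod.mk.injEq, Nat.cast_inj] at e
      simp only [Prod.ext_iff]
      tauto
    have hfs := first_spacing (K := K) (H := H) (μ := μ) (y₀ := y) (ε := ε) (Y := Y) (A := κ)
      (L := L) hK (by omega) hHμ hY hy (by linarith) (by positivity) hκ hL
      (by rw [hΘ, div_le_iff₀ hN0]; nlinarith) (by rw [hΘ]; exact c₂) (by rw [hΘ]; exact c₃)
      (S.image g) (fun t ht => by
        obtain ⟨q, hq, rfl⟩ := Finset.mem_image.1 ht
        rw [hS, Finset.mem_filter] at hq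
        exact fourRel_of_coincidence hy0 hη0 hN₃ (by rw [hε]; field_simp; rfl) hq.1 hq.2.1 hq.2.2.1
          hq.2.2.2)
    rw [Finset.card_image_of_injective _ hginj] at hfs
    calc C * (80 * H : ℕ) * (80 * H * μ : ℕ) * N₃ * (S.card : ℝ)
        ≤ C * (80 * H : ℕ) * (80 * H * μ : ℕ) * N₃ *
          (2 ^ 42 * κ * (√(K / H) * (H ^ 2 * μ ^ 2 * L))) := by gcongr
      _ = _ := by push_cast; ring

theorem sum_Ico_two_pow {M : Type*} [AddCommMonoid M] (f : ℕ → M) (J : ℕ) :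
    ∑ k ∈ Finset.Ico 1 (2 ^ J), f k =
      ∑ a ∈ Finset.range J, ∑ k ∈ Finset.Ico (2 ^ a) (2 * 2 ^ a), f k := by
  induction J with
  | zero => simp
  | succ J ih =>
    rw [Finset.sum_range_succ, ← ih, pow_succ, mul_comm (2 ^ J) 2,
      Finset.sum_Ico_consecutive f Nat.one_le_two_pow (by omega)]

theorem sum_fourthRoot_sqrt_le (J : ℕ) :
    ∑ a ∈ Finset.range J, fourthRoot √((2 : ℝ) ^ a / 2 ^ J) ≤ 16 := by
  set β := fourthRoot √2 with hβ
  have hβ0 : 0 ≤ β := fourthRoot_nonneg _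
  have hβ8 : β ^ 8 = 2 := by
    rw [show (8 : ℕ) = 4 * 2 by norm_num, pow_mul, hβ, fourthRoot_pow (Real.sqrt_nonneg _),
      Real.sq_sqrt (by norm_num)]
  have hβ1 : 17 / 16 ≤ β := by
    refine le_of_pow_le_pow_left₀ (n := 8) (by norm_num) hβ0 ?_
    rw [hβ8]; norm_num
  have e : ∀ a, fourthRoot √((2 : ℝ) ^ a / 2 ^ J) = β ^ a / β ^ J := by
    intro a
    have e1 : ((2 : ℝ) ^ a / 2 ^ J) = ((β ^ a / β ^ J) ^ 4) ^ 2 := by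
      rw [← hβ8]; ring
    have : 0 ≤ β ^ a / β ^ J := by positivity
    rw [e1, Real.sqrt_sq (by positivity), fourthRoot_pow_four this]
  simp only [e]
  rw [← Finset.sum_div, div_le_iff₀ (by positivity), geom_sum_eq (by linarith),
    div_le_iff₀ (by linarith)]
  have : 0 < β ^ J := by positivity
  nlinarith

section
variable {x ν A y A₀ D Y : ℝ} {H μ N₃ N₄ : ℕ}

theorem near_int_of_round (hH : 1 ≤ H) (hμ : 1 ≤ μ) (hN₄ : 1 ≤ N₄) (hY : 0 < Y) (hA₀ : 0 ≤ A₀)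
    (hA : A₀ ≤ A) (hA' : A ≤ A₀ + D) (hy : Y ≤ y)
    (h₄ : 20 * H * (A₀ + D) * (μ : ℝ) ^ 2 ≤ N₄ * (Y ^ 2 * √Y)) {j : ℕ} (hj : j < μ)
    (h : ∃ n : ℤ, |x + ν * j + A * sqrtBend y j - n| * (40 * H) ≤ 1) :
    ∃ n : ℤ, |(((⌊Int.fract x * ((80 * H : ℕ) : ℝ)⌋₊ : ℕ) : ℝ) / ((80 * H : ℕ) : ℝ) +
      ((⌊Int.fract ν * ((80 * H * μ : ℕ) : ℝ)⌋₊ : ℕ) : ℝ) / ((80 * H * μ : ℕ) : ℝ) * j +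
      (A₀ + Y * √Y / (80 * H * (μ : ℝ) ^ 2) *
        ((⌊(A - A₀) / (Y * √Y / (80 * H * (μ : ℝ) ^ 2))⌋₊ : ℕ) : ℝ)) *
        sqrtBend (Y + ((⌊(y - Y) * (N₄ : ℝ)⌋₊ : ℕ) : ℝ) / N₄) j - n : ℝ)| * (8 * H) ≤ 1 := by
  obtain ⟨n, hn⟩ := h
  refine ⟨n - ⌊x⌋ - ⌊ν⌋ * j, ?_⟩
  have hH0 : (0 : ℝ) < H := by exact_mod_cast hH
  have hμ0 : (0 : ℝ) < μ := by exact_mod_cast hμ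
  have hN0 : (0 : ℝ) < N₄ := by exact_mod_cast hN₄
  have hsY : 0 < √Y := Real.sqrt_pos.2 hY
  have hjμ : (j : ℝ) ≤ μ := by exact_mod_cast hj.le
  have hfl : ∀ (z : ℝ) (c : ℝ), 0 ≤ z → 0 < c → |z - ((⌊z * c⌋₊ : ℕ) : ℝ) / c| ≤ 1 / c ∧
      ((⌊z * c⌋₊ : ℕ) : ℝ) / c ≤ z := by
    intro z c hz hc
    have h1 := Nat.floor_le (by positivity : 0 ≤ z * c)
    have h2 := Nat.lt_floor_add_one (z * c)
    have h3 : ((⌊z * c⌋₊ : ℕ) : ℝ) / c ≤ z := (div_le_iff₀ hc).2 h1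
    rw [abs_of_nonneg (by linarith)]
    refine ⟨?_, h3⟩
    rw [sub_le_iff_le_add, ← add_div, le_div_iff₀ hc]
    linarith
  set η := Y * √Y / (80 * H * (μ : ℝ) ^ 2) with hη
  have hη0 : 0 < η := by positivity
  have q1 := (hfl (Int.fract x) ((80 * H : ℕ) : ℝ) (Int.fract_nonneg x) (by push_cast; positivity)).1
  have q2 := (hfl (Int.fract ν) ((80 * H * μ : ℕ) : ℝ) (Int.fract_nonneg ν) (by push_cast; positivity)).1
  have q3 := hfl (A - A₀) (1 / η) (by linarith) (by positivity)
  have q4 := hfl (y - Y) N₄ (by linarith) hN0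
  rw [mul_one_div, one_div_one_div, div_div_eq_mul_div, div_one, mul_comm _ η] at q3
  set a := ((⌊Int.fract x * ((80 * H : ℕ) : ℝ)⌋₊ : ℕ) : ℝ) / ((80 * H : ℕ) : ℝ)
  set b := ((⌊Int.fract ν * ((80 * H * μ : ℕ) : ℝ)⌋₊ : ℕ) : ℝ) / ((80 * H * μ : ℕ) : ℝ)
  set k := η * ((⌊(A - A₀) / η⌋₊ : ℕ) : ℝ) with hk
  set l := ((⌊(y - Y) * (N₄ : ℝ)⌋₊ : ℕ) : ℝ) / N₄ with hl
  have hk0 : 0 ≤ k := by positivity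
  have hl0 : 0 ≤ l := by positivity
  have r2 : |(Int.fract ν - b) * j| ≤ 1 / (80 * H) := by
    rw [abs_mul, Nat.abs_cast]
    calc |Int.fract ν - b| * j ≤ 1 / ((80 * H * μ : ℕ) : ℝ) * μ := by gcongr
      _ = _ := by push_cast; field_simp
  have r3 : |(A - A₀ - k) * sqrtBend y j| ≤ 1 / (640 * H) := by
    rw [abs_mul]
    calc |A - A₀ - k| * |sqrtBend y j| ≤ η * ((μ : ℝ) ^ 2 / (8 * (Y * √Y))) := by
          refine mul_le_mul q3.1 ((abs_sqrtBend_le hY hy (by positivity)).trans ?_)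
            (abs_nonneg _) hη0.le
          gcongr
      _ = _ := by rw [hη]; field_simp; norm_num
  have r4 : |(A₀ + k) * (sqrtBend y j - sqrtBend (Y + l) j)| ≤ 1 / (80 * H) := by
    rw [abs_mul, abs_of_nonneg (by linarith)]
    have h1 := abs_sqrtBend_sub_le (j := j) hY hy (by linarith : Y ≤ Y + l) (by positivity)
    have h2 : |y - (Y + l)| ≤ 1 / N₄ := by rw [← sub_sub]; exact q4.1
    calc (A₀ + k) * |sqrtBend y j - sqrtBend (Y + l) j|
        ≤ (A₀ + D) * (1 / N₄ * (μ : ℝ) ^ 2 / (4 * (Y ^ 2 * √Y))) := by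
          refine mul_le_mul (by linarith [q3.2]) (h1.trans ?_) (abs_nonneg _) (by linarith)
          gcongr
      _ = 20 * H * (A₀ + D) * (μ : ℝ) ^ 2 / (N₄ * (Y ^ 2 * √Y)) / (80 * H) := by
        field_simp; ring
      _ ≤ _ := by
        gcongr
        rw [div_le_one (by positivity)]
        exact h₄
  have hn' : |x + ν * j + A * sqrtBend y j - n| ≤ 1 / (40 * H) := by
    rw [le_div_iff₀ (by positivity)]; exact hn
  have q1' : |Int.fract x - a| ≤ 1 / (80 * H) := by
    refine q1.trans (le_of_eq ?_)
    push_cast; ring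
  have ex := Int.self_sub_floor x
  have eν := Int.self_sub_floor ν
  have e : a + b * j + (A₀ + k) * sqrtBend (Y + l) j - ((n - ⌊x⌋ - ⌊ν⌋ * j : ℤ) : ℝ) =
      (x + ν * j + A * sqrtBend y j - n) - (Int.fract x - a) - (Int.fract ν - b) * j -
      (A - A₀ - k) * sqrtBend y j - (A₀ + k) * (sqrtBend y j - sqrtBend (Y + l) j) := by
    push_cast
    rw [← ex, ← eν]
    ring
  have t1 : (1 : ℝ) / (40 * H) = 16 * (1 / (640 * H)) := by field_simp; norm_num
  have t2 : (1 : ℝ) / (80 * H) = 8 * (1 / (640 * H)) := by field_simp; norm_num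
  have t3 : (1 : ℝ) / (8 * H) = 80 * (1 / (640 * H)) := by field_simp; norm_num
  have t0 : (0 : ℝ) ≤ 1 / (640 * H) := by positivity
  rw [e, ← le_div_iff₀ (by positivity), t3]
  rw [t1] at hn'
  rw [t2] at q1' r2 r4
  rw [abs_le] at *
  constructor <;> linarith

end

open Classical in
theorem block_hits_le : ∃ C : ℝ, 0 < C ∧ ∀ {ι : Type} (W : Finset ι) (x ν A y : ι → ℝ)
    (J μ N₃ N₄ : ℕ) (Y A₀ D κ L : ℝ) (H : ℕ), H = 2 ^ J → 16 * H ^ 2 ≤ μ → μ ≤ Y → 1 ≤ N₃ →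
    1 ≤ N₄ → 0 ≤ A₀ → (∀ i ∈ W, A₀ ≤ A i ∧ A i ≤ A₀ + D ∧ Y ≤ y i ∧ y i < Y + 1) →
    80 * H * (μ : ℝ) ^ 2 * D < N₃ * (Y * √Y) →
    20 * H * (A₀ + D) * (μ : ℝ) ^ 2 ≤ N₄ * (Y ^ 2 * √Y) → 1 ≤ κ → 1 ≤ L →
    80 * H * (μ : ℝ) ≤ κ * N₃ → (80 * H * (μ : ℝ) ^ 2 / N₃) ^ 3 ≤ κ * (H ^ 3 * μ ^ 2) →
    80 * H * (μ : ℝ) ^ 2 / N₃ * Y ^ 2 ≤ L * (H * μ ^ 2 * √μ) →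
    ∑ i ∈ W, (((Finset.range μ).filter fun j : ℕ => ∃ n : ℤ,
      |x i + ν i * j + A i * sqrtBend (y i) j - n| * (40 * H) ≤ 1).card : ℝ) ≤
    C * (W.card * μ / H + fourthRoot (κ * W.card ^ 2 * ((W ×ˢ W).filter fun q =>
      (∃ k : ℤ, |ν q.1 - ν q.2 - k| * (80 * H * μ) ≤ 1) ∧
      |A q.1 - A q.2| * (80 * H * μ ^ 2) ≤ Y * √Y ∧ |y q.1 - y q.2| * N₄ ≤ 1).card * μ ^ 3 * N₃ * N₄ * L)) := by
  obtain ⟨C, hC, hmf⟩ := mean_fourth_power_le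
  refine ⟨2 + 64 * fourthRoot C, by have := fourthRoot_nonneg C; positivity, ?_⟩
  intro ι W x ν A y J μ N₃ N₄ Y A₀ D κ L H hHJ hHμ hμY hN₃ hN₄ hA₀ hW hN₃' hN₄' hκ hL c₁ c₂ c₃
  have hH : 1 ≤ H := by rw [hHJ]; exact Nat.one_le_two_pow
  have hμ : 1 ≤ μ := by nlinarith
  have hH0 : (0 : ℝ) < H := by exact_mod_cast hH
  have hμ0 : (1 : ℝ) ≤ μ := by exact_mod_cast hμ
  have hN30 : (0 : ℝ) < N₃ := by exact_mod_cast hN₃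
  have hN40 : (0 : ℝ) < N₄ := by exact_mod_cast hN₄
  have hY : 0 < Y := by linarith
  have hsY : 0 < √Y := Real.sqrt_pos.2 hY
  set η := Y * √Y / (80 * H * (μ : ℝ) ^ 2) with hη
  have hη0 : 0 < η := by positivity
  set c : ι → ℕ × ℕ × ℕ × ℕ := fun i => (⌊(y i - Y) * (N₄ : ℝ)⌋₊, ⌊Int.fract (x i) * ((80 * H : ℕ) : ℝ)⌋₊,
    ⌊Int.fract (ν i) * ((80 * H * μ : ℕ) : ℝ)⌋₊, ⌊(A i - A₀) / η⌋₊) with hc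
  set G := Finset.range N₄ ×ˢ Finset.range (80 * H) ×ˢ Finset.range (80 * H * μ) ×ˢ
    Finset.range N₃ with hG
  have hcG : ∀ i ∈ W, c i ∈ G := by
    intro i hi
    obtain ⟨a1, a2, a3, a4⟩ := hW i hi
    simp only [hc, hG, Finset.mem_product, Finset.mem_range]
    have f1 : ∀ (z : ℝ) (N : ℕ), 0 ≤ z → z < 1 → 1 ≤ N → ⌊z * (N : ℝ)⌋₊ < N := by
      intro z N h0 h1 hN
      have : (0 : ℝ) < N := by exact_mod_cast hN
      rw [Nat.floor_lt (by positivity)]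
      nlinarith
    refine ⟨f1 _ _ (by linarith) (by linarith) hN₄, f1 _ _ (Int.fract_nonneg _)
      (Int.fract_lt_one _) (by omega), f1 _ _ (Int.fract_nonneg _)
      (Int.fract_lt_one _) (by nlinarith), ?_⟩
    rw [Nat.floor_lt (div_nonneg (by linarith) hη0.le), div_lt_iff₀ hη0]
    have : D < N₃ * η := by
      rw [hη, ← mul_div_assoc, lt_div_iff₀ (by positivity)]
      linarith
    linarith
  set X : ℕ × ℕ × ℕ × ℕ → ℕ → ℝ := fun d j => (d.2.1 : ℝ) / ((80 * H : ℕ) : ℝ) +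
    (d.2.2.1 : ℝ) / ((80 * H * μ : ℕ) : ℝ) * j +
      (A₀ + η * d.2.2.2) * sqrtBend (Y + (d.1 : ℝ) / N₄) j with hX
  set z : ℕ → ℕ × ℕ × ℕ × ℕ → ℝ := fun a d => ‖∑ h ∈ Finset.Ico ((2 : ℕ) ^ a) (2 * 2 ^ a),
    ((1 - (h : ℕ) / H : ℝ) : ℂ) * ∑ j ∈ Finset.range μ, ec ((h : ℝ) * X d j)‖ with hz
  set pairs := (W ×ˢ W).filter fun q =>
      (∃ k : ℤ, |ν q.1 - ν q.2 - k| * (80 * H * μ) ≤ 1) ∧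
      |A q.1 - A q.2| * (80 * H * μ ^ 2) ≤ Y * √Y ∧ |y q.1 - y q.2| * N₄ ≤ 1 with hpairs
  have hcpairs : ((W ×ˢ W).filter fun q => c q.1 = c q.2).card ≤ pairs.card := by
    refine Finset.card_le_card fun q hq => ?_
    rw [Finset.mem_filter] at hq
    obtain ⟨hq, e⟩ := hq
    rw [hpairs, Finset.mem_filter]
    refine ⟨hq, ?_⟩
    rw [Finset.mem_product] at hq
    simp only [hc, Prod.mk.injEq] at e
    obtain ⟨e1, -, e3, e4⟩ := e
    have f2 : ∀ u v : ℝ, 0 ≤ u → 0 ≤ v → ⌊u⌋₊ = ⌊v⌋₊ → |u - v| ≤ 1 := by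
      intro u v hu hv huv
      have h1 := Nat.floor_le hu
      have h2 := Nat.lt_floor_add_one u
      have h3 := Nat.floor_le hv
      have h4 := Nat.lt_floor_add_one v
      rw [huv] at h1 h2
      rw [abs_le]
      constructor <;> linarith
    refine ⟨?_, ?_, ?_⟩
    · refine ⟨⌊ν q.1⌋ - ⌊ν q.2⌋, ?_⟩
      have := f2 _ _ (mul_nonneg (Int.fract_nonneg _) (by positivity))
        (mul_nonneg (Int.fract_nonneg _) (by positivity)) e3
      rw [← sub_mul, abs_mul, Nat.abs_cast] at this
      have e5 : ν q.1 - ν q.2 - ((⌊ν q.1⌋ - ⌊ν q.2⌋ : ℤ) : ℝ) =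
          Int.fract (ν q.1) - Int.fract (ν q.2) := by
        rw [← Int.self_sub_floor, ← Int.self_sub_floor]; push_cast; ring
      rw [e5]
      exact_mod_cast this
    · have := f2 _ _ (div_nonneg (by linarith [(hW _ hq.1).1]) hη0.le)
        (div_nonneg (by linarith [(hW _ hq.2).1]) hη0.le) e4
      rw [← sub_div, sub_sub_sub_cancel_right, abs_div, abs_of_pos hη0, div_le_one hη0, hη,
        le_div_iff₀ (by positivity)] at this
      exact this
    · have := f2 _ _ (mul_nonneg (by linarith [(hW _ hq.1).2.2.1]) hN40.le)
        (mul_nonneg (by linarith [(hW _ hq.2).2.2.1]) hN40.le) e1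
      rw [← sub_mul, sub_sub_sub_cancel_right, abs_mul, Nat.abs_cast] at this
      exact this
  have hstep : ∀ i ∈ W, (((Finset.range μ).filter fun j : ℕ => ∃ n : ℤ,
      |x i + ν i * j + A i * sqrtBend (y i) j - n| * (40 * H) ≤ 1).card : ℝ) ≤
      2 * μ / H + 4 / H * ∑ a ∈ Finset.range J, z a (c i) := by
    intro i hi
    obtain ⟨a1, a2, a3, a4⟩ := hW i hi
    have h1 : ((Finset.range μ).filter fun j : ℕ => ∃ n : ℤ,
        |x i + ν i * j + A i * sqrtBend (y i) j - n| * (40 * H) ≤ 1).card ≤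
        ((Finset.range μ).filter fun j : ℕ => ∃ n : ℤ, |X (c i) j - n| * (8 * H) ≤ 1).card := by
      refine Finset.card_le_card fun j hj => ?_
      rw [Finset.mem_filter] at hj ⊢
      exact ⟨hj.1, near_int_of_round hH hμ hN₄ hY hA₀ a1 a2 a3 hN₄' (Finset.mem_range.1 hj.1) hj.2⟩
    have h2 := card_near_int_le (Finset.range μ) (X (c i)) hH
    rw [Finset.card_range] at h2
    refine (Nat.cast_le.2 h1).trans (h2.trans ?_)
    gcongr
    rw [hHJ, sum_Ico_two_pow, ← hHJ]
    simp only [hz]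
    exact norm_sum_le _ _
  have hT : ∀ a ∈ Finset.range J, ∑ i ∈ W, z a (c i) ≤ fourthRoot √((2 : ℝ) ^ a / 2 ^ J) *
      (H * (fourthRoot C * fourthRoot (κ * W.card ^ 2 * pairs.card * μ ^ 3 * N₃ * N₄ * L))) := by
    intro a ha
    rw [Finset.mem_range] at ha
    have h1 := sum_comp_pow_four_le W G c hcG (z a)
    have h2 : ∑ d ∈ G, z a d ^ 4 ≤ N₄ * (C * (κ * √((2 : ℝ) ^ a / 2 ^ J) *
        (H ^ 4 * μ ^ 3 * N₃ * L))) := by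
      rw [hG, Finset.sum_product]
      have : ∀ l ∈ Finset.range N₄, ∑ d ∈ Finset.range (80 * H) ×ˢ Finset.range (80 * H * μ) ×ˢ
          Finset.range N₃, z a (l, d) ^ 4 ≤ C * (κ * √((2 : ℝ) ^ a / 2 ^ J) *
          (H ^ 4 * μ ^ 3 * N₃ * L)) := by
        intro l hl
        have hl1 : (l : ℝ) / N₄ ≤ 1 := by
          rw [div_le_one hN40]
          exact_mod_cast (Finset.mem_range.1 hl).le
        have hl0 : 0 ≤ (l : ℝ) / N₄ := by positivity
        have := hmf (2 ^ a) H μ N₃ (Y + (l : ℝ) / N₄) Y A₀ κ L Nat.one_le_two_pow (by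
          rw [hHJ, ← pow_succ']
          exact Nat.pow_le_pow_right (by norm_num) ha) hHμ hN₃ hμY (by linarith) (by linarith)
          hκ hL c₁ c₂ c₃
        rw [Finset.sum_product]
        simp only [Finset.sum_product]
        refine this.trans (le_of_eq ?_)
        rw [hHJ]
        push_cast
        rfl
      refine (Finset.sum_le_sum this).trans ?_
      rw [Finset.sum_const, Finset.card_range, nsmul_eq_mul]
    have h3 : (∑ i ∈ W, z a (c i)) ^ 4 ≤ √((2 : ℝ) ^ a / 2 ^ J) * (H ^ 4 *
        (C * (κ * W.card ^ 2 * pairs.card * μ ^ 3 * N₃ * N₄ * L))) := by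
      refine h1.trans ?_
      have h4 : (((W ×ˢ W).filter fun q => c q.1 = c q.2).card : ℝ) ≤ pairs.card := by
        exact_mod_cast hcpairs
      calc _ ≤ (W.card : ℝ) ^ 2 * pairs.card * (N₄ * (C * (κ * √((2 : ℝ) ^ a / 2 ^ J) *
            (H ^ 4 * μ ^ 3 * N₃ * L)))) := by gcongr
        _ = _ := by ring
    refine (le_fourthRoot (Finset.sum_nonneg fun i _ => norm_nonneg _) h3).trans (le_of_eq ?_)
    rw [fourthRoot_mul (Real.sqrt_nonneg _), fourthRoot_mul (by positivity),
      fourthRoot_pow_four hH0.le, fourthRoot_mul hC.le]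
  set E := fourthRoot (κ * W.card ^ 2 * pairs.card * μ ^ 3 * N₃ * N₄ * L) with hE
  have hE0 : 0 ≤ E := fourthRoot_nonneg _
  have hfC := fourthRoot_nonneg C
  calc _ ≤ ∑ i ∈ W, (2 * μ / H + 4 / H * ∑ a ∈ Finset.range J, z a (c i)) :=
        Finset.sum_le_sum hstep
    _ = 2 * (W.card * μ / H) + 4 / H * ∑ a ∈ Finset.range J, ∑ i ∈ W, z a (c i) := by
      rw [Finset.sum_add_distrib, ← Finset.mul_sum, Finset.sum_comm, Finset.sum_const, nsmul_eq_mul]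
      ring
    _ ≤ 2 * (W.card * μ / H) + 4 / H * ∑ a ∈ Finset.range J, fourthRoot √((2 : ℝ) ^ a / 2 ^ J) *
        (H * (fourthRoot C * E)) := by
      gcongr with a ha
      exact hT a ha
    _ ≤ 2 * (W.card * μ / H) + 4 / H * (16 * (H * (fourthRoot C * E))) := by
      rw [← Finset.sum_mul]
      gcongr
      exact sum_fourthRoot_sqrt_le J
    _ = 2 * (W.card * μ / H) + 64 * fourthRoot C * E := by field_simp; ring
    _ ≤ _ := by
      have h1 : 0 ≤ (W.card : ℝ) * μ / H := by positivity
      nlinarith [mul_nonneg hfC h1]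

/-- The coefficient `c / |v|^{3/2}` of the square-root term attached to the direction `v`. -/
def bendCoeff (c : ℝ) (v : ℤ × ℤ) : ℝ := c / fourthRoot (sqLen v) ^ 3

/-- The slope of the phase attached to the direction `v`, its partner `u` and the base height `y`. -/
def phaseSlope (c σ : ℝ) (v u : ℤ × ℤ) (y : ℝ) : ℝ :=
  σ * ((dotZ v u : ℝ) / sqLen v) + bendCoeff c v / (2 * √y)

section
variable {c w₀ : ℝ} {v v' : ℤ × ℤ}

theorem fourthRoot_sqLen_bounds (hw : 0 < w₀) (h1 : w₀ ^ 4 / 256 ≤ sqLen v)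
    (h2 : (sqLen v : ℝ) ≤ w₀ ^ 4) :
    w₀ / 4 ≤ fourthRoot (sqLen v) ∧ fourthRoot (sqLen v) ≤ w₀ ∧
      fourthRoot (sqLen v) ^ 4 = sqLen v := by
  have h0 : (0 : ℝ) ≤ sqLen v := le_trans (by positivity) h1
  refine ⟨le_fourthRoot (by linarith) (le_trans (le_of_eq (by ring)) h1), fourthRoot_le hw.le h2,
    fourthRoot_pow h0⟩

theorem bendCoeff_bounds (hc : 0 < c) (hw : 0 < w₀) (h1 : w₀ ^ 4 / 256 ≤ sqLen v)
    (h2 : (sqLen v : ℝ) ≤ w₀ ^ 4) :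
    c / w₀ ^ 3 ≤ bendCoeff c v ∧ bendCoeff c v ≤ 64 * (c / w₀ ^ 3) := by
  obtain ⟨a, b, -⟩ := fourthRoot_sqLen_bounds hw h1 h2
  have hpos : 0 < fourthRoot (sqLen v) := by linarith
  unfold bendCoeff
  constructor
  · gcongr
  · calc _ ≤ c / (w₀ / 4) ^ 3 := by gcongr
      _ = _ := by field_simp; norm_num

theorem abs_sqLen_sub_le (hc : 0 < c) (hw : 0 < w₀) (h1 : w₀ ^ 4 / 256 ≤ sqLen v)
    (h2 : (sqLen v : ℝ) ≤ w₀ ^ 4) (h1' : w₀ ^ 4 / 256 ≤ sqLen v')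
    (h2' : (sqLen v' : ℝ) ≤ w₀ ^ 4) :
    |(sqLen v : ℝ) - sqLen v'| ≤ 2 * w₀ ^ 7 / c * |bendCoeff c v - bendCoeff c v'| := by
  obtain ⟨a, b, e⟩ := fourthRoot_sqLen_bounds hw h1 h2
  obtain ⟨a', b', e'⟩ := fourthRoot_sqLen_bounds hw h1' h2'
  unfold bendCoeff
  rw [← e, ← e']
  rw [e, e']
  set w := fourthRoot (sqLen v)
  set w' := fourthRoot (sqLen v')
  have hpos : 0 < w := by linarith
  have hpos' : 0 < w' := by linarith
  rw [← e, ← e']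
  have key : |w ^ 4 - w' ^ 4| ≤ 2 * w₀ * |w ^ 3 - w' ^ 3| := by
    have e1 : w ^ 4 - w' ^ 4 = (w - w') * ((w + w') * (w ^ 2 + w' ^ 2)) := by ring
    have e2 : w ^ 3 - w' ^ 3 = (w - w') * (w ^ 2 + w * w' + w' ^ 2) := by ring
    rw [e1, e2, abs_mul (w - w'), abs_mul (w - w'),
      abs_of_pos (by positivity : 0 < (w + w') * (w ^ 2 + w' ^ 2)),
      abs_of_pos (by positivity : 0 < w ^ 2 + w * w' + w' ^ 2)]
    have : (w + w') * (w ^ 2 + w' ^ 2) ≤ 2 * w₀ * (w ^ 2 + w * w' + w' ^ 2) := by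
      apply mul_le_mul (by linarith) (by nlinarith [mul_pos hpos hpos']) (by positivity)
        (by positivity)
    nlinarith [abs_nonneg (w - w')]
  have e3 : c / w ^ 3 - c / w' ^ 3 = -(c / (w ^ 3 * w' ^ 3) * (w ^ 3 - w' ^ 3)) := by
    field_simp; ring
  rw [e3, abs_neg, abs_mul, abs_of_pos (by positivity : 0 < c / (w ^ 3 * w' ^ 3))]
  refine key.trans ?_
  rw [← mul_assoc]
  refine mul_le_mul_of_nonneg_right ?_ (abs_nonneg _)
  rw [div_mul_div_comm, mul_comm c, mul_div_mul_right _ _ hc.ne', le_div_iff₀ (by positivity)]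
  calc 2 * w₀ * (w ^ 3 * w' ^ 3) ≤ 2 * w₀ * (w₀ ^ 3 * w₀ ^ 3) := by gcongr
    _ = _ := by ring

end

theorem abs_half_inv_sqrt_sub_le {Y y y' : ℝ} (hY : 0 < Y) (hy : Y ≤ y) (hy' : Y ≤ y') :
    |1 / (2 * √y) - 1 / (2 * √y')| ≤ |y - y'| / (4 * (Y * √Y)) := by
  have h0 : 0 < √Y := Real.sqrt_pos.2 hY
  have h1 : √Y ≤ √y := Real.sqrt_le_sqrt hy
  have h2 : √Y ≤ √y' := Real.sqrt_le_sqrt hy'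
  have p1 : 0 < √y := by linarith
  have p2 : 0 < √y' := by linarith
  have e : 1 / (2 * √y) - 1 / (2 * √y') = (y' - y) / (2 * (√y * √y') * (√y + √y')) := by
    have a1 := Real.sq_sqrt (by linarith : 0 ≤ y)
    have a2 := Real.sq_sqrt (by linarith : 0 ≤ y')
    rw [eq_div_iff (by positivity)]
    have : y' - y = (√y' - √y) * (√y + √y') := by nlinarith
    rw [this]
    field_simp
  rw [e, abs_div, abs_sub_comm, abs_of_pos (by positivity : 0 < 2 * (√y * √y') * (√y + √y'))]
  refine div_le_div_of_nonneg_left (abs_nonneg _) (by positivity) ?_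
  calc 4 * (Y * √Y) = 2 * (√Y * √Y) * (√Y + √Y) := by rw [Real.mul_self_sqrt hY.le]; ring
    _ ≤ _ := by gcongr

open Classical in
theorem block_pairs_le : ∃ C : ℝ, 1 ≤ C ∧ ∀ (w₀ c σ Y : ℝ) (H μ N₄ : ℕ) (V : Finset (ℤ × ℤ))
    (bar : ℤ × ℤ → ℤ × ℤ) (y : ℤ × ℤ → ℝ), 1 ≤ w₀ → 0 < c → |σ| = 1 → 1 ≤ H → 1 ≤ μ → μ ≤ Y →
    1 ≤ N₄ →
    (∀ v ∈ V, crossZ v (bar v) = 1 ∧ w₀ ^ 4 / 256 ≤ sqLen v ∧ (sqLen v : ℝ) ≤ w₀ ^ 4) →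
    (∀ v ∈ V, Y ≤ y v) → 20 * H * (64 * (c / w₀ ^ 3)) * (μ : ℝ) ^ 2 ≤ N₄ * (Y ^ 2 * √Y) →
    ((((V ×ˢ V).filter fun q =>
      (∃ k : ℤ, |phaseSlope c σ q.1 (bar q.1) (y q.1) - phaseSlope c σ q.2 (bar q.2) (y q.2) - k| *
        (80 * H * μ) ≤ 1) ∧
      |bendCoeff c q.1 - bendCoeff c q.2| * (80 * H * μ ^ 2) ≤ Y * √Y ∧
      |y q.1 - y q.2| * N₄ ≤ 1).card : ℕ) : ℝ) ≤
    C * (w₀ ^ 4 + (1 + w₀ ^ 4 * (Y / (H * μ ^ 2))) ^ 2 +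
      w₀ ^ 7 / c * (Y * √Y / (H * μ ^ 2)) * (1 + w₀ ^ 4 * (Y / (H * μ ^ 2)))) := by
  obtain ⟨C, hC, hs⟩ := second_spacing
  refine ⟨C, hC, ?_⟩
  intro w₀ c σ Y H μ N₄ V bar y hw hc hσ hH hμ hμY hN hV hy hN₄
  have hH0 : (0 : ℝ) < H := by exact_mod_cast hH
  have hμ0 : (0 : ℝ) < μ := by exact_mod_cast hμ
  have hN0 : (0 : ℝ) < N₄ := by exact_mod_cast hN
  have hY : 0 < Y := by linarith
  have hsY : 0 < √Y := Real.sqrt_pos.2 hY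
  refine hs (w₀ ^ 4) (Y / (H * μ ^ 2)) (w₀ ^ 7 / c * (Y * √Y / (H * μ ^ 2))) V bar _
    (one_le_pow₀ hw) (by positivity) (by positivity) hV ?_
  intro p hp
  rw [Finset.mem_filter, Finset.mem_product] at hp
  obtain ⟨⟨m1, m2⟩, ⟨k, hk⟩, hA, hyy⟩ := hp
  refine ⟨m1, m2, ?_, ?_⟩
  · obtain ⟨-, a1, a2⟩ := hV _ m1
    obtain ⟨-, b1, b2⟩ := hV _ m2
    have B1 := bendCoeff_bounds hc (by linarith) a1 a2
    have B2 := bendCoeff_bounds hc (by linarith) b1 b2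
    set A := bendCoeff c p.1 with hAdef
    set A' := bendCoeff c p.2 with hAdef'
    have hA0 : 0 < c / w₀ ^ 3 := by positivity
    set f := (dotZ p.1 (bar p.1) : ℝ) / sqLen p.1 with hf
    set f' := (dotZ p.2 (bar p.2) : ℝ) / sqLen p.2 with hf'
    have q1 : |phaseSlope c σ p.1 (bar p.1) (y p.1) - phaseSlope c σ p.2 (bar p.2) (y p.2) - k| ≤
        Y / (80 * (H * (μ : ℝ) ^ 2)) := by
      rw [← le_div_iff₀ (by positivity)] at hk
      refine hk.trans ?_
      rw [div_le_div_iff₀ (by positivity) (by positivity)]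
      have : 0 ≤ 80 * H * (μ : ℝ) := by positivity
      nlinarith
    have q2 : |(A - A') * (1 / (2 * √(y p.1)))| ≤ Y / (160 * (H * (μ : ℝ) ^ 2)) := by
      rw [← le_div_iff₀ (by positivity)] at hA
      rw [abs_mul, abs_of_nonneg (by positivity : 0 ≤ 1 / (2 * √(y p.1)))]
      calc |A - A'| * (1 / (2 * √(y p.1))) ≤ Y * √Y / (80 * H * μ ^ 2) * (1 / (2 * √Y)) := by
            gcongr
            exact hy _ m1
        _ = _ := by field_simp; norm_num
    have q3 : |A' * (1 / (2 * √(y p.1)) - 1 / (2 * √(y p.2)))| ≤ Y / (80 * (H * (μ : ℝ) ^ 2)) := by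
      rw [abs_mul, abs_of_pos (by linarith)]
      have := abs_half_inv_sqrt_sub_le hY (hy _ m1) (hy _ m2)
      have h3 : |y p.1 - y p.2| ≤ 1 / N₄ := by rwa [le_div_iff₀ hN0]
      calc _ ≤ 64 * (c / w₀ ^ 3) * (1 / N₄ / (4 * (Y * √Y))) := by
            refine mul_le_mul B2.2 (this.trans ?_) (abs_nonneg _) (by positivity)
            gcongr
        _ = 20 * H * (64 * (c / w₀ ^ 3)) * (μ : ℝ) ^ 2 / (N₄ * (Y ^ 2 * √Y)) *
            (Y / (80 * (H * (μ : ℝ) ^ 2))) := by field_simp; norm_num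
        _ ≤ 1 * (Y / (80 * (H * (μ : ℝ) ^ 2))) := by
            gcongr
            rw [div_le_one (by positivity)]
            exact hN₄
        _ = _ := one_mul _
    have t1 : Y / (80 * (H * (μ : ℝ) ^ 2)) = 2 * (Y / (160 * (H * (μ : ℝ) ^ 2))) := by
      field_simp; norm_num
    have t2 : Y / (H * (μ : ℝ) ^ 2) = 160 * (Y / (160 * (H * (μ : ℝ) ^ 2))) := by
      field_simp
    have t0 : 0 ≤ Y / (160 * (H * (μ : ℝ) ^ 2)) := by positivity
    have e : phaseSlope c σ p.1 (bar p.1) (y p.1) - phaseSlope c σ p.2 (bar p.2) (y p.2) - k =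
        (σ * (f - f') - k) + (A - A') * (1 / (2 * √(y p.1))) +
          A' * (1 / (2 * √(y p.1)) - 1 / (2 * √(y p.2))) := by
      simp only [phaseSlope]
      rw [← hAdef, ← hAdef', ← hf, ← hf']
      ring
    have q4 : |σ * (f - f') - k| ≤ Y / (H * (μ : ℝ) ^ 2) := by
      rw [e] at q1
      rw [t1] at q1 q3
      rw [t2]
      rw [abs_le] at *
      constructor <;> linarith
    rcases (abs_eq (by norm_num)).1 hσ with rfl | rfl
    · exact ⟨k, by rwa [one_mul] at q4⟩
    · refine ⟨-k, ?_⟩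
      rw [← abs_neg]
      convert q4 using 2
      push_cast
      ring
  · obtain ⟨-, a1, a2⟩ := hV _ m1
    obtain ⟨-, b1, b2⟩ := hV _ m2
    refine (abs_sqLen_sub_le hc (by linarith) a1 a2 b1 b2).trans ?_
    rw [← le_div_iff₀ (by positivity)] at hA
    calc _ ≤ 2 * w₀ ^ 7 / c * (Y * √Y / (80 * H * μ ^ 2)) := by gcongr
      _ = 1 / 40 * (w₀ ^ 7 / c * (Y * √Y / (H * μ ^ 2))) := by field_simp; norm_num
      _ ≤ _ := by
        have : 0 ≤ w₀ ^ 7 / c * (Y * √Y / (H * (μ : ℝ) ^ 2)) := by positivity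
        linarith

theorem exists_two_pow_between {h : ℝ} (hh : 1 ≤ h) : ∃ J : ℕ, (2 : ℝ) ^ J ≤ h ∧ h < 2 * 2 ^ J := by
  obtain ⟨n, h1, h2⟩ := exists_nat_pow_near hh (by norm_num : (1 : ℝ) < 2)
  exact ⟨n, h1, by rwa [pow_succ'] at h2⟩

set_option maxHeartbeats 1000000 in
open Classical in
theorem block_hits_scaled : ∀ K : ℝ, 1 ≤ K → ∃ C : ℝ, 0 < C ∧ ∀ (ξ g υ σ L : ℝ) (μ : ℕ)
    (V : Finset (ℤ × ℤ)) (bar : ℤ × ℤ → ℤ × ℤ) (x y : ℤ × ℤ → ℝ), 1 ≤ g → g ≤ ξ →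
    0 < υ → |σ| = 1 → 1 ≤ L → 640 * g ^ 4 ≤ υ ^ 2 → μ ≤ υ ^ 4 → υ ^ 4 ≤ 25600 * g ^ 8 * μ →
    υ ^ 6 ≤ K * (μ * ξ ^ 4 * g ^ 12) → υ ^ 12 ≤ K * (ξ ^ 12 * g ^ 24 * μ ^ 2) →
    υ ^ 12 ≤ L * (ξ ^ 4 * g ^ 8 * (μ ^ 2 * √μ)) → υ ^ 4 ≤ K * (μ ^ 2 * ξ ^ 4 * g ^ 8) →
    (∀ v ∈ V, crossZ v (bar v) = 1 ∧ (ξ ^ 6 / g ^ 4) ^ 4 / 256 ≤ sqLen v ∧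
      (sqLen v : ℝ) ≤ (ξ ^ 6 / g ^ 4) ^ 4) →
    (∀ v ∈ V, υ ^ 4 ≤ y v ∧ y v < υ ^ 4 + 1) →
    ∑ v ∈ V, (((Finset.range μ).filter fun j : ℕ => ∃ n : ℤ,
      |x v + phaseSlope (√2 * ξ ^ 22) σ v (bar v) (y v) * j +
        bendCoeff (√2 * ξ ^ 22) v * sqrtBend (y v) j - n| * υ ^ 2 ≤ 16 * g ^ 4).card : ℝ) ≤
    C * (ξ ^ 24 / g ^ 12 * (μ / υ ^ 2) + fourthRoot ((ξ ^ 6 / g ^ 4) ^ 8 *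
      ((ξ ^ 6 / g ^ 4) ^ 4 + (1 + (ξ ^ 6 / g ^ 4) ^ 4 * (υ ^ 2 * g ^ 4 / μ ^ 2)) ^ 2 +
        ξ ^ 20 * υ ^ 4 / (g ^ 24 * μ ^ 2) *
          (1 + (ξ ^ 6 / g ^ 4) ^ 4 * (υ ^ 2 * g ^ 4 / μ ^ 2))) * μ ^ 3 *
      (μ ^ 2 * ξ ^ 4 * g ^ 8 / υ ^ 4) * (1 + μ ^ 2 * ξ ^ 4 * g ^ 8 / υ ^ 8) * L)) := by
  intro K hK
  obtain ⟨C₁, hC₁, hblock⟩ := block_hits_le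
  obtain ⟨C₂, hC₂, hpairs⟩ := block_pairs_le
  refine ⟨C₁ * (11520 + fourthRoot (K * 1280 ^ 3 * 9 ^ 2 * (C₂ * 1280 ^ 2) * (16 + K) * 3 * 1280)),
    mul_pos hC₁ (add_pos_of_pos_of_nonneg (by norm_num) (fourthRoot_nonneg _)), ?_⟩
  intro ξ g υ σ L μ V bar x y hg hgξ hυ hσ hL hgυ hμυ hHμ k1 k2 k3 k4 hV hy
  have hξ : 1 ≤ ξ := hg.trans hgξ
  have hg0 : 0 < g := by linarith
  have hξ0 : 0 < ξ := by linarith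
  obtain ⟨J, hJ1, hJ2⟩ := exists_two_pow_between
    (show 1 ≤ υ ^ 2 / (640 * g ^ 4) from (one_le_div (by positivity)).2 hgυ)
  set H : ℕ := 2 ^ J with hHdef
  have hHc : (H : ℝ) = 2 ^ J := by rw [hHdef]; push_cast; ring
  rw [← hHc] at hJ1 hJ2
  have hH : 1 ≤ H := Nat.one_le_two_pow
  have hH0 : (0 : ℝ) < H := by exact_mod_cast hH
  have hHu : H * (640 * g ^ 4) ≤ υ ^ 2 := (le_div_iff₀ (by positivity)).1 hJ1
  have hHl : υ ^ 2 ≤ 1280 * (H * g ^ 4) := by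
    have := (div_lt_iff₀ (by positivity)).1 hJ2
    nlinarith
  have hμ0 : (0 : ℝ) < μ := by
    by_contra h
    have : (μ : ℝ) = 0 := le_antisymm (not_lt.1 h) (Nat.cast_nonneg _)
    rw [this] at hHμ
    have : 0 < υ ^ 4 := by positivity
    linarith
  have hμ : 1 ≤ μ := by exact_mod_cast hμ0
  have hHμ' : 16 * H ^ 2 ≤ μ := by
    have h1 : (16 * H ^ 2 : ℝ) ≤ μ := by
      have h2 : (H * (640 * g ^ 4)) ^ 2 ≤ (υ ^ 2) ^ 2 := by gcongr
      have h3 : 25600 * g ^ 8 * (16 * (H : ℝ) ^ 2) ≤ 25600 * g ^ 8 * μ :=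
        le_trans (le_of_eq (by ring)) ((h2.trans (le_of_eq (by ring))).trans hHμ)
      exact le_of_mul_le_mul_left h3 (by positivity)
    exact_mod_cast h1
  set w₀ := ξ ^ 6 / g ^ 4 with hw₀
  have hw1 : 1 ≤ w₀ := by
    rw [hw₀, one_le_div (by positivity)]
    calc g ^ 4 ≤ ξ ^ 4 := by gcongr
      _ ≤ ξ ^ 6 := pow_le_pow_right₀ hξ (by norm_num)
  have hw0 : 0 < w₀ := by linarith
  set c := √2 * ξ ^ 22 with hc
  have h2a : 1 ≤ √2 := by rw [Real.one_le_sqrt]; norm_num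
  have h2b : √2 ≤ 1.415 := by rw [Real.sqrt_le_left (by norm_num)]; norm_num
  have hc0 : 0 < c := by positivity
  set A₀ := c / w₀ ^ 3 with hA₀
  have hA₀e : A₀ = √2 * (ξ ^ 4 * g ^ 12) := by rw [hA₀, hc, hw₀]; field_simp
  have hA0 : 0 < A₀ := by positivity
  set Y := υ ^ 4 with hYdef
  have hYs : √Y = υ ^ 2 := by
    rw [hYdef, show υ ^ 4 = (υ ^ 2) ^ 2 by ring, Real.sqrt_sq (by positivity)]
  have hY0 : 0 < Y := by positivity
  have hsY : 0 < √Y := Real.sqrt_pos.2 hY0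
  set T₃ := 80 * H * (μ : ℝ) ^ 2 * (63 * A₀) / (Y * √Y) with hT₃
  set T₄ := 20 * H * (A₀ + 63 * A₀) * (μ : ℝ) ^ 2 / (Y ^ 2 * √Y) with hT₄
  set N₃ : ℕ := ⌊T₃⌋₊ + 1 with hN₃
  set N₄ : ℕ := ⌊T₄⌋₊ + 1 with hN₄
  have hT₃0 : 0 < T₃ := by positivity
  have hT₄0 : 0 < T₄ := by positivity
  have hN₃l : T₃ < N₃ := by rw [hN₃]; push_cast; exact Nat.lt_floor_add_one _
  have hN₃u : (N₃ : ℝ) ≤ T₃ + 1 := by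
    rw [hN₃]; push_cast; linarith [Nat.floor_le hT₃0.le]
  have hN₄l : T₄ < N₄ := by rw [hN₄]; push_cast; exact Nat.lt_floor_add_one _
  have hN₄u : (N₄ : ℝ) ≤ T₄ + 1 := by
    rw [hN₄]; push_cast; linarith [Nat.floor_le hT₄0.le]
  have hN₃0 : (0 : ℝ) < N₃ := by linarith
  have hN₄0 : (0 : ℝ) < N₄ := by linarith
  set N := (μ : ℝ) ^ 2 * ξ ^ 4 * g ^ 8 / υ ^ 4 with hN
  have hN0 : 0 < N := by positivity
  have hN₃N : (N₃ : ℝ) ≤ (16 + K) * N := by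
    have h1 : T₃ ≤ 16 * N := by
      have e : T₃ = (H * (640 * g ^ 4)) * (√2 * (63 / 8) * (μ ^ 2 * ξ ^ 4 * g ^ 8 / υ ^ 6)) := by
        rw [hT₃, hA₀e, hYs, hYdef]; field_simp; norm_num
      have e' : 16 * N = υ ^ 2 * (16 * (μ ^ 2 * ξ ^ 4 * g ^ 8 / υ ^ 6)) := by
        rw [hN]; field_simp
      rw [e, e']
      gcongr
      linarith
    have h2 : 1 ≤ K * N := by
      rw [hN, ← mul_div_assoc, one_le_div (by positivity)]; exact k4
    linarith
  have hN₄N : (N₄ : ℝ) ≤ 3 * (1 + μ ^ 2 * ξ ^ 4 * g ^ 8 / υ ^ 8) := by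
    have h1 : T₄ ≤ 3 * (μ ^ 2 * ξ ^ 4 * g ^ 8 / υ ^ 8) := by
      have e : T₄ = (H * (640 * g ^ 4)) * (√2 * 2 * (μ ^ 2 * ξ ^ 4 * g ^ 8 / υ ^ 10)) := by
        rw [hT₄, hA₀e, hYs, hYdef]; field_simp; norm_num
      have e' : 3 * (μ ^ 2 * ξ ^ 4 * g ^ 8 / υ ^ 8) =
          υ ^ 2 * (3 * (μ ^ 2 * ξ ^ 4 * g ^ 8 / υ ^ 10)) := by field_simp
      rw [e, e']
      gcongr
      linarith
    have h2 : 0 ≤ μ ^ 2 * ξ ^ 4 * g ^ 8 / υ ^ 8 := by positivity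
    linarith
  have hΘ : 80 * H * (μ : ℝ) ^ 2 / N₃ ≤ υ ^ 6 / (ξ ^ 4 * g ^ 12) := by
    rw [div_le_div_iff₀ hN₃0 (by positivity)]
    have h1 : 80 * H * (μ : ℝ) ^ 2 * (63 * A₀) < N₃ * (Y * √Y) := (div_lt_iff₀ (by positivity)).1 hN₃l
    have h2 : Y * √Y = υ ^ 6 := by rw [hYs, hYdef]; ring
    rw [h2, hA₀e] at h1
    have h3 : 0 ≤ 80 * H * (μ : ℝ) ^ 2 * (ξ ^ 4 * g ^ 12) := by positivity
    calc _ ≤ 80 * H * (μ : ℝ) ^ 2 * (ξ ^ 4 * g ^ 12) * (63 * √2) :=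
          le_mul_of_one_le_right h3 (by linarith)
      _ = 80 * H * (μ : ℝ) ^ 2 * (63 * (√2 * (ξ ^ 4 * g ^ 12))) := by ring
      _ ≤ _ := h1.le.trans (le_of_eq (mul_comm _ _))
  have c₁ : 80 * H * (μ : ℝ) ≤ K * 1280 ^ 3 * N₃ := by
    have h1 : 80 * H * (μ : ℝ) ≤ K * (N₃ * 1) := by
      have h2 : 80 * H * (μ : ℝ) * υ ^ 6 ≤ 80 * H * (μ : ℝ) * (K * (μ * ξ ^ 4 * g ^ 12)) := by gcongr
      rw [div_le_div_iff₀ hN₃0 (by positivity)] at hΘ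
      have h4 : 80 * H * (μ : ℝ) * υ ^ 6 ≤ K * (N₃ * 1) * υ ^ 6 := by
        calc _ ≤ _ := h2
          _ = K * (80 * H * (μ : ℝ) ^ 2 * (ξ ^ 4 * g ^ 12)) := by ring
          _ ≤ K * (υ ^ 6 * N₃) := by gcongr
          _ = _ := by ring
      exact le_of_mul_le_mul_right h4 (by positivity)
    have : 0 ≤ K * (N₃ : ℝ) := by positivity
    linarith
  have c₂ : (80 * H * (μ : ℝ) ^ 2 / N₃) ^ 3 ≤ K * 1280 ^ 3 * (H ^ 3 * μ ^ 2) := by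
    calc _ ≤ (υ ^ 6 / (ξ ^ 4 * g ^ 12)) ^ 3 := by gcongr
      _ = (υ ^ 2) ^ 3 * υ ^ 12 / (ξ ^ 12 * g ^ 36) := by rw [div_pow]; ring_nf
      _ ≤ (1280 * (H * g ^ 4)) ^ 3 * (K * (ξ ^ 12 * g ^ 24 * μ ^ 2)) / (ξ ^ 12 * g ^ 36) := by
        gcongr
      _ = _ := by field_simp
  have c₃ : 80 * H * (μ : ℝ) ^ 2 / N₃ * Y ^ 2 ≤ 1280 * L * (H * μ ^ 2 * √μ) := by
    calc _ ≤ υ ^ 6 / (ξ ^ 4 * g ^ 12) * Y ^ 2 := by gcongr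
      _ = υ ^ 2 * υ ^ 12 / (ξ ^ 4 * g ^ 12) := by rw [hYdef]; ring
      _ ≤ 1280 * (H * g ^ 4) * (L * (ξ ^ 4 * g ^ 8 * (μ ^ 2 * √μ))) / (ξ ^ 4 * g ^ 12) := by
        gcongr
      _ = _ := by field_simp
  have hA : ∀ v ∈ V, A₀ ≤ bendCoeff c v ∧ bendCoeff c v ≤ A₀ + 63 * A₀ := by
    intro v hv
    obtain ⟨-, h1, h2⟩ := hV v hv
    have := bendCoeff_bounds hc0 hw0 h1 h2
    exact ⟨this.1, by linarith [this.2]⟩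
  have hN₄' : 20 * H * (A₀ + 63 * A₀) * (μ : ℝ) ^ 2 ≤ N₄ * (Y ^ 2 * √Y) :=
    ((div_lt_iff₀ (by positivity)).1 hN₄l).le
  have main := hblock V x (fun v => phaseSlope c σ v (bar v) (y v)) (fun v => bendCoeff c v) y J μ
    N₃ N₄ Y A₀ (63 * A₀) (K * 1280 ^ 3) (1280 * L) H rfl hHμ' hμυ (by omega) (by omega) hA0.le
    (fun v hv => ⟨(hA v hv).1, (hA v hv).2, hy v hv⟩) ((div_lt_iff₀ (by positivity)).1 hN₃l)
    hN₄' (by linarith) (by linarith) c₁ c₂ c₃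
  have hpr := hpairs w₀ c σ Y H μ N₄ V bar y hw1 hc0 hσ hH hμ hμυ (by omega) hV
    (fun v hv => (hy v hv).1) (by
      refine le_trans (le_of_eq ?_) hN₄'
      rw [hA₀]; ring)
  refine (le_trans ?_ main).trans ?_
  · refine Finset.sum_le_sum fun v hv => Nat.cast_le.2 (Finset.card_le_card fun j hj => ?_)
    rw [Finset.mem_filter] at hj ⊢
    obtain ⟨hj, n, hn⟩ := hj
    refine ⟨hj, n, ?_⟩
    have h1 : |x v + phaseSlope c σ v (bar v) (y v) * j + bendCoeff c v * sqrtBend (y v) j - n| *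
        (40 * H) * (16 * g ^ 4) ≤ 1 * (16 * g ^ 4) := by
      refine le_trans ?_ (hn.trans (one_mul _).ge)
      rw [mul_assoc]
      refine mul_le_mul_of_nonneg_left (le_trans (le_of_eq ?_) hHu) (abs_nonneg _)
      ring
    exact le_of_mul_le_mul_right h1 (by positivity)
  have hcard : (V.card : ℝ) ≤ 9 * w₀ ^ 4 :=
    card_le_of_sqLen_le (one_le_pow₀ hw1) V fun v hv => (hV v hv).2.2
  have hcard0 : (0 : ℝ) ≤ V.card := Nat.cast_nonneg _
  have hmain : (V.card : ℝ) * μ / H ≤ 11520 * (ξ ^ 24 / g ^ 12 * (μ / υ ^ 2)) := by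
    rw [div_le_iff₀ hH0]
    calc (V.card : ℝ) * μ ≤ 9 * w₀ ^ 4 * μ := by gcongr
      _ = 9 * (ξ ^ 24 / g ^ 12 * (μ / υ ^ 2)) * (υ ^ 2 / g ^ 4) := by
        rw [hw₀]; field_simp
      _ ≤ 9 * (ξ ^ 24 / g ^ 12 * (μ / υ ^ 2)) * (1280 * (H * g ^ 4) / g ^ 4) := by gcongr
      _ = _ := by field_simp; norm_num
  set T := υ ^ 2 * g ^ 4 / (μ : ℝ) ^ 2 with hT
  set E := ξ ^ 20 * υ ^ 4 / (g ^ 24 * (μ : ℝ) ^ 2) with hE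
  have hT0 : 0 ≤ T := by positivity
  have hE0 : 0 ≤ E := by positivity
  have hTT : Y / (H * (μ : ℝ) ^ 2) ≤ 1280 * T := by
    rw [div_le_iff₀ (by positivity)]
    calc Y = υ ^ 2 * υ ^ 2 := by rw [hYdef]; ring
      _ ≤ υ ^ 2 * (1280 * (H * g ^ 4)) := by gcongr
      _ = _ := by rw [hT]; field_simp
  have hEE : w₀ ^ 7 / c * (Y * √Y / (H * (μ : ℝ) ^ 2)) ≤ 1280 * E := by
    calc w₀ ^ 7 / c * (Y * √Y / (H * (μ : ℝ) ^ 2)) =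
        w₀ ^ 7 / c * υ ^ 2 * (Y / (H * (μ : ℝ) ^ 2)) := by rw [hYs]; ring
      _ ≤ ξ ^ 20 / g ^ 28 * υ ^ 2 * (1280 * T) := by
        have : w₀ ^ 7 / c ≤ ξ ^ 20 / g ^ 28 := by
          rw [div_le_div_iff₀ hc0 (by positivity), hw₀, hc, div_pow, div_mul_eq_mul_div,
            div_le_iff₀ (by positivity)]
          calc (ξ ^ 6) ^ 7 * g ^ 28 = ξ ^ 20 * (1 * ξ ^ 22) * (g ^ 4) ^ 7 := by ring
            _ ≤ _ := by gcongr
        exact mul_le_mul (mul_le_mul_of_nonneg_right this (by positivity)) hTT (by positivity)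
          (by positivity)
      _ = _ := by rw [hT, hE]; field_simp
  set B := w₀ ^ 4 + (1 + w₀ ^ 4 * T) ^ 2 + E * (1 + w₀ ^ 4 * T) with hB
  have hB0 : 0 ≤ B := by positivity
  have hpB := hpr.trans (show _ ≤ C₂ * 1280 ^ 2 * B from by
    calc _ ≤ C₂ * (1280 ^ 2 * w₀ ^ 4 + (1280 * (1 + w₀ ^ 4 * T)) ^ 2 +
          1280 * E * (1280 * (1 + w₀ ^ 4 * T))) := by
          have h5 : 1 + w₀ ^ 4 * (Y / (H * (μ : ℝ) ^ 2)) ≤ 1280 * (1 + w₀ ^ 4 * T) := by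
            have := mul_le_mul_of_nonneg_left hTT (by positivity : 0 ≤ w₀ ^ 4)
            linarith
          have h6 : w₀ ^ 4 ≤ 1280 ^ 2 * w₀ ^ 4 := by
            have : 0 ≤ w₀ ^ 4 := by positivity
            linarith
          gcongr
      _ = _ := by rw [hB]; ring)
  refine (mul_le_mul_of_nonneg_left (add_le_add hmain (fourthRoot_mono (y :=
    (K * 1280 ^ 3 * 9 ^ 2 * (C₂ * 1280 ^ 2) * (16 + K) * 3 * 1280) * (w₀ ^ 8 * B * μ ^ 3 * N *
      (1 + μ ^ 2 * ξ ^ 4 * g ^ 8 / υ ^ 8) * L)) ?_)) hC₁.le).trans ?_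
  · refine le_trans (b := K * 1280 ^ 3 * (9 * w₀ ^ 4) ^ 2 * (C₂ * 1280 ^ 2 * B) * μ ^ 3 *
      ((16 + K) * N) * (3 * (1 + μ ^ 2 * ξ ^ 4 * g ^ 8 / υ ^ 8)) * (1280 * L)) ?_ (le_of_eq ?_)
    · gcongr
    · ring
  · rw [fourthRoot_mul (by positivity), mul_assoc C₁]
    refine mul_le_mul_of_nonneg_left ?_ hC₁.le
    have a1 := fourthRoot_nonneg (K * 1280 ^ 3 * 9 ^ 2 * (C₂ * 1280 ^ 2) * (16 + K) * 3 * 1280)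
    have a2 := fourthRoot_nonneg (w₀ ^ 8 * B * μ ^ 3 * N *
      (1 + μ ^ 2 * ξ ^ 4 * g ^ 8 / υ ^ 8) * L)
    have a3 : 0 ≤ ξ ^ 24 / g ^ 12 * (μ / υ ^ 2) := by positivity
    have a4 := mul_nonneg a1 a3
    linarith

section
variable {ξ g υ μ : ℝ}

theorem block_error_small_le (hg : 1 ≤ g) (hgξ : g ≤ ξ) (hυ : 0 < υ) (hυξ : υ ≤ ξ ^ 2)
    (h1 : υ ^ 4 / 2 ≤ μ) (h2 : μ ≤ υ ^ 4) :
    fourthRoot ((ξ ^ 6 / g ^ 4) ^ 8 *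
      ((ξ ^ 6 / g ^ 4) ^ 4 + (1 + (ξ ^ 6 / g ^ 4) ^ 4 * (υ ^ 2 * g ^ 4 / μ ^ 2)) ^ 2 +
        ξ ^ 20 * υ ^ 4 / (g ^ 24 * μ ^ 2) *
          (1 + (ξ ^ 6 / g ^ 4) ^ 4 * (υ ^ 2 * g ^ 4 / μ ^ 2))) * μ ^ 3 *
      (μ ^ 2 * ξ ^ 4 * g ^ 8 / υ ^ 4) * (1 + μ ^ 2 * ξ ^ 4 * g ^ 8 / υ ^ 8) * 8) ≤
    6 * (ξ ^ 26 * υ / g ^ 8) := by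
  have hg0 : 0 < g := by linarith
  have hξ : 1 ≤ ξ := hg.trans hgξ
  have hξ0 : 0 < ξ := by linarith
  have hμ : 0 < μ := lt_of_lt_of_le (by positivity) h1
  have hμ2 : υ ^ 8 / 4 ≤ μ ^ 2 := by
    calc υ ^ 8 / 4 = (υ ^ 4 / 2) ^ 2 := by ring
      _ ≤ _ := by gcongr
  have hT : υ ^ 2 * g ^ 4 / μ ^ 2 ≤ 4 * g ^ 4 / υ ^ 6 := by
    calc _ ≤ υ ^ 2 * g ^ 4 / (υ ^ 8 / 4) := by gcongr
      _ = _ := by field_simp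
  have hE : ξ ^ 20 * υ ^ 4 / (g ^ 24 * μ ^ 2) ≤ 4 * ξ ^ 20 / (g ^ 24 * υ ^ 4) := by
    calc _ ≤ ξ ^ 20 * υ ^ 4 / (g ^ 24 * (υ ^ 8 / 4)) := by gcongr
      _ = _ := by field_simp
  have hN : μ ^ 2 * ξ ^ 4 * g ^ 8 / υ ^ 8 ≤ ξ ^ 4 * g ^ 8 := by
    calc _ ≤ (υ ^ 4) ^ 2 * ξ ^ 4 * g ^ 8 / υ ^ 8 := by gcongr
      _ = _ := by field_simp
  have hN1 : 1 ≤ ξ ^ 4 * g ^ 8 := one_le_mul_of_one_le_of_one_le (one_le_pow₀ hξ) (one_le_pow₀ hg)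
  set B := (ξ ^ 6 / g ^ 4) ^ 4 + (1 + (ξ ^ 6 / g ^ 4) ^ 4 * (4 * g ^ 4 / υ ^ 6)) ^ 2 +
    4 * ξ ^ 20 / (g ^ 24 * υ ^ 4) * (1 + (ξ ^ 6 / g ^ 4) ^ 4 * (4 * g ^ 4 / υ ^ 6)) with hB
  have hB1 : B * (υ ^ 12 * g ^ 16) ≤ 47 * ξ ^ 48 := by
    have e : B * (υ ^ 12 * g ^ 16) = ξ ^ 24 * υ ^ 12 + υ ^ 12 * g ^ 16 + 8 * (ξ ^ 24 * υ ^ 6 * g ^ 4)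
        + 16 * (ξ ^ 48 / g ^ 8) + 4 * (ξ ^ 20 * υ ^ 8 / g ^ 8) + 16 * (ξ ^ 44 * υ ^ 2 / g ^ 20) := by
      rw [hB]; field_simp; ring
    have b1 : ξ ^ 24 * υ ^ 12 ≤ ξ ^ 48 := by
      calc _ ≤ ξ ^ 24 * (ξ ^ 2) ^ 12 := by gcongr
        _ = _ := by ring
    have b2 : υ ^ 12 * g ^ 16 ≤ ξ ^ 48 := by
      calc _ ≤ (ξ ^ 2) ^ 12 * ξ ^ 16 := by gcongr
        _ = ξ ^ 40 := by ring
        _ ≤ _ := pow_le_pow_right₀ hξ (by norm_num)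
    have b3 : ξ ^ 24 * υ ^ 6 * g ^ 4 ≤ ξ ^ 48 := by
      calc _ ≤ ξ ^ 24 * (ξ ^ 2) ^ 6 * ξ ^ 4 := by gcongr
        _ = ξ ^ 40 := by ring
        _ ≤ _ := pow_le_pow_right₀ hξ (by norm_num)
    have b4 : ξ ^ 48 / g ^ 8 ≤ ξ ^ 48 := div_le_self (by positivity) (one_le_pow₀ hg)
    have b5 : ξ ^ 20 * υ ^ 8 / g ^ 8 ≤ ξ ^ 48 := by
      calc _ ≤ ξ ^ 20 * υ ^ 8 := div_le_self (by positivity) (one_le_pow₀ hg)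
        _ ≤ ξ ^ 20 * (ξ ^ 2) ^ 8 := by gcongr
        _ = ξ ^ 36 := by ring
        _ ≤ _ := pow_le_pow_right₀ hξ (by norm_num)
    have b6 : ξ ^ 44 * υ ^ 2 / g ^ 20 ≤ ξ ^ 48 := by
      calc _ ≤ ξ ^ 44 * υ ^ 2 := div_le_self (by positivity) (one_le_pow₀ hg)
        _ ≤ ξ ^ 44 * (ξ ^ 2) ^ 2 := by gcongr
        _ = _ := by ring
    have b0 : 0 ≤ ξ ^ 48 := by positivity
    rw [e]
    linarith
  have hB2 : (ξ ^ 6 / g ^ 4) ^ 4 + (1 + (ξ ^ 6 / g ^ 4) ^ 4 * (υ ^ 2 * g ^ 4 / μ ^ 2)) ^ 2 +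
      ξ ^ 20 * υ ^ 4 / (g ^ 24 * μ ^ 2) *
        (1 + (ξ ^ 6 / g ^ 4) ^ 4 * (υ ^ 2 * g ^ 4 / μ ^ 2)) ≤ B := by
    rw [hB]
    gcongr
  refine fourthRoot_le (by positivity) ?_
  calc _ ≤ (ξ ^ 6 / g ^ 4) ^ 8 * B * (υ ^ 4) ^ 3 * ((υ ^ 4) ^ 2 * ξ ^ 4 * g ^ 8 / υ ^ 4) *
      (ξ ^ 4 * g ^ 8 + ξ ^ 4 * g ^ 8) * 8 := by gcongr
    _ = 16 * (B * (υ ^ 12 * g ^ 16)) * (ξ ^ 56 * υ ^ 4 / g ^ 32) := by field_simp; ring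
    _ ≤ 16 * (47 * ξ ^ 48) * (ξ ^ 56 * υ ^ 4 / g ^ 32) := by gcongr
    _ = 752 * (ξ ^ 26 * υ / g ^ 8) ^ 4 := by field_simp; ring
    _ ≤ 1296 * (ξ ^ 26 * υ / g ^ 8) ^ 4 := by gcongr; norm_num
    _ = _ := by ring

theorem block_error_large_le (hg : 1 ≤ g) (hgξ : g ≤ ξ) (hυ : ξ ^ 2 ≤ υ)
    (hυg : υ ≤ 4 * (ξ ^ 2 * g ^ 2)) (h1 : ξ ^ 8 / 2 ≤ μ) (h2 : μ ≤ ξ ^ 8) :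
    fourthRoot ((ξ ^ 6 / g ^ 4) ^ 8 *
      ((ξ ^ 6 / g ^ 4) ^ 4 + (1 + (ξ ^ 6 / g ^ 4) ^ 4 * (υ ^ 2 * g ^ 4 / μ ^ 2)) ^ 2 +
        ξ ^ 20 * υ ^ 4 / (g ^ 24 * μ ^ 2) *
          (1 + (ξ ^ 6 / g ^ 4) ^ 4 * (υ ^ 2 * g ^ 4 / μ ^ 2))) * μ ^ 3 *
      (μ ^ 2 * ξ ^ 4 * g ^ 8 / υ ^ 4) * (1 + μ ^ 2 * ξ ^ 4 * g ^ 8 / υ ^ 8) *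
        (8 * (1 + υ ^ 12 / (ξ ^ 24 * g ^ 8)))) ≤
    500 * (ξ ^ 28 / g ^ 8 * ((ξ ^ 2 / υ) ^ 2 + 1 / g)) := by
  have hg0 : 0 < g := by linarith
  have hξ : 1 ≤ ξ := hg.trans hgξ
  have hξ0 : 0 < ξ := by linarith
  have hυ0 : 0 < υ := lt_of_lt_of_le (by positivity) hυ
  have hμ : 0 < μ := lt_of_lt_of_le (by positivity) h1
  have hμ2 : ξ ^ 16 / 4 ≤ μ ^ 2 := by
    calc ξ ^ 16 / 4 = (ξ ^ 8 / 2) ^ 2 := by ring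
      _ ≤ _ := by gcongr
  have hT : υ ^ 2 * g ^ 4 / μ ^ 2 ≤ 4 * (υ ^ 2 * g ^ 4) / ξ ^ 16 := by
    calc _ ≤ υ ^ 2 * g ^ 4 / (ξ ^ 16 / 4) := by gcongr
      _ = _ := by field_simp
  have hE : ξ ^ 20 * υ ^ 4 / (g ^ 24 * μ ^ 2) ≤ 4 * ξ ^ 4 * υ ^ 4 / g ^ 24 := by
    calc _ ≤ ξ ^ 20 * υ ^ 4 / (g ^ 24 * (ξ ^ 16 / 4)) := by gcongr
      _ = _ := by field_simp
  set B := (ξ ^ 6 / g ^ 4) ^ 4 + (1 + (ξ ^ 6 / g ^ 4) ^ 4 * (4 * (υ ^ 2 * g ^ 4) / ξ ^ 16)) ^ 2 +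
    4 * ξ ^ 4 * υ ^ 4 / g ^ 24 * (1 + (ξ ^ 6 / g ^ 4) ^ 4 * (4 * (υ ^ 2 * g ^ 4) / ξ ^ 16)) with hB
  have hB1 : B ≤ 100000 * (ξ ^ 24 / g ^ 16) := by
    have e : B = ξ ^ 24 / g ^ 16 + 1 + 8 * (ξ ^ 8 * υ ^ 2 / g ^ 12)
        + 16 * (ξ ^ 16 * υ ^ 4 / g ^ 24) + 4 * (ξ ^ 4 * υ ^ 4 / g ^ 24)
        + 16 * (ξ ^ 12 * υ ^ 6 / g ^ 36) := by
      rw [hB]; field_simp; ring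
    have b1 : 1 ≤ ξ ^ 24 / g ^ 16 := by
      rw [one_le_div (by positivity)]
      calc g ^ 16 ≤ ξ ^ 16 := by gcongr
        _ ≤ _ := pow_le_pow_right₀ hξ (by norm_num)
    have b2 : ξ ^ 8 * υ ^ 2 / g ^ 12 ≤ 16 * (ξ ^ 24 / g ^ 16) := by
      calc _ ≤ ξ ^ 8 * (4 * (ξ ^ 2 * g ^ 2)) ^ 2 / g ^ 12 := by gcongr
        _ = 16 * (ξ ^ 12 * g ^ 8 / g ^ 16) := by field_simp; ring
        _ ≤ 16 * (ξ ^ 12 * ξ ^ 8 / g ^ 16) := by gcongr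
        _ = 16 * (ξ ^ 20 / g ^ 16) := by ring
        _ ≤ _ := by gcongr <;> first | assumption | norm_num
    have b3 : ξ ^ 16 * υ ^ 4 / g ^ 24 ≤ 256 * (ξ ^ 24 / g ^ 16) := by
      calc _ ≤ ξ ^ 16 * (4 * (ξ ^ 2 * g ^ 2)) ^ 4 / g ^ 24 := by gcongr
        _ = _ := by field_simp; ring
    have b4 : ξ ^ 4 * υ ^ 4 / g ^ 24 ≤ 256 * (ξ ^ 24 / g ^ 16) := by
      refine le_trans ?_ b3
      gcongr <;> first | assumption | norm_num
    have b5 : ξ ^ 12 * υ ^ 6 / g ^ 36 ≤ 4096 * (ξ ^ 24 / g ^ 16) := by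
      calc _ ≤ ξ ^ 12 * (4 * (ξ ^ 2 * g ^ 2)) ^ 6 / g ^ 36 := by gcongr
        _ = 4096 * (ξ ^ 24 / g ^ 24) := by field_simp; ring
        _ ≤ _ := by gcongr <;> first | assumption | norm_num
    rw [e]
    linarith
  refine fourthRoot_le (by positivity) ?_
  have hs : ξ ^ 2 / υ ≤ 1 := (div_le_one hυ0).2 hυ
  have hs0 : 0 ≤ ξ ^ 2 / υ := by positivity
  calc _ ≤ (ξ ^ 6 / g ^ 4) ^ 8 * (100000 * (ξ ^ 24 / g ^ 16)) * (ξ ^ 8) ^ 3 *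
      ((ξ ^ 8) ^ 2 * ξ ^ 4 * g ^ 8 / υ ^ 4) * (1 + (ξ ^ 8) ^ 2 * ξ ^ 4 * g ^ 8 / υ ^ 8) *
        (8 * (1 + υ ^ 12 / (ξ ^ 24 * g ^ 8))) := by
        have : (ξ ^ 6 / g ^ 4) ^ 4 + (1 + (ξ ^ 6 / g ^ 4) ^ 4 * (υ ^ 2 * g ^ 4 / μ ^ 2)) ^ 2 +
          ξ ^ 20 * υ ^ 4 / (g ^ 24 * μ ^ 2) *
          (1 + (ξ ^ 6 / g ^ 4) ^ 4 * (υ ^ 2 * g ^ 4 / μ ^ 2)) ≤ 100000 * (ξ ^ 24 / g ^ 16) := by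
          refine le_trans ?_ hB1
          rw [hB]
          gcongr
        gcongr
    _ = 800000 * (ξ ^ 108 / g ^ 40 * (ξ ^ 2 / υ) ^ 4 + ξ ^ 112 / g ^ 32 * (ξ ^ 2 / υ) ^ 12 +
        ξ ^ 92 * υ ^ 8 / g ^ 48 + ξ ^ 112 / g ^ 40) := by field_simp; ring
    _ ≤ 800000 * (ξ ^ 112 / g ^ 36 + ξ ^ 112 / g ^ 32 * (ξ ^ 2 / υ) ^ 8 +
        65536 * (ξ ^ 112 / g ^ 36) + ξ ^ 112 / g ^ 36) := by
        have d1 : ξ ^ 108 / g ^ 40 * (ξ ^ 2 / υ) ^ 4 ≤ ξ ^ 112 / g ^ 36 := by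
          calc _ ≤ ξ ^ 108 / g ^ 40 * 1 := by gcongr; exact pow_le_one₀ hs0 hs
            _ = ξ ^ 108 / g ^ 40 := mul_one _
            _ ≤ _ := by gcongr <;> first | assumption | norm_num
        have d2 : (ξ ^ 2 / υ) ^ 12 ≤ (ξ ^ 2 / υ) ^ 8 := pow_le_pow_of_le_one hs0 hs (by norm_num)
        have d3 : ξ ^ 92 * υ ^ 8 / g ^ 48 ≤ 65536 * (ξ ^ 112 / g ^ 36) := by
          calc _ ≤ ξ ^ 92 * (4 * (ξ ^ 2 * g ^ 2)) ^ 8 / g ^ 48 := by gcongr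
            _ = 65536 * (ξ ^ 108 * g ^ 4 / g ^ 36) := by field_simp; ring
            _ ≤ 65536 * (ξ ^ 108 * ξ ^ 4 / g ^ 36) := by gcongr
            _ = _ := by ring
        gcongr
        norm_num
    _ ≤ 62500000000 * (ξ ^ 112 / g ^ 32 * (((ξ ^ 2 / υ) ^ 2) ^ 4 + (1 / g) ^ 4)) := by
        have e1 : ξ ^ 112 / g ^ 32 * (((ξ ^ 2 / υ) ^ 2) ^ 4 + (1 / g) ^ 4) =
          ξ ^ 112 / g ^ 32 * (ξ ^ 2 / υ) ^ 8 + ξ ^ 112 / g ^ 36 := by field_simp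
        rw [e1]
        have p1 : 0 ≤ ξ ^ 112 / g ^ 32 * (ξ ^ 2 / υ) ^ 8 := by positivity
        have p2 : 0 ≤ ξ ^ 112 / g ^ 36 := by positivity
        linarith
    _ ≤ 62500000000 * (ξ ^ 112 / g ^ 32 * ((ξ ^ 2 / υ) ^ 2 + 1 / g) ^ 4) := by
        have hadd : ((ξ ^ 2 / υ) ^ 2) ^ 4 + (1 / g) ^ 4 ≤ ((ξ ^ 2 / υ) ^ 2 + 1 / g) ^ 4 :=
          pow_add_pow_le (by positivity) (by positivity) (by norm_num)
        gcongr
    _ = _ := by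
        have : (ξ ^ 28 / g ^ 8) ^ 4 = ξ ^ 112 / g ^ 32 := by rw [div_pow]; ring_nf
        rw [mul_pow, mul_pow, this]
        norm_num

end

open Classical in
theorem block_hits_small : ∃ C : ℝ, 0 < C ∧ ∀ (ξ g υ σ : ℝ) (μ : ℕ) (V : Finset (ℤ × ℤ))
    (bar : ℤ × ℤ → ℤ × ℤ) (x y : ℤ × ℤ → ℝ), 1 ≤ g → g ≤ ξ → |σ| = 1 → 0 < υ →
    640 * g ^ 4 ≤ υ ^ 2 →
    υ ≤ ξ ^ 2 → υ ^ 4 / 2 ≤ μ → μ ≤ υ ^ 4 →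
    (∀ v ∈ V, crossZ v (bar v) = 1 ∧ (ξ ^ 6 / g ^ 4) ^ 4 / 256 ≤ sqLen v ∧
      (sqLen v : ℝ) ≤ (ξ ^ 6 / g ^ 4) ^ 4) →
    (∀ v ∈ V, υ ^ 4 ≤ y v ∧ y v < υ ^ 4 + 1) →
    ∑ v ∈ V, (((Finset.range μ).filter fun j : ℕ => ∃ n : ℤ,
      |x v + phaseSlope (√2 * ξ ^ 22) σ v (bar v) (y v) * j +
        bendCoeff (√2 * ξ ^ 22) v * sqrtBend (y v) j - n| * υ ^ 2 ≤ 16 * g ^ 4).card : ℝ) ≤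
    C * (ξ ^ 26 * υ / g ^ 8) := by
  obtain ⟨C, hC, h⟩ := block_hits_scaled 4 (by norm_num)
  refine ⟨C * 7, by positivity, ?_⟩
  intro ξ g υ σ μ V bar x y hg hgξ hσ hυ hgυ hυξ h1 h2 hV hy
  have hg0 : 0 < g := by linarith
  have hξ : 1 ≤ ξ := hg.trans hgξ
  have hξ0 : 0 < ξ := by linarith
  have hg8 : 1 ≤ g ^ 8 := one_le_pow₀ hg
  have hg12 : 1 ≤ g ^ 12 := one_le_pow₀ hg
  have hg24 : 1 ≤ g ^ 24 := one_le_pow₀ hg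
  have hμ2 : υ ^ 8 / 4 ≤ (μ : ℝ) ^ 2 := by
    calc υ ^ 8 / 4 = (υ ^ 4 / 2) ^ 2 := by ring
      _ ≤ _ := by gcongr
  have hsμ : υ ^ 2 / 2 ≤ √(μ : ℝ) := by
    apply Real.le_sqrt_of_sq_le
    have : 0 < υ ^ 4 := by positivity
    calc (υ ^ 2 / 2) ^ 2 = υ ^ 4 / 4 := by ring
      _ ≤ _ := by linarith
  have hυ0 : 1 ≤ υ ^ 2 := by
    have : 1 ≤ g ^ 4 := one_le_pow₀ hg
    linarith
  have hυ4 : 1 ≤ υ ^ 4 := by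
    calc (1 : ℝ) ≤ (υ ^ 2) ^ 2 := one_le_pow₀ hυ0
      _ = _ := by ring
  have hυ2 : υ ^ 2 ≤ ξ ^ 4 := by
    calc υ ^ 2 ≤ (ξ ^ 2) ^ 2 := by gcongr
      _ = _ := by ring
  refine (h ξ g υ σ 8 μ V bar x y hg hgξ hυ hσ (by norm_num) hgυ h2 ?_ ?_ ?_ ?_ ?_ hV hy).trans ?_
  · calc υ ^ 4 ≤ 2 * (1 * μ) := by linarith
      _ ≤ 25600 * (g ^ 8 * μ) := by gcongr; norm_num
      _ = _ := by ring
  · calc υ ^ 6 = 2 * (υ ^ 4 / 2 * υ ^ 2 * 1) := by ring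
      _ ≤ 4 * (μ * ξ ^ 4 * g ^ 12) := by gcongr; norm_num
  · calc υ ^ 12 = 4 * ((υ ^ 2) ^ 2 * 1 * (υ ^ 8 / 4)) := by ring
      _ ≤ 4 * ((ξ ^ 4) ^ 2 * g ^ 24 * μ ^ 2) := by gcongr
      _ = 4 * (ξ ^ 8 * g ^ 24 * μ ^ 2) := by ring
      _ ≤ _ := by gcongr <;> first | assumption | norm_num
  · calc υ ^ 12 = 8 * (υ ^ 2 * 1 * (υ ^ 8 / 4 * (υ ^ 2 / 2))) := by ring
      _ ≤ _ := by gcongr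
  · calc υ ^ 4 = 4 * (υ ^ 4 / 4 * 1 * 1) := by ring
      _ ≤ 4 * (υ ^ 8 / 4 * ξ ^ 4 * g ^ 8) := by
        have : υ ^ 4 ≤ υ ^ 8 := by
          calc υ ^ 4 = υ ^ 4 * 1 := by ring
            _ ≤ υ ^ 4 * υ ^ 4 := by gcongr
            _ = _ := by ring
        have h3 : 1 ≤ ξ ^ 4 := one_le_pow₀ hξ
        gcongr
      _ ≤ _ := by gcongr
  · rw [mul_assoc C]
    refine mul_le_mul_of_nonneg_left ?_ hC.le
    have := block_error_small_le hg hgξ hυ hυξ h1 h2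
    have hm : ξ ^ 24 / g ^ 12 * (μ / υ ^ 2) ≤ ξ ^ 26 * υ / g ^ 8 := by
      calc _ ≤ ξ ^ 24 / g ^ 12 * (υ ^ 4 / υ ^ 2) := by gcongr
        _ = ξ ^ 24 * υ * υ / g ^ 12 := by field_simp
        _ ≤ ξ ^ 24 * ξ ^ 2 * υ / g ^ 8 := by gcongr <;> first | assumption | norm_num
        _ = _ := by ring
    linarith

open Classical in
theorem block_hits_large : ∃ C : ℝ, 0 < C ∧ ∀ (ξ g υ σ : ℝ) (μ : ℕ) (V : Finset (ℤ × ℤ))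
    (bar : ℤ × ℤ → ℤ × ℤ) (x y : ℤ × ℤ → ℝ), 1 ≤ g → g ≤ ξ → |σ| = 1 → 0 < υ →
    640 * g ^ 4 ≤ υ ^ 2 →
    ξ ^ 2 ≤ υ → υ ≤ 4 * (ξ ^ 2 * g ^ 2) → ξ ^ 8 / 2 ≤ μ → μ ≤ ξ ^ 8 →
    (∀ v ∈ V, crossZ v (bar v) = 1 ∧ (ξ ^ 6 / g ^ 4) ^ 4 / 256 ≤ sqLen v ∧
      (sqLen v : ℝ) ≤ (ξ ^ 6 / g ^ 4) ^ 4) →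
    (∀ v ∈ V, υ ^ 4 ≤ y v ∧ y v < υ ^ 4 + 1) →
    ∑ v ∈ V, (((Finset.range μ).filter fun j : ℕ => ∃ n : ℤ,
      |x v + phaseSlope (√2 * ξ ^ 22) σ v (bar v) (y v) * j +
        bendCoeff (√2 * ξ ^ 22) v * sqrtBend (y v) j - n| * υ ^ 2 ≤ 16 * g ^ 4).card : ℝ) ≤
    C * (ξ ^ 28 / g ^ 8 * ((ξ ^ 2 / υ) ^ 2 + 1 / g)) := by
  obtain ⟨C, hC, h⟩ := block_hits_scaled 67108864 (by norm_num)
  refine ⟨C * 501, by positivity, ?_⟩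
  intro ξ g υ σ μ V bar x y hg hgξ hσ hυ hgυ hυξ hυg h1 h2 hV hy
  have hg0 : 0 < g := by linarith
  have hξ : 1 ≤ ξ := hg.trans hgξ
  have hξ0 : 0 < ξ := by linarith
  have hμ2 : ξ ^ 16 / 4 ≤ (μ : ℝ) ^ 2 := by
    calc ξ ^ 16 / 4 = (ξ ^ 8 / 2) ^ 2 := by ring
      _ ≤ _ := by gcongr
  have hsμ : ξ ^ 4 / 2 ≤ √(μ : ℝ) := by
    apply Real.le_sqrt_of_sq_le
    have : 0 < ξ ^ 8 := by positivity
    calc (ξ ^ 4 / 2) ^ 2 = ξ ^ 8 / 4 := by ring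
      _ ≤ _ := by linarith
  have hυ4 : υ ^ 4 ≤ 256 * (ξ ^ 8 * g ^ 8) := by
    calc υ ^ 4 ≤ (4 * (ξ ^ 2 * g ^ 2)) ^ 4 := by gcongr
      _ = _ := by ring
  have hυ6 : υ ^ 6 ≤ 4096 * (ξ ^ 12 * g ^ 12) := by
    calc υ ^ 6 ≤ (4 * (ξ ^ 2 * g ^ 2)) ^ 6 := by gcongr
      _ = _ := by ring
  have hL0 : 0 ≤ υ ^ 12 / (ξ ^ 24 * g ^ 8) := by positivity
  have hμυ : (μ : ℝ) ≤ υ ^ 4 := by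
    calc (μ : ℝ) ≤ (ξ ^ 2) ^ 4 := h2.trans (le_of_eq (by ring))
      _ ≤ _ := by gcongr
  refine (h ξ g υ σ (8 * (1 + υ ^ 12 / (ξ ^ 24 * g ^ 8))) μ V bar x y hg hgξ hυ hσ (by linarith) hgυ
    hμυ ?_ ?_ ?_ ?_ ?_ hV hy).trans ?_
  · calc υ ^ 4 ≤ 512 * (ξ ^ 8 / 2 * g ^ 8) := hυ4.trans (le_of_eq (by ring))
      _ ≤ 25600 * (μ * g ^ 8) := by gcongr; norm_num
      _ = _ := by ring
  · calc υ ^ 6 ≤ 8192 * (ξ ^ 8 / 2 * ξ ^ 4 * g ^ 12) := hυ6.trans (le_of_eq (by ring))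
      _ ≤ _ := by gcongr; norm_num
  · calc υ ^ 12 = (υ ^ 6) ^ 2 := by ring
      _ ≤ (4096 * (ξ ^ 12 * g ^ 12)) ^ 2 := by gcongr
      _ = 67108864 * (ξ ^ 8 * g ^ 24 * (ξ ^ 16 / 4)) := by ring
      _ ≤ 67108864 * (ξ ^ 12 * g ^ 24 * (ξ ^ 16 / 4)) := by gcongr <;> first | assumption | norm_num
      _ ≤ _ := by gcongr
  · calc υ ^ 12 = 8 * (υ ^ 12 / (ξ ^ 24 * g ^ 8)) * (ξ ^ 4 * g ^ 8 * (ξ ^ 16 / 4 * (ξ ^ 4 / 2))) := by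
          field_simp; norm_num
      _ ≤ 8 * (1 + υ ^ 12 / (ξ ^ 24 * g ^ 8)) * (ξ ^ 4 * g ^ 8 * (μ ^ 2 * √(μ : ℝ))) := by
          gcongr
          linarith
  · calc υ ^ 4 ≤ 256 * (ξ ^ 8 * g ^ 8) := hυ4
      _ ≤ 256 * (ξ ^ 20 * g ^ 8) := by gcongr <;> first | assumption | norm_num
      _ = 1024 * (ξ ^ 16 / 4 * ξ ^ 4 * g ^ 8) := by ring
      _ ≤ _ := by gcongr; norm_num
  · rw [mul_assoc C]
    refine mul_le_mul_of_nonneg_left ?_ hC.le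
    have := block_error_large_le hg hgξ hυξ hυg h1 h2
    have hm : ξ ^ 24 / g ^ 12 * (μ / υ ^ 2) ≤ ξ ^ 28 / g ^ 8 * ((ξ ^ 2 / υ) ^ 2 + 1 / g) := by
      calc _ ≤ ξ ^ 24 / g ^ 12 * (ξ ^ 8 / υ ^ 2) := by gcongr
        _ = ξ ^ 28 / g ^ 12 * ((ξ ^ 2 / υ) ^ 2 + 0) := by field_simp; ring
        _ ≤ _ := by gcongr <;> first | exact hg | positivity | norm_num
    linarith

/-- The component of `n - a` along `v`, scaled by `|v|`. -/
def latDot (a : ℝ × ℝ) (v n : ℤ × ℤ) : ℝ := v.1 * (n.1 - a.1) + v.2 * (n.2 - a.2)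

/-- The component of `n - a` orthogonal to `v`, scaled by `|v|`. -/
def latCross (a : ℝ × ℝ) (v n : ℤ × ℤ) : ℝ := v.1 * (n.2 - a.2) - v.2 * (n.1 - a.1)

/-- The depth of `n` below the tangent to the circle of radius `ξ ^ 44` parallel to `v`, scaled by
`|v|`. -/
def shellHeight (ξ : ℝ) (a : ℝ × ℝ) (v n : ℤ × ℤ) : ℝ :=
  fourthRoot (sqLen v) ^ 2 * ξ ^ 44 - latCross a v n

/-- `n` lies close to the circle of radius `ξ ^ 44` around `a`, and near the point where the tangent
has the primitive direction `v`, whose length is about `ξ ^ 12 / g ^ 8`. -/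
structure ShellPoint (ξ g : ℝ) (a : ℝ × ℝ) (v n : ℤ × ℤ) : Prop where
  coprime : IsCoprime v.1 v.2
  lower : (ξ ^ 6 / g ^ 4) ^ 4 / 256 ≤ sqLen v
  upper : (sqLen v : ℝ) ≤ (ξ ^ 6 / g ^ 4) ^ 4
  cross_pos : 0 < latCross a v n
  dot_le : |latDot a v n| ≤ 3 * ξ ^ 32
  inner : ξ ^ 88 ≤ (n.1 - a.1) ^ 2 + (n.2 - a.2) ^ 2
  outer : (n.1 - a.1) ^ 2 + (n.2 - a.2) ^ 2 ≤ ξ ^ 88 + 3 * ξ ^ 28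

theorem latDot_sub (a : ℝ × ℝ) (v n n' : ℤ × ℤ) :
    latDot a v n - latDot a v n' = dotZ v (n - n') := by
  simp only [latDot, dotZ, Prod.fst_sub, Prod.snd_sub]; push_cast; ring

theorem latCross_sub (a : ℝ × ℝ) (v n n' : ℤ × ℤ) :
    latCross a v n - latCross a v n' = crossZ v (n - n') := by
  simp only [latCross, crossZ, Prod.fst_sub, Prod.snd_sub]; push_cast; ring

theorem latDot_sq_add (a : ℝ × ℝ) (v n : ℤ × ℤ) : latDot a v n ^ 2 + latCross a v n ^ 2 =
    sqLen v * (((n.1 : ℝ) - a.1) ^ 2 + (n.2 - a.2) ^ 2) := by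
  simp only [latDot, latCross, sqLen]; push_cast; ring

theorem card_le_of_separated {ι : Type*} (S : Finset ι) (f : ι → ℝ) {d Δ : ℝ} (hd : 0 < d)
    (hΔ : 0 ≤ Δ) (hsep : ∀ i ∈ S, ∀ j ∈ S, i ≠ j → d ≤ |f i - f j|)
    (hdiam : ∀ i ∈ S, ∀ j ∈ S, |f i - f j| ≤ Δ * d) : (S.card : ℝ) ≤ Δ + 1 := by
  rcases S.eq_empty_or_nonempty with rfl | hne
  · simp; linarith
  obtain ⟨i₀, hi₀, hmin⟩ := S.exists_min_image f hne
  have hmaps : Set.MapsTo (fun i => ⌊(f i - f i₀) / d⌋₊) S (Finset.range (⌊Δ⌋₊ + 1)) := by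
    intro i hi
    simp only [Finset.coe_range, Set.mem_Iio]
    refine Nat.lt_succ_of_le (Nat.floor_le_floor ?_)
    rw [div_le_iff₀ hd]
    exact (le_abs_self _).trans (hdiam i hi i₀ hi₀)
  have hinj : Set.InjOn (fun i => ⌊(f i - f i₀) / d⌋₊) S := by
    intro i hi j hj hij
    by_contra hne'
    have h1 := hsep i hi j hj hne'
    simp only at hij
    have a1 : 0 ≤ (f i - f i₀) / d := div_nonneg (by linarith [hmin i hi]) hd.le
    have a2 : 0 ≤ (f j - f i₀) / d := div_nonneg (by linarith [hmin j hj]) hd.le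
    have b1 := Nat.floor_le a1
    have b2 := Nat.floor_le a2
    have c1 := Nat.lt_floor_add_one ((f i - f i₀) / d)
    have c2 := Nat.lt_floor_add_one ((f j - f i₀) / d)
    rw [hij] at b1 c1
    have h2 : |(f i - f i₀) / d - (f j - f i₀) / d| < 1 := by rw [abs_lt]; constructor <;> linarith
    rw [← sub_div, abs_div, abs_of_pos hd, div_lt_one hd] at h2
    have : f i - f i₀ - (f j - f i₀) = f i - f j := by ring
    rw [this] at h2
    linarith
  have := Finset.card_le_card_of_injOn _ hmaps hinj
  rw [Finset.card_range] at this
  calc (S.card : ℝ) ≤ ((⌊Δ⌋₊ + 1 : ℕ) : ℝ) := by exact_mod_cast this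
    _ ≤ Δ + 1 := by push_cast; linarith [Nat.floor_le hΔ]

theorem sqLen_le_of_crossZ_eq_zero {v d : ℤ × ℤ} (hv : IsCoprime v.1 v.2) (hd : d ≠ 0)
    (h : crossZ v d = 0) : sqLen v ≤ |dotZ v d| := by
  unfold crossZ at h
  obtain ⟨p, q, hpq⟩ := hv
  obtain ⟨k, hk, hdk⟩ : ∃ k, d.1 = v.1 * k ∧ d.2 = v.2 * k :=
    ⟨p * d.1 + q * d.2, by linear_combination -d.1 * hpq - q * h, by
      linear_combination -d.2 * hpq + p * h⟩
  have hk0 : k ≠ 0 := by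
    rintro rfl
    apply hd
    ext <;> simp [hk, hdk]
  have e : dotZ v d = sqLen v * k := by unfold dotZ sqLen; rw [hk, hdk]; ring
  rw [e, abs_mul, abs_of_nonneg (by unfold sqLen; positivity : 0 ≤ sqLen v)]
  have : 1 ≤ |k| := Int.one_le_abs hk0
  have : 0 ≤ sqLen v := by unfold sqLen; positivity
  nlinarith

namespace ShellPoint
variable {ξ g : ℝ} {a : ℝ × ℝ} {v n n' : ℤ × ℤ}

theorem fourthRoot_bounds (h : ShellPoint ξ g a v n) (hξ : 1 ≤ ξ) (hg : 1 ≤ g) :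
    ξ ^ 6 ≤ 4 * (g ^ 4 * fourthRoot (sqLen v)) ∧ fourthRoot (sqLen v) ≤ ξ ^ 6 / g ^ 4 ∧
      fourthRoot (sqLen v) ^ 4 = sqLen v ∧ 0 < fourthRoot (sqLen v) ∧
      fourthRoot (sqLen v) ≤ ξ ^ 6 := by
  have hg0 : 0 < g := by linarith
  have hξ0 : 0 < ξ := by linarith
  have hw : 0 < ξ ^ 6 / g ^ 4 := by positivity
  obtain ⟨h1, h2, h3⟩ := fourthRoot_sqLen_bounds hw h.lower h.upper
  refine ⟨?_, h2, h3, by linarith, h2.trans (div_le_self (by positivity) (one_le_pow₀ hg))⟩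
  rw [div_div, div_le_iff₀ (by positivity)] at h1
  linarith

theorem dot_sq (h : ShellPoint ξ g a v n) (hξ : 1 ≤ ξ) (hg : 1 ≤ g) :
    2 * (fourthRoot (sqLen v) ^ 2 * ξ ^ 44 * shellHeight ξ a v n) - shellHeight ξ a v n ^ 2 ≤
      latDot a v n ^ 2 ∧ latDot a v n ^ 2 ≤
    2 * (fourthRoot (sqLen v) ^ 2 * ξ ^ 44 * shellHeight ξ a v n) - shellHeight ξ a v n ^ 2 +
      3 * (fourthRoot (sqLen v) ^ 4 * ξ ^ 28) := by
  obtain ⟨-, -, e, hw, -⟩ := h.fourthRoot_bounds hξ hg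
  have h1 := latDot_sq_add a v n
  rw [← e] at h1
  have hD : latCross a v n = fourthRoot (sqLen v) ^ 2 * ξ ^ 44 - shellHeight ξ a v n := by
    unfold shellHeight; ring
  rw [hD] at h1
  set w := fourthRoot (sqLen v)
  have p := mul_le_mul_of_nonneg_left h.inner (by positivity : 0 ≤ w ^ 4)
  have q := mul_le_mul_of_nonneg_left h.outer (by positivity : 0 ≤ w ^ 4)
  constructor <;> nlinarith

theorem neg_one_lt_height (h : ShellPoint ξ g a v n) (hξ : 2 ≤ ξ) (hg : 1 ≤ g) :
    -1 < shellHeight ξ a v n := by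
  have hξ1 : 1 ≤ ξ := by linarith
  obtain ⟨-, -, e, hw, hw6⟩ := h.fourthRoot_bounds hξ1 hg
  obtain ⟨-, h2⟩ := h.dot_sq hξ1 hg
  set w := fourthRoot (sqLen v)
  set y := shellHeight ξ a v n
  by_contra! hy
  have h3 : w ^ 4 * ξ ^ 28 * 2 ≤ w ^ 2 * ξ ^ 44 := by
    calc w ^ 4 * ξ ^ 28 * 2 = w ^ 2 * ξ ^ 28 * (w ^ 2 * 2) := by ring
      _ ≤ w ^ 2 * ξ ^ 28 * ((ξ ^ 6) ^ 2 * ξ ^ 4) := by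
          have : (2 : ℝ) ≤ ξ ^ 4 := by
            calc (2 : ℝ) ≤ 2 ^ 4 := by norm_num
              _ ≤ _ := by gcongr
          gcongr
      _ = _ := by ring
  have h4 : 0 < w ^ 2 * ξ ^ 44 := by positivity
  have h5 : w ^ 2 * ξ ^ 44 * y ≤ w ^ 2 * ξ ^ 44 * (-1) := mul_le_mul_of_nonneg_left hy h4.le
  nlinarith [sq_nonneg (latDot a v n), sq_nonneg y]

theorem height_mul_le (h : ShellPoint ξ g a v n) (hξ : 1 ≤ ξ) (hg : 1 ≤ g)
    (hy : 0 ≤ shellHeight ξ a v n) :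
    fourthRoot (sqLen v) ^ 2 * ξ ^ 44 * shellHeight ξ a v n ≤ latDot a v n ^ 2 := by
  obtain ⟨h1, -⟩ := h.dot_sq hξ hg
  have hc := h.cross_pos
  have hD : latCross a v n = fourthRoot (sqLen v) ^ 2 * ξ ^ 44 - shellHeight ξ a v n := by
    unfold shellHeight; ring
  rw [hD] at hc
  nlinarith

theorem height_le (h : ShellPoint ξ g a v n) (hξ : 1 ≤ ξ) (hg : 1 ≤ g) :
    shellHeight ξ a v n ≤ 144 * (ξ ^ 8 * g ^ 8) := by
  have hg0 : 0 < g := by linarith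
  have hξ0 : 0 < ξ := by linarith
  rcases le_or_gt 0 (shellHeight ξ a v n) with hy | hy
  swap
  · exact hy.le.trans (by positivity)
  obtain ⟨h6, -, e, hw, -⟩ := h.fourthRoot_bounds hξ hg
  have h1 := h.height_mul_le hξ hg hy
  set w := fourthRoot (sqLen v)
  set y := shellHeight ξ a v n
  have h2 : latDot a v n ^ 2 ≤ (3 * ξ ^ 32) ^ 2 := sq_le_sq' (abs_le.1 h.dot_le).1 (abs_le.1 h.dot_le).2
  have h3 : ξ ^ 12 ≤ 16 * (g ^ 8 * w ^ 2) := by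
    calc ξ ^ 12 = (ξ ^ 6) ^ 2 := by ring
      _ ≤ (4 * (g ^ 4 * w)) ^ 2 := by gcongr
      _ = _ := by ring
  have h4 : ξ ^ 56 * y ≤ ξ ^ 56 * (144 * (ξ ^ 8 * g ^ 8)) := by
    calc ξ ^ 56 * y = ξ ^ 12 * (ξ ^ 44 * y) := by ring
      _ ≤ 16 * (g ^ 8 * w ^ 2) * (ξ ^ 44 * y) := by gcongr
      _ = 16 * g ^ 8 * (w ^ 2 * ξ ^ 44 * y) := by ring
      _ ≤ 16 * g ^ 8 * (3 * ξ ^ 32) ^ 2 := by gcongr; exact h1.trans h2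
      _ = _ := by ring
  exact le_of_mul_le_mul_left h4 (by positivity)

theorem abs_dot_sub_le (h : ShellPoint ξ g a v n) (h' : ShellPoint ξ g a v n') (hξ : 1 ≤ ξ)
    (hg : 1 ≤ g) (hy : shellHeight ξ a v n = shellHeight ξ a v n')
    (hs : 0 ≤ latDot a v n ↔ 0 ≤ latDot a v n') {s : ℝ} (hs0 : 0 < s)
    (hsy : s ^ 2 ≤ shellHeight ξ a v n) :
    |latDot a v n - latDot a v n'| ≤ 6 * g ^ 4 / s * sqLen v := by
  have hg0 : 0 < g := by linarith
  have hξ0 : 0 < ξ := by linarith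
  obtain ⟨h6, -, e, hw, -⟩ := h.fourthRoot_bounds hξ hg
  obtain ⟨l, u⟩ := h.dot_sq hξ hg
  obtain ⟨l', u'⟩ := h'.dot_sq hξ hg
  have m := h.height_mul_le hξ hg ((sq_nonneg s).trans hsy)
  have m' := h'.height_mul_le hξ hg (by rw [← hy]; exact (sq_nonneg s).trans hsy)
  rw [← hy] at l' u' m'
  rw [← e]
  set w := fourthRoot (sqLen v)
  set y := shellHeight ξ a v n
  set t := latDot a v n
  set t' := latDot a v n'
  have hm : (w * ξ ^ 22 * s) ^ 2 ≤ w ^ 2 * ξ ^ 44 * y := by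
    calc _ = w ^ 2 * ξ ^ 44 * s ^ 2 := by ring
      _ ≤ _ := by gcongr
  have k1 : w * ξ ^ 22 * s ≤ |t| := by
    rw [← abs_of_nonneg (by positivity : 0 ≤ w * ξ ^ 22 * s)]
    exact sq_le_sq.1 (hm.trans m)
  have k2 : w * ξ ^ 22 * s ≤ |t'| := by
    rw [← abs_of_nonneg (by positivity : 0 ≤ w * ξ ^ 22 * s)]
    exact sq_le_sq.1 (hm.trans m')
  have k3 : |t + t'| = |t| + |t'| := by
    rcases le_or_gt 0 t with ht | ht
    · rw [abs_of_nonneg ht, abs_of_nonneg (hs.1 ht), abs_of_nonneg (add_nonneg ht (hs.1 ht))]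
    · have ht' : t' < 0 := by
        by_contra! hc
        linarith [hs.2 hc]
      rw [abs_of_neg ht, abs_of_neg ht', abs_of_neg (by linarith)]; ring
  have k4 : |t - t'| * |t + t'| ≤ 3 * (w ^ 4 * ξ ^ 28) := by
    rw [← abs_mul, abs_le]
    constructor <;> nlinarith
  rw [k3] at k4
  have k5 : |t - t'| * (2 * (w * ξ ^ 22 * s)) ≤ 3 * (w ^ 4 * ξ ^ 28) := by
    refine le_trans ?_ k4
    gcongr
    linarith
  have k6 : |t - t'| * (2 * (w * ξ ^ 22 * s)) ≤ 6 * g ^ 4 / s * w ^ 4 * (2 * (w * ξ ^ 22 * s)) := by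
    refine k5.trans ?_
    calc 3 * (w ^ 4 * ξ ^ 28) = 3 * w ^ 4 * ξ ^ 22 * ξ ^ 6 := by ring
      _ ≤ 3 * w ^ 4 * ξ ^ 22 * (4 * (g ^ 4 * w)) := by gcongr
      _ = _ := by field_simp; ring
  exact le_of_mul_le_mul_right k6 (by positivity)

theorem abs_dot_le_of_height_lt_one (h : ShellPoint ξ g a v n) (hξ : 1 ≤ ξ) (hg : 1 ≤ g)
    (hy : shellHeight ξ a v n < 1) : |latDot a v n| ≤ 192 * (ξ ^ 4 * g ^ 12) * sqLen v := by
  have hg0 : 0 < g := by linarith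
  have hξ0 : 0 < ξ := by linarith
  obtain ⟨h6, -, e, hw, hw6⟩ := h.fourthRoot_bounds hξ hg
  obtain ⟨-, u⟩ := h.dot_sq hξ hg
  rw [← e]
  set w := fourthRoot (sqLen v)
  set y := shellHeight ξ a v n
  have h1 : w ^ 2 * ξ ^ 44 * y ≤ w ^ 2 * ξ ^ 44 * 1 := by gcongr
  have h2 : w ^ 4 * ξ ^ 28 ≤ w ^ 2 * ξ ^ 44 := by
    calc w ^ 4 * ξ ^ 28 = w ^ 2 * ξ ^ 28 * w ^ 2 := by ring
      _ ≤ w ^ 2 * ξ ^ 28 * (ξ ^ 6) ^ 2 := by gcongr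
      _ = w ^ 2 * ξ ^ 40 := by ring
      _ ≤ _ := by gcongr <;> first | assumption | norm_num
  have h3 : latDot a v n ^ 2 ≤ (3 * (w * ξ ^ 22)) ^ 2 := by
    have : 0 < w ^ 2 * ξ ^ 44 := by positivity
    nlinarith [sq_nonneg y]
  have h4 := sq_le_sq.1 h3
  rw [abs_of_nonneg (by positivity : 0 ≤ 3 * (w * ξ ^ 22))] at h4
  refine h4.trans ?_
  calc 3 * (w * ξ ^ 22) = 3 * w * ξ ^ 4 * (ξ ^ 6) ^ 3 := by ring
    _ ≤ 3 * w * ξ ^ 4 * (4 * (g ^ 4 * w)) ^ 3 := by gcongr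
    _ = _ := by ring

theorem phase_error_le (h : ShellPoint ξ g a v n) (hξ : 60 ≤ ξ) (hg : 1 ≤ g) (hgξ : g ≤ ξ) {υ : ℝ}
    (hυ : 0 < υ) (hy : υ ^ 4 ≤ shellHeight ξ a v n) :
    |(|latDot a v n|) / sqLen v - bendCoeff (√2 * ξ ^ 22) v * √(shellHeight ξ a v n)| * υ ^ 2 ≤
      16 * g ^ 4 := by
  have hg0 : 0 < g := by linarith
  have hξ0 : 0 < ξ := by linarith
  have hξ1 : 1 ≤ ξ := by linarith
  have hy0 : 0 < shellHeight ξ a v n := lt_of_lt_of_le (by positivity) hy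
  obtain ⟨h6, -, e, hw, hw6⟩ := h.fourthRoot_bounds hξ1 hg
  obtain ⟨l, u⟩ := h.dot_sq hξ1 hg
  have hmax := h.height_le hξ1 hg
  have hsv : 0 < √(shellHeight ξ a v n) := Real.sqrt_pos.2 hy0
  have hsq : √(shellHeight ξ a v n) ^ 2 = shellHeight ξ a v n := Real.sq_sqrt hy0.le
  unfold bendCoeff
  rw [← e]
  set s := √(shellHeight ξ a v n) with hs
  have hsυ : υ ^ 2 ≤ s := by
    apply Real.le_sqrt_of_sq_le
    calc (υ ^ 2) ^ 2 = υ ^ 4 := by ring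
      _ ≤ _ := hy
  rw [← hsq] at l u hmax
  rw [e]
  set w := fourthRoot (sqLen v)
  rw [← e]
  set t := |latDot a v n|
  have ht : t ^ 2 = latDot a v n ^ 2 := sq_abs _
  rw [← ht] at l u
  have h2 : √(2 : ℝ) ^ 2 = 2 := Real.sq_sqrt (by norm_num)
  have h2' : 7 / 5 ≤ √(2 : ℝ) := Real.le_sqrt_of_sq_le (by norm_num)
  set z := √2 * ξ ^ 22 * w * s with hz
  have hz2 : z ^ 2 = 2 * (w ^ 2 * ξ ^ 44 * s ^ 2) := by
    rw [hz, mul_pow, mul_pow, mul_pow, h2]; ring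
  have hzpos : 0 < z := by positivity
  have hzlow : 7 / 5 * (ξ ^ 22 * w * s) ≤ z := by
    calc 7 / 5 * (ξ ^ 22 * w * s) ≤ √2 * (ξ ^ 22 * w * s) := by gcongr
      _ = _ := by rw [hz]; ring
  have ht0 : 0 ≤ t := abs_nonneg _
  have e1 : t / w ^ 4 - √2 * ξ ^ 22 / w ^ 3 * s = (t - z) / w ^ 4 := by
    rw [hz]; field_simp
  rw [e1, abs_div, abs_of_pos (by positivity : 0 < w ^ 4), div_mul_eq_mul_div, div_le_iff₀ (by positivity)]
  have h3 : |t - z| * z ≤ s ^ 4 + 3 * (w ^ 4 * ξ ^ 28) := by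
    have hp : 0 < w ^ 4 * ξ ^ 28 := by positivity
    have : |t - z| * (t + z) ≤ s ^ 4 + 3 * (w ^ 4 * ξ ^ 28) := by
      rw [← abs_of_nonneg (by linarith : 0 ≤ t + z), ← abs_mul, abs_le]
      constructor <;> nlinarith
    refine le_trans ?_ this
    gcongr
    linarith
  have h4 : s ^ 4 ≤ 10 * (g ^ 4 * w ^ 5 * ξ ^ 22) := by
    have hξ4 : 144 ^ 2 * 4 ^ 5 ≤ 10 * ξ ^ 4 := by
      calc (144 : ℝ) ^ 2 * 4 ^ 5 ≤ 10 * 60 ^ 4 := by norm_num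
        _ ≤ _ := by gcongr
    have h5 : (ξ ^ 6) ^ 5 ≤ (4 * (g ^ 4 * w)) ^ 5 := by gcongr
    have h6' : (4 : ℝ) ^ 5 * g ^ 16 * s ^ 4 ≤ 4 ^ 5 * g ^ 16 * (10 * (g ^ 4 * w ^ 5 * ξ ^ 22)) := by
      calc (4 : ℝ) ^ 5 * g ^ 16 * s ^ 4 = 4 ^ 5 * g ^ 16 * (s ^ 2) ^ 2 := by ring
        _ ≤ 4 ^ 5 * g ^ 16 * (144 * (ξ ^ 8 * g ^ 8)) ^ 2 := by gcongr
        _ = 144 ^ 2 * 4 ^ 5 * (ξ ^ 16 * g ^ 32) := by ring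
        _ ≤ 10 * ξ ^ 4 * (ξ ^ 16 * ξ ^ 32) := by gcongr
        _ = 10 * ξ ^ 22 * (ξ ^ 6) ^ 5 := by ring
        _ ≤ 10 * ξ ^ 22 * (4 * (g ^ 4 * w)) ^ 5 := by gcongr
        _ = _ := by ring
    exact le_of_mul_le_mul_left h6' (by positivity)
  have h5 : w ^ 4 * ξ ^ 28 ≤ 4 * (g ^ 4 * w ^ 5 * ξ ^ 22) := by
    calc w ^ 4 * ξ ^ 28 = w ^ 4 * ξ ^ 22 * ξ ^ 6 := by ring
      _ ≤ w ^ 4 * ξ ^ 22 * (4 * (g ^ 4 * w)) := by gcongr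
      _ = _ := by ring
  have h7 : |t - z| * υ ^ 2 * z ≤ 16 * g ^ 4 * w ^ 4 * z := by
    calc |t - z| * υ ^ 2 * z = |t - z| * z * υ ^ 2 := by ring
      _ ≤ 22 * (g ^ 4 * w ^ 5 * ξ ^ 22) * s := by
          exact mul_le_mul (by linarith) hsυ (by positivity) (by positivity)
      _ ≤ 16 * g ^ 4 * w ^ 4 * (7 / 5 * (ξ ^ 22 * w * s)) := by
          have : 0 ≤ g ^ 4 * w ^ 5 * ξ ^ 22 * s := by positivity
          nlinarith
      _ ≤ _ := by gcongr
  exact le_of_mul_le_mul_right h7 hzpos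

end ShellPoint

theorem latCross_eq (a : ℝ × ℝ) (v n : ℤ × ℤ) :
    latCross a v n = crossZ v n - (v.1 * a.2 - v.2 * a.1) := by
  simp only [latCross, crossZ]; push_cast; ring

theorem sqLen_le_abs_dot_sub {a : ℝ × ℝ} {v n n' : ℤ × ℤ} {ξ : ℝ} (hv : IsCoprime v.1 v.2)
    (hne : n ≠ n') (h : shellHeight ξ a v n = shellHeight ξ a v n') :
    (sqLen v : ℝ) ≤ |latDot a v n - latDot a v n'| := by
  have h1 : latCross a v n - latCross a v n' = 0 := by unfold shellHeight at h; linarith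
  rw [latCross_sub] at h1
  rw [latDot_sub]
  exact_mod_cast sqLen_le_of_crossZ_eq_zero hv (sub_ne_zero.2 hne) (by exact_mod_cast h1)

section
variable {ξ g : ℝ} {a : ℝ × ℝ} {S : Finset (ℤ × ℤ)} {dir : ℤ × ℤ → ℤ × ℤ}

theorem card_image_dir_le (hg : 1 ≤ g) (hgξ : g ^ 8 ≤ ξ ^ 12)
    (hS : ∀ n ∈ S, ShellPoint ξ g a (dir n) n) :
    ((S.image dir).card : ℝ) ≤ 9 * (ξ ^ 24 / g ^ 16) := by
  have hg0 : 0 < g := by linarith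
  have e : (ξ ^ 6 / g ^ 4) ^ 4 = ξ ^ 24 / g ^ 16 := by rw [div_pow]; ring_nf
  rw [← e]
  apply card_le_of_sqLen_le
  · rw [e, one_le_div (by positivity)]
    calc g ^ 16 = (g ^ 8) ^ 2 := by ring
      _ ≤ (ξ ^ 12) ^ 2 := by gcongr
      _ = _ := by ring
  · intro v hv
    obtain ⟨n, hn, rfl⟩ := Finset.mem_image.1 hv
    exact (hS n hn).upper

theorem card_band_le (hξ : 1 ≤ ξ) (hg : 1 ≤ g) (hgξ : g ^ 8 ≤ ξ ^ 12) {U U' Δ : ℝ}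
    (hΔ : 0 ≤ Δ) (hS : ∀ n ∈ S, ShellPoint ξ g a (dir n) n) (hU : U ≤ U')
    (hy : ∀ n ∈ S, U ≤ shellHeight ξ a (dir n) n ∧ shellHeight ξ a (dir n) n < U')
    (hdiam : ∀ n ∈ S, ∀ n' ∈ S, dir n = dir n' →
      shellHeight ξ a (dir n) n = shellHeight ξ a (dir n) n' →
      (0 ≤ latDot a (dir n) n ↔ 0 ≤ latDot a (dir n) n') →
      |latDot a (dir n) n - latDot a (dir n) n'| ≤ Δ * sqLen (dir n)) :
    (S.card : ℝ) ≤ 18 * (ξ ^ 24 / g ^ 16) * (U' - U + 1) * (Δ + 1) := by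
  classical
  have hg0 : 0 < g := by linarith
  set f : ℤ × ℤ → (ℤ × ℤ) × ℕ × Bool := fun n =>
    (dir n, ⌊shellHeight ξ a (dir n) n - U⌋₊, decide (0 ≤ latDot a (dir n) n)) with hf
  set T := (S.image dir) ×ˢ (Finset.range (⌊U' - U⌋₊ + 1)) ×ˢ (Finset.univ : Finset Bool) with hT
  have hmaps : ∀ n ∈ S, f n ∈ T := by
    intro n hn
    simp only [hf, hT, Finset.mem_product, Finset.mem_univ, and_true, Finset.mem_range]
    refine ⟨Finset.mem_image_of_mem _ hn, Nat.lt_succ_of_le (Nat.floor_le_floor ?_)⟩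
    linarith [(hy n hn).2]
  have hfib : ∀ b ∈ T, (S.filter fun n => f n = b).card ≤ ⌊Δ + 1⌋₊ := by
    intro b _
    apply Nat.le_floor
    rcases (S.filter fun n => f n = b).eq_empty_or_nonempty with h0 | ⟨n₀, hn₀⟩
    · rw [h0]; simp; linarith
    have key : ∀ n ∈ S.filter (fun n => f n = b), ∀ n' ∈ S.filter (fun n => f n = b),
        dir n = dir n' ∧ shellHeight ξ a (dir n) n = shellHeight ξ a (dir n) n' ∧
        (0 ≤ latDot a (dir n) n ↔ 0 ≤ latDot a (dir n) n') := by
      intro n hn n' hn'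
      obtain ⟨hnS, hnb⟩ := Finset.mem_filter.1 hn
      obtain ⟨hnS', hnb'⟩ := Finset.mem_filter.1 hn'
      rw [← hnb'] at hnb
      simp only [hf, Prod.mk.injEq, decide_eq_decide] at hnb
      obtain ⟨hd, hfl, hs⟩ := hnb
      have y1 := hy n hnS
      have y2 := hy n' hnS'
      rw [← hd] at hfl hs y2
      refine ⟨hd, ?_, hs⟩
      have p1 := Nat.floor_le (by linarith : 0 ≤ shellHeight ξ a (dir n) n - U)
      have p2 := Nat.floor_le (by linarith : 0 ≤ shellHeight ξ a (dir n) n' - U)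
      have q1 := Nat.lt_floor_add_one (shellHeight ξ a (dir n) n - U)
      have q2 := Nat.lt_floor_add_one (shellHeight ξ a (dir n) n' - U)
      rw [hfl] at p1 q1
      have e : shellHeight ξ a (dir n) n' - shellHeight ξ a (dir n) n = crossZ (dir n) (n - n') := by
        rw [← latCross_sub a]; unfold shellHeight; ring
      have c1 : (-1 : ℝ) < crossZ (dir n) (n - n') := by rw [← e]; linarith
      have c2 : (crossZ (dir n) (n - n') : ℝ) < 1 := by rw [← e]; linarith
      have c3 : crossZ (dir n) (n - n') = 0 := by
        have c1' : -1 < crossZ (dir n) (n - n') := by exact_mod_cast c1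
        have c2' : crossZ (dir n) (n - n') < 1 := by exact_mod_cast c2
        omega
      rw [c3] at e
      push_cast at e
      linarith
    have hn₀S := (Finset.mem_filter.1 hn₀).1
    have hN : (0 : ℝ) < sqLen (dir n₀) := by
      obtain ⟨-, -, e, hw, -⟩ := (hS n₀ hn₀S).fourthRoot_bounds hξ hg
      rw [← e]; positivity
    refine card_le_of_separated _ (fun n => latDot a (dir n₀) n) hN hΔ ?_ ?_
    · intro n hn n' hn' hne
      obtain ⟨d1, -, -⟩ := key n₀ hn₀ n hn
      obtain ⟨-, d2, -⟩ := key n hn n' hn'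
      rw [← d1] at d2
      exact sqLen_le_abs_dot_sub (hS n₀ hn₀S).coprime hne d2
    · intro n hn n' hn'
      obtain ⟨d1, -, -⟩ := key n₀ hn₀ n hn
      obtain ⟨d2, d3, d4⟩ := key n hn n' hn'
      have := hdiam n (Finset.mem_filter.1 hn).1 n' (Finset.mem_filter.1 hn').1 d2 d3 d4
      rwa [← d1] at this
  have h1 := Finset.card_le_mul_card_image_of_maps_to hmaps _ hfib
  have h2 := card_image_dir_le hg hgξ hS
  have hTc : (T.card : ℝ) ≤ 9 * (ξ ^ 24 / g ^ 16) * ((U' - U + 1) * 2) := by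
    rw [hT, Finset.card_product, Finset.card_product, Finset.card_range, Finset.card_univ,
      Fintype.card_bool]
    push_cast
    have := Nat.floor_le (by linarith : 0 ≤ U' - U)
    gcongr
  calc (S.card : ℝ) ≤ (⌊Δ + 1⌋₊ : ℝ) * T.card := by exact_mod_cast h1
    _ ≤ (Δ + 1) * (9 * (ξ ^ 24 / g ^ 16) * ((U' - U + 1) * 2)) := by
        gcongr
        exact Nat.floor_le (by linarith)
    _ = _ := by ring

open Classical in
theorem card_strip_signed_le (hξ : 60 ≤ ξ) (hg : 1 ≤ g) (hgξ : g ≤ ξ) {υ B : ℝ} {μ : ℕ}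
    (hυ : 0 < υ) (hυg : 640 * g ^ 4 ≤ υ ^ 2) (hS : ∀ n ∈ S, ShellPoint ξ g a (dir n) n)
    (hy : ∀ n ∈ S, υ ^ 4 ≤ shellHeight ξ a (dir n) n ∧ shellHeight ξ a (dir n) n < υ ^ 4 + μ)
    {ε : ℤ} (hε : |ε| = 1) (hsgn : ∀ n ∈ S, |latDot a (dir n) n| = ε * latDot a (dir n) n)
    (hB : ∀ (V : Finset (ℤ × ℤ)) (bar : ℤ × ℤ → ℤ × ℤ) (x y : ℤ × ℤ → ℝ),
      (∀ v ∈ V, crossZ v (bar v) = 1 ∧ (ξ ^ 6 / g ^ 4) ^ 4 / 256 ≤ sqLen v ∧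
        (sqLen v : ℝ) ≤ (ξ ^ 6 / g ^ 4) ^ 4) →
      (∀ v ∈ V, υ ^ 4 ≤ y v ∧ y v < υ ^ 4 + 1) →
      ∑ v ∈ V, (((Finset.range μ).filter fun j : ℕ => ∃ n : ℤ,
        |x v + phaseSlope (√2 * ξ ^ 22) ε v (bar v) (y v) * j +
          bendCoeff (√2 * ξ ^ 22) v * sqrtBend (y v) j - n| * υ ^ 2 ≤ 16 * g ^ 4).card : ℝ) ≤ B) :
    (S.card : ℝ) ≤ B := by
  have hg0 : 0 < g := by linarith
  have hξ1 : 1 ≤ ξ := by linarith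
  have hbar : ∀ v : ℤ × ℤ, ∃ u : ℤ × ℤ, IsCoprime v.1 v.2 → crossZ v u = 1 := by
    intro v
    by_cases hv : IsCoprime v.1 v.2
    · obtain ⟨p, q, hpq⟩ := hv
      exact ⟨(-q, p), fun _ => by simp only [crossZ]; linarith⟩
    · exact ⟨0, fun h => absurd h hv⟩
  choose bar hbar using hbar
  set τ : ℤ × ℤ → ℝ := fun v => v.1 * a.2 - v.2 * a.1 with hτ
  set m₀ : ℤ × ℤ → ℤ := fun v => ⌊fourthRoot (sqLen v) ^ 2 * ξ ^ 44 + τ v - υ ^ 4⌋ with hm₀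
  set y₀ : ℤ × ℤ → ℝ := fun v => fourthRoot (sqLen v) ^ 2 * ξ ^ 44 + τ v - m₀ v with hy₀
  set x₀ : ℤ × ℤ → ℝ := fun v => ε * ((v.1 * a.1 + v.2 * a.2) / sqLen v) -
    ε * (m₀ v * ((dotZ v (bar v) : ℝ) / sqLen v)) + bendCoeff (√2 * ξ ^ 22) v * √(y₀ v) with hx₀
  have hy₀b : ∀ v, υ ^ 4 ≤ y₀ v ∧ y₀ v < υ ^ 4 + 1 := by
    intro v
    have h1 := Int.floor_le (fourthRoot (sqLen v) ^ 2 * ξ ^ 44 + τ v - υ ^ 4)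
    have h2 := Int.lt_floor_add_one (fourthRoot (sqLen v) ^ 2 * ξ ^ 44 + τ v - υ ^ 4)
    constructor
    · simp only [hy₀, hm₀]; linarith
    · simp only [hy₀, hm₀]; linarith
  have hht : ∀ v n, shellHeight ξ a v n = y₀ v + (m₀ v - crossZ v n : ℤ) := by
    intro v n
    unfold shellHeight
    rw [latCross_eq]
    simp only [hy₀, hτ]; push_cast; ring
  have hj : ∀ n ∈ S, 0 ≤ m₀ (dir n) - crossZ (dir n) n := by
    intro n hn
    have h1 := hy n hn
    rw [hht] at h1
    have h2 := hy₀b (dir n)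
    have h3 : (-1 : ℝ) < (m₀ (dir n) - crossZ (dir n) n : ℤ) := by linarith
    have : -1 < m₀ (dir n) - crossZ (dir n) n := by exact_mod_cast h3
    omega
  have hjr : ∀ n ∈ S, (((m₀ (dir n) - crossZ (dir n) n).toNat : ℕ) : ℝ) =
      ((m₀ (dir n) - crossZ (dir n) n : ℤ) : ℝ) := by
    intro n hn
    exact_mod_cast congrArg (Int.cast (R := ℝ)) (Int.toNat_of_nonneg (hj n hn))
  refine le_trans ?_ (hB (S.image dir) bar x₀ y₀ ?_ fun v _ => hy₀b v)
  swap
  · intro v hv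
    obtain ⟨n, hn, rfl⟩ := Finset.mem_image.1 hv
    exact ⟨hbar _ (hS n hn).coprime, (hS n hn).lower, (hS n hn).upper⟩
  rw [← Nat.cast_sum, Nat.cast_le, ← Finset.card_sigma]
  refine Finset.card_le_card_of_injOn
    (fun n => ⟨dir n, (m₀ (dir n) - crossZ (dir n) n).toNat⟩) ?_ ?_
  · intro n hn
    have hn : n ∈ S := hn
    have hP := hS n hn
    obtain ⟨-, -, ew, hw, -⟩ := hP.fourthRoot_bounds hξ1 hg
    have hN : (0 : ℝ) < sqLen (dir n) := by rw [← ew]; positivity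
    have hyn := hy n hn
    simp only [Finset.coe_sigma, Set.mem_sigma_iff, Finset.mem_coe, Finset.mem_filter,
      Finset.mem_range]
    refine ⟨Finset.mem_image_of_mem _ hn, ?_, ε * crossZ n (bar (dir n)), ?_⟩
    · have h3 : (((m₀ (dir n) - crossZ (dir n) n).toNat : ℕ) : ℝ) < μ := by
        rw [hjr n hn]
        have := hht (dir n) n
        linarith [(hy₀b (dir n)).1]
      exact_mod_cast h3
    · have herr := hP.phase_error_le hξ hg hgξ hυ hyn.1
      rw [hjr n hn]
      have hyy := hht (dir n) n
      have hc := hbar _ hP.coprime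
      have hdot : dotZ (dir n) n = crossZ n (bar (dir n)) * sqLen (dir n) +
          crossZ (dir n) n * dotZ (dir n) (bar (dir n)) := by
        have e1 : dotZ (dir n) n * crossZ (dir n) (bar (dir n)) =
            crossZ n (bar (dir n)) * sqLen (dir n) +
            crossZ (dir n) n * dotZ (dir n) (bar (dir n)) := by
          simp only [dotZ, crossZ, sqLen]; ring
        rw [hc, mul_one] at e1
        exact e1
      have hdotR : latDot a (dir n) n = (crossZ n (bar (dir n)) : ℝ) * sqLen (dir n) +
          crossZ (dir n) n * dotZ (dir n) (bar (dir n)) -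
          ((dir n).1 * a.1 + (dir n).2 * a.2) := by
        have : latDot a (dir n) n = (dotZ (dir n) n : ℝ) - ((dir n).1 * a.1 + (dir n).2 * a.2) := by
          simp only [latDot, dotZ]; push_cast; ring
        rw [this, hdot]; push_cast; ring
      rw [hsgn n hn, abs_sub_comm] at herr
      convert herr using 3
      rw [hdotR, hyy]
      simp only [hx₀, phaseSlope, sqrtBend]
      push_cast
      field_simp
      ring
  · intro n hn n' hn' hnn
    have hn : n ∈ S := hn
    have hn' : n' ∈ S := hn'
    by_contra hne
    simp only [Sigma.mk.injEq, heq_eq_eq] at hnn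
    obtain ⟨hd, hjj⟩ := hnn
    have hj1 := hj n hn
    have hj2 := hj n' hn'
    have hh : shellHeight ξ a (dir n) n = shellHeight ξ a (dir n) n' := by
      rw [hht, hht]
      rw [← hd] at hjj hj2
      have : m₀ (dir n) - crossZ (dir n) n = m₀ (dir n) - crossZ (dir n) n' := by omega
      rw [this]
    have hsep := sqLen_le_abs_dot_sub (hS n hn).coprime hne hh
    obtain ⟨-, -, ew, hw, -⟩ := (hS n hn).fourthRoot_bounds hξ1 hg
    have hN : (0 : ℝ) < sqLen (dir n) := by rw [← ew]; positivity
    have e1 := (hS n hn).phase_error_le hξ hg hgξ hυ (hy n hn).1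
    have e2 := (hS n' hn').phase_error_le hξ hg hgξ hυ (hy n' hn').1
    rw [hsgn n hn] at e1
    rw [hsgn n' hn', ← hd, ← hh] at e2
    set Z := bendCoeff (√2 * ξ ^ 22) (dir n) * √(shellHeight ξ a (dir n) n)
    have hεR : |(ε : ℝ)| = 1 := by rw [← Int.cast_abs, hε]; simp
    have e3 : |latDot a (dir n) n - latDot a (dir n) n'| / sqLen (dir n) * υ ^ 2 ≤ 32 * g ^ 4 := by
      have : |latDot a (dir n) n - latDot a (dir n) n'| / sqLen (dir n) =
          |(ε * latDot a (dir n) n / sqLen (dir n) - Z) -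
            (ε * latDot a (dir n) n' / sqLen (dir n) - Z)| := by
        rw [sub_sub_sub_cancel_right, ← sub_div, ← mul_sub, abs_div, abs_mul, hεR, one_mul,
          abs_of_pos hN]
      rw [this]
      have := abs_sub (ε * latDot a (dir n) n / sqLen (dir n) - Z)
        (ε * latDot a (dir n) n' / sqLen (dir n) - Z)
      have h2 : 0 ≤ υ ^ 2 := by positivity
      nlinarith
    have e4 : 1 ≤ |latDot a (dir n) n - latDot a (dir n) n'| / sqLen (dir n) := by
      rwa [one_le_div hN]
    have : 0 < g ^ 4 := by positivity
    have h2 : 0 < υ ^ 2 := by positivity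
    nlinarith

end

open Classical in
theorem card_strip_le {ξ g : ℝ} {a : ℝ × ℝ} {S : Finset (ℤ × ℤ)} {dir : ℤ × ℤ → ℤ × ℤ}
    (hξ : 60 ≤ ξ) (hg : 1 ≤ g) (hgξ : g ≤ ξ) {υ B : ℝ} {μ : ℕ}
    (hυ : 0 < υ) (hυg : 640 * g ^ 4 ≤ υ ^ 2) (hS : ∀ n ∈ S, ShellPoint ξ g a (dir n) n)
    (hy : ∀ n ∈ S, υ ^ 4 ≤ shellHeight ξ a (dir n) n ∧ shellHeight ξ a (dir n) n < υ ^ 4 + μ)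
    (hB : ∀ (σ : ℝ) (V : Finset (ℤ × ℤ)) (bar : ℤ × ℤ → ℤ × ℤ) (x y : ℤ × ℤ → ℝ), |σ| = 1 →
      (∀ v ∈ V, crossZ v (bar v) = 1 ∧ (ξ ^ 6 / g ^ 4) ^ 4 / 256 ≤ sqLen v ∧
        (sqLen v : ℝ) ≤ (ξ ^ 6 / g ^ 4) ^ 4) →
      (∀ v ∈ V, υ ^ 4 ≤ y v ∧ y v < υ ^ 4 + 1) →
      ∑ v ∈ V, (((Finset.range μ).filter fun j : ℕ => ∃ n : ℤ,
        |x v + phaseSlope (√2 * ξ ^ 22) σ v (bar v) (y v) * j +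
          bendCoeff (√2 * ξ ^ 22) v * sqrtBend (y v) j - n| * υ ^ 2 ≤ 16 * g ^ 4).card : ℝ) ≤ B) :
    (S.card : ℝ) ≤ 2 * B := by
  have h1 : ((S.filter fun n => 0 ≤ latDot a (dir n) n).card : ℝ) ≤ B := by
    refine card_strip_signed_le (ε := 1) hξ hg hgξ hυ hυg (a := a) (dir := dir)
      (fun n hn => hS n (Finset.mem_filter.1 hn).1) (fun n hn => hy n (Finset.mem_filter.1 hn).1)
      (by simp) (fun n hn => ?_) fun V bar x y => hB _ V bar x y (by simp)
    rw [abs_of_nonneg (Finset.mem_filter.1 hn).2]; simp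
  have h2 : ((S.filter fun n => ¬ 0 ≤ latDot a (dir n) n).card : ℝ) ≤ B := by
    refine card_strip_signed_le (ε := -1) hξ hg hgξ hυ hυg (a := a) (dir := dir)
      (fun n hn => hS n (Finset.mem_filter.1 hn).1) (fun n hn => hy n (Finset.mem_filter.1 hn).1)
      (by simp) (fun n hn => ?_) fun V bar x y => hB _ V bar x y (by simp)
    rw [abs_of_neg (not_le.1 (Finset.mem_filter.1 hn).2)]; simp
  have h3 := Finset.card_filter_add_card_filter_not (s := S) fun n => 0 ≤ latDot a (dir n) n
  rw [← h3]
  push_cast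
  linarith

theorem card_le_add_of_split {α : Type*} {S : Finset α} {f : α → ℝ} {c A B : ℝ}
    (h1 : ((S.filter fun n => c ≤ f n).card : ℝ) ≤ A)
    (h2 : ((S.filter fun n => ¬ c ≤ f n).card : ℝ) ≤ B) : (S.card : ℝ) ≤ A + B := by
  have h3 := Finset.card_filter_add_card_filter_not (s := S) fun n => c ≤ f n
  rw [← h3]
  push_cast
  linarith

theorem card_lower_range_le : ∃ C : ℝ, 0 < C ∧ ∀ (ξ g : ℝ) (a : ℝ × ℝ) (dir : ℤ × ℤ → ℤ × ℤ),
    60 ≤ ξ → 1 ≤ g → g ≤ ξ → ∀ S : Finset (ℤ × ℤ), (∀ n ∈ S, ShellPoint ξ g a (dir n) n) →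
    (∀ n ∈ S, ξ ^ 4 * g ^ 8 ≤ shellHeight ξ a (dir n) n ∧ shellHeight ξ a (dir n) n < ξ ^ 8) →
    (S.card : ℝ) ≤ C * (ξ ^ 28 / g ^ 8) := by
  obtain ⟨C, hC, h⟩ := block_hits_small
  refine ⟨2 * C * 9, by positivity, ?_⟩
  intro ξ g a dir hξ hg hgξ
  have hg0 : 0 < g := by linarith
  have hξ0 : 0 < ξ := by linarith
  have hξ1 : 1 ≤ ξ := by linarith
  have key : ∀ (L : ℕ) (S : Finset (ℤ × ℤ)), (∀ n ∈ S, ShellPoint ξ g a (dir n) n) →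
      (∀ n ∈ S, (ξ ^ 2 * (9 / 10) ^ L) ^ 4 ≤ shellHeight ξ a (dir n) n ∧
        shellHeight ξ a (dir n) n < ξ ^ 8) →
      9 / 10 * (ξ * g ^ 2) ≤ ξ ^ 2 * (9 / 10) ^ L →
      (S.card : ℝ) ≤ 2 * C * (ξ ^ 26 / g ^ 8) * (9 * ξ ^ 2 - 9 * (ξ ^ 2 * (9 / 10) ^ L)) := by
    intro L
    induction L with
    | zero =>
      intro S hS hy _
      have : S = ∅ := by
        rw [Finset.eq_empty_iff_forall_notMem]
        intro n hn
        have := hy n hn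
        have e : (ξ ^ 2 * (9 / 10) ^ 0) ^ 4 = ξ ^ 8 := by ring
        rw [e] at this
        linarith
      rw [this]; simp
    | succ L ih =>
      intro S hS hy hL
      set υ := ξ ^ 2 * (9 / 10) ^ (L + 1) with hυd
      have hυL : ξ ^ 2 * (9 / 10) ^ L = υ * (10 / 9) := by rw [hυd, pow_succ]; ring
      have hυ0 : 0 < υ := by positivity
      have hυξ : υ ≤ ξ ^ 2 := by
        rw [hυd]
        exact mul_le_of_le_one_right (by positivity) (pow_le_one₀ (by norm_num) (by norm_num))
      have hυg : 640 * g ^ 4 ≤ υ ^ 2 := by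
        calc 640 * g ^ 4 ≤ (9 / 10) ^ 2 * 60 ^ 2 * g ^ 4 := by
              have : 0 < g ^ 4 := by positivity
              nlinarith
          _ ≤ (9 / 10) ^ 2 * ξ ^ 2 * g ^ 4 := by gcongr
          _ = (9 / 10 * (ξ * g ^ 2)) ^ 2 := by ring
          _ ≤ _ := by gcongr
      have hυ4 : 640 ≤ υ ^ 4 := by
        have h1 : 1 ≤ g ^ 4 := one_le_pow₀ hg
        have : υ ^ 4 = υ ^ 2 * υ ^ 2 := by ring
        nlinarith
      have f1 := Nat.floor_le (by positivity : 0 ≤ υ ^ 4)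
      have f2 := Nat.lt_floor_add_one (υ ^ 4)
      have p1 := ih (S.filter fun n => (ξ ^ 2 * (9 / 10) ^ L) ^ 4 ≤ shellHeight ξ a (dir n) n)
        (fun n hn => hS n (Finset.mem_filter.1 hn).1)
        (fun n hn => ⟨(Finset.mem_filter.1 hn).2, (hy n (Finset.mem_filter.1 hn).1).2⟩)
        (by rw [hυL]; linarith)
      have p2 : ((S.filter fun n => ¬ (ξ ^ 2 * (9 / 10) ^ L) ^ 4 ≤
          shellHeight ξ a (dir n) n).card : ℝ) ≤ 2 * (C * (ξ ^ 26 * υ / g ^ 8)) := by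
        refine card_strip_le (μ := ⌊υ ^ 4⌋₊) hξ hg hgξ hυ0 hυg (a := a) (dir := dir)
          (fun n hn => hS n (Finset.mem_filter.1 hn).1) ?_ ?_
        · intro n hn
          obtain ⟨hn1, hn2⟩ := Finset.mem_filter.1 hn
          refine ⟨(hy n hn1).1, lt_of_lt_of_le (not_le.1 hn2) ?_⟩
          rw [hυL, mul_pow]
          norm_num
          linarith
        · intro σ V bar x y hσ hV hyV
          exact h ξ g υ σ _ V bar x y hg hgξ hσ hυ0 hυg hυξ (by linarith) f1 hV hyV
      refine (card_le_add_of_split p1 p2).trans (le_of_eq ?_)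
      rw [hυL]; ring
  intro S hS hy
  rcases S.eq_empty_or_nonempty with rfl | ⟨n₀, hn₀⟩
  · simp; positivity
  have hgg : g ^ 2 < ξ := by
    have h1 : ξ ^ 4 * (g ^ 2) ^ 4 < ξ ^ 4 * ξ ^ 4 := by
      calc _ = ξ ^ 4 * g ^ 8 := by ring
        _ < ξ ^ 8 := lt_of_le_of_lt (hy n₀ hn₀).1 (hy n₀ hn₀).2
        _ = _ := by ring
    exact lt_of_pow_lt_pow_left₀ 4 hξ0.le (lt_of_mul_lt_mul_left h1 (by positivity))
  obtain ⟨L, hL1, hL2⟩ := exists_nat_pow_near_of_lt_one (x := g ^ 2 / ξ) (y := (9 / 10 : ℝ))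
    (by positivity) ((div_le_one hξ0).2 hgg.le) (by norm_num) (by norm_num)
  have e : ξ ^ 2 * (g ^ 2 / ξ) = ξ * g ^ 2 := by field_simp
  have l1 : ξ ^ 2 * (9 / 10) ^ (L + 1) ≤ ξ * g ^ 2 := by
    rw [← e]; gcongr
  have l2 : ξ * g ^ 2 ≤ ξ ^ 2 * (9 / 10) ^ L := by
    rw [← e]; gcongr
  refine (key (L + 1) S hS ?_ ?_).trans ?_
  · intro n hn
    refine ⟨?_, (hy n hn).2⟩
    calc _ ≤ (ξ * g ^ 2) ^ 4 := by gcongr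
      _ = ξ ^ 4 * g ^ 8 := by ring
      _ ≤ _ := (hy n hn).1
  · have : ξ ^ 2 * (9 / 10 : ℝ) ^ (L + 1) = 9 / 10 * (ξ ^ 2 * (9 / 10) ^ L) := by
      rw [pow_succ]; ring
    rw [this]; linarith
  · have : 0 < ξ ^ 2 * (9 / 10) ^ (L + 1) := by positivity
    calc _ ≤ 2 * C * (ξ ^ 26 / g ^ 8) * (9 * ξ ^ 2) := by gcongr; linarith
      _ = _ := by ring

theorem card_upper_range_le : ∃ C : ℝ, 0 < C ∧ ∀ (ξ g : ℝ) (a : ℝ × ℝ) (dir : ℤ × ℤ → ℤ × ℤ),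
    60 ≤ ξ → 1 ≤ g → g ≤ ξ → ∀ S : Finset (ℤ × ℤ), (∀ n ∈ S, ShellPoint ξ g a (dir n) n) →
    (∀ n ∈ S, ξ ^ 4 * g ^ 8 ≤ shellHeight ξ a (dir n) n ∧ ξ ^ 8 ≤ shellHeight ξ a (dir n) n) →
    (S.card : ℝ) ≤ C * (ξ ^ 28 / g) := by
  obtain ⟨C, hC, h⟩ := block_hits_large
  refine ⟨2 * C * 362, by positivity, ?_⟩
  intro ξ g a dir hξ hg hgξ
  have hg0 : 0 < g := by linarith
  have hξ0 : 0 < ξ := by linarith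
  have hξ1 : 1 ≤ ξ := by linarith
  have hg8 : 1 ≤ g ^ 8 := one_le_pow₀ hg
  have hξ8 : 1 ≤ ξ ^ 8 := one_le_pow₀ hξ1
  have key : ∀ (k : ℕ) (S : Finset (ℤ × ℤ)), (∀ n ∈ S, ShellPoint ξ g a (dir n) n) →
      (∀ n ∈ S, ξ ^ 4 * g ^ 8 ≤ shellHeight ξ a (dir n) n ∧ ξ ^ 8 ≤ shellHeight ξ a (dir n) n ∧
        shellHeight ξ a (dir n) n < (k + 2) / 2 * ξ ^ 8) → (k : ℝ) ≤ 290 * g ^ 8 →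
      (S.card : ℝ) ≤ 2 * C * (ξ ^ 28 / g ^ 8) * (4 * √k + k / g) := by
    intro k
    induction k with
    | zero =>
      intro S hS hy _
      have : S = ∅ := by
        rw [Finset.eq_empty_iff_forall_notMem]
        intro n hn
        have := hy n hn
        norm_num at this
        linarith
      rw [this]; simp
    | succ k ih =>
      intro S hS hy hk
      push_cast at hk
      set υ := fourthRoot ((k + 2) / 2 * ξ ^ 8) with hυd
      have hυ4 : υ ^ 4 = (k + 2) / 2 * ξ ^ 8 := fourthRoot_pow (by positivity)
      have hυ0 : 0 < υ := fourthRoot_pos (by positivity)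
      have hυξ : ξ ^ 2 ≤ υ := by
        refine le_fourthRoot (by positivity) ?_
        have : (0 : ℝ) ≤ k := k.cast_nonneg
        calc (ξ ^ 2) ^ 4 = 1 * ξ ^ 8 := by ring
          _ ≤ _ := by gcongr; linarith
      have hυg4 : υ ≤ 4 * (ξ ^ 2 * g ^ 2) := by
        refine fourthRoot_le (by positivity) ?_
        calc ((k : ℝ) + 2) / 2 * ξ ^ 8 ≤ 256 * g ^ 8 * ξ ^ 8 := by gcongr; linarith
          _ = _ := by ring
      have p1 := ih (S.filter fun n => ¬ ((k : ℝ) + 2) / 2 * ξ ^ 8 ≤ shellHeight ξ a (dir n) n)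
        (fun n hn => hS n (Finset.mem_filter.1 hn).1)
        (fun n hn => ⟨(hy n (Finset.mem_filter.1 hn).1).1, (hy n (Finset.mem_filter.1 hn).1).2.1,
          not_le.1 (Finset.mem_filter.1 hn).2⟩) (by linarith)
      have hz : (ξ ^ 2 / υ) ^ 2 ≤ 4 * (√((k : ℝ) + 1) - √k) := by
        have hk0 : (0 : ℝ) ≤ k := k.cast_nonneg
        have a1 : √((k : ℝ) + 1) ^ 2 = k + 1 := Real.sq_sqrt (by linarith)
        have a2 : √(k : ℝ) ^ 2 = k := Real.sq_sqrt hk0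
        have a3 : √(k : ℝ) ≤ √((k : ℝ) + 1) := Real.sqrt_le_sqrt (by linarith)
        have a4 : 0 ≤ √(k : ℝ) := Real.sqrt_nonneg _
        have a5 : 0 < √((k : ℝ) + 1) := Real.sqrt_pos.2 (by linarith)
        have b1 : (ξ ^ 2 / υ) ^ 2 ≤ 2 / √((k : ℝ) + 1) := by
          apply le_of_sq_le_sq _ (by positivity)
          rw [div_pow 2, a1]
          have : ((ξ ^ 2 / υ) ^ 2) ^ 2 = 2 / (k + 2) := by
            rw [← pow_mul, div_pow, hυ4]; field_simp; ring
          rw [this, div_le_div_iff₀ (by linarith) (by linarith)]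
          linarith
        refine b1.trans ?_
        rw [div_le_iff₀ a5]
        nlinarith
      have p2 : ((S.filter fun n => ((k : ℝ) + 2) / 2 * ξ ^ 8 ≤
          shellHeight ξ a (dir n) n).card : ℝ) ≤
          2 * (C * (ξ ^ 28 / g ^ 8 * ((ξ ^ 2 / υ) ^ 2 + 1 / g))) := by
        rcases (S.filter fun n => ((k : ℝ) + 2) / 2 * ξ ^ 8 ≤
          shellHeight ξ a (dir n) n).eq_empty_or_nonempty with h0 | ⟨n₀, hn₀⟩
        · rw [h0]; simp; positivity
        have hυg : 640 * g ^ 4 ≤ υ ^ 2 := by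
          obtain ⟨hn1, hn2⟩ := Finset.mem_filter.1 hn₀
          obtain ⟨q1, -, q3⟩ := hy n₀ hn1
          push_cast at q3
          have hk0 : (0 : ℝ) ≤ k := k.cast_nonneg
          have q4 : 2 / 3 * (ξ ^ 4 * g ^ 8) ≤ υ ^ 4 := by
            have : ξ ^ 4 * g ^ 8 ≤ 3 / 2 * (((k : ℝ) + 2) / 2 * ξ ^ 8) := by
              calc _ ≤ ((k : ℝ) + 1 + 2) / 2 * ξ ^ 8 := (q1.trans_lt q3).le
                _ ≤ (3 / 2 * (((k : ℝ) + 2) / 2)) * ξ ^ 8 := by gcongr; linarith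
                _ = _ := by ring
            linarith
          apply le_of_sq_le_sq _ (by positivity)
          calc (640 * g ^ 4) ^ 2 = 409600 * g ^ 8 := by ring
            _ ≤ 2 / 3 * (60 ^ 4 * g ^ 8) := by nlinarith
            _ ≤ 2 / 3 * (ξ ^ 4 * g ^ 8) := by gcongr
            _ ≤ υ ^ 4 := q4
            _ = _ := by ring
        have f1 := Nat.floor_le (by positivity : 0 ≤ ξ ^ 8)
        have f2 := Nat.lt_floor_add_one (ξ ^ 8)
        have hξ8' : 2 ≤ ξ ^ 8 := by
          calc (2 : ℝ) ≤ 2 ^ 8 := by norm_num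
            _ ≤ _ := by gcongr; linarith
        refine card_strip_le (μ := ⌊ξ ^ 8⌋₊) hξ hg hgξ hυ0 hυg (a := a) (dir := dir)
          (fun n hn => hS n (Finset.mem_filter.1 hn).1) ?_ ?_
        · intro n hn
          obtain ⟨hn1, hn2⟩ := Finset.mem_filter.1 hn
          rw [hυ4]
          refine ⟨hn2, lt_of_lt_of_le (hy n hn1).2.2 ?_⟩
          push_cast
          linarith
        · intro σ V bar x y hσ hV hyV
          exact h ξ g υ σ _ V bar x y hg hgξ hσ hυ0 hυg hυξ hυg4 (by linarith) f1 hV hyV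
      refine (card_le_add_of_split p2 p1).trans ?_
      have hp : 0 ≤ 2 * C * (ξ ^ 28 / g ^ 8) := by positivity
      calc _ = 2 * C * (ξ ^ 28 / g ^ 8) * ((ξ ^ 2 / υ) ^ 2 + 1 / g + (4 * √k + k / g)) := by ring
        _ ≤ 2 * C * (ξ ^ 28 / g ^ 8) * (4 * √((k : ℝ) + 1) + (k + 1) / g) := by
            apply mul_le_mul_of_nonneg_left _ hp
            rw [add_div]
            linarith
        _ = _ := by push_cast; ring
  intro S hS hy
  set k := ⌈288 * g ^ 8⌉₊
  have k1 := Nat.le_ceil (288 * g ^ 8)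
  have k2 := Nat.ceil_lt_add_one (by positivity : 0 ≤ 288 * g ^ 8)
  have hk : (k : ℝ) ≤ 290 * g ^ 8 := by linarith
  refine (key k S hS ?_ hk).trans ?_
  · intro n hn
    refine ⟨(hy n hn).1, (hy n hn).2, ?_⟩
    have h1 := (hS n hn).height_le hξ1 hg
    calc _ ≤ 144 * g ^ 8 * ξ ^ 8 := h1.trans (le_of_eq (by ring))
      _ < (k + 2) / 2 * ξ ^ 8 := by gcongr; linarith
  · have hs : √(k : ℝ) ≤ 18 * g ^ 4 := by
      apply Real.sqrt_le_iff.2 ⟨by positivity, ?_⟩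
      calc (k : ℝ) ≤ 324 * g ^ 8 := by linarith
        _ = _ := by ring
    calc _ ≤ 2 * C * (ξ ^ 28 / g ^ 8) * (4 * (18 * g ^ 4) + 290 * g ^ 8 / g) := by gcongr
      _ = 2 * C * (ξ ^ 28 / g ^ 8) * (72 * g ^ 4 + 290 * g ^ 7) := by field_simp; norm_num
      _ ≤ 2 * C * (ξ ^ 28 / g ^ 8) * (72 * g ^ 7 + 290 * g ^ 7) := by
          gcongr <;> first | assumption | norm_num
      _ = _ := by field_simp; norm_num

/-- The number of lattice points near a circle whose tangent direction is close to a primitive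
vector of length about `ξ ^ 12 / g ^ 8`. -/
theorem card_shellPoint_le : ∃ C : ℝ, 0 < C ∧ ∀ (ξ g : ℝ) (a : ℝ × ℝ) (dir : ℤ × ℤ → ℤ × ℤ),
    60 ≤ ξ → 1 ≤ g → g ^ 8 ≤ ξ ^ 12 → ∀ S : Finset (ℤ × ℤ),
    (∀ n ∈ S, ShellPoint ξ g a (dir n) n) → (S.card : ℝ) ≤ C * (ξ ^ 28 / g) := by
  obtain ⟨C₁, hC₁, h₁⟩ := card_lower_range_le
  obtain ⟨C₂, hC₂, h₂⟩ := card_upper_range_le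
  refine ⟨C₁ + C₂ + 1000000, by positivity, ?_⟩
  intro ξ g a dir hξ hg hgξ S hS
  have hg0 : 0 < g := by linarith
  have hξ0 : 0 < ξ := by linarith
  have hξ1 : 1 ≤ ξ := by linarith
  have hg8 : 1 ≤ g ^ 8 := one_le_pow₀ hg
  have hg4 : 1 ≤ g ^ 4 := one_le_pow₀ hg
  have hξ4 : 1 ≤ ξ ^ 4 := one_le_pow₀ hξ1
  have hξg : 1 ≤ ξ ^ 4 * g ^ 8 := one_le_mul_of_one_le_of_one_le hξ4 hg8
  have hξg' : 1 ≤ ξ ^ 4 * g ^ 12 := one_le_mul_of_one_le_of_one_le hξ4 (one_le_pow₀ hg)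
  have hfin : ξ ^ 28 / g ^ 4 ≤ ξ ^ 28 / g := by
    gcongr
    calc g = g ^ 1 := by ring
      _ ≤ g ^ 4 := pow_le_pow_right₀ hg (by norm_num)
  have hfin8 : ξ ^ 28 / g ^ 8 ≤ ξ ^ 28 / g := by
    gcongr
    calc g = g ^ 1 := by ring
      _ ≤ g ^ 8 := pow_le_pow_right₀ hg (by norm_num)
  set y : ℤ × ℤ → ℝ := fun n => shellHeight ξ a (dir n) n with hyd
  have t1 : ((S.filter fun n => ¬ 1 ≤ y n).card : ℝ) ≤ 40000 * (ξ ^ 28 / g) := by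
    have := card_band_le (S := S.filter fun n => ¬ 1 ≤ y n) (a := a) (dir := dir)
      (U := -1) (U' := 1) (Δ := 384 * (ξ ^ 4 * g ^ 12)) hξ1 hg hgξ (by positivity)
      (fun n hn => hS n (Finset.mem_filter.1 hn).1) (by norm_num)
      (fun n hn => ⟨((hS n (Finset.mem_filter.1 hn).1).neg_one_lt_height (by linarith) hg).le,
        not_le.1 (Finset.mem_filter.1 hn).2⟩) (by
        intro n hn n' hn' hd hh _
        have hn1 := (Finset.mem_filter.1 hn)
        have hn2 := (Finset.mem_filter.1 hn')
        have b1 := (hS n hn1.1).abs_dot_le_of_height_lt_one hξ1 hg (not_le.1 hn1.2)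
        have b2 := (hS n' hn2.1).abs_dot_le_of_height_lt_one hξ1 hg (not_le.1 hn2.2)
        rw [← hd] at b2
        refine (abs_sub _ _).trans ?_
        linarith)
    calc _ ≤ _ := this
      _ ≤ 18 * (ξ ^ 24 / g ^ 16) * 3 * (385 * (ξ ^ 4 * g ^ 12)) := by
          gcongr
          · norm_num
          · linarith
      _ = 20790 * (ξ ^ 28 / g ^ 4) := by field_simp; norm_num
      _ ≤ 20790 * (ξ ^ 28 / g) := by gcongr
      _ ≤ _ := by gcongr; norm_num
  have t2 : (((S.filter fun n => 1 ≤ y n).filter fun n => ¬ ξ ^ 4 * g ^ 8 ≤ y n).card : ℝ) ≤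
      40000 * (ξ ^ 28 / g) := by
    have := card_band_le (S := (S.filter fun n => 1 ≤ y n).filter fun n => ¬ ξ ^ 4 * g ^ 8 ≤ y n)
      (a := a) (dir := dir)
      (U := 1) (U' := ξ ^ 4 * g ^ 8) (Δ := 6 * g ^ 4 / 1) hξ1 hg hgξ (by positivity)
      (fun n hn => hS n (Finset.mem_filter.1 (Finset.mem_filter.1 hn).1).1) hξg
      (fun n hn => ⟨(Finset.mem_filter.1 (Finset.mem_filter.1 hn).1).2,
        not_le.1 (Finset.mem_filter.1 hn).2⟩) (by
        intro n hn n' hn' hd hh hs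
        have hn1 := (Finset.mem_filter.1 (Finset.mem_filter.1 hn).1)
        have hn2 := (Finset.mem_filter.1 (Finset.mem_filter.1 hn').1)
        have q := hS n' hn2.1
        rw [← hd] at q
        exact (hS n hn1.1).abs_dot_sub_le q hξ1 hg hh hs one_pos (by rw [one_pow]; exact hn1.2))
    calc _ ≤ _ := this
      _ ≤ 18 * (ξ ^ 24 / g ^ 16) * (ξ ^ 4 * g ^ 8) * (7 * g ^ 4) := by
          gcongr
          · linarith
          · linarith
      _ = 126 * (ξ ^ 28 / g ^ 4) := by field_simp; norm_num
      _ ≤ 126 * (ξ ^ 28 / g) := by gcongr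
      _ ≤ _ := by gcongr; norm_num
  have t3 : (((S.filter fun n => 1 ≤ y n).filter fun n => ξ ^ 4 * g ^ 8 ≤ y n).card : ℝ) ≤
      (C₁ + C₂ + 40000) * (ξ ^ 28 / g) := by
    rcases le_or_gt g ξ with hgl | hgl
    · have r1 := h₂ ξ g a dir hξ hg hgl
        (((S.filter fun n => 1 ≤ y n).filter fun n => ξ ^ 4 * g ^ 8 ≤ y n).filter
          fun n => ξ ^ 8 ≤ y n)
        (fun n hn => hS n (by simp only [Finset.mem_filter] at hn; exact hn.1.1.1))
        (fun n hn => by simp only [Finset.mem_filter] at hn; exact ⟨hn.1.2, hn.2⟩)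
      have r2 := h₁ ξ g a dir hξ hg hgl
        (((S.filter fun n => 1 ≤ y n).filter fun n => ξ ^ 4 * g ^ 8 ≤ y n).filter
          fun n => ¬ ξ ^ 8 ≤ y n)
        (fun n hn => hS n (by simp only [Finset.mem_filter] at hn; exact hn.1.1.1))
        (fun n hn => by simp only [Finset.mem_filter] at hn; exact ⟨hn.1.2, not_le.1 hn.2⟩)
      refine (card_le_add_of_split r1 r2).trans ?_
      have e1 : C₁ * (ξ ^ 28 / g ^ 8) ≤ C₁ * (ξ ^ 28 / g) := by gcongr
      have : 0 ≤ ξ ^ 28 / g := by positivity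
      nlinarith
    · have := card_band_le
        (S := (S.filter fun n => 1 ≤ y n).filter fun n => ξ ^ 4 * g ^ 8 ≤ y n)
        (a := a) (dir := dir) (U := ξ ^ 4 * g ^ 8) (U' := 145 * (ξ ^ 8 * g ^ 8))
        (Δ := 6 * g ^ 4 / (ξ ^ 2 * g ^ 4)) hξ1 hg hgξ (by positivity)
        (fun n hn => hS n (Finset.mem_filter.1 (Finset.mem_filter.1 hn).1).1) (by
          calc ξ ^ 4 * g ^ 8 ≤ ξ ^ 8 * g ^ 8 := by gcongr <;> first | assumption | norm_num
            _ ≤ _ := by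
              have : 0 < ξ ^ 8 * g ^ 8 := by positivity
              linarith)
        (fun n hn => ⟨(Finset.mem_filter.1 hn).2, by
          have := (hS n (Finset.mem_filter.1 (Finset.mem_filter.1 hn).1).1).height_le hξ1 hg
          have h0 : 0 < ξ ^ 8 * g ^ 8 := by positivity
          linarith⟩) (by
          intro n hn n' hn' hd hh hs
          have hn1 := (Finset.mem_filter.1 (Finset.mem_filter.1 hn).1)
          have hn2 := (Finset.mem_filter.1 (Finset.mem_filter.1 hn').1)
          have q := hS n' hn2.1
          rw [← hd] at q
          refine (hS n hn1.1).abs_dot_sub_le q hξ1 hg hh hs (by positivity) ?_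
          calc (ξ ^ 2 * g ^ 4) ^ 2 = ξ ^ 4 * g ^ 8 := by ring
            _ ≤ _ := (Finset.mem_filter.1 hn).2)
      have hΔ : 6 * g ^ 4 / (ξ ^ 2 * g ^ 4) ≤ 6 := by
        rw [div_le_iff₀ (by positivity)]
        have : 1 ≤ ξ ^ 2 := one_le_pow₀ hξ1
        nlinarith
      calc _ ≤ _ := this
        _ ≤ 18 * (ξ ^ 24 / g ^ 16) * (145 * (ξ ^ 8 * g ^ 8)) * 7 := by
            gcongr
            · linarith
            · linarith
        _ = 18270 * (ξ ^ 28 * ξ ^ 4 / g ^ 8) := by field_simp; norm_num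
        _ ≤ 18270 * (ξ ^ 28 * g ^ 4 / g ^ 8) := by gcongr
        _ = 18270 * (ξ ^ 28 / g ^ 4) := by field_simp
        _ ≤ 18270 * (ξ ^ 28 / g) := by gcongr
        _ ≤ _ := by gcongr; linarith
  have t4 := card_le_add_of_split t3 t2
  have t5 := card_le_add_of_split t4 t1
  refine t5.trans ?_
  have : 0 ≤ ξ ^ 28 / g := by positivity
  nlinarith

theorem exists_isCoprime_dot_le_of_abs_le {x y M : ℝ} (hM : 2 ≤ M) (hyx : |y| ≤ |x|) :
    ∃ v : ℤ × ℤ, IsCoprime v.1 v.2 ∧ (sqLen v : ℝ) ≤ M ^ 2 ∧ |v.1 * x + v.2 * y| ≤ 2 / M * |x| := by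
  rcases eq_or_ne x 0 with rfl | hx
  · have hy : y = 0 := by simpa using hyx
    refine ⟨(1, 0), isCoprime_one_left, ?_, by simp [hy]⟩
    simp only [sqLen]; push_cast; nlinarith
  have hx0 : 0 < |x| := abs_pos.2 hx
  have hN : 0 < ⌊M / 2⌋₊ := Nat.floor_pos.2 (by linarith)
  obtain ⟨q, hq, hqN⟩ := Real.exists_rat_abs_sub_le_and_den_le (y / x) hN
  have hN1 : M / 2 < (⌊M / 2⌋₊ : ℝ) + 1 := Nat.lt_floor_add_one _
  have hN2 : (⌊M / 2⌋₊ : ℝ) ≤ M / 2 := Nat.floor_le (by linarith)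
  have hd0 : (0 : ℝ) < q.den := by exact_mod_cast q.den_pos
  have hdM : (q.den : ℝ) ≤ M / 2 := le_trans (by exact_mod_cast hqN) hN2
  have hqe : (q : ℝ) * q.den = q.num := by exact_mod_cast Rat.mul_den_eq_num q
  have h1 : |y / x * q.den - q.num| ≤ 1 / (⌊M / 2⌋₊ + 1) := by
    have : y / x * q.den - q.num = (y / x - q) * q.den := by rw [sub_mul, hqe]
    rw [this, abs_mul, abs_of_pos hd0]
    calc _ ≤ 1 / ((⌊M / 2⌋₊ + 1) * (q.den : ℝ)) * q.den := by gcongr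
      _ = _ := by field_simp
  have h2 : 1 / ((⌊M / 2⌋₊ : ℝ) + 1) < 1 := by
    rw [div_lt_one (by positivity)]
    have : (1 : ℝ) ≤ ⌊M / 2⌋₊ := by exact_mod_cast hN
    linarith
  have ht : |y / x| ≤ 1 := by rw [abs_div]; exact div_le_one_of_le₀ hyx hx0.le
  have hp : |q.num| ≤ q.den := by
    have : (|q.num| : ℝ) < q.den + 1 := by
      calc (|q.num| : ℝ) = |y / x * q.den - (y / x * q.den - q.num)| := by congr 1; ring
        _ ≤ |y / x * q.den| + |y / x * q.den - q.num| := abs_sub _ _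
        _ < 1 * q.den + 1 := by
          rw [abs_mul, abs_of_pos hd0]
          have : |y / x| * (q.den : ℝ) ≤ 1 * q.den := by gcongr
          linarith
        _ = _ := by ring
    have h' : |q.num| < (q.den : ℤ) + 1 := by exact_mod_cast this
    omega
  refine ⟨(-q.num, q.den), ?_, ?_, ?_⟩
  · have := Int.isCoprime_iff_nat_coprime.2 (show Nat.Coprime q.num.natAbs (q.den : ℤ).natAbs from
      by simpa using q.reduced)
    exact this.neg_left
  · have : (q.num : ℝ) ^ 2 ≤ q.den ^ 2 := by
      rw [← sq_abs]; gcongr; exact_mod_cast hp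
    simp only [sqLen]; push_cast
    nlinarith
  · have : (((-q.num, (q.den : ℤ)) : ℤ × ℤ).1 : ℝ) * x + (((-q.num, (q.den : ℤ)) : ℤ × ℤ).2 : ℝ) * y
        = (y / x * q.den - q.num) * x := by
      push_cast; field_simp; ring
    rw [this, abs_mul]
    gcongr
    refine h1.trans ?_
    rw [div_le_div_iff₀ (by positivity) (by positivity)]
    linarith

theorem exists_isCoprime_dot_le {x y M W : ℝ} (hM : 2 ≤ M) (hx : |x| ≤ W) (hy : |y| ≤ W) :
    ∃ v : ℤ × ℤ, IsCoprime v.1 v.2 ∧ (sqLen v : ℝ) ≤ M ^ 2 ∧ |v.1 * x + v.2 * y| ≤ 2 / M * W := by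
  have hM0 : 0 < M := by linarith
  rcases le_total |y| |x| with h | h
  · obtain ⟨v, h1, h2, h3⟩ := exists_isCoprime_dot_le_of_abs_le hM h
    exact ⟨v, h1, h2, h3.trans (by gcongr)⟩
  · obtain ⟨v, h1, h2, h3⟩ := exists_isCoprime_dot_le_of_abs_le hM h
    refine ⟨(v.2, v.1), h1.symm, ?_, ?_⟩
    · convert h2 using 2
      simp only [sqLen]; ring
    · rw [add_comm]; exact h3.trans (by gcongr)

theorem exists_shellPoint {ξ : ℝ} (hξ : 60 ≤ ξ) {a : ℝ × ℝ} {n : ℤ × ℤ}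
    (hin : ξ ^ 88 ≤ ((n.1 : ℝ) - a.1) ^ 2 + (n.2 - a.2) ^ 2)
    (hout : ((n.1 : ℝ) - a.1) ^ 2 + (n.2 - a.2) ^ 2 ≤ ξ ^ 88 + 3 * ξ ^ 28) :
    ∃ (v : ℤ × ℤ) (k : ℕ), ShellPoint ξ (√2 ^ k) a v n ∧ (√2 ^ k) ^ 8 ≤ ξ ^ 12 := by
  have hξ0 : 0 < ξ := by linarith
  have hξ1 : 1 ≤ ξ := by linarith
  have hW : ξ ^ 88 + 3 * ξ ^ 28 ≤ (3 / 2 * ξ ^ 44) ^ 2 := by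
    have : 60 * ξ ^ 28 ≤ ξ ^ 60 * ξ ^ 28 := by
      gcongr
      calc (60 : ℝ) ≤ ξ := hξ
        _ ≤ ξ ^ 60 := le_self_pow₀ hξ1 (by norm_num)
    nlinarith [pow_pos hξ0 28]
  have hM : 2 ≤ ξ ^ 12 := by
    calc (2 : ℝ) ≤ ξ := by linarith
      _ ≤ ξ ^ 12 := le_self_pow₀ hξ1 (by norm_num)
  obtain ⟨v, hv, hvM, hvd⟩ := exists_isCoprime_dot_le (W := 3 / 2 * ξ ^ 44)
    (x := n.1 - a.1) (y := n.2 - a.2) hM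
    (abs_le_of_sq_le_sq (by nlinarith [sq_nonneg ((n.2 : ℝ) - a.2)]) (by positivity))
    (abs_le_of_sq_le_sq (by nlinarith [sq_nonneg ((n.1 : ℝ) - a.1)]) (by positivity))
  have hvd' : |latDot a v n| ≤ 3 * ξ ^ 32 := by
    refine hvd.trans (le_of_eq ?_)
    field_simp
  have hs1 : (1 : ℝ) ≤ sqLen v := by
    have : 0 < sqLen v := by
      rcases lt_or_eq_of_le (show 0 ≤ sqLen v by unfold sqLen; positivity) with h | h
      · exact h
      · exfalso
        unfold sqLen at h
        have h1 : v.1 = 0 := by nlinarith [sq_nonneg v.1, sq_nonneg v.2]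
        have h2 : v.2 = 0 := by nlinarith [sq_nonneg v.1, sq_nonneg v.2]
        rw [h1, h2] at hv
        exact not_isCoprime_zero_zero hv
    exact_mod_cast this
  have hs0 : (0 : ℝ) < sqLen v := by linarith
  have hcr : latCross a v n ≠ 0 := by
    intro h
    have e := latDot_sq_add a v n
    rw [h] at e
    have h1 : latDot a v n ^ 2 ≤ (3 * ξ ^ 32) ^ 2 := by
      rw [← sq_abs]; gcongr
    have h2 : ξ ^ 88 ≤ sqLen v * (((n.1 : ℝ) - a.1) ^ 2 + (n.2 - a.2) ^ 2) := by
      have h0 : 0 ≤ ((n.1 : ℝ) - a.1) ^ 2 + (n.2 - a.2) ^ 2 := by positivity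
      nlinarith
    have h3 : 60 * ξ ^ 64 ≤ ξ ^ 24 * ξ ^ 64 := by
      gcongr
      calc (60 : ℝ) ≤ ξ := hξ
        _ ≤ ξ ^ 24 := le_self_pow₀ hξ1 (by norm_num)
    nlinarith [pow_pos hξ0 64]
  obtain ⟨k, hk1, hk2⟩ := exists_nat_pow_near (x := ξ ^ 24 / sqLen v) (y := (256 : ℝ))
    (by rw [le_div_iff₀ hs0]; rw [one_mul]; refine hvM.trans (le_of_eq (by ring))) (by norm_num)
  have h2 : (√2 : ℝ) ^ 2 = 2 := Real.sq_sqrt (by norm_num)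
  have h8 : (√2 ^ k : ℝ) ^ 8 = 16 ^ k := by
    rw [← pow_mul, mul_comm, pow_mul, show (8 : ℕ) = 2 * 4 from rfl, pow_mul, h2]; norm_num
  have h16 : (√2 ^ k : ℝ) ^ 16 = 256 ^ k := by
    rw [← pow_mul, mul_comm, pow_mul, show (16 : ℕ) = 2 * 8 from rfl, pow_mul, h2]; norm_num
  have hg : (ξ ^ 6 / (√2 ^ k) ^ 4) ^ 4 = ξ ^ 24 / 256 ^ k := by
    rw [div_pow, ← pow_mul, ← pow_mul, h16]
  have hlow : (ξ ^ 6 / (√2 ^ k) ^ 4) ^ 4 / 256 ≤ sqLen v := by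
    rw [hg]
    rw [div_lt_iff₀ hs0, pow_succ] at hk2
    rw [div_div, div_le_iff₀ (by positivity)]
    exact hk2.le.trans (le_of_eq (by ring))
  have hup : (sqLen v : ℝ) ≤ (ξ ^ 6 / (√2 ^ k) ^ 4) ^ 4 := by
    rw [hg]
    rw [le_div_iff₀ hs0] at hk1
    rw [le_div_iff₀ (by positivity)]
    linarith
  have hgξ : (√2 ^ k : ℝ) ^ 8 ≤ ξ ^ 12 := by
    refine (sq_le_sq₀ (by positivity) (by positivity)).1 ?_
    rw [show ((√2 ^ k : ℝ) ^ 8) ^ 2 = (√2 ^ k) ^ 16 by ring, h16]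
    refine hk1.trans ?_
    rw [div_le_iff₀ hs0]
    nlinarith [pow_pos hξ0 24]
  rcases lt_or_gt_of_ne hcr with h | h
  · refine ⟨-v, k, ⟨hv.neg_neg, ?_, ?_, ?_, ?_, hin, hout⟩, hgξ⟩
    · convert hlow using 2; simp [sqLen]
    · convert hup using 2; simp [sqLen]
    · have : latCross a (-v) n = -latCross a v n := by simp [latCross]; ring
      linarith
    · have : latDot a (-v) n = -latDot a v n := by simp [latDot]; ring
      rwa [this, abs_neg]
  · exact ⟨v, k, ⟨hv, hlow, hup, h, hvd', hin, hout⟩, hgξ⟩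

open Classical in
theorem card_thin_annulus_le : ∃ C : ℝ, 0 < C ∧ ∀ (ξ : ℝ) (a : ℝ × ℝ), 60 ≤ ξ →
    ∀ S : Finset (ℤ × ℤ), (∀ n ∈ S, ξ ^ 88 ≤ ((n.1 : ℝ) - a.1) ^ 2 + (n.2 - a.2) ^ 2 ∧
      ((n.1 : ℝ) - a.1) ^ 2 + (n.2 - a.2) ^ 2 ≤ ξ ^ 88 + 3 * ξ ^ 28) →
    (S.card : ℝ) ≤ C * ξ ^ 28 := by
  obtain ⟨C, hC, key⟩ := card_shellPoint_le
  refine ⟨4 * C, by positivity, fun ξ a hξ S hS => ?_⟩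
  have hex : ∀ n : ℤ × ℤ, ∃ (v : ℤ × ℤ) (k : ℕ),
      n ∈ S → ShellPoint ξ (√2 ^ k) a v n ∧ (√2 ^ k) ^ 8 ≤ ξ ^ 12 := by
    intro n
    by_cases hn : n ∈ S
    · obtain ⟨v, k, h⟩ := exists_shellPoint hξ (hS n hn).1 (hS n hn).2
      exact ⟨v, k, fun _ => h⟩
    · exact ⟨0, 0, fun h => absurd h hn⟩
  choose dir κ hκ using hex
  have h2 : (√2 : ℝ) ^ 2 = 2 := Real.sq_sqrt (by norm_num)
  have hs : (4 / 3 : ℝ) ≤ √2 := by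
    rw [Real.le_sqrt (by norm_num) (by norm_num)]; norm_num
  have hfib : ∀ k ∈ S.image κ, ((S.filter fun n => κ n = k).card : ℝ) ≤
      C * ξ ^ 28 * (3 / 4) ^ k := by
    intro k hk
    obtain ⟨n, hn, rfl⟩ := Finset.mem_image.1 hk
    refine (key ξ (√2 ^ κ n) a dir hξ (one_le_pow₀ (by linarith)) (hκ n hn).2 _ ?_).trans ?_
    · intro m hm
      obtain ⟨hm, e⟩ := Finset.mem_filter.1 hm
      rw [← e]; exact (hκ m hm).1
    · rw [mul_div_assoc', div_eq_mul_inv, ← inv_pow]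
      gcongr
      rw [inv_le_comm₀ (by positivity) (by norm_num)]
      norm_num; exact hs
  rw [Finset.card_eq_sum_card_image κ S]
  push_cast
  have hsum := (summable_geometric_of_lt_one (r := (3 / 4 : ℝ)) (by norm_num) (by norm_num)).sum_le_tsum
    (S.image κ) (fun _ _ => by positivity)
  rw [tsum_geometric_of_lt_one (by norm_num) (by norm_num)] at hsum
  calc _ ≤ ∑ k ∈ S.image κ, C * ξ ^ 28 * (3 / 4) ^ k := Finset.sum_le_sum hfib
    _ = C * ξ ^ 28 * ∑ k ∈ S.image κ, (3 / 4 : ℝ) ^ k := by rw [Finset.mul_sum]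
    _ ≤ C * ξ ^ 28 * (1 - 3 / 4)⁻¹ := by gcongr
    _ = _ := by norm_num; ring

theorem card_le_of_floor_fibers {ι : Type*} (S : Finset ι) (f : ι → ℝ) {x y M : ℝ} (hxy : x ≤ y)
    (hf : ∀ i ∈ S, x ≤ f i ∧ f i ≤ y)
    (hM : ∀ j : ℤ, ((S.filter fun i => ⌊f i⌋ = j).card : ℝ) ≤ M) :
    (S.card : ℝ) ≤ (y - x + 2) * M := by
  have hmap : ∀ i ∈ S, ⌊f i⌋ ∈ Finset.Icc ⌊x⌋ ⌊y⌋ := fun i hi =>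
    Finset.mem_Icc.2 ⟨Int.floor_le_floor (hf i hi).1, Int.floor_le_floor (hf i hi).2⟩
  have hM0 : 0 ≤ M := (Nat.cast_nonneg _).trans (hM 0)
  rw [Finset.card_eq_sum_card_fiberwise hmap]
  push_cast
  refine (Finset.sum_le_card_nsmul _ _ M fun j _ => hM j).trans ?_
  rw [nsmul_eq_mul, Int.card_Icc]
  gcongr
  have h1 : ⌊x⌋ ≤ ⌊y⌋ := Int.floor_le_floor hxy
  have h2 : (((⌊y⌋ + 1 - ⌊x⌋).toNat : ℤ) : ℝ) = ⌊y⌋ + 1 - ⌊x⌋ := by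
    rw [Int.toNat_of_nonneg (by omega)]; push_cast; ring
  have h3 := Int.floor_le y
  have h4 := Int.lt_floor_add_one x
  rw [← Int.cast_natCast, h2]
  linarith

open Classical in
theorem card_wide_annulus_le : ∃ C : ℝ, 0 < C ∧ ∀ (Q ρ : ℝ) (a : ℝ × ℝ), 60 ^ 44 ≤ Q → 0 < ρ →
    ρ ≤ Q → ∀ S : Finset (ℤ × ℤ), (∀ n ∈ S, Q ^ 2 ≤ ((n.1 : ℝ) - a.1) ^ 2 + (n.2 - a.2) ^ 2 ∧
      ((n.1 : ℝ) - a.1) ^ 2 + (n.2 - a.2) ^ 2 ≤ Q ^ 2 + 3 * (Q * ρ)) →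
    (S.card : ℝ) ≤ C * (Q * ρ + Q ^ ((7 : ℝ) / 11)) := by
  obtain ⟨C, hC, key⟩ := card_thin_annulus_le
  refine ⟨6 * C, by positivity, fun Q ρ a hQ hρ hρQ S hS => ?_⟩
  have hQ0 : 0 < Q := lt_of_lt_of_le (by positivity) hQ
  have hP : 0 < Q ^ ((7 : ℝ) / 11) := by positivity
  set P := Q ^ ((7 : ℝ) / 11) with hPdef
  have hroot : ∀ R : ℝ, Q ≤ R → 60 ≤ R ^ ((1 : ℝ) / 44) ∧ (R ^ ((1 : ℝ) / 44)) ^ 88 = R ^ 2 ∧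
      (R ^ ((1 : ℝ) / 44)) ^ 28 = R ^ ((7 : ℝ) / 11) := by
    intro R hR
    have hR0 : 0 ≤ R := hQ0.le.trans hR
    refine ⟨?_, ?_, ?_⟩
    · calc (60 : ℝ) = ((60 : ℝ) ^ (44 : ℕ)) ^ ((1 : ℝ) / 44) := by
            rw [← Real.rpow_natCast, ← Real.rpow_mul (by norm_num)]; norm_num
        _ ≤ _ := Real.rpow_le_rpow (by positivity) (hQ.trans hR) (by norm_num)
    · rw [← Real.rpow_natCast, ← Real.rpow_mul hR0, ← Real.rpow_natCast]; norm_num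
    · rw [← Real.rpow_natCast, ← Real.rpow_mul hR0]; norm_num
  have hfib : ∀ j : ℤ, ((S.filter fun n : ℤ × ℤ =>
      ⌊(((n.1 : ℝ) - a.1) ^ 2 + (n.2 - a.2) ^ 2 - Q ^ 2) / P⌋ = j).card : ℝ) ≤ 2 * C * P := by
    intro j
    rcases Finset.eq_empty_or_nonempty (S.filter fun n : ℤ × ℤ =>
      ⌊(((n.1 : ℝ) - a.1) ^ 2 + (n.2 - a.2) ^ 2 - Q ^ 2) / P⌋ = j) with h | ⟨m, hm⟩
    · rw [h]; simp only [Finset.card_empty, Nat.cast_zero]; positivity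
    have hmem : ∀ n ∈ S.filter (fun n : ℤ × ℤ =>
        ⌊(((n.1 : ℝ) - a.1) ^ 2 + (n.2 - a.2) ^ 2 - Q ^ 2) / P⌋ = j), n ∈ S ∧
        Q ^ 2 + j * P ≤ ((n.1 : ℝ) - a.1) ^ 2 + (n.2 - a.2) ^ 2 ∧
        ((n.1 : ℝ) - a.1) ^ 2 + (n.2 - a.2) ^ 2 ≤ Q ^ 2 + j * P + P := by
      intro n hn
      obtain ⟨hn, e⟩ := Finset.mem_filter.1 hn
      obtain ⟨e1, e2⟩ := Int.floor_eq_iff.1 e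
      rw [le_div_iff₀ hP] at e1
      rw [div_lt_iff₀ hP] at e2
      refine ⟨hn, by linarith, by linarith⟩
    have hj : 0 ≤ (j : ℝ) := by
      obtain ⟨hm, e⟩ := Finset.mem_filter.1 hm
      rw [← e]
      exact_mod_cast Int.floor_nonneg.2 (div_nonneg (by linarith [(hS m hm).1]) hP.le)
    have hR4 : Q ^ 2 + j * P ≤ (2 * Q) ^ 2 := by
      obtain ⟨hm, h1, h2⟩ := hmem m hm
      nlinarith [(hS m hm).2]
    set R := √(Q ^ 2 + j * P) with hRdef
    have hR2 : R ^ 2 = Q ^ 2 + j * P := Real.sq_sqrt (by positivity)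
    have hQR : Q ≤ R := Real.le_sqrt_of_sq_le (by nlinarith)
    have hRQ : R ≤ 2 * Q := Real.sqrt_le_iff.2 ⟨by linarith, hR4⟩
    obtain ⟨r1, r2, r3⟩ := hroot R hQR
    have hPR : P ≤ R ^ ((7 : ℝ) / 11) := Real.rpow_le_rpow hQ0.le hQR (by norm_num)
    have hRP : R ^ ((7 : ℝ) / 11) ≤ 2 * P := by
      calc R ^ ((7 : ℝ) / 11) ≤ (2 * Q) ^ ((7 : ℝ) / 11) :=
            Real.rpow_le_rpow (by positivity) hRQ (by norm_num)
        _ = 2 ^ ((7 : ℝ) / 11) * P := Real.mul_rpow (by norm_num) hQ0.le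
        _ ≤ 2 ^ (1 : ℝ) * P := by
          gcongr <;> norm_num
        _ = _ := by rw [Real.rpow_one]
    refine (key _ a r1 _ ?_).trans ?_
    · intro n hn
      obtain ⟨-, h1, h2⟩ := hmem n hn
      rw [r2, r3, hR2]
      exact ⟨h1, by linarith⟩
    · rw [r3]
      calc C * R ^ ((7 : ℝ) / 11) ≤ C * (2 * P) := by gcongr
        _ = _ := by ring
  refine (card_le_of_floor_fibers S _ (x := 0) (y := 3 * (Q * ρ) / P) (by positivity) ?_ hfib).trans
    ?_
  · intro n hn
    obtain ⟨h1, h2⟩ := hS n hn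
    exact ⟨div_nonneg (by linarith) hP.le, by gcongr; linarith⟩
  · have : (3 * (Q * ρ) / P - 0 + 2) * (2 * C * P) = 6 * C * (Q * ρ) + 4 * C * P := by
      field_simp; ring
    rw [this]
    nlinarith [mul_pos hC hP]

theorem card_le_of_same_side {a : ℝ × ℝ} {e : ℤ × ℤ} (he : e ≠ 0) {κ A B : ℝ} (hB : 0 ≤ B)
    (S : Finset (ℤ × ℤ)) (hc : ∀ n ∈ S, latCross a e n = κ)
    (hs : ∀ n ∈ S, ∀ m ∈ S, 0 ≤ latDot a e n * latDot a e m)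
    (hD : ∀ n ∈ S, A ≤ ((n.1 : ℝ) - a.1) ^ 2 + (n.2 - a.2) ^ 2 ∧
      ((n.1 : ℝ) - a.1) ^ 2 + (n.2 - a.2) ^ 2 ≤ A + B) : (S.card : ℝ) ≤ √B + 1 := by
  have hN : 0 < sqLen e := by
    rcases not_and_or.1 (fun h : e.1 = 0 ∧ e.2 = 0 => he (Prod.ext h.1 h.2)) with h | h
    · have := sq_pos_of_ne_zero h; unfold sqLen; positivity
    · have := sq_pos_of_ne_zero h; unfold sqLen; positivity
  have hN' : (0 : ℝ) < sqLen e := by exact_mod_cast hN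
  refine card_le_of_separated S (latDot a e) (Real.sqrt_pos.2 hN') (Real.sqrt_nonneg B) ?_ ?_
  · intro n hn m hm hnm
    have h0 : crossZ e (n - m) = 0 := by
      have := latCross_sub a e n m
      rw [hc n hn, hc m hm, sub_self] at this
      exact_mod_cast this.symm
    have h1 : dotZ e (n - m) ^ 2 = sqLen e * sqLen (n - m) := by
      have : dotZ e (n - m) ^ 2 + crossZ e (n - m) ^ 2 = sqLen e * sqLen (n - m) := by
        unfold dotZ crossZ sqLen; ring
      rw [h0] at this; linarith
    have h2 : 1 ≤ sqLen (n - m) := by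
      have h3 : n - m ≠ 0 := sub_ne_zero.2 hnm
      rcases not_and_or.1 (fun h : (n - m).1 = 0 ∧ (n - m).2 = 0 => h3 (Prod.ext h.1 h.2)) with h | h
      · have := sq_pos_of_ne_zero h; unfold sqLen; nlinarith [sq_nonneg (n - m).2]
      · have := sq_pos_of_ne_zero h; unfold sqLen; nlinarith [sq_nonneg (n - m).1]
    have h3 : sqLen e ≤ dotZ e (n - m) ^ 2 := by rw [h1]; nlinarith
    rw [latDot_sub, Real.sqrt_le_left (abs_nonneg _), sq_abs]
    exact_mod_cast h3
  · intro n hn m hm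
    have e1 := latDot_sq_add a e n
    have e2 := latDot_sq_add a e m
    rw [hc n hn] at e1
    rw [hc m hm] at e2
    have h3 : (latDot a e n - latDot a e m) ^ 2 ≤ |latDot a e n ^ 2 - latDot a e m ^ 2| := by
      have hnm := hs n hn m hm
      rcases le_total (latDot a e n ^ 2) (latDot a e m ^ 2) with h | h
      · rw [abs_of_nonpos (by linarith)]
        have := sq_le_sq.1 h
        nlinarith [abs_mul (latDot a e n) (latDot a e m), abs_of_nonneg hnm,
          sq_abs (latDot a e n), abs_nonneg (latDot a e n)]
      · rw [abs_of_nonneg (by linarith)]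
        have := sq_le_sq.1 h
        nlinarith [abs_mul (latDot a e n) (latDot a e m), abs_of_nonneg hnm,
          sq_abs (latDot a e m), abs_nonneg (latDot a e m)]
    have h4 : |latDot a e n ^ 2 - latDot a e m ^ 2| ≤ B * sqLen e := by
      rw [show latDot a e n ^ 2 - latDot a e m ^ 2 = sqLen e *
        (((n.1 : ℝ) - a.1) ^ 2 + (n.2 - a.2) ^ 2 - (((m.1 : ℝ) - a.1) ^ 2 + (m.2 - a.2) ^ 2)) by
        linarith, abs_mul, abs_of_pos hN', mul_comm]
      gcongr
      rw [abs_le]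
      constructor <;> linarith [(hD n hn).1, (hD n hn).2, (hD m hm).1, (hD m hm).2]
    rw [← Real.sqrt_mul hB]
    exact Real.abs_le_sqrt (h3.trans h4)

open Classical in
theorem card_collinear_le {a : ℝ × ℝ} {e : ℤ × ℤ} (he : e ≠ 0) {κ A B : ℝ} (hB : 0 ≤ B)
    (S : Finset (ℤ × ℤ)) (hc : ∀ n ∈ S, latCross a e n = κ)
    (hD : ∀ n ∈ S, A ≤ ((n.1 : ℝ) - a.1) ^ 2 + (n.2 - a.2) ^ 2 ∧
      ((n.1 : ℝ) - a.1) ^ 2 + (n.2 - a.2) ^ 2 ≤ A + B) : (S.card : ℝ) ≤ 2 * (√B + 1) := by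
  have h := Finset.card_filter_add_card_filter_not (s := S) (fun n => 0 ≤ latDot a e n)
  have h1 := card_le_of_same_side he hB (S.filter fun n => 0 ≤ latDot a e n)
    (fun n hn => hc n (Finset.mem_filter.1 hn).1)
    (fun n hn m hm => mul_nonneg (Finset.mem_filter.1 hn).2 (Finset.mem_filter.1 hm).2)
    (fun n hn => hD n (Finset.mem_filter.1 hn).1)
  have h2 := card_le_of_same_side he hB (S.filter fun n => ¬ 0 ≤ latDot a e n)
    (fun n hn => hc n (Finset.mem_filter.1 hn).1)
    (fun n hn m hm => mul_nonneg_of_nonpos_of_nonpos (not_le.1 (Finset.mem_filter.1 hn).2).le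
      (not_le.1 (Finset.mem_filter.1 hm).2).le)
    (fun n hn => hD n (Finset.mem_filter.1 hn).1)
  have : (S.card : ℝ) = (S.filter fun n => 0 ≤ latDot a e n).card +
      (S.filter fun n => ¬ 0 ≤ latDot a e n).card := by exact_mod_cast h.symm
  linarith

/-- Three nearby points of an annulus span a triangle of small area. -/
theorem abs_det_lt_one {Q ρ ℓ : ℝ} {p u v : ℝ × ℝ} (hQ : 0 < Q) (hρ : 0 < ρ) (hℓ : 0 < ℓ)
    (hℓρ : 27 * (ℓ * ρ) ≤ 1) (hℓQ : 27 ^ 3 * ℓ ^ 3 ≤ Q)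
    (hp : Q ^ 2 ≤ p.1 ^ 2 + p.2 ^ 2) (hp' : p.1 ^ 2 + p.2 ^ 2 ≤ Q ^ 2 + 3 * (Q * ρ))
    (hu : u.1 ^ 2 + u.2 ^ 2 ≤ (3 * ℓ) ^ 2) (hv : v.1 ^ 2 + v.2 ^ 2 ≤ (3 * ℓ) ^ 2)
    (hpu : Q ^ 2 ≤ (p.1 + u.1) ^ 2 + (p.2 + u.2) ^ 2)
    (hpu' : (p.1 + u.1) ^ 2 + (p.2 + u.2) ^ 2 ≤ Q ^ 2 + 3 * (Q * ρ))
    (hpv : Q ^ 2 ≤ (p.1 + v.1) ^ 2 + (p.2 + v.2) ^ 2)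
    (hpv' : (p.1 + v.1) ^ 2 + (p.2 + v.2) ^ 2 ≤ Q ^ 2 + 3 * (Q * ρ)) :
    |u.1 * v.2 - u.2 * v.1| < 1 := by
  set P := √(p.1 ^ 2 + p.2 ^ 2) with hP
  have hP2 : P ^ 2 = p.1 ^ 2 + p.2 ^ 2 := Real.sq_sqrt (by positivity)
  have hQP : Q ≤ P := Real.le_sqrt_of_sq_le hp
  have hP0 : 0 < P := by linarith
  have d1 : |p.1 * u.1 + p.2 * u.2| ≤ (3 * (Q * ρ) + 9 * ℓ ^ 2) / 2 := by
    rw [abs_le]; constructor <;> nlinarith [sq_nonneg u.1, sq_nonneg u.2]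
  have d2 : |p.1 * v.1 + p.2 * v.2| ≤ (3 * (Q * ρ) + 9 * ℓ ^ 2) / 2 := by
    rw [abs_le]; constructor <;> nlinarith [sq_nonneg v.1, sq_nonneg v.2]
  have c1 : |p.1 * u.2 - p.2 * u.1| ≤ P * (3 * ℓ) := by
    refine abs_le_of_sq_le_sq ?_ (by positivity)
    rw [mul_pow, hP2]
    have : (p.1 * u.2 - p.2 * u.1) ^ 2 + (p.1 * u.1 + p.2 * u.2) ^ 2 =
      (p.1 ^ 2 + p.2 ^ 2) * (u.1 ^ 2 + u.2 ^ 2) := by ring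
    have h0 : 0 ≤ p.1 ^ 2 + p.2 ^ 2 := by positivity
    nlinarith [sq_nonneg (p.1 * u.1 + p.2 * u.2), mul_le_mul_of_nonneg_left hu h0]
  have c2 : |p.1 * v.2 - p.2 * v.1| ≤ P * (3 * ℓ) := by
    refine abs_le_of_sq_le_sq ?_ (by positivity)
    rw [mul_pow, hP2]
    have : (p.1 * v.2 - p.2 * v.1) ^ 2 + (p.1 * v.1 + p.2 * v.2) ^ 2 =
      (p.1 ^ 2 + p.2 ^ 2) * (v.1 ^ 2 + v.2 ^ 2) := by ring
    have h0 : 0 ≤ p.1 ^ 2 + p.2 ^ 2 := by positivity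
    nlinarith [sq_nonneg (p.1 * v.1 + p.2 * v.2), mul_le_mul_of_nonneg_left hv h0]
  have id : P ^ 2 * (u.1 * v.2 - u.2 * v.1) = (p.1 * u.1 + p.2 * u.2) * (p.1 * v.2 - p.2 * v.1) -
      (p.1 * u.2 - p.2 * u.1) * (p.1 * v.1 + p.2 * v.2) := by rw [hP2]; ring
  have e1 : P ^ 2 * |u.1 * v.2 - u.2 * v.1| ≤
      P * ((3 * (Q * ρ) + 9 * ℓ ^ 2) * (3 * ℓ)) := by
    calc _ = |P ^ 2 * (u.1 * v.2 - u.2 * v.1)| := by rw [abs_mul, abs_of_pos (pow_pos hP0 2)]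
      _ ≤ |(p.1 * u.1 + p.2 * u.2) * (p.1 * v.2 - p.2 * v.1)| +
          |(p.1 * u.2 - p.2 * u.1) * (p.1 * v.1 + p.2 * v.2)| := by rw [id]; exact abs_sub _ _
      _ ≤ (3 * (Q * ρ) + 9 * ℓ ^ 2) / 2 * (P * (3 * ℓ)) +
          (P * (3 * ℓ)) * ((3 * (Q * ρ) + 9 * ℓ ^ 2) / 2) := by
        rw [abs_mul, abs_mul]; gcongr
      _ = _ := by ring
  have e2 : (3 * (Q * ρ) + 9 * ℓ ^ 2) * (3 * ℓ) < P := by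
    have : (3 * (Q * ρ) + 9 * ℓ ^ 2) * (3 * ℓ) = 9 * (ℓ * ρ) * Q + 27 * ℓ ^ 3 := by ring
    have : ℓ * ρ * Q ≤ 1 / 27 * Q := by gcongr; linarith
    have : 0 < ℓ ^ 3 := by positivity
    linarith
  have e3 : P ^ 2 * |u.1 * v.2 - u.2 * v.1| < P ^ 2 * 1 := by
    calc _ ≤ P * ((3 * (Q * ρ) + 9 * ℓ ^ 2) * (3 * ℓ)) := e1
      _ < P * P := by gcongr
      _ = _ := by ring
  exact lt_of_mul_lt_mul_left e3 (by positivity)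

theorem abs_sub_le_of_strip {Q ρ ℓ x y x' y' : ℝ} (hQ : 0 < Q) (hℓ : 0 < ℓ)
    (hρℓ : 3 * ρ ≤ ℓ) (hx : |x| ≤ |y|) (hx' : |x'| ≤ |y'|) (hy : 0 ≤ y * y')
    (hxx : |x - x'| ≤ ℓ) (h1 : Q ^ 2 ≤ x ^ 2 + y ^ 2) (h2 : x ^ 2 + y ^ 2 ≤ Q ^ 2 + 3 * (Q * ρ))
    (h1' : Q ^ 2 ≤ x' ^ 2 + y' ^ 2) (h2' : x' ^ 2 + y' ^ 2 ≤ Q ^ 2 + 3 * (Q * ρ)) :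
    (x - x') ^ 2 + (y - y') ^ 2 ≤ (3 * ℓ) ^ 2 := by
  have q : Q / 2 ≤ |y| := by
    have : x ^ 2 ≤ y ^ 2 := sq_le_sq.2 hx
    by_contra! h
    nlinarith [sq_abs y, abs_nonneg y]
  have q' : Q / 2 ≤ |y'| := by
    have : x' ^ 2 ≤ y' ^ 2 := sq_le_sq.2 hx'
    by_contra! h
    nlinarith [sq_abs y', abs_nonneg y']
  have hsum : |y + y'| = |y| + |y'| := by
    rcases le_total 0 y with h | h <;> rcases le_total 0 y' with h' | h'
    · rw [abs_of_nonneg h, abs_of_nonneg h', abs_of_nonneg (by linarith)]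
    · exfalso; rw [abs_of_nonneg h] at q; rw [abs_of_nonpos h'] at q'; nlinarith
    · exfalso; rw [abs_of_nonpos h] at q; rw [abs_of_nonneg h'] at q'; nlinarith
    · rw [abs_of_nonpos h, abs_of_nonpos h', abs_of_nonpos (by linarith)]; ring
  have h3 : |y - y'| * (|y| + |y'|) ≤ 3 * (Q * ρ) + ℓ * (|y| + |y'|) := by
    rw [← hsum, ← abs_mul, show (y - y') * (y + y') = (x ^ 2 + y ^ 2 - (x' ^ 2 + y' ^ 2)) -
      (x - x') * (x + x') by ring]
    refine (abs_sub _ _).trans (add_le_add ?_ ?_)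
    · rw [abs_le]; constructor <;> linarith
    · rw [abs_mul, hsum]
      gcongr
      exact (abs_add_le _ _).trans (add_le_add hx hx')
  have h4 : |y - y'| ≤ 2 * ℓ := by
    by_contra! h
    nlinarith
  have h5 : (x - x') ^ 2 ≤ ℓ ^ 2 := by rw [← sq_abs]; gcongr
  have h6 : (y - y') ^ 2 ≤ (2 * ℓ) ^ 2 := by rw [← sq_abs]; gcongr
  nlinarith

theorem card_strip_piece_le {Q ρ ℓ : ℝ} {a : ℝ × ℝ} (hQ : 0 < Q) (hρ : 0 < ρ) (hℓ : 0 < ℓ)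
    (hρℓ : 3 * ρ ≤ ℓ) (hℓρ : 27 * (ℓ * ρ) ≤ 1) (hℓQ : 27 ^ 3 * ℓ ^ 3 ≤ Q) (S : Finset (ℤ × ℤ))
    (hD : ∀ n ∈ S, Q ^ 2 ≤ ((n.1 : ℝ) - a.1) ^ 2 + (n.2 - a.2) ^ 2 ∧
      ((n.1 : ℝ) - a.1) ^ 2 + (n.2 - a.2) ^ 2 ≤ Q ^ 2 + 3 * (Q * ρ))
    (hxy : ∀ n ∈ S, |(n.1 : ℝ) - a.1| ≤ |(n.2 : ℝ) - a.2|)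
    (hy : ∀ n ∈ S, ∀ m ∈ S, 0 ≤ ((n.2 : ℝ) - a.2) * (m.2 - a.2))
    (hx : ∀ n ∈ S, ∀ m ∈ S, |(n.1 : ℝ) - m.1| ≤ ℓ) :
    (S.card : ℝ) ≤ 2 * (√(3 * (Q * ρ)) + 1) := by
  rcases Nat.lt_or_ge 1 S.card with h | h
  swap
  · have : (S.card : ℝ) ≤ 1 := by exact_mod_cast h
    linarith [Real.sqrt_nonneg (3 * (Q * ρ))]
  obtain ⟨p, hp, q, hq, hpq⟩ := Finset.one_lt_card.1 h
  refine card_collinear_le (e := q - p) (κ := latCross a (q - p) p) (sub_ne_zero.2 hpq.symm)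
    (by positivity) S ?_ hD
  intro r hr
  have hdist : ∀ n ∈ S, (((n.1 : ℝ) - p.1) ^ 2 + ((n.2 : ℝ) - p.2) ^ 2) ≤ (3 * ℓ) ^ 2 := by
    intro n hn
    have := abs_sub_le_of_strip hQ hℓ hρℓ (hxy n hn) (hxy p hp) (hy n hn p hp)
      (by simpa using hx n hn p hp) (hD n hn).1 (hD n hn).2 (hD p hp).1 (hD p hp).2
    simpa using this
  have hshift : ∀ n ∈ S, Q ^ 2 ≤ ((p.1 : ℝ) - a.1 + (n.1 - p.1)) ^ 2 +
      ((p.2 : ℝ) - a.2 + (n.2 - p.2)) ^ 2 ∧ ((p.1 : ℝ) - a.1 + (n.1 - p.1)) ^ 2 +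
      ((p.2 : ℝ) - a.2 + (n.2 - p.2)) ^ 2 ≤ Q ^ 2 + 3 * (Q * ρ) := by
    intro n hn
    convert hD n hn using 2 <;> ring
  have hdet := abs_det_lt_one (p := ((p.1 : ℝ) - a.1, (p.2 : ℝ) - a.2))
    (u := ((q.1 : ℝ) - p.1, (q.2 : ℝ) - p.2)) (v := ((r.1 : ℝ) - p.1, (r.2 : ℝ) - p.2)) hQ hρ hℓ hℓρ
    hℓQ (hD p hp).1 (hD p hp).2 (hdist q hq) (hdist r hr) (hshift q hq).1 (hshift q hq).2
    (hshift r hr).1 (hshift r hr).2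
  have hc : ((crossZ (q - p) (r - p) : ℤ) : ℝ) = ((q.1 : ℝ) - p.1) * (r.2 - p.2) -
      (q.2 - p.2) * (r.1 - p.1) := by
    simp only [crossZ, Prod.fst_sub, Prod.snd_sub]; push_cast; ring
  have h0 : crossZ (q - p) (r - p) = 0 := by
    rw [← hc] at hdet
    exact Int.abs_lt_one_iff.1 (by exact_mod_cast hdet)
  have := latCross_sub a (q - p) r p
  rw [h0] at this
  push_cast at this
  linarith

open Classical in
theorem card_steep_le {Q ρ ℓ L : ℝ} {a b : ℝ × ℝ} (hQ : 0 < Q) (hρ : 0 < ρ) (hℓ : 0 < ℓ)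
    (hL : 0 < L) (hρℓ : 3 * ρ ≤ ℓ) (hℓρ : 27 * (ℓ * ρ) ≤ 1) (hℓQ : 27 ^ 3 * ℓ ^ 3 ≤ Q)
    (S : Finset (ℤ × ℤ))
    (hD : ∀ n ∈ S, Q ^ 2 ≤ ((n.1 : ℝ) - a.1) ^ 2 + (n.2 - a.2) ^ 2 ∧
      ((n.1 : ℝ) - a.1) ^ 2 + (n.2 - a.2) ^ 2 ≤ Q ^ 2 + 3 * (Q * ρ))
    (hxy : ∀ n ∈ S, |(n.1 : ℝ) - a.1| ≤ |(n.2 : ℝ) - a.2|)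
    (hb : ∀ n ∈ S, |(n.1 : ℝ) - b.1| ≤ L) :
    (S.card : ℝ) ≤ 2 * ((2 * (L / ℓ) + 2) * (2 * (√(3 * (Q * ρ)) + 1))) := by
  have signed : ∀ T ⊆ S, (∀ n ∈ T, ∀ m ∈ T, 0 ≤ ((n.2 : ℝ) - a.2) * (m.2 - a.2)) →
      (T.card : ℝ) ≤ (2 * (L / ℓ) + 2) * (2 * (√(3 * (Q * ρ)) + 1)) := by
    intro T hT hy
    refine (card_le_of_floor_fibers T (fun n => (n.1 : ℝ) / ℓ) (x := (b.1 - L) / ℓ)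
      (y := (b.1 + L) / ℓ) (M := 2 * (√(3 * (Q * ρ)) + 1)) (by gcongr; linarith) ?_ ?_).trans
      (le_of_eq ?_)
    · intro n hn
      have := abs_le.1 (hb n (hT hn))
      constructor <;> gcongr <;> linarith
    · intro j
      have hmem : ∀ n ∈ T.filter (fun n : ℤ × ℤ => ⌊(n.1 : ℝ) / ℓ⌋ = j), n ∈ T ∧
          j * ℓ ≤ n.1 ∧ n.1 < j * ℓ + ℓ := by
        intro n hn
        obtain ⟨hn, e⟩ := Finset.mem_filter.1 hn
        obtain ⟨e1, e2⟩ := Int.floor_eq_iff.1 e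
        rw [le_div_iff₀ hℓ] at e1
        rw [div_lt_iff₀ hℓ] at e2
        exact ⟨hn, e1, by linarith⟩
      refine card_strip_piece_le hQ hρ hℓ hρℓ hℓρ hℓQ _ (fun n hn => hD n (hT (hmem n hn).1))
        (fun n hn => hxy n (hT (hmem n hn).1))
        (fun n hn m hm => hy n (hmem n hn).1 m (hmem m hm).1) fun n hn m hm => ?_
      obtain ⟨-, h1, h2⟩ := hmem n hn
      obtain ⟨-, h3, h4⟩ := hmem m hm
      rw [abs_le]; constructor <;> linarith
    · congr 1; field_simp; ring
  have h := Finset.card_filter_add_card_filter_not (s := S) (fun n : ℤ × ℤ => 0 ≤ (n.2 : ℝ) - a.2)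
  have h1 := signed (S.filter fun n : ℤ × ℤ => 0 ≤ (n.2 : ℝ) - a.2) (Finset.filter_subset _ _)
    (fun n hn m hm => mul_nonneg (Finset.mem_filter.1 hn).2 (Finset.mem_filter.1 hm).2)
  have h2 := signed (S.filter fun n : ℤ × ℤ => ¬ 0 ≤ (n.2 : ℝ) - a.2) (Finset.filter_subset _ _)
    (fun n hn m hm => mul_nonneg_of_nonpos_of_nonpos (not_le.1 (Finset.mem_filter.1 hn).2).le
      (not_le.1 (Finset.mem_filter.1 hm).2).le)
  have : (S.card : ℝ) = (S.filter fun n : ℤ × ℤ => 0 ≤ (n.2 : ℝ) - a.2).card +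
      (S.filter fun n : ℤ × ℤ => ¬ 0 ≤ (n.2 : ℝ) - a.2).card := by exact_mod_cast h.symm
  linarith

theorem card_rows_le {Q ρ L : ℝ} {a b : ℝ × ℝ} (hQ : 0 < Q) (hρ : 0 < ρ) (hL : 0 < L)
    (S : Finset (ℤ × ℤ))
    (hD : ∀ n ∈ S, Q ^ 2 ≤ ((n.1 : ℝ) - a.1) ^ 2 + (n.2 - a.2) ^ 2 ∧
      ((n.1 : ℝ) - a.1) ^ 2 + (n.2 - a.2) ^ 2 ≤ Q ^ 2 + 3 * (Q * ρ))
    (hb : ∀ n ∈ S, |(n.2 : ℝ) - b.2| ≤ L) :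
    (S.card : ℝ) ≤ (2 * L + 2) * (2 * (√(3 * (Q * ρ)) + 1)) := by
  refine (card_le_of_floor_fibers S (fun n => (n.2 : ℝ)) (x := b.2 - L) (y := b.2 + L)
    (M := 2 * (√(3 * (Q * ρ)) + 1)) (by linarith) ?_ ?_).trans (le_of_eq (by ring))
  · intro n hn
    have := abs_le.1 (hb n hn)
    constructor <;> linarith
  · intro j
    refine card_collinear_le (a := a) (e := (1, 0)) (κ := j - a.2) (by simp) (by positivity) _ ?_
      (fun n hn => hD n (Finset.mem_filter.1 hn).1)
    intro n hn
    have := (Finset.mem_filter.1 hn).2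
    rw [Int.floor_intCast] at this
    simp [latCross, this]

open Classical in
theorem card_arc_le {Q ρ L : ℝ} {a b : ℝ × ℝ} (hQ : 1 ≤ Q) (hρ : 0 < ρ) (hL : 0 < L)
    (hQρ : 1 ≤ Q * ρ) (S : Finset (ℤ × ℤ))
    (hD : ∀ n ∈ S, Q ^ 2 ≤ ((n.1 : ℝ) - a.1) ^ 2 + (n.2 - a.2) ^ 2 ∧
      ((n.1 : ℝ) - a.1) ^ 2 + (n.2 - a.2) ^ 2 ≤ Q ^ 2 + 3 * (Q * ρ))
    (hb1 : ∀ n ∈ S, |(n.1 : ℝ) - b.1| ≤ L) (hb2 : ∀ n ∈ S, |(n.2 : ℝ) - b.2| ≤ L) :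
    (S.card : ℝ) ≤ 1500 * (√(Q * ρ) * (1 + L * ρ + L * Q ^ (-(1 : ℝ) / 3))) := by
  have hQ0 : 0 < Q := by linarith
  have hs1 : 1 ≤ √(Q * ρ) := Real.one_le_sqrt.2 hQρ
  have hs : √(3 * (Q * ρ)) + 1 ≤ 3 * √(Q * ρ) := by
    have : √(3 * (Q * ρ)) ≤ 2 * √(Q * ρ) := by
      rw [Real.sqrt_le_left (by positivity), mul_pow, Real.sq_sqrt (by positivity)]
      linarith
    linarith
  have hc0 : 0 < Q ^ ((1 : ℝ) / 3) := by positivity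
  have hc1 : 1 ≤ Q ^ ((1 : ℝ) / 3) := Real.one_le_rpow hQ (by norm_num)
  have hc3 : (Q ^ ((1 : ℝ) / 3)) ^ 3 = Q := by
    rw [← Real.rpow_natCast, ← Real.rpow_mul hQ0.le]; norm_num
  have hci : Q ^ (-(1 : ℝ) / 3) = (Q ^ ((1 : ℝ) / 3))⁻¹ := by
    rw [← Real.rpow_neg hQ0.le]; norm_num
  rcases le_or_gt ρ (1 / 100) with h | h
  · set t := ρ + (Q ^ ((1 : ℝ) / 3))⁻¹ with ht
    have ht0 : 0 < t := by positivity
    have hti : (Q ^ ((1 : ℝ) / 3))⁻¹ ≤ 1 := inv_le_one_of_one_le₀ hc1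
    have hℓ0 : 0 < 1 / (27 * t) := by positivity
    have hρℓ : 3 * ρ ≤ 1 / (27 * t) := by
      rw [le_div_iff₀ (by positivity)]
      nlinarith
    have hℓρ : 27 * (1 / (27 * t) * ρ) ≤ 1 := by
      rw [show 27 * (1 / (27 * t) * ρ) = ρ / t by field_simp, div_le_one ht0]
      linarith [inv_pos.2 hc0]
    have hℓQ : 27 ^ 3 * (1 / (27 * t)) ^ 3 ≤ Q := by
      rw [show 27 ^ 3 * (1 / (27 * t)) ^ 3 = (t⁻¹) ^ 3 by field_simp]
      calc (t⁻¹) ^ 3 ≤ (Q ^ ((1 : ℝ) / 3)) ^ 3 := by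
            gcongr
            exact inv_le_of_inv_le₀ hc0 (by linarith)
        _ = Q := hc3
    have half : ∀ (a b : ℝ × ℝ) (T : Finset (ℤ × ℤ)),
        (∀ n ∈ T, Q ^ 2 ≤ ((n.1 : ℝ) - a.1) ^ 2 + (n.2 - a.2) ^ 2 ∧
          ((n.1 : ℝ) - a.1) ^ 2 + (n.2 - a.2) ^ 2 ≤ Q ^ 2 + 3 * (Q * ρ)) →
        (∀ n ∈ T, |(n.1 : ℝ) - a.1| ≤ |(n.2 : ℝ) - a.2|) → (∀ n ∈ T, |(n.1 : ℝ) - b.1| ≤ L) →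
        (T.card : ℝ) ≤ √(Q * ρ) * (750 * (1 + L * t)) := by
      intro a b T h1 h2 h3
      calc (T.card : ℝ) ≤ 2 * ((2 * (L / (1 / (27 * t))) + 2) * (2 * (√(3 * (Q * ρ)) + 1))) :=
            card_steep_le hQ0 hρ hℓ0 hL hρℓ hℓρ hℓQ T h1 h2 h3
        _ ≤ 2 * ((2 * (L / (1 / (27 * t))) + 2) * (2 * (3 * √(Q * ρ)))) := by gcongr
        _ = √(Q * ρ) * (24 + 648 * (L * t)) := by field_simp; ring
        _ ≤ _ := by
          refine mul_le_mul_of_nonneg_left ?_ (by positivity)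
          nlinarith [mul_pos hL ht0]
    have h1 := half a b (S.filter fun n : ℤ × ℤ => |(n.1 : ℝ) - a.1| ≤ |(n.2 : ℝ) - a.2|)
      (fun n hn => hD n (Finset.mem_filter.1 hn).1) (fun n hn => (Finset.mem_filter.1 hn).2)
      (fun n hn => hb1 n (Finset.mem_filter.1 hn).1)
    have h2 := half a.swap b.swap
      ((S.filter fun n : ℤ × ℤ => ¬ |(n.1 : ℝ) - a.1| ≤ |(n.2 : ℝ) - a.2|).image Prod.swap) ?_ ?_ ?_
    · rw [Finset.card_image_of_injective _ Prod.swap_injective] at h2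
      have e : (S.card : ℝ) =
          (S.filter fun n : ℤ × ℤ => |(n.1 : ℝ) - a.1| ≤ |(n.2 : ℝ) - a.2|).card +
          (S.filter fun n : ℤ × ℤ => ¬ |(n.1 : ℝ) - a.1| ≤ |(n.2 : ℝ) - a.2|).card := by
        exact_mod_cast (Finset.card_filter_add_card_filter_not
          (s := S) (fun n : ℤ × ℤ => |(n.1 : ℝ) - a.1| ≤ |(n.2 : ℝ) - a.2|)).symm
      rw [e, hci]
      refine (add_le_add h1 h2).trans (le_of_eq ?_)
      rw [ht]; ring
    all_goals
      intro n hn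
      obtain ⟨m, hm, rfl⟩ := Finset.mem_image.1 hn
      obtain ⟨hm, hm'⟩ := Finset.mem_filter.1 hm
    · simp only [Prod.fst_swap, Prod.snd_swap]
      rw [add_comm]; exact hD m hm
    · exact (not_le.1 hm').le
    · exact hb2 m hm
  · have := card_rows_le hQ0 hρ hL S hD hb2
    calc _ ≤ (2 * L + 2) * (2 * (3 * √(Q * ρ))) := this.trans (by gcongr)
      _ = √(Q * ρ) * (12 * (1 + L)) := by ring
      _ ≤ √(Q * ρ) * (1500 * (1 + L * ρ + L * Q ^ (-(1 : ℝ) / 3))) := by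
        have : 0 < L * Q ^ (-(1 : ℝ) / 3) := by positivity
        refine mul_le_mul_of_nonneg_left ?_ (by positivity)
        nlinarith
      _ = _ := by ring

theorem ncard_intLattice2_le {P : EuclideanSpace ℝ (Fin 2) → Prop} {B : ℝ} (hB : 0 ≤ B)
    (h : ∀ S : Finset (ℤ × ℤ), (∀ n ∈ S, P !₂[(n.1 : ℝ), (n.2 : ℝ)]) → (S.card : ℝ) ≤ B) :
    (Set.ncard {x : EuclideanSpace ℝ (Fin 2) | x ∈ intLattice2 ∧ P x} : ℝ) ≤ B := by
  set φ : ℤ × ℤ → EuclideanSpace ℝ (Fin 2) := fun n => !₂[(n.1 : ℝ), (n.2 : ℝ)] with hφ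
  have hinj : Function.Injective φ := by
    intro n m hnm
    have h0 := congrArg (fun x : EuclideanSpace ℝ (Fin 2) => x 0) hnm
    have h1 := congrArg (fun x : EuclideanSpace ℝ (Fin 2) => x 1) hnm
    simp only [hφ] at h0 h1
    exact Prod.ext (by simpa using h0) (by simpa using h1)
  have himg : {x : EuclideanSpace ℝ (Fin 2) | x ∈ intLattice2 ∧ P x} = φ '' {n | P (φ n)} := by
    ext x
    constructor
    · rintro ⟨hx, hP⟩
      obtain ⟨m, hm⟩ := hx 0
      obtain ⟨k, hk⟩ := hx 1
      have e : φ (m, k) = x := by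
        ext i; fin_cases i
        · simp [hφ, hm]
        · simp [hφ, hk]
      exact ⟨(m, k), by rw [Set.mem_ofPred_eq, e]; exact hP, e⟩
    · rintro ⟨n, hn, rfl⟩
      refine ⟨fun i => ?_, hn⟩
      fin_cases i
      · exact ⟨n.1, by simp [hφ]⟩
      · exact ⟨n.2, by simp [hφ]⟩
  rw [himg, Set.ncard_image_of_injective _ hinj]
  rcases Set.finite_or_infinite {n | P (φ n)} with hf | hf
  · rw [Set.ncard_eq_toFinset_card _ hf]
    exact h _ fun n hn => (hf.mem_toFinset.1 hn)
  · rw [hf.ncard]; simpa using hB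

theorem norm_vec_sub_sq (x y : ℝ) (a : EuclideanSpace ℝ (Fin 2)) :
    ‖!₂[x, y] - a‖ ^ 2 = (x - a 0) ^ 2 + (y - a 1) ^ 2 := by
  rw [EuclideanSpace.norm_sq_eq]; simp [Fin.sum_univ_two]

/-- Lattice point count in the intersection of an annulus (radius `Q`, width `ρ`)
and a disc of radius `L`. -/
theorem statement0 :
    ∃ C : ℝ, 1 ≤ C ∧
      ∀ Q ρ L : ℝ, 0 < Q → 0 < ρ → 0 < L →
        C * Q⁻¹ ≤ ρ → ρ ≤ C⁻¹ * Q →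
        ∀ a b : EuclideanSpace ℝ (Fin 2),
          (Set.ncard {x : EuclideanSpace ℝ (Fin 2) |
              x ∈ intLattice2 ∧ Q ≤ ‖x - a‖ ∧ ‖x - a‖ ≤ Q + ρ ∧ ‖x - b‖ ≤ L} : ℝ) ≤
            C * min (Q * ρ + Q ^ ((7 : ℝ) / 11))
              ((Q * ρ) ^ ((1 : ℝ) / 2) + L * (Q * ρ) ^ ((3 : ℝ) / 2) * Q⁻¹ +
                L * (Q * ρ) ^ ((1 : ℝ) / 2) * Q ^ (-(1 : ℝ) / 3)) := by
  obtain ⟨C₀, hC₀, key⟩ := card_wide_annulus_le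
  have h60 : (1500 : ℝ) ≤ 60 ^ 44 := by norm_num
  refine ⟨60 ^ 44 + C₀, by linarith, ?_⟩
  generalize (60 : ℝ) ^ 44 = K at key h60 ⊢
  intro Q ρ L hQ hρ hL hlow hup a b
  have hC : 0 < K + C₀ := by linarith
  have hQρ : K + C₀ ≤ Q * ρ := by
    have := mul_le_mul_of_nonneg_left hlow hQ.le
    rwa [show Q * ((K + C₀) * Q⁻¹) = K + C₀ by field_simp] at this
  have hρQ' : (K + C₀) * ρ ≤ Q := by
    have := mul_le_mul_of_nonneg_left hup hC.le
    rwa [mul_inv_cancel_left₀ hC.ne'] at this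
  have hρQ : ρ ≤ Q := by nlinarith
  have hQK : K ≤ Q := by
    by_contra! h
    nlinarith
  refine ncard_intLattice2_le (by positivity) fun S hS => ?_
  have hD : ∀ n ∈ S, Q ^ 2 ≤ ((n.1 : ℝ) - a 0) ^ 2 + (n.2 - a 1) ^ 2 ∧
      ((n.1 : ℝ) - a 0) ^ 2 + (n.2 - a 1) ^ 2 ≤ Q ^ 2 + 3 * (Q * ρ) := by
    intro n hn
    obtain ⟨h1, h2, -⟩ := hS n hn
    rw [← norm_vec_sub_sq]
    constructor
    · gcongr
    · calc _ ≤ (Q + ρ) ^ 2 := by gcongr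
        _ ≤ _ := by nlinarith
  have hB : ∀ n ∈ S, ((n.1 : ℝ) - b 0) ^ 2 + (n.2 - b 1) ^ 2 ≤ L ^ 2 := by
    intro n hn
    obtain ⟨-, -, h3⟩ := hS n hn
    rw [← norm_vec_sub_sq]; gcongr
  rw [mul_min_of_nonneg _ _ hC.le]
  refine le_min ?_ ?_
  · refine (key Q ρ (a 0, a 1) hQK hρ hρQ S hD).trans ?_
    gcongr
    linarith
  · refine (card_arc_le (a := (a 0, a 1)) (b := (b 0, b 1)) (by linarith) hρ hL (by linarith) S hD
      (fun n hn => abs_le_of_sq_le_sq ?_ hL.le) (fun n hn => abs_le_of_sq_le_sq ?_ hL.le)).trans ?_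
    · have := hB n hn
      nlinarith [sq_nonneg ((n.2 : ℝ) - b 1)]
    · have := hB n hn
      nlinarith [sq_nonneg ((n.1 : ℝ) - b 0)]
    · have hp : 0 < Q * ρ := by positivity
      have e : (Q * ρ) ^ ((3 : ℝ) / 2) = Q * ρ * √(Q * ρ) := by
        rw [show (3 : ℝ) / 2 = 1 + 1 / 2 by norm_num, Real.rpow_add hp, Real.rpow_one,
          Real.sqrt_eq_rpow]
      rw [e, ← Real.sqrt_eq_rpow]
      calc _ ≤ (K + C₀) * (√(Q * ρ) * (1 + L * ρ + L * Q ^ (-(1 : ℝ) / 3))) := by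
            gcongr; linarith
        _ = _ := by field_simp
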